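/- There exists a surjective group homomorphism λ : H₃(PSL(2,ℂ);ℤ) → êB(ℂ) whose kernel has order 2. -/

import Mathlib

open Complex
open scoped Classical

noncomputable section

namespace ExtendedBloch

/-- `π` as a complex number. -/
def Cpi : ℂ := (Real.pi : ℂ)

/-- Membership in `ℂ ∖ {0,1}`. -/
def Reg (z : ℂ) : Prop := z ≠ 0 ∧ z ≠ 1

/-- The open upper half plane. -/
def UHP : Set ℂ := {z : ℂ | 0 < z.im}

/-- The 5-tuple occurring in the five term relation. -/
def ftTuple (x y : ℂ) : Fin 5 → ℂ :=
  ![x, y, y / x, (1 - x⁻¹) / (1 - y⁻¹), (1 - x) / (1 - y)]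

/-- The set `FT` of five term tuples. -/
def FT : Set (Fin 5 → ℂ) :=
  {v | ∃ x y : ℂ, Reg x ∧ Reg y ∧ x ≠ y ∧ v = ftTuple x y}

/-- The subset `FT⁺` of tuples with all coordinates in the upper half plane. -/
def FTplus : Set (Fin 5 → ℂ) := {v | v ∈ FT ∧ ∀ i, v i ∈ UHP}

/-- The point `(z; p, q)` of the cover `𝓒` of `ℂ ∖ {0,1}`, realized concretely as the pair of
branch values `(log z + pπi, -log(1-z) + qπi)` (Riemann surface model of `𝓒`). -/
def pt (z : ℂ) (p q : ℤ) : ℂ × ℂ :=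
  (Complex.log z + p * (Cpi * I), -Complex.log (1 - z) + q * (Cpi * I))

/-- The cover `𝓒`, realized as the Riemann surface of all branches of
`(log z + pπi, -log(1-z) + qπi)` on `ℂ ∖ {0,1}`. -/
def Cover : Set (ℂ × ℂ) := {w | ∃ z : ℂ, Reg z ∧ ∃ p q : ℤ, w = pt z p q}

lemma pt_mem_Cover {z : ℂ} (h : Reg z) (p q : ℤ) : pt z p q ∈ Cover :=
  ⟨z, h, p, q, rfl⟩

/-- `w ∈ 𝓒` lies over `z ∈ ℂ ∖ {0,1}`. -/
def LiesOver (w : ℂ × ℂ) (z : ℂ) : Prop := Reg z ∧ ∃ p q : ℤ, w = pt z p q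

/-- The covering action of `ℤ × ℤ` on `𝓒`. -/
def covAct (v : ℤ × ℤ) (w : ℂ × ℂ) : ℂ × ℂ :=
  (w.1 + v.1 * (Cpi * I), w.2 + v.2 * (Cpi * I))

/-- The subset `V ⊂ (ℤ × ℤ)⁵`. -/
def Vset : Set (Fin 5 → ℤ × ℤ) :=
  {v | ∃ p₀ p₁ q₀ q₁ q₂ : ℤ,
    v = ![(p₀, q₀), (p₁, q₁), (p₁ - p₀, q₂), (p₁ - p₀ + q₁ - q₀, q₂ - q₁),
          (q₁ - q₀, q₂ - q₁ - p₀)]}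

/-- The preimage of `FT` in `𝓒⁵`. -/
def FTpre : Set (Fin 5 → ℂ × ℂ) := {w | ∃ v ∈ FT, ∀ i, LiesOver (w i) (v i)}

/-- A base point `((x₀;0,0),…,(x₄;0,0))` with `(x₀,…,x₄) ∈ FT⁺`. -/
def basePt : Fin 5 → ℂ × ℂ := fun i => pt (ftTuple ((1 + I) / 4) I i) 0 0

/-- `𝓕𝓣̂₀`: the connected component of the preimage of `FT` in `𝓒⁵` containing the points
`((x₀;0,0),…,(x₄;0,0))` with `(x₀,…,x₄) ∈ FT⁺`. -/
def FThat₀ : Set (Fin 5 → ℂ × ℂ) := connectedComponentIn FTpre basePt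

/-- `𝓕𝓣̂ = 𝓕𝓣̂₀ + V`. -/
def FThat : Set (Fin 5 → ℂ × ℂ) :=
  {u | ∃ w ∈ FThat₀, ∃ v ∈ Vset, u = fun i => covAct (v i) (w i)}

abbrev CoverT : Type := ↥Cover

/-- The generator `(z; p, q)` of the free abelian group on `𝓒`. -/
def genOf (z : ℂ) (h : Reg z) (p q : ℤ) : FreeAbelianGroup CoverT :=
  FreeAbelianGroup.of ⟨pt z p q, pt_mem_Cover h p q⟩

/-- The lifted five term relators. -/
def FiveTermRels : Set (FreeAbelianGroup CoverT) :=
  {a | ∃ w : Fin 5 → ℂ × ℂ, w ∈ FThat ∧ ∃ hc : ∀ i, w i ∈ Cover,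
    a = ∑ i : Fin 5, (-1 : ℤ) ^ (i : ℕ) • FreeAbelianGroup.of (⟨w i, hc i⟩ : CoverT)}

/-- The transfer relators. -/
def TransferRels : Set (FreeAbelianGroup CoverT) :=
  {a | ∃ z : ℂ, ∃ h : Reg z, ∃ p q p' q' : ℤ,
    a = genOf z h p q + genOf z h p' q' - genOf z h p q' - genOf z h p' q}

def relSub : AddSubgroup (FreeAbelianGroup CoverT) :=
  AddSubgroup.closure (FiveTermRels ∪ TransferRels)

def relSub' : AddSubgroup (FreeAbelianGroup CoverT) :=
  AddSubgroup.closure FiveTermRels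

/-- The extended pre-Bloch group `êP(ℂ)`. -/
abbrev EPreBloch : Type := FreeAbelianGroup CoverT ⧸ relSub

/-- The variant `êP'(ℂ)` without the transfer relations. -/
abbrev EPreBloch' : Type := FreeAbelianGroup CoverT ⧸ relSub'

/-- The class `[z, p, q] ∈ êP(ℂ)` (junk value `0` if `z ∈ {0,1}`). -/
def cls (z : ℂ) (p q : ℤ) : EPreBloch :=
  if h : Reg z then QuotientAddGroup.mk (genOf z h p q) else 0

/-- The class `[z, p, q] ∈ êP'(ℂ)` (junk value `0` if `z ∈ {0,1}`). -/
def cls' (z : ℂ) (p q : ℤ) : EPreBloch' :=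
  if h : Reg z then QuotientAddGroup.mk (genOf z h p q) else 0

/-- `ℂ ∧_ℤ ℂ`, the second exterior power of `ℂ` as a `ℤ`-module. -/
abbrev L2C : Type := ↥(⋀[ℤ]^2 ℂ)

/-- The wedge `a ∧ b ∈ ℂ ∧_ℤ ℂ`. -/
def wedge (a b : ℂ) : L2C :=
  ⟨ExteriorAlgebra.ιMulti ℤ 2 ![a, b],
   ExteriorAlgebra.ιMulti_range ℤ 2 (Set.mem_range_self _)⟩

def nuFree : FreeAbelianGroup CoverT →+ L2C :=
  FreeAbelianGroup.lift fun w : CoverT => wedge w.1.1 w.1.2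

/-- The homomorphism `ν : êP(ℂ) → ℂ ∧_ℤ ℂ`. -/
def nuHom : EPreBloch →+ L2C :=
  if h : ∀ a ∈ relSub, nuFree a = 0 then QuotientAddGroup.lift relSub nuFree h else 0

/-- The homomorphism `ν : êP'(ℂ) → ℂ ∧_ℤ ℂ`. -/
def nuHom' : EPreBloch' →+ L2C :=
  if h : ∀ a ∈ relSub', nuFree a = 0 then QuotientAddGroup.lift relSub' nuFree h else 0

/-- The extended Bloch group `êB(ℂ) = ker ν`. -/
def EBloch : AddSubgroup EPreBloch := nuHom.ker

/-- `êB'(ℂ) = ker ν` on `êP'(ℂ)`. -/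
def EBloch' : AddSubgroup EPreBloch' := nuHom'.ker

/-- The component `X₀₀` of `𝓒` (both fiber coordinates even). -/
def X00 : Set (ℂ × ℂ) := {w | ∃ z : ℂ, Reg z ∧ ∃ p q : ℤ, w = pt z (2 * p) (2 * q)}

abbrev X00T : Type := ↥X00

lemma pt_mem_X00 {z : ℂ} (h : Reg z) (p q : ℤ) : pt z (2 * p) (2 * q) ∈ X00 :=
  ⟨z, h, p, q, rfl⟩

/-- The generator `(z; 2p, 2q)` of the free abelian group on `X₀₀`. -/
def genOf₀ (z : ℂ) (h : Reg z) (p q : ℤ) : FreeAbelianGroup X00T :=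
  FreeAbelianGroup.of ⟨pt z (2 * p) (2 * q), pt_mem_X00 h p q⟩

/-- The five term relators coming from `𝓕𝓣̂ ∩ (X₀₀)⁵`. -/
def FiveTermRels₀ : Set (FreeAbelianGroup X00T) :=
  {a | ∃ w : Fin 5 → ℂ × ℂ, w ∈ FThat ∧ ∃ hc : ∀ i, w i ∈ X00,
    a = ∑ i : Fin 5, (-1 : ℤ) ^ (i : ℕ) • FreeAbelianGroup.of (⟨w i, hc i⟩ : X00T)}

def relSub₀ : AddSubgroup (FreeAbelianGroup X00T) := AddSubgroup.closure FiveTermRels₀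

/-- The true extended pre-Bloch group `êêP(ℂ)`. -/
abbrev EEPreBloch : Type := FreeAbelianGroup X00T ⧸ relSub₀

/-- The class `[z, 2p, 2q] ∈ êêP(ℂ)` (junk value `0` if `z ∈ {0,1}`). -/
def cls₀ (z : ℂ) (p q : ℤ) : EEPreBloch :=
  if h : Reg z then QuotientAddGroup.mk (genOf₀ z h p q) else 0

def nuFree₀ : FreeAbelianGroup X00T →+ L2C :=
  FreeAbelianGroup.lift fun w : X00T => wedge w.1.1 w.1.2

/-- The homomorphism `ν̂ : êêP(ℂ) → ℂ ∧_ℤ ℂ`. -/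
def nuHom₀ : EEPreBloch →+ L2C :=
  if h : ∀ a ∈ relSub₀, nuFree₀ a = 0 then QuotientAddGroup.lift relSub₀ nuFree₀ h else 0

/-- The true extended Bloch group `êêB(ℂ) = ker ν̂`. -/
def EEBloch : AddSubgroup EEPreBloch := nuHom₀.ker

/-- The Rogers dilogarithm `𝓡(z) = ½ log z log(1-z) - ∫₀ᶻ log(1-t)/t dt` (straight segment,
parametrized by `t = s z`). -/
def rogers (z : ℂ) : ℂ :=
  (1 / 2) * Complex.log z * Complex.log (1 - z) -
    ∫ s in (0:ℝ)..(1:ℝ), Complex.log (1 - (s : ℂ) * z) / (s : ℂ)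

/-- `R(z; p, q) = 𝓡(z) + (πi/2)(p log(1-z) + q log z) - π²/6`. -/
def Rfun (z : ℂ) (p q : ℤ) : ℂ :=
  rogers z + (Cpi * I / 2) * (p * Complex.log (1 - z) + q * Complex.log z) - Cpi ^ 2 / 6

/-- `R̂(z; 2p, 2q) = 𝓡(z) + πi(p log(1-z) + q log z) - π²/6`. -/
def Rhat (z : ℂ) (p q : ℤ) : ℂ :=
  rogers z + Cpi * I * (p * Complex.log (1 - z) + q * Complex.log z) - Cpi ^ 2 / 6

/-- `ℂ / π²ℤ`. -/
abbrev ModPiSq : Type := ℂ ⧸ AddSubgroup.zmultiples (Cpi ^ 2)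

/-- `ℂ / 2π²ℤ`. -/
abbrev Mod2PiSq : Type := ℂ ⧸ AddSubgroup.zmultiples (2 * Cpi ^ 2)

abbrev RegT : Type := {z : ℂ // Reg z}

def pbGen (z : ℂ) (h : Reg z) : FreeAbelianGroup RegT := FreeAbelianGroup.of ⟨z, h⟩

/-- The five term relators for the classical pre-Bloch group. -/
def pbRels : Set (FreeAbelianGroup RegT) :=
  {a | ∃ x y : ℂ, ∃ hx : Reg x, ∃ hy : Reg y, x ≠ y ∧
    ∃ h2 : Reg (y / x), ∃ h3 : Reg ((1 - x⁻¹) / (1 - y⁻¹)), ∃ h4 : Reg ((1 - x) / (1 - y)),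
    a = pbGen x hx - pbGen y hy + pbGen (y / x) h2 -
        pbGen ((1 - x⁻¹) / (1 - y⁻¹)) h3 + pbGen ((1 - x) / (1 - y)) h4}

def pbSub : AddSubgroup (FreeAbelianGroup RegT) := AddSubgroup.closure pbRels

/-- The classical pre-Bloch group `P(ℂ)`. -/
abbrev PreBloch : Type := FreeAbelianGroup RegT ⧸ pbSub

/-- The class `[z] ∈ P(ℂ)` (junk value `0` if `z ∈ {0,1}`). -/
def pbCls (z : ℂ) : PreBloch :=
  if h : Reg z then QuotientAddGroup.mk (pbGen z h) else 0

/-- `ℂ* ∧_ℤ ℂ*`, the second exterior power of the multiplicative group `ℂ*` as `ℤ`-module. -/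
abbrev L2CU : Type := ↥(⋀[ℤ]^2 (Additive ℂˣ))

/-- The wedge `a ∧ b ∈ ℂ* ∧_ℤ ℂ*`. -/
def wedgeU (a b : ℂˣ) : L2CU :=
  ⟨ExteriorAlgebra.ιMulti ℤ 2 ![Additive.ofMul a, Additive.ofMul b],
   ExteriorAlgebra.ιMulti_range ℤ 2 (Set.mem_range_self _)⟩

def nuPBFree : FreeAbelianGroup RegT →+ L2CU :=
  FreeAbelianGroup.lift fun z : RegT =>
    2 • wedgeU (Units.mk0 z.1 z.2.1) (Units.mk0 (1 - z.1) (sub_ne_zero_of_ne (Ne.symm z.2.2)))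

/-- The homomorphism `P(ℂ) → ℂ* ∧_ℤ ℂ*`, `[z] ↦ 2 (z ∧ (1-z))`. -/
def nuPB : PreBloch →+ L2CU :=
  if h : ∀ a ∈ pbSub, nuPBFree a = 0 then QuotientAddGroup.lift pbSub nuPBFree h else 0

/-- The classical Bloch group `B(ℂ)`. -/
def Bloch : AddSubgroup PreBloch := nuPB.ker

/-- The roots of unity in `ℂ*`. -/
def muStar : Set ℂˣ := {ζ | ∃ n : ℕ, 0 < n ∧ ζ ^ n = 1}

abbrev SL2C := Matrix.SpecialLinearGroup (Fin 2) ℂ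

/-- `PSL(2,ℂ) = SL(2,ℂ)/{±1}` as a discrete group. -/
abbrev PSL2C := SL2C ⧸ Subgroup.center SL2C

/-- The boundary map `C₃ → C₂` of the inhomogeneous bar complex computing `H₃(PSL(2,ℂ);ℤ)`. -/
def d3 : FreeAbelianGroup (Fin 3 → PSL2C) →+ FreeAbelianGroup (Fin 2 → PSL2C) :=
  FreeAbelianGroup.lift fun g =>
    FreeAbelianGroup.of ![g 1, g 2] - FreeAbelianGroup.of ![g 0 * g 1, g 2] +
      FreeAbelianGroup.of ![g 0, g 1 * g 2] - FreeAbelianGroup.of ![g 0, g 1]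

/-- The boundary map `C₄ → C₃` of the inhomogeneous bar complex computing `H₃(PSL(2,ℂ);ℤ)`. -/
def d4 : FreeAbelianGroup (Fin 4 → PSL2C) →+ FreeAbelianGroup (Fin 3 → PSL2C) :=
  FreeAbelianGroup.lift fun g =>
    FreeAbelianGroup.of ![g 1, g 2, g 3] - FreeAbelianGroup.of ![g 0 * g 1, g 2, g 3] +
      FreeAbelianGroup.of ![g 0, g 1 * g 2, g 3] - FreeAbelianGroup.of ![g 0, g 1, g 2 * g 3] +
      FreeAbelianGroup.of ![g 0, g 1, g 2]

/-- `H₃(PSL(2,ℂ);ℤ)`, defined as homology of the inhomogeneous bar complex. -/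
abbrev H3PSL2C : Type := ↥d3.ker ⧸ ((d4.range).addSubgroupOf d3.ker)

/-- The set of combinatorial flattenings. -/
def Flattenings : Set (ℂ × ℂ × ℂ) :=
  {w | w.1 + w.2.1 + w.2.2 = 0 ∧ ∃ z : ℂ, Reg z ∧ ∃ p q r : ℤ,
    w.1 = Complex.log z + p * (Cpi * I) ∧
    w.2.1 = -Complex.log (1 - z) + q * (Cpi * I) ∧
    w.2.2 = Complex.log (1 - z) - Complex.log z + r * (Cpi * I)}

/-- The map `ℓ : 𝓒 → ℂ³`. -/
def ellMap (w : ℂ × ℂ) : ℂ × ℂ × ℂ := (w.1, w.2, -w.1 - w.2)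

/-- The element `κ = [x,1,1] + [x,0,0] - [x,1,0] - [x,0,1] ∈ êP'(ℂ)`. -/
def kap (x : ℂ) : EPreBloch' := cls' x 1 1 + cls' x 0 0 - cls' x 1 0 - cls' x 0 1

/-- The natural projection `êP'(ℂ) → êP(ℂ)`. -/
def projP : EPreBloch' →+ EPreBloch :=
  QuotientAddGroup.map relSub' relSub (AddMonoidHom.id _)
    (by
      rw [AddSubgroup.comap_id]
      exact AddSubgroup.closure_mono Set.subset_union_left)

/-! ### Tuples and chains -/

section Homology

set_option linter.unusedSectionVars false
set_option linter.unusedSimpArgs false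

local instance {α : Type*} : AddCommGroup (FreeAbelianGroup α) := instAddCommGroupFreeAbelianGroup α
local instance {α : Type*} : AddGroup (FreeAbelianGroup α) := AddCommGroup.toAddGroup
local instance {α : Type*} : AddCommMonoid (FreeAbelianGroup α) := AddCommGroup.toAddCommMonoid
local instance {α : Type*} : SubNegMonoid (FreeAbelianGroup α) := AddGroup.toSubNegMonoid
local instance {α : Type*} : AddMonoid (FreeAbelianGroup α) := SubNegMonoid.toAddMonoid
local instance {α : Type*} : AddZeroClass (FreeAbelianGroup α) := AddMonoid.toAddZeroClass
local instance {α : Type*} : AddZero (FreeAbelianGroup α) := AddZeroClass.toAddZero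
local instance {α : Type*} : Add (FreeAbelianGroup α) := AddZero.toAdd
local instance {α : Type*} : Zero (FreeAbelianGroup α) := AddZero.toZero
local instance {α : Type*} : Sub (FreeAbelianGroup α) := SubNegMonoid.toSub
local instance {α : Type*} : Neg (FreeAbelianGroup α) := SubNegMonoid.toNeg

section Chains

open FreeAbelianGroup

variable {α β γ : Type*}

/-- Homogeneous chains: the free abelian group on `n`-tuples. -/
abbrev Ch (α : Type*) (n : ℕ) : Type _ := FreeAbelianGroup (Fin n → α)

lemma exists_vecCons {n : ℕ} (v : Fin (n + 1) → α) : ∃ a l, v = Matrix.vecCons a l :=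
  ⟨v 0, Matrix.vecTail v, (Matrix.cons_head_tail v).symm⟩

lemma comp_cons {n : ℕ} (f : α → β) (a : α) (l : Fin n → α) :
    (f ∘ Matrix.vecCons a l) = Matrix.vecCons (f a) (f ∘ l) := by
  funext i; refine Fin.cases ?_ (fun j => ?_) i <;> rfl

lemma fab_ind {p : FreeAbelianGroup α → Prop} (c : FreeAbelianGroup α) (h0 : p 0)
    (h1 : ∀ a, p (of a)) (hn : ∀ x, p x → p (-x)) (ha : ∀ x y, p x → p y → p (x + y)) : p c :=
  FreeAbelianGroup.induction_on c h0 h1 (fun _ => hn _) ha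

/-- A homomorphism maps everything into a subgroup as soon as it does so on generators. -/
lemma map_mem_of_gen {A : Type*} [AddCommGroup A] (f : FreeAbelianGroup α →+ A) (J : AddSubgroup A)
    (h : ∀ a, f (of a) ∈ J) (c : FreeAbelianGroup α) : f c ∈ J := by
  induction c using fab_ind with
  | h0 => simp
  | h1 a => exact h a
  | hn x hx => rw [map_neg]; exact J.neg_mem hx
  | ha x y hx hy => rw [map_add]; exact J.add_mem hx hy

/-- Prepend a vertex. -/
def cone {n : ℕ} (a : α) : Ch α n →+ Ch α (n + 1) := FreeAbelianGroup.map (Matrix.vecCons a)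

@[simp] lemma cone_of {n : ℕ} (a : α) (l : Fin n → α) :
    cone a (of l) = of (Matrix.vecCons a l) := map_of_apply _

/-- The (augmented) simplicial boundary. -/
def bd : (n : ℕ) → Ch α (n + 1) →+ Ch α n
  | 0 => FreeAbelianGroup.map Matrix.vecTail
  | n + 1 => FreeAbelianGroup.lift fun v =>
      of (Matrix.vecTail v) - cone (v 0) (bd n (of (Matrix.vecTail v)))

@[simp] lemma bd_zero_of (a : α) (l : Fin 0 → α) : bd 0 (of (Matrix.vecCons a l)) = of l :=
  map_of_apply _

@[simp] lemma bd_succ_of {n : ℕ} (a : α) (l : Fin (n + 1) → α) :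
    bd (n + 1) (of (Matrix.vecCons a l)) = of l - cone a (bd n (of l)) := by
  simp [bd]

@[simp] lemma bd_zero_cone (a : α) (c : Ch α 0) : bd 0 (cone a c) = c := by
  have : (bd 0).comp (cone a) = AddMonoidHom.id (Ch α 0) := by ext v; simp
  exact DFunLike.congr_fun this c

@[simp] lemma bd_succ_cone {n : ℕ} (a : α) (c : Ch α (n + 1)) :
    bd (n + 1) (cone a c) = c - cone a (bd n c) := by
  have : (bd (n + 1)).comp (cone a) = AddMonoidHom.id _ - (cone a).comp (bd n) := by ext v; simp
  exact DFunLike.congr_fun this c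

@[simp] lemma bd_bd {n : ℕ} (c : Ch α (n + 2)) : bd n (bd (n + 1) c) = 0 := by
  induction n with
  | zero =>
    have : (bd 0).comp (bd 1) = (0 : Ch α 2 →+ _) := by
      ext v; obtain ⟨a, l, rfl⟩ := exists_vecCons v; simp
    exact DFunLike.congr_fun this c
  | succ n ih =>
    have : (bd (n + 1)).comp (bd (n + 2)) = (0 : Ch α (n + 3) →+ _) := by
      ext v; obtain ⟨a, l, rfl⟩ := exists_vecCons v; simp [ih]
    exact DFunLike.congr_fun this c

/-- A chain with zero boundary is a boundary. -/
lemma exists_bd_of_bd_eq_zero [Nonempty α] {n : ℕ} (c : Ch α (n + 1)) (h : bd n c = 0) :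
    ∃ d, bd (n + 1) d = c :=
  ⟨cone (Classical.arbitrary α) c, by simp [h]⟩

/-- The map on chains induced by a map of vertices. -/
def cmap (f : α → β) {n : ℕ} : Ch α n →+ Ch β n := FreeAbelianGroup.map (f ∘ ·)

@[simp] lemma cmap_of (f : α → β) {n : ℕ} (l : Fin n → α) : cmap f (of l) = of (f ∘ l) :=
  map_of_apply _

@[simp] lemma cmap_cone (f : α → β) {n : ℕ} (a : α) (c : Ch α n) :
    cmap f (cone a c) = cone (f a) (cmap f c) := by
  have : (cmap f).comp (cone (n := n) a) = (cone (f a)).comp (cmap f) := by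
    ext v; simp [comp_cons]
  exact DFunLike.congr_fun this c

lemma bd_cmap (f : α → β) {n : ℕ} (c : Ch α (n + 1)) : bd n (cmap f c) = cmap f (bd n c) := by
  induction n with
  | zero =>
    have : (bd 0).comp (cmap f) = (cmap f).comp (bd 0) := by
      ext v; obtain ⟨a, l, rfl⟩ := exists_vecCons v; simp [comp_cons]
    exact DFunLike.congr_fun this c
  | succ n ih =>
    have : (bd (n + 1)).comp (cmap f) = (cmap f).comp (bd (n + 1)) := by
      ext v; obtain ⟨a, l, rfl⟩ := exists_vecCons v
      simp [comp_cons, ← ih]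
    exact DFunLike.congr_fun this c

lemma cmap_cmap (f : α → β) (g : β → γ) {n : ℕ} (c : Ch α n) :
    cmap g (cmap f c) = cmap (g ∘ f) c := by
  have : (cmap g).comp (cmap (n := n) f) = cmap (g ∘ f) := by ext v; simp [Function.comp_assoc]
  exact DFunLike.congr_fun this c

@[simp] lemma cmap_id {n : ℕ} (c : Ch α n) : cmap id c = c := by
  have : cmap (n := n) (id : α → α) = AddMonoidHom.id _ := by ext v; simp
  exact DFunLike.congr_fun this c

/-- The prism operator between two vertex maps. -/
def prism (φ ψ : α → β) : (n : ℕ) → Ch α n →+ Ch β (n + 1)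
  | 0 => 0
  | n + 1 => FreeAbelianGroup.lift fun v =>
      cone (φ (v 0)) (of (ψ ∘ v)) - cone (φ (v 0)) (prism φ ψ n (of (Matrix.vecTail v)))

@[simp] lemma prism_zero (φ ψ : α → β) (c : Ch α 0) : prism φ ψ 0 c = 0 := rfl

@[simp] lemma prism_succ_of (φ ψ : α → β) {n : ℕ} (a : α) (l : Fin n → α) :
    prism φ ψ (n + 1) (of (Matrix.vecCons a l)) =
      cone (φ a) (cone (ψ a) (of (ψ ∘ l))) - cone (φ a) (prism φ ψ n (of l)) := by
  simp [prism, comp_cons]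

@[simp] lemma prism_cone (φ ψ : α → β) {n : ℕ} (a : α) (c : Ch α n) :
    prism φ ψ (n + 1) (cone a c) =
      cone (φ a) (cone (ψ a) (cmap ψ c)) - cone (φ a) (prism φ ψ n c) := by
  have : (prism φ ψ (n + 1)).comp (cone a) =
      (cone (φ a)).comp ((cone (ψ a)).comp (cmap ψ)) - (cone (φ a)).comp (prism φ ψ n) := by
    ext v; simp
  exact DFunLike.congr_fun this c

lemma bd_prism_zero (φ ψ : α → β) (c : Ch α 1) :
    bd 1 (prism φ ψ 1 c) = cmap ψ c - cmap φ c := by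
  have : (bd 1).comp (prism φ ψ 1) = cmap ψ - cmap φ := by
    ext v; obtain ⟨a, l, rfl⟩ := exists_vecCons v
    simp [comp_cons, Subsingleton.elim (ψ ∘ l) (φ ∘ l)]
  exact DFunLike.congr_fun this c

lemma bd_prism (φ ψ : α → β) {n : ℕ} (c : Ch α (n + 1)) :
    bd (n + 1) (prism φ ψ (n + 1) c) = cmap ψ c - cmap φ c - prism φ ψ n (bd n c) := by
  induction n with
  | zero => rw [bd_prism_zero]; simp
  | succ n ih =>
    have : (bd (n + 2)).comp (prism φ ψ (n + 2)) =
        cmap ψ - cmap φ - (prism φ ψ (n + 1)).comp (bd (n + 1)) := by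
      ext v; obtain ⟨a, l, rfl⟩ := exists_vecCons v
      simp [comp_cons, ih]
      simp only [← cmap_of, bd_cmap]
      abel
    exact DFunLike.congr_fun this c

/-- The homotopy between composites of prisms. -/
def prismTwo (φ ψ χ : α → β) : (n : ℕ) → Ch α n →+ Ch β (n + 2)
  | 0 => 0
  | n + 1 => FreeAbelianGroup.lift fun v =>
      cone (φ (v 0)) (prism ψ χ (n + 1) (of v)) +
        cone (φ (v 0)) (prismTwo φ ψ χ n (of (Matrix.vecTail v)))

@[simp] lemma prismTwo_zero (φ ψ χ : α → β) (c : Ch α 0) : prismTwo φ ψ χ 0 c = 0 := rfl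

@[simp] lemma prismTwo_succ_of (φ ψ χ : α → β) {n : ℕ} (a : α) (l : Fin n → α) :
    prismTwo φ ψ χ (n + 1) (of (Matrix.vecCons a l)) =
      cone (φ a) (prism ψ χ (n + 1) (of (Matrix.vecCons a l))) +
        cone (φ a) (prismTwo φ ψ χ n (of l)) := by
  simp [prismTwo]

lemma prismTwo_cone (φ ψ χ : α → β) {n : ℕ} (a : α) (c : Ch α n) :
    prismTwo φ ψ χ (n + 1) (cone a c) =
      cone (φ a) (prism ψ χ (n + 1) (cone a c)) + cone (φ a) (prismTwo φ ψ χ n c) := by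
  have : (prismTwo φ ψ χ (n + 1)).comp (cone a) =
      (cone (φ a)).comp ((prism ψ χ (n + 1)).comp (cone a)) +
        (cone (φ a)).comp (prismTwo φ ψ χ n) := by
    ext v; simp
  exact DFunLike.congr_fun this c

lemma bd_prismTwo (φ ψ χ : α → β) {n : ℕ} (c : Ch α (n + 1)) :
    bd (n + 2) (prismTwo φ ψ χ (n + 1) c) - prismTwo φ ψ χ n (bd n c) =
      prism φ ψ (n + 1) c + prism ψ χ (n + 1) c - prism φ χ (n + 1) c := by
  induction n with
  | zero =>
    have : (bd 2).comp (prismTwo φ ψ χ 1) =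
        prism φ ψ 1 + prism ψ χ 1 - prism φ χ 1 := by
      ext v; obtain ⟨a, l, rfl⟩ := exists_vecCons v
      simp [Subsingleton.elim (ψ ∘ l) (φ ∘ l), Subsingleton.elim (χ ∘ l) (φ ∘ l)]
      abel
    simpa using DFunLike.congr_fun this c
  | succ n ih =>
    have : (bd (n + 3)).comp (prismTwo φ ψ χ (n + 2)) -
        (prismTwo φ ψ χ (n + 1)).comp (bd (n + 1)) =
        prism φ ψ (n + 2) + prism ψ χ (n + 2) - prism φ χ (n + 2) := by
      ext v; obtain ⟨a, l, rfl⟩ := exists_vecCons v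
      have h := ih (of l)
      simp only [AddMonoidHom.sub_apply, AddMonoidHom.comp_apply, AddMonoidHom.add_apply] at h ⊢
      rw [prismTwo_succ_of, map_add, bd_succ_cone, bd_succ_cone, bd_prism, bd_succ_of,
        map_sub (prismTwo φ ψ χ (n + 1)), prismTwo_cone, sub_eq_iff_eq_add.mp h]
      simp [comp_cons]
      abel
    exact DFunLike.congr_fun this c

lemma cmap_prism (φ ψ : α → β) (f : β → γ) {n : ℕ} (c : Ch α n) :
    cmap f (prism φ ψ n c) = prism (f ∘ φ) (f ∘ ψ) n c := by
  induction n with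
  | zero => simp
  | succ n ih =>
    have : (cmap f).comp (prism φ ψ (n + 1)) = prism (f ∘ φ) (f ∘ ψ) (n + 1) := by
      ext v; obtain ⟨a, l, rfl⟩ := exists_vecCons v
      simp [ih, comp_cons, Function.comp_assoc]
    exact DFunLike.congr_fun this c

lemma prism_cmap (f : α → β) (φ ψ : β → γ) {n : ℕ} (c : Ch α n) :
    prism φ ψ n (cmap f c) = prism (φ ∘ f) (ψ ∘ f) n c := by
  induction n with
  | zero => simp
  | succ n ih =>
    have : (prism φ ψ (n + 1)).comp (cmap f) = prism (φ ∘ f) (ψ ∘ f) (n + 1) := by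
      ext v; obtain ⟨a, l, rfl⟩ := exists_vecCons v
      simp [comp_cons, ← ih, Function.comp_assoc]
    exact DFunLike.congr_fun this c

lemma prismTwo_cmap (f : α → β) (φ ψ χ : β → γ) {n : ℕ} (c : Ch α n) :
    prismTwo φ ψ χ n (cmap f c) = prismTwo (φ ∘ f) (ψ ∘ f) (χ ∘ f) n c := by
  induction n with
  | zero => simp
  | succ n ih =>
    have : (prismTwo φ ψ χ (n + 1)).comp (cmap f) = prismTwo (φ ∘ f) (ψ ∘ f) (χ ∘ f) (n + 1) := by
      ext v; obtain ⟨a, l, rfl⟩ := exists_vecCons v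
      simp [comp_cons, ← ih, ← prism_cmap, Function.comp_assoc]
    exact DFunLike.congr_fun this c

lemma cmap_prismTwo (φ ψ χ : α → β) (f : β → γ) {n : ℕ} (c : Ch α n) :
    cmap f (prismTwo φ ψ χ n c) = prismTwo (f ∘ φ) (f ∘ ψ) (f ∘ χ) n c := by
  induction n with
  | zero => simp
  | succ n ih =>
    have : (cmap f).comp (prismTwo φ ψ χ (n + 1)) =
        prismTwo (f ∘ φ) (f ∘ ψ) (f ∘ χ) (n + 1) := by
      ext v; obtain ⟨a, l, rfl⟩ := exists_vecCons v
      simp [ih, comp_cons, cmap_prism, Function.comp_assoc]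
    exact DFunLike.congr_fun this c

end Chains

section Coinvariants

open FreeAbelianGroup

variable {G : Type*} [Group G] {β γ : Type*} [MulAction G β]

/-- The subgroup of the free abelian group on a `G`-set whose quotient is the group of
`S`-coinvariants. -/
def coinv (S : Subgroup G) (β : Type*) [MulAction G β] : AddSubgroup (FreeAbelianGroup β) :=
  AddSubgroup.closure {x | ∃ s ∈ S, ∃ b : β, x = of (s • b) - of b}

lemma of_smul_sub_mem_coinv {S : Subgroup G} {s : G} (hs : s ∈ S) (b : β) :
    of (s • b) - of b ∈ coinv S β :=
  AddSubgroup.subset_closure ⟨s, hs, b, rfl⟩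

lemma coinv_mono {S S' : Subgroup G} (h : S ≤ S') : coinv S β ≤ coinv S' β :=
  AddSubgroup.closure_mono fun _ ⟨s, hs, b, e⟩ => ⟨s, h hs, b, e⟩

lemma coinv_le_comap {S : Subgroup G} {A : Type*} [AddCommGroup A] (f : FreeAbelianGroup β →+ A)
    (J : AddSubgroup A) (h : ∀ s ∈ S, ∀ b, f (of (s • b)) - f (of b) ∈ J) {c : FreeAbelianGroup β}
    (hc : c ∈ coinv S β) : f c ∈ J := by
  have : coinv S β ≤ J.comap f := by
    refine (AddSubgroup.closure_le _).2 ?_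
    rintro _ ⟨s, hs, b, rfl⟩
    simpa using h s hs b
  exact this hc

lemma coinv_le_ker {S : Subgroup G} {A : Type*} [AddCommGroup A] (f : FreeAbelianGroup β →+ A)
    (h : ∀ s ∈ S, ∀ b, f (of (s • b)) = f (of b)) {c : FreeAbelianGroup β}
    (hc : c ∈ coinv S β) : f c = 0 := by
  have := coinv_le_comap f ⊥ (fun s hs b => by simp [h s hs b]) hc
  simpa using this

/-- Coinvariants only involve finitely many group elements. -/
lemma exists_finset_of_mem_coinv {S : Subgroup G} {c : FreeAbelianGroup β} (hc : c ∈ coinv S β) :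
    ∃ t : Finset G, (t : Set G) ⊆ S ∧
      ∀ S' : Subgroup G, (t : Set G) ⊆ S' → c ∈ coinv S' β := by
  induction hc using AddSubgroup.closure_induction with
  | mem x hx =>
    obtain ⟨s, hs, b, rfl⟩ := hx
    exact ⟨{s}, by simpa using hs, fun S' h => of_smul_sub_mem_coinv (by simpa using h) b⟩
  | zero => exact ⟨∅, by simp, fun S' _ => zero_mem _⟩
  | add x y _ _ hx hy =>
    obtain ⟨t, ht, h⟩ := hx
    obtain ⟨t', ht', h'⟩ := hy
    refine ⟨t ∪ t', by simpa using ⟨ht, ht'⟩, fun S' hS => ?_⟩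
    simp only [Finset.coe_union, Set.union_subset_iff] at hS
    exact add_mem (h S' hS.1) (h' S' hS.2)
  | neg x _ hx =>
    obtain ⟨t, ht, h⟩ := hx
    exact ⟨t, ht, fun S' hS => neg_mem (h S' hS)⟩

/-- A normalisation map moves chains within their class of coinvariants. -/
lemma sub_map_mem_coinv {S : Subgroup G} (f : β → β) (hf : ∀ b, ∃ s ∈ S, f b = s • b)
    (c : FreeAbelianGroup β) : FreeAbelianGroup.map f c - c ∈ coinv S β := by
  refine map_mem_of_gen (FreeAbelianGroup.map f - AddMonoidHom.id _) _ (fun b => ?_) c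
  obtain ⟨s, hs, e⟩ := hf b
  simpa [e] using of_smul_sub_mem_coinv hs b

end Coinvariants

section Translation

open FreeAbelianGroup

variable {G : Type*} [Group G] {n : ℕ}

/-- Left translation of chains. -/
abbrev tr (g : G) : Ch G n →+ Ch G n := cmap (g * ·)

lemma of_smul_eq_tr (g : G) (l : Fin n → G) : of (g • l) = tr g (of l) := by
  rw [cmap_of]; rfl

lemma tr_tr (g h : G) (c : Ch G n) : tr g (tr h c) = tr (g * h) c := by
  rw [cmap_cmap]; congr 2; funext x; simp [mul_assoc]

lemma tr_one (c : Ch G n) : tr 1 c = c := by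
  have : ((1 : G) * ·) = id := by funext x; simp
  rw [tr, this, cmap_id]

lemma tr_sub_mem_coinv {S : Subgroup G} {s : G} (hs : s ∈ S) (c : Ch G n) :
    tr s c - c ∈ coinv S (Fin n → G) := by
  refine map_mem_of_gen (tr s - AddMonoidHom.id _) _ (fun b => ?_) c
  exact of_smul_sub_mem_coinv hs b

lemma coinv_le_of_tr {S : Subgroup G} {A : Type*} [AddCommGroup A] (f : Ch G n →+ A)
    (J : AddSubgroup A) (h : ∀ s ∈ S, ∀ b, f (tr s b) - f b ∈ J) {c : Ch G n}
    (hc : c ∈ coinv S (Fin n → G)) : f c ∈ J :=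
  coinv_le_comap f J (fun s hs b => by rw [of_smul_eq_tr]; exact h s hs (of b)) hc

lemma bd_coinv {S : Subgroup G} {c : Ch G (n + 1)} (hc : c ∈ coinv S (Fin (n + 1) → G)) :
    bd n c ∈ coinv S (Fin n → G) :=
  coinv_le_of_tr (bd n) _ (fun s hs b => by rw [bd_cmap]; exact tr_sub_mem_coinv hs _) hc

/-- Boundaries modulo `S`-coinvariants. -/
def Bd (S : Subgroup G) (n : ℕ) : AddSubgroup (Ch G n) :=
  coinv S (Fin n → G) ⊔ (bd n).range

variable {S : Subgroup G}

lemma mem_Bd {c : Ch G n} : c ∈ Bd S n ↔ ∃ d, c - bd n d ∈ coinv S (Fin n → G) := by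
  constructor
  · intro h
    obtain ⟨y, hy, _, ⟨d, rfl⟩, rfl⟩ := AddSubgroup.mem_sup.1 h
    exact ⟨d, by simpa using hy⟩
  · rintro ⟨d, hd⟩
    exact AddSubgroup.mem_sup.2 ⟨_, hd, _, ⟨d, rfl⟩, by simp⟩

lemma coinv_le_Bd : coinv S (Fin n → G) ≤ Bd S n := le_sup_left

lemma bd_mem_Bd (d : Ch G (n + 1)) : bd n d ∈ Bd S n := le_sup_right (a := coinv S _) ⟨d, rfl⟩

lemma Bd_mono {S' : Subgroup G} (h : S ≤ S') : Bd S n ≤ Bd S' n :=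
  sup_le_sup_right (coinv_mono h) _

/-- Chains that are closed modulo `S`-coinvariants. -/
def Closed (S : Subgroup G) (n : ℕ) : AddSubgroup (Ch G (n + 1)) :=
  (coinv S (Fin n → G)).comap (bd n)

lemma mem_Closed {c : Ch G (n + 1)} : c ∈ Closed S n ↔ bd n c ∈ coinv S (Fin n → G) := Iff.rfl

lemma Bd_le_Closed : Bd S (n + 1) ≤ Closed S n := by
  refine sup_le (fun c hc => bd_coinv hc) ?_
  rintro _ ⟨d, rfl⟩
  simp [mem_Closed]

lemma Closed_mono {S' : Subgroup G} (h : S ≤ S') : Closed S n ≤ Closed S' n :=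
  fun _ hc => coinv_mono h hc

end Translation

section Functoriality

open FreeAbelianGroup

variable {G G' : Type*} [Group G] [Group G'] {S : Subgroup G} {S' : Subgroup G'} {n : ℕ}

/-- `φ` intertwines the actions of `S` and `S'`. -/
def Equivar (S : Subgroup G) (S' : Subgroup G') (φ : G → G') : Prop :=
  ∀ s ∈ S, ∃ s' ∈ S', ∀ a, φ (s * a) = s' * φ a

/-- `φ` and `ψ` intertwine the actions of `S` and `S'` in the same way. -/
def Equivar₂ (S : Subgroup G) (S' : Subgroup G') (φ ψ : G → G') : Prop :=
  ∀ s ∈ S, ∃ s' ∈ S', (∀ a, φ (s * a) = s' * φ a) ∧ ∀ a, ψ (s * a) = s' * ψ a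

lemma cmap_tr {φ : G → G'} {s : G} {s' : G'} (h : ∀ a, φ (s * a) = s' * φ a) (c : Ch G n) :
    cmap φ (tr s c) = tr s' (cmap φ c) := by
  rw [tr, tr, cmap_cmap, cmap_cmap]; congr 2; funext a; exact h a

lemma Equivar.cmap_coinv {φ : G → G'} (h : Equivar S S' φ) {c : Ch G n}
    (hc : c ∈ coinv S (Fin n → G)) : cmap φ c ∈ coinv S' (Fin n → G') := by
  refine coinv_le_of_tr (cmap φ) _ (fun s hs b => ?_) hc
  obtain ⟨s', hs', e⟩ := h s hs
  rw [cmap_tr e]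
  exact tr_sub_mem_coinv hs' _

lemma Equivar.cmap_Bd {φ : G → G'} (h : Equivar S S' φ) {c : Ch G n}
    (hc : c ∈ Bd S n) : cmap φ c ∈ Bd S' n := by
  obtain ⟨d, hd⟩ := mem_Bd.1 hc
  refine mem_Bd.2 ⟨cmap φ d, ?_⟩
  rw [bd_cmap, ← map_sub]
  exact h.cmap_coinv hd

lemma Equivar.cmap_Closed {φ : G → G'} (h : Equivar S S' φ) {c : Ch G (n + 1)}
    (hc : c ∈ Closed S n) : cmap φ c ∈ Closed S' n := by
  rw [mem_Closed, bd_cmap]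
  exact h.cmap_coinv hc

lemma prism_tr {φ ψ : G → G'} {s : G} {s' : G'} (h : ∀ a, φ (s * a) = s' * φ a)
    (h' : ∀ a, ψ (s * a) = s' * ψ a) (c : Ch G n) :
    prism φ ψ n (tr s c) = tr s' (prism φ ψ n c) := by
  rw [tr, tr, prism_cmap, cmap_prism]
  congr 2 <;> funext a
  exacts [h a, h' a]

lemma Equivar₂.prism_coinv {φ ψ : G → G'} (h : Equivar₂ S S' φ ψ) {c : Ch G n}
    (hc : c ∈ coinv S (Fin n → G)) : prism φ ψ n c ∈ coinv S' (Fin (n + 1) → G') := by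
  refine coinv_le_of_tr (prism φ ψ n) _ (fun s hs b => ?_) hc
  obtain ⟨s', hs', e, e'⟩ := h s hs
  rw [prism_tr e e']
  exact tr_sub_mem_coinv hs' _

/-- Equivariantly homotopic maps agree on homology. -/
lemma Equivar₂.cmap_sub_cmap_mem_Bd {φ ψ : G → G'} (h : Equivar₂ S S' φ ψ) {c : Ch G (n + 1)}
    (hc : c ∈ Closed S n) : cmap ψ c - cmap φ c ∈ Bd S' (n + 1) := by
  refine mem_Bd.2 ⟨prism φ ψ (n + 1) c, ?_⟩
  rw [bd_prism, sub_sub_cancel]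
  exact h.prism_coinv hc

lemma equivar_hom (f : G →* G') (hf : ∀ s ∈ S, f s ∈ S') : Equivar S S' f :=
  fun s hs => ⟨f s, hf s hs, fun a => map_mul f s a⟩

/-- An equivariant retraction of a group onto a subgroup. -/
lemma exists_retraction (S : Subgroup G) :
    ∃ ρ : G → S, (∀ (s : S) (g : G), ρ (s * g) = s * ρ g) ∧ ∀ s : S, ρ s = s := by
  let o : G → G := fun g => (Quotient.mk (QuotientGroup.rightRel S) g).out
  have ho : ∀ g, g * (o g)⁻¹ ∈ S := fun g => by
    have : QuotientGroup.rightRel S (o g) g := Quotient.mk_out g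
    exact QuotientGroup.rightRel_apply.1 this
  have ho' : ∀ (s : S) g, o (s * g) = o g := fun s g => by
    have : (Quotient.mk (QuotientGroup.rightRel S) (s * g)) = Quotient.mk _ g := by
      refine Quotient.sound (QuotientGroup.rightRel_apply.2 ?_)
      simp
    simp only [o, this]
  let ρ₀ : G → S := fun g => ⟨g * (o g)⁻¹, ho g⟩
  have h0 : ∀ (s : S) (g : G), ρ₀ (s * g) = s * ρ₀ g := fun s g => by
    ext; simp [ρ₀, ho', mul_assoc]
  refine ⟨fun g => ρ₀ g * (ρ₀ 1)⁻¹, fun s g => by simp [h0, mul_assoc], fun s => ?_⟩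
  have := h0 s 1
  rw [mul_one] at this
  simp [this]

/-- Closed chains can be moved into the subgroup. -/
lemma exists_closed_subgroup (S : Subgroup G) {c : Ch G (n + 1)} (hc : c ∈ Closed S n) :
    ∃ c' ∈ Closed (⊤ : Subgroup S) n, cmap S.subtype c' - c ∈ Bd S (n + 1) := by
  obtain ⟨ρ, h1, -⟩ := exists_retraction S
  have e : Equivar S (⊤ : Subgroup S) ρ := fun s hs => ⟨⟨s, hs⟩, trivial, fun a => h1 ⟨s, hs⟩ a⟩
  refine ⟨cmap ρ c, e.cmap_Closed hc, ?_⟩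
  have e2 : Equivar₂ S S id (S.subtype ∘ ρ) := fun s hs =>
    ⟨s, hs, fun a => rfl, fun a => by simpa using congrArg Subtype.val (h1 ⟨s, hs⟩ a)⟩
  have := e2.cmap_sub_cmap_mem_Bd hc
  rwa [cmap_id, ← cmap_cmap] at this

lemma cmap_conj (g : G) (c : Ch G n) :
    tr g c = cmap (· * g) (cmap (MulAut.conj g) c) := by
  rw [tr, cmap_cmap]; congr 2; funext a; simp

/-- Translation by an element normalising `S` acts on homology like conjugation. -/
lemma tr_sub_conj_mem_Bd {g : G} (hg : ∀ s ∈ S, g * s * g⁻¹ ∈ S) {c : Ch G (n + 1)}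
    (hc : c ∈ Closed S n) : tr g c - cmap (MulAut.conj g) c ∈ Bd S (n + 1) := by
  have e : Equivar S S (MulAut.conj g : G → G) :=
    equivar_hom (MulAut.conj g).toMonoidHom fun s hs => by simpa using hg s hs
  have e2 : Equivar₂ S S id (· * g) := fun s hs => ⟨s, hs, fun a => rfl, fun a => mul_assoc s a g⟩
  have := e2.cmap_sub_cmap_mem_Bd (e.cmap_Closed hc)
  rwa [← cmap_conj, cmap_id] at this

lemma equivar_tr {g : G} (hg : ∀ s ∈ S, g * s * g⁻¹ ∈ S) : Equivar S S (g * ·) :=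
  fun s hs => ⟨_, hg s hs, fun a => by simp [mul_assoc]⟩

end Functoriality

section Pontryagin

open FreeAbelianGroup

variable {G G' : Type*} [Group G] [Group G'] {n : ℕ}

/-- The Pontryagin product with a degree one class. -/
abbrev pr (r : G) (n : ℕ) : Ch G n →+ Ch G (n + 1) := prism id (· * r) n

/-- The one-chain attached to a group element. -/
def pont₁ (t : G) : Ch G 2 := of ![1, t]

def pont₂ (s t : G) : Ch G 3 := pr s 2 (pont₁ t)

def pont₃ (r s t : G) : Ch G 4 := pr r 3 (pont₂ s t)

lemma cmap_pr (f : G →* G') (r : G) (c : Ch G n) :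
    cmap f (pr r n c) = pr (f r) n (cmap f c) := by
  rw [cmap_prism, prism_cmap]
  congr 2
  funext a; simp

lemma cmap_pont₁ (f : G →* G') (t : G) : cmap f (pont₁ t) = pont₁ (f t) := by
  simp [pont₁, comp_cons, Matrix.empty_eq]

lemma cmap_pont₂ (f : G →* G') (s t : G) : cmap f (pont₂ s t) = pont₂ (f s) (f t) := by
  rw [pont₂, cmap_pr, cmap_pont₁, pont₂]

lemma cmap_pont₃ (f : G →* G') (r s t : G) :
    cmap f (pont₃ r s t) = pont₃ (f r) (f s) (f t) := by
  rw [pont₃, cmap_pr, cmap_pont₂, pont₃]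

lemma pont₁_eq (t : G) : pont₁ t = cone 1 (cone t (of ![])) := by simp [pont₁]

lemma pont₂_eq (s t : G) : pont₂ s t =
    of ![1, s, t * s] - of ![1, t, t * s] := by
  simp [pont₂, pont₁_eq, comp_cons, Matrix.empty_eq]

lemma pont₂_self (s : G) : pont₂ s s = 0 := by
  rw [pont₂_eq]; simp

variable {S : Subgroup G}

lemma equivar₂_pr (r : G) : Equivar₂ S S id (· * r) :=
  fun s hs => ⟨s, hs, fun _ => rfl, fun a => mul_assoc s a r⟩

lemma pr_coinv (r : G) {c : Ch G n} (hc : c ∈ coinv S (Fin n → G)) :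
    pr r n c ∈ coinv S (Fin (n + 1) → G) := (equivar₂_pr r).prism_coinv hc

lemma pont₁_closed {t : G} (ht : t ∈ S) : pont₁ t ∈ Closed S 1 := by
  rw [mem_Closed]
  have := of_smul_sub_mem_coinv ht (![1] : Fin 1 → G)
  simpa [pont₁_eq] using this

end Pontryagin

section PontryaginComm

open FreeAbelianGroup

variable {H : Type*} [CommGroup H] {n : ℕ}

lemma cmap_mul_right (r : H) (c : Ch H n) : cmap (· * r) c = tr r c := by
  congr 2; funext a; exact mul_comm _ _

lemma pr_closed (r : H) {c : Ch H (n + 1)} (hc : c ∈ Closed ⊤ n) :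
    pr r (n + 1) c ∈ Closed ⊤ (n + 1) := by
  rw [mem_Closed, bd_prism, cmap_mul_right, cmap_id]
  exact sub_mem (tr_sub_mem_coinv (Subgroup.mem_top _) _) (pr_coinv r hc)

lemma pr_Bd (r : H) {c : Ch H (n + 1)} (hc : c ∈ Bd ⊤ (n + 1)) :
    pr r (n + 1) c ∈ Bd ⊤ (n + 2) := by
  obtain ⟨d, hd⟩ := mem_Bd.1 hc
  have h1 := coinv_le_Bd (pr_coinv r hd)
  have h2 := bd_prism id (· * r) d
  rw [cmap_mul_right, cmap_id] at h2
  have h3 : pr r (n + 1) c = pr r (n + 1) (c - bd (n + 1) d) + (tr r d - d)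
      - bd (n + 2) (pr r (n + 2) d) := by rw [h2, map_sub]; abel
  rw [h3]
  exact sub_mem (add_mem h1 (coinv_le_Bd (tr_sub_mem_coinv (Subgroup.mem_top _) _))) (bd_mem_Bd _)

lemma pr_mul (r r' : H) {c : Ch H (n + 1)} (hc : c ∈ Closed ⊤ n) :
    pr (r * r') (n + 1) c - pr r (n + 1) c - pr r' (n + 1) c ∈ Bd ⊤ (n + 2) := by
  have h := bd_prismTwo id (· * r) (· * (r * r')) c
  have h1 : prism (· * r) (· * (r * r')) (n + 1) c = tr r (pr r' (n + 1) c) := by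
    rw [← cmap_mul_right, cmap_prism]
    congr 2
    funext a; simp [mul_comm, mul_left_comm]
  rw [h1] at h
  have h2 : prismTwo id (· * r) (· * (r * r')) n (bd n c) ∈ coinv (⊤ : Subgroup H) _ := by
    refine coinv_le_of_tr (prismTwo id (· * r) (· * (r * r')) n) _ (fun s hs b => ?_) hc
    have : prismTwo id (· * r) (· * (r * r')) n (tr s b) =
        tr s (prismTwo id (· * r) (· * (r * r')) n b) := by
      rw [tr, tr, prismTwo_cmap, cmap_prismTwo]
      congr 2 <;> funext a <;> simp [mul_assoc]
    rw [this]
    exact tr_sub_mem_coinv hs _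
  have h3 : pr (r * r') (n + 1) c - pr r (n + 1) c - pr r' (n + 1) c =
      (tr r (pr r' (n + 1) c) - pr r' (n + 1) c) +
        prismTwo id (· * r) (· * (r * r')) n (bd n c) -
        bd (n + 2) (prismTwo id (· * r) (· * (r * r')) (n + 1) c) := by
    rw [sub_eq_iff_eq_add.1 h]
    abel
  rw [h3]
  exact sub_mem (add_mem (coinv_le_Bd (tr_sub_mem_coinv (Subgroup.mem_top _) _)) (coinv_le_Bd h2)) (bd_mem_Bd _)

lemma pont₁_mul (s t : H) : pont₁ (s * t) - pont₁ s - pont₁ t ∈ Bd (⊤ : Subgroup H) 2 := by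
  refine mem_Bd.2 ⟨-of ![1, s, s * t], ?_⟩
  have := of_smul_sub_mem_coinv (S := ⊤) (β := Fin 2 → H) (s := s) trivial ![1, t]
  convert this using 1
  simp only [pont₁, map_neg, sub_neg_eq_add, bd_succ_of, bd_zero_of, cone_of, map_sub]
  simp

end PontryaginComm

section Gysin

open FreeAbelianGroup

variable {G : Type*} [Group G] {n : ℕ} {S S' : Subgroup G} {t : G}

/-- Geometric sums of translates. -/
def geo (t : G) : ℤ → (Ch G n →+ Ch G n)
  | Int.ofNat m => ∑ i ∈ Finset.range m, tr (t⁻¹ ^ (i + 1))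
  | Int.negSucc m => -∑ i ∈ Finset.range (m + 1), tr (t ^ i)

lemma geo_succ (t : G) (j : ℤ) (c : Ch G n) : geo t (j + 1) (tr t c) = geo t j c + c := by
  rcases j with m | m
  · have : (Int.ofNat m + 1) = Int.ofNat (m + 1) := rfl
    rw [this]
    simp only [geo, AddMonoidHom.finsetSum_apply, tr_tr]
    rw [Finset.sum_range_succ']
    simp [pow_succ, tr_one]
  · rcases m with _ | m
    · simp [geo, tr_one, Int.negSucc_eq, -Int.ofNat_eq_natCast, -Int.ofNat_zero]
    · have : (Int.negSucc (m + 1) + 1) = Int.negSucc m := by omega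
      rw [this]
      simp only [geo, AddMonoidHom.neg_apply, AddMonoidHom.finsetSum_apply, tr_tr]
      rw [Finset.sum_range_succ' _ (m + 1)]
      simp [pow_succ, tr_one]

lemma tr_comm_sub_mem {x : G} (hx : ∀ s ∈ S, x * s * x⁻¹ ∈ S) {s : G} (hs : s ∈ S) (c : Ch G n) :
    tr x (tr s c) - tr x c ∈ coinv S (Fin n → G) := by
  have : tr x (tr s c) = tr (x * s * x⁻¹) (tr x c) := by simp [tr_tr]
  rw [this]
  exact tr_sub_mem_coinv (hx s hs) _

lemma tr_coinv {x : G} (hx : ∀ s ∈ S, x * s * x⁻¹ ∈ S) {c : Ch G n}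
    (hc : c ∈ coinv S (Fin n → G)) : tr x c ∈ coinv S (Fin n → G) :=
  (equivar_tr hx).cmap_coinv hc

lemma geo_coinv (hN : ∀ x ∈ S', ∀ s ∈ S, x * s * x⁻¹ ∈ S) (ht : t ∈ S') (j : ℤ) {s : G}
    (hs : s ∈ S) (c : Ch G n) : geo t j (tr s c) - geo t j c ∈ coinv S (Fin n → G) := by
  rcases j with m | m
  · simp only [geo, AddMonoidHom.finsetSum_apply, ← Finset.sum_sub_distrib]
    exact sum_mem fun i _ => tr_comm_sub_mem (hN _ (pow_mem (inv_mem ht) _)) hs c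
  · simp only [geo, AddMonoidHom.neg_apply, AddMonoidHom.finsetSum_apply, ← neg_sub',
      ← Finset.sum_sub_distrib]
    exact neg_mem (sum_mem fun i _ => tr_comm_sub_mem (hN _ (pow_mem ht _)) hs c)

/-- If `t` generates an infinite cyclic extension of `S`, then `t - 1` is injective on
`S`-coinvariants of chains. -/
lemma mem_coinv_of_tr_sub_mem (hN : ∀ x ∈ S', ∀ s ∈ S, x * s * x⁻¹ ∈ S) (ht : t ∈ S') (k : G → ℤ)
    (hk : ∀ s ∈ S, ∀ g, k (s * g) = k g) (hkt : ∀ g, k (t * g) = k g + 1) {h : Ch G (n + 1)}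
    (hh : tr t h - h ∈ coinv S (Fin (n + 1) → G)) : h ∈ coinv S (Fin (n + 1) → G) := by
  let D : Ch G (n + 1) →+ Ch G (n + 1) := FreeAbelianGroup.lift fun l => geo t (k (l 0)) (of l)
  have hD : ∀ l : Fin (n + 1) → G, D (of l) = geo t (k (l 0)) (of l) := fun l => by simp [D]
  have h1 : ∀ c, D (tr t c - c) = c := fun c => by
    have : D.comp (tr t - AddMonoidHom.id _) = AddMonoidHom.id _ := by
      ext l
      have e := geo_succ t (k (l 0)) (of l)
      simp only [AddMonoidHom.comp_apply, AddMonoidHom.sub_apply, AddMonoidHom.id_apply, map_sub]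
      rw [← of_smul_eq_tr, hD, hD, show (t • l) 0 = t * l 0 from rfl, hkt, of_smul_eq_tr, e]
      abel
    exact DFunLike.congr_fun this c
  rw [← h1 h]
  refine coinv_le_comap D _ (fun s hs l => ?_) hh
  rw [hD, hD, show (s • l) 0 = s * l 0 from rfl, hk s hs, of_smul_eq_tr]
  exact geo_coinv hN ht _ hs _

/-- Coinvariants for a cyclic extension. -/
lemma exists_tr_sub_of_mem_coinv (hS' : ∀ x ∈ S', ∃ s ∈ S, ∃ j : ℤ, x = s * t ^ j)
    {c : Ch G n} (hc : c ∈ coinv S' (Fin n → G)) :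
    ∃ h, c - (tr t h - h) ∈ coinv S (Fin n → G) := by
  let K := coinv S (Fin n → G) ⊔ (tr t - AddMonoidHom.id (Ch G n)).range
  have hr : ∀ b, tr t b - b ∈ K := fun b => AddSubgroup.mem_sup_right ⟨b, rfl⟩
  have hpow : ∀ (j : ℤ) (b : Ch G n), tr (t ^ j) b - b ∈ K := by
    intro j b
    induction j with
    | zero => simp [tr_one]
    | succ i ih =>
      have : tr (t ^ ((i : ℤ) + 1)) b - b =
          (tr t (tr (t ^ (i : ℤ)) b) - tr (t ^ (i : ℤ)) b) + (tr (t ^ (i : ℤ)) b - b) := by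
        rw [tr_tr, ← zpow_one_add, add_comm (1 : ℤ)]; abel
      rw [this]
      exact add_mem (hr _) ih
    | pred i ih =>
      have : tr (t ^ (-(i : ℤ) - 1)) b - b =
          -(tr t (tr (t ^ (-(i : ℤ) - 1)) b) - tr (t ^ (-(i : ℤ) - 1)) b) +
            (tr (t ^ (-(i : ℤ))) b - b) := by
        rw [tr_tr, ← zpow_one_add, add_sub_cancel]; abel
      rw [this]
      exact add_mem (neg_mem (hr _)) ih
  have : c ∈ K := by
    refine coinv_le_of_tr (AddMonoidHom.id (Ch G n)) K (fun x hx b => ?_) hc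
    obtain ⟨s, hs, j, rfl⟩ := hS' x hx
    have : tr (s * t ^ j) b - b = (tr s (tr (t ^ j) b) - tr (t ^ j) b) + (tr (t ^ j) b - b) := by
      rw [tr_tr]; abel
    simp only [AddMonoidHom.id_apply]
    rw [this]
    exact add_mem (AddSubgroup.mem_sup_left (tr_sub_mem_coinv hs _)) (hpow j b)
  obtain ⟨y, hy, _, ⟨h, rfl⟩, rfl⟩ := AddSubgroup.mem_sup.1 this
  exact ⟨h, by simpa using hy⟩

/-- The Gysin decomposition for infinite cyclic extensions. -/
lemma gysin (hN : ∀ x ∈ S', ∀ s ∈ S, x * s * x⁻¹ ∈ S) (ht : t ∈ S')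
    (hS' : ∀ x ∈ S', ∃ s ∈ S, ∃ j : ℤ, x = s * t ^ j) (k : G → ℤ)
    (hk : ∀ s ∈ S, ∀ g, k (s * g) = k g) (hkt : ∀ g, k (t * g) = k g + 1) {f : Ch G (n + 3)}
    (hf : f ∈ Closed S' (n + 2)) :
    ∃ h ∈ Closed S (n + 1), bd (n + 2) f - (tr t h - h) ∈ coinv S (Fin (n + 2) → G) := by
  obtain ⟨h, hh⟩ := exists_tr_sub_of_mem_coinv hS' hf
  refine ⟨h, mem_coinv_of_tr_sub_mem hN ht k hk hkt ?_, hh⟩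
  have := bd_coinv hh
  rw [map_sub, bd_bd, zero_sub, neg_mem_iff, map_sub, bd_cmap] at this
  exact this

end Gysin

section Cyclic

open FreeAbelianGroup

variable {G : Type*} [Group G] {m : ℕ} {S S' : Subgroup G} {t : G}

/-- The norm element of a cyclic group. -/
def nm (t : G) (n : ℕ) : Ch G m →+ Ch G m := ∑ i ∈ Finset.range n, tr (t ^ i)

lemma nm_apply (t : G) (n : ℕ) (c : Ch G m) : nm t n c = ∑ i ∈ Finset.range n, tr (t ^ i) c := by
  simp [nm, AddMonoidHom.finsetSum_apply]

lemma bd_nm (t : G) (n : ℕ) (c : Ch G (m + 1)) : bd m (nm t n c) = nm t n (bd m c) := by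
  simp [nm_apply, bd_cmap]

lemma tr_nm_sub (t : G) (n : ℕ) (c : Ch G m) : tr t (nm t n c) - nm t n c = tr (t ^ n) c - c := by
  simp only [nm_apply, map_sum, tr_tr, ← Finset.sum_sub_distrib, ← pow_succ']
  rw [Finset.sum_range_sub (fun i => tr (t ^ i) c)]
  simp [tr_one]

lemma nm_tr_sub (t : G) (n : ℕ) (c : Ch G m) : nm t n (tr t c - c) = tr (t ^ n) c - c := by
  rw [← tr_nm_sub, map_sub]
  congr 1
  simp only [nm_apply, map_sum, tr_tr, ← pow_succ, ← pow_succ']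

lemma nm_coinv (hN : ∀ x ∈ S', ∀ s ∈ S, x * s * x⁻¹ ∈ S) (ht : t ∈ S') (n : ℕ) {c : Ch G m}
    (hc : c ∈ coinv S (Fin m → G)) : nm t n c ∈ coinv S (Fin m → G) := by
  rw [nm_apply]
  exact sum_mem fun i _ => tr_coinv (hN _ (pow_mem ht _)) hc

variable (k : G → ℕ) {n : ℕ}

lemma cyclic_index (hn : ∀ g, k g < n) (hkt : ∀ g, 0 < k g → k (t * g) + 1 = k g)
    (hkt' : ∀ g, k g = 0 → k (t * g) + 1 = n) (g : G) (i : ℕ) (hi : i < n) :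
    k (t ^ i * g) = 0 ↔ i = k g := by
  have h1 : ∀ i, i ≤ k g → k (t ^ i * g) + i = k g := by
    intro i
    induction i with
    | zero => simp
    | succ i ih =>
      intro h
      have h2 := ih (by omega)
      have h3 := hkt (t ^ i * g) (by omega)
      rw [pow_succ', mul_assoc]; omega
  have h2 : ∀ i, i + k g + 1 < n + 1 → k (t ^ (k g + 1 + i) * g) + i + 1 = n := by
    intro i
    induction i with
    | zero =>
      intro _
      have := hkt' (t ^ (k g) * g) (by have := h1 (k g) le_rfl; omega)
      rw [add_zero, pow_succ', mul_assoc]; omega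
    | succ i ih =>
      intro h
      have h3 := ih (by omega)
      have h4 := hkt (t ^ (k g + 1 + i) * g) (by omega)
      have e : k g + 1 + (i + 1) = (k g + 1 + i) + 1 := by ring
      rw [e, pow_succ', mul_assoc]; omega
  rcases le_or_gt i (k g) with h | h
  · have := h1 i h; omega
  · obtain ⟨j, rfl⟩ := Nat.exists_eq_add_of_lt h
    have h5 := h2 j (by omega)
    have e : k g + j + 1 = k g + 1 + j := by ring
    rw [e]; omega

/-- Tate cohomology of the coinvariants for a finite cyclic extension vanishes. -/
lemma cyclic_exact (hN : ∀ x ∈ S', ∀ s ∈ S, x * s * x⁻¹ ∈ S) (ht : t ∈ S') (hn : ∀ g, k g < n)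
    (hk : ∀ s ∈ S, ∀ g, k (s * g) = k g) (hkt : ∀ g, 0 < k g → k (t * g) + 1 = k g)
    (hkt' : ∀ g, k g = 0 → k (t * g) + 1 = n) (h : Ch G (m + 1)) :
    (tr t h - h ∈ coinv S (Fin (m + 1) → G) → ∃ d, h - nm t n d ∈ coinv S (Fin (m + 1) → G)) ∧
    (nm t n h ∈ coinv S (Fin (m + 1) → G) →
      ∃ d, h - (tr t d - d) ∈ coinv S (Fin (m + 1) → G)) := by
  let D : Ch G (m + 1) →+ Ch G (m + 1) := FreeAbelianGroup.lift fun l => -nm t (k (l 0)) (of l)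
  have hD : ∀ l : Fin (m + 1) → G, D (of l) = -nm t (k (l 0)) (of l) := fun l => by simp [D]
  let E : Ch G (m + 1) →+ Ch G (m + 1) :=
    FreeAbelianGroup.lift fun l => if k (l 0) = 0 then of l else 0
  have hE : ∀ l : Fin (m + 1) → G, E (of l) = if k (l 0) = 0 then of l else 0 :=
    fun l => by simp [E]
  have hE' : ∀ (x : G) (l : Fin (m + 1) → G), E (tr x (of l)) =
      if k (x * l 0) = 0 then tr x (of l) else 0 := fun x l => by
    rw [← of_smul_eq_tr, hE]; rfl
  have h1 : ∀ c, D (tr t c - c) = c - nm t n (E c) := fun c => by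
    have : D.comp (tr t - AddMonoidHom.id _) = AddMonoidHom.id _ - (nm t n).comp E := by
      ext l
      simp only [AddMonoidHom.comp_apply, AddMonoidHom.sub_apply, AddMonoidHom.id_apply, map_sub]
      rw [← of_smul_eq_tr, hD, hD, hE, show (t • l) 0 = t * l 0 from rfl, of_smul_eq_tr]
      by_cases h0 : k (l 0) = 0
      · rw [if_pos h0, h0, ← hkt' _ h0, nm_apply, nm_apply, nm_apply, Finset.sum_range_succ']
        simp only [tr_tr, ← pow_succ, pow_zero, tr_one, Finset.range_zero, Finset.sum_empty]
        abel
      · have h3 := hkt (l 0) (by omega)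
        rw [if_neg h0, ← h3, nm_apply, nm_apply, Finset.sum_range_succ']
        simp only [tr_tr, ← pow_succ, pow_zero, tr_one, map_zero]
        abel
    exact DFunLike.congr_fun this c
  have h2 : ∀ c, c = (tr t (D c) - D c) + E (nm t n c) := fun c => by
    have : AddMonoidHom.id _ = (tr t - AddMonoidHom.id _).comp D + E.comp (nm t n) := by
      ext l
      simp only [AddMonoidHom.comp_apply, AddMonoidHom.sub_apply, AddMonoidHom.id_apply,
        AddMonoidHom.add_apply]
      rw [hD, map_neg, sub_neg_eq_add, neg_add_eq_sub, ← neg_sub, tr_nm_sub, nm_apply, map_sum,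
        Finset.sum_eq_single (k (l 0))]
      · rw [hE', if_pos ((cyclic_index k hn hkt hkt' _ _ (hn _)).2 rfl)]; abel
      · intro i hi hik
        rw [hE', if_neg]
        rwa [cyclic_index k hn hkt hkt' _ _ (Finset.mem_range.1 hi)]
      · intro h; exact absurd (Finset.mem_range.2 (hn _)) h
    exact DFunLike.congr_fun this c
  constructor
  · intro hh
    refine ⟨E h, ?_⟩
    rw [← h1]
    refine coinv_le_comap D _ (fun s hs l => ?_) hh
    rw [hD, hD, show (s • l) 0 = s * l 0 from rfl, hk s hs, of_smul_eq_tr, nm_apply, nm_apply,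
      neg_sub_neg, ← neg_sub, ← Finset.sum_sub_distrib]
    exact neg_mem (sum_mem fun i _ => tr_comm_sub_mem (hN _ (pow_mem ht _)) hs _)
  · intro hh
    refine ⟨D h, ?_⟩
    have : h - (tr t (D h) - D h) = E (nm t n h) := by
      rw [sub_eq_iff_eq_add', ← h2]
    rw [this]
    refine coinv_le_comap E _ (fun s hs l => ?_) hh
    rw [hE, hE, show (s • l) 0 = s * l 0 from rfl, hk s hs]
    split_ifs
    · exact of_smul_sub_mem_coinv hs l
    · simp

/-- The two-chain entering the definition of `rho`. -/
def rhoAux (t : G) (n : ℕ) : Ch G 3 := cone 1 (nm t n (pont₁ t))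

/-- The standard generator of the third homology of a finite cyclic group. -/
def rho (t : G) (n : ℕ) : Ch G 4 := cone 1 (tr t (rhoAux t n) - rhoAux t n)

lemma bd_pont₁ (t : G) : bd 1 (pont₁ t) = tr t (of ![1]) - of ![1] := by
  simp [pont₁_eq, comp_cons, Matrix.empty_eq]

lemma bd_rhoAux (ht : t ^ n = 1) : bd 2 (rhoAux t n) = nm t n (pont₁ t) := by
  rw [rhoAux, bd_succ_cone, bd_nm, bd_pont₁, nm_tr_sub, ht, tr_one]
  simp

lemma bd_rho (ht : t ^ n = 1) : bd 3 (rho t n) = tr t (rhoAux t n) - rhoAux t n := by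
  rw [rho, bd_succ_cone, map_sub (bd 2), bd_cmap, bd_rhoAux ht, tr_nm_sub, ht, tr_one]
  simp

lemma rho_closed (hn : t ^ n = 1) (ht : t ∈ S) : rho t n ∈ Closed S 3 := by
  rw [mem_Closed, bd_rho hn]
  exact tr_sub_mem_coinv ht _

/-- The third homology of a finite cyclic extension of an (almost) acyclic group is generated by
the class of `rho`. -/
theorem cyclic_homology_three (hN : ∀ x ∈ S', ∀ s ∈ S, x * s * x⁻¹ ∈ S) (ht : t ∈ S')
    (hS' : ∀ x ∈ S', ∃ s ∈ S, ∃ j : ℤ, x = s * t ^ j) (hn : ∀ g, k g < n)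
    (hk : ∀ s ∈ S, ∀ g, k (s * g) = k g) (hkt : ∀ g, 0 < k g → k (t * g) + 1 = k g)
    (hkt' : ∀ g, k g = 0 → k (t * g) + 1 = n) (htn : t ^ n = 1)
    (χ : Ch G 2 →+ ℚ) (hχ : ∀ x ∈ S', ∀ c, χ (tr x c) = χ c) (hχ' : ∀ d, χ (bd 2 d) = 0)
    (H1 : ∀ c ∈ Closed S 1, χ c = 0 → c ∈ Bd S 2)
    (H2 : Closed S 2 ≤ Bd S 3) (H3 : Closed S 3 ≤ Bd S 4) (hSS' : S ≤ S')
    {f : Ch G 4} (hf : f ∈ Closed S' 3) : ∃ m : ℤ, f - m • rho t n ∈ Bd S' 4 := by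
  have ex : ∀ {m : ℕ} (h : Ch G (m + 1)), _ := fun {m} h =>
    cyclic_exact (m := m) k hN ht hn hk hkt hkt' h
  obtain ⟨h₂, hh₂⟩ := exists_tr_sub_of_mem_coinv hS' hf
  have a1 : tr t (bd 2 h₂) - bd 2 h₂ ∈ coinv S _ := by
    have := bd_coinv hh₂
    rwa [map_sub, bd_bd, zero_sub, neg_mem_iff, map_sub, bd_cmap] at this
  obtain ⟨h₁, hh₁⟩ := (ex _).1 a1
  have a2 : nm t n (bd 1 h₁) ∈ coinv S _ := by
    have := bd_coinv hh₁
    rwa [map_sub, bd_bd, zero_sub, neg_mem_iff, bd_nm] at this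
  obtain ⟨h₀, hh₀⟩ := (ex _).2 a2
  obtain ⟨m, hm⟩ : ∃ m : ℤ, bd 0 (h₀ - m • of ![1]) = 0 := by
    have : ∀ c : Ch G 0, ∃ m : ℤ, c = m • of ![] := fun c => by
      induction c using fab_ind with
      | h0 => exact ⟨0, by simp⟩
      | h1 a => exact ⟨1, by rw [one_smul, Subsingleton.elim a]⟩
      | hn x hx => obtain ⟨m, rfl⟩ := hx; exact ⟨-m, by simp⟩
      | ha x y hx hy =>
        obtain ⟨m, rfl⟩ := hx; obtain ⟨m', rfl⟩ := hy; exact ⟨m + m', by rw [add_smul]⟩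
    obtain ⟨m, hm⟩ := this (bd 0 h₀)
    refine ⟨m, ?_⟩
    rw [map_sub, map_zsmul, hm, show (![1] : Fin 1 → G) = Matrix.vecCons 1 ![] from rfl,
      bd_zero_of, sub_self]
  refine ⟨m, ?_⟩
  obtain ⟨k₁, hk₁⟩ := exists_bd_of_bd_eq_zero _ hm
  set g₁ := h₁ - m • pont₁ t - (tr t k₁ - k₁) with hg₁
  have b1 : g₁ ∈ Closed S 1 := by
    rw [mem_Closed, hg₁]
    convert hh₀ using 1
    simp only [map_sub, map_zsmul, bd_cmap, hk₁, bd_pont₁, smul_sub]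
    abel
  have e1 : nm t n g₁ = nm t n h₁ - m • nm t n (pont₁ t) := by
    rw [hg₁, map_sub, map_sub, nm_tr_sub, htn, tr_one, sub_self, sub_zero, map_zsmul]
  have b2 : χ g₁ = 0 := by
    have h1 : χ (nm t n g₁) = n * χ g₁ := by
      rw [nm_apply, map_sum, Finset.sum_congr rfl fun i _ => hχ _ (pow_mem ht i) g₁]
      simp
    have h2 : χ (nm t n g₁) = 0 := by
      rw [e1, ← bd_rhoAux htn, map_sub, map_zsmul, hχ', smul_zero, sub_zero]
      have := coinv_le_of_tr χ ⊥ (fun s hs b => by simp [hχ s (hSS' hs)]) hh₁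
      rw [AddSubgroup.mem_bot, map_sub, hχ', zero_sub, neg_eq_zero] at this
      exact this
    have : (n : ℚ) ≠ 0 := by
      have := hn 1; exact_mod_cast (by omega : n ≠ 0)
    rw [h1] at h2
    exact (mul_eq_zero.1 h2).resolve_left this
  obtain ⟨k₂, hk₂⟩ := mem_Bd.1 (H1 g₁ b1 b2)
  set g₂ := h₂ - m • rhoAux t n - nm t n k₂ with hg₂
  have b3 : g₂ ∈ Closed S 2 := by
    rw [mem_Closed, hg₂]
    have c1 := nm_coinv hN ht n hk₂
    rw [map_sub, e1] at c1
    convert add_mem hh₁ c1 using 1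
    simp only [map_sub, map_zsmul, bd_nm, bd_rhoAux htn]
    abel
  obtain ⟨k₃, hk₃⟩ := mem_Bd.1 (H2 b3)
  set g₃ := f - m • rho t n - (tr t k₃ - k₃) with hg₃
  have b4 : g₃ ∈ Closed S 3 := by
    rw [mem_Closed, hg₃]
    have c1 := sub_mem (tr_coinv (hN t ht) hk₃) hk₃
    convert add_mem hh₂ c1 using 1
    have c2 := tr_nm_sub t n k₂
    rw [htn, tr_one, sub_self, sub_eq_zero] at c2
    simp only [map_sub, map_zsmul, bd_cmap, bd_rho htn, hg₂, c2, smul_sub]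
    abel
  have : f - m • rho t n = g₃ + (tr t k₃ - k₃) := by rw [hg₃]; abel
  rw [this]
  exact add_mem (Bd_mono hSS' (H3 b4)) (coinv_le_Bd (tr_sub_mem_coinv ht _))

/-- Two-cycles for a finite cyclic extension come from one-cycles of the kernel. -/
theorem cyclic_homology_two (hN : ∀ x ∈ S', ∀ s ∈ S, x * s * x⁻¹ ∈ S) (ht : t ∈ S')
    (hS' : ∀ x ∈ S', ∃ s ∈ S, ∃ j : ℤ, x = s * t ^ j) (hn : ∀ g, k g < n)
    (hk : ∀ s ∈ S, ∀ g, k (s * g) = k g) (hkt : ∀ g, 0 < k g → k (t * g) + 1 = k g)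
    (hkt' : ∀ g, k g = 0 → k (t * g) + 1 = n) (htn : t ^ n = 1)
    {f : Ch G 3} (hf : f ∈ Closed S' 2) :
    ∃ h ∈ Closed S 1, bd 2 f - (tr t h - h) ∈ coinv S (Fin 2 → G) := by
  obtain ⟨h₁, hh₁⟩ := exists_tr_sub_of_mem_coinv hS' hf
  have a1 : tr t (bd 1 h₁) - bd 1 h₁ ∈ coinv S _ := by
    have := bd_coinv hh₁
    rwa [map_sub, bd_bd, zero_sub, neg_mem_iff, map_sub, bd_cmap] at this
  obtain ⟨h₀, hh₀⟩ := (cyclic_exact k hN ht hn hk hkt hkt' _).1 a1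
  have a2 : bd 0 h₀ = 0 := by
    have h1 := bd_coinv hh₀
    have h2 : ∀ (c : Ch G 0) (x : G), tr x c = c := fun c x => by
      have : tr x = AddMonoidHom.id (Ch G 0) := by
        ext v; simp [Subsingleton.elim ((x * ·) ∘ v) v]
      exact DFunLike.congr_fun this c
    rw [map_sub, bd_bd, zero_sub, neg_mem_iff, bd_nm, nm_apply] at h1
    simp only [h2, Finset.sum_const, Finset.card_range] at h1
    have h3 := coinv_le_of_tr (AddMonoidHom.id (Ch G 0)) ⊥ (fun s hs b => by simp [h2]) h1
    rw [AddSubgroup.mem_bot, AddMonoidHom.id_apply] at h3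
    let e := FreeAbelianGroup.uniqueEquiv (Fin 0 → G)
    have h4 : n • e (bd 0 h₀) = 0 := by rw [← map_nsmul, h3, map_zero]
    have h5 := hn 1
    have h6 : e (bd 0 h₀) = 0 := by
      rw [nsmul_eq_mul, mul_eq_zero] at h4
      rcases h4 with h4 | h4
      · omega
      · exact h4
    exact (AddEquiv.map_eq_zero_iff e).1 h6
  obtain ⟨k₁, hk₁⟩ := exists_bd_of_bd_eq_zero _ a2
  refine ⟨h₁ - nm t n k₁, ?_, ?_⟩
  · rw [mem_Closed, map_sub, bd_nm, hk₁]; exact hh₀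
  · have c2 := tr_nm_sub t n k₁
    rw [htn, tr_one, sub_self, sub_eq_zero] at c2
    convert hh₁ using 1
    rw [map_sub, c2]; abel

end Cyclic

section PontryaginGeneration

open FreeAbelianGroup

lemma mem_coinv_bot {G β : Type*} [Group G] [MulAction G β] {c : FreeAbelianGroup β}
    (hc : c ∈ coinv (⊥ : Subgroup G) β) : c = 0 := by
  refine coinv_le_ker (AddMonoidHom.id _) (fun s hs b => ?_) hc
  rw [Subgroup.mem_bot.1 hs, one_smul]

lemma closed_bot_le {G : Type*} [Group G] {n : ℕ} :
    Closed (⊥ : Subgroup G) n ≤ Bd (⊥ : Subgroup G) (n + 1) := fun c hc => by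
  obtain ⟨d, rfl⟩ := exists_bd_of_bd_eq_zero c (mem_coinv_bot hc)
  exact bd_mem_Bd d

/-- The subgroup of two-chains spanned by Pontryagin products. -/
def Pont2 (H : Type*) [Group H] : AddSubgroup (Ch H 3) :=
  AddSubgroup.closure (Set.range fun p : H × H => pont₂ p.1 p.2)

/-- The subgroup of three-chains spanned by Pontryagin products and classes of finite cyclic
groups. -/
def Pont3 (H : Type*) [Group H] : AddSubgroup (Ch H 4) :=
  AddSubgroup.closure ((Set.range fun p : H × H × H => pont₃ p.1 p.2.1 p.2.2) ∪
    {c | ∃ t n, 0 < n ∧ t ^ n = 1 ∧ c = rho t n})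

/-- Low dimensional homology is generated by Pontryagin products and cyclic groups. -/
structure PontGen (H : Type*) [Group H] : Prop where
  two : Closed (⊤ : Subgroup H) 2 ≤ Pont2 H ⊔ Bd ⊤ 3
  three : Closed (⊤ : Subgroup H) 3 ≤ Pont3 H ⊔ Bd ⊤ 4

section Hom

variable {H K : Type*} [Group H] [Group K] (f : H →* K)

lemma cmap_rho (t : H) (n : ℕ) : cmap f (rho t n) = rho (f t) n := by
  have h1 : ∀ {m : ℕ} (g : H) (c : Ch H m), cmap f (tr g c) = tr (f g) (cmap f c) :=
    fun g c => cmap_tr (fun a => map_mul f g a) c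
  have h2 : cmap f (rhoAux t n) = rhoAux (f t) n := by
    simp only [rhoAux]
    rw [cmap_cone, map_one, nm_apply, nm_apply, map_sum]
    congr 1
    exact Finset.sum_congr rfl fun i _ => by rw [h1, map_pow, cmap_pont₁]
  rw [rho, rho, cmap_cone, map_one, map_sub, h1, h2]

lemma cmap_Pont2 {c : Ch H 3} (hc : c ∈ Pont2 H) : cmap f c ∈ Pont2 K := by
  suffices Pont2 H ≤ (Pont2 K).comap (cmap f) from this hc
  refine (AddSubgroup.closure_le _).2 ?_
  rintro _ ⟨p, rfl⟩
  exact AddSubgroup.subset_closure ⟨(f p.1, f p.2), (cmap_pont₂ f _ _).symm⟩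

lemma cmap_Pont3 {c : Ch H 4} (hc : c ∈ Pont3 H) : cmap f c ∈ Pont3 K := by
  suffices Pont3 H ≤ (Pont3 K).comap (cmap f) from this hc
  refine (AddSubgroup.closure_le _).2 ?_
  rintro _ (⟨p, rfl⟩ | ⟨t, n, hn, ht, rfl⟩)
  · exact AddSubgroup.subset_closure (Or.inl ⟨(f p.1, f p.2.1, f p.2.2), (cmap_pont₃ f _ _ _).symm⟩)
  · exact AddSubgroup.subset_closure
      (Or.inr ⟨f t, n, hn, by rw [← map_pow, ht, map_one], cmap_rho f t n⟩)

lemma equivar_top : Equivar (⊤ : Subgroup H) (⊤ : Subgroup K) f := equivar_hom f fun _ _ => trivial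

lemma cmap_Pont2_Bd {S : Subgroup K} (hS : ∀ h, f h ∈ S) {c : Ch H 3}
    (hc : c ∈ Pont2 H ⊔ Bd ⊤ 3) : cmap f c ∈ Pont2 K ⊔ Bd S 3 := by
  obtain ⟨y, hy, z, hz, rfl⟩ := AddSubgroup.mem_sup.1 hc
  rw [map_add]
  exact AddSubgroup.add_mem_sup (cmap_Pont2 f hy) ((equivar_hom f fun s _ => hS s).cmap_Bd hz)

lemma cmap_Pont3_Bd {S : Subgroup K} (hS : ∀ h, f h ∈ S) {c : Ch H 4}
    (hc : c ∈ Pont3 H ⊔ Bd ⊤ 4) : cmap f c ∈ Pont3 K ⊔ Bd S 4 := by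
  obtain ⟨y, hy, z, hz, rfl⟩ := AddSubgroup.mem_sup.1 hc
  rw [map_add]
  exact AddSubgroup.add_mem_sup (cmap_Pont3 f hy) ((equivar_hom f fun s _ => hS s).cmap_Bd hz)

lemma PontGen.congr (e : H ≃* K) (h : PontGen H) : PontGen K := by
  have key : ∀ {n : ℕ} (c : Ch K n), cmap e.toMonoidHom (cmap e.symm.toMonoidHom c) = c := by
    intro n c
    rw [cmap_cmap]
    have : ((e.toMonoidHom : H → K) ∘ (e.symm.toMonoidHom : K → H)) = id := by
      funext x; simp
    rw [this, cmap_id]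
  constructor
  · intro f hf
    rw [← key f]
    exact cmap_Pont2_Bd _ (fun _ => Subgroup.mem_top _) (h.two ((equivar_top _).cmap_Closed hf))
  · intro f hf
    rw [← key f]
    exact cmap_Pont3_Bd _ (fun _ => Subgroup.mem_top _) (h.three ((equivar_top _).cmap_Closed hf))

/-- A subgroup is generated by Pontryagin products if it is the isomorphic image of such a group. -/
lemma PontGen.of_subgroup (S : Subgroup K) (h : PontGen S) :
    Closed S 2 ≤ Pont2 K ⊔ Bd S 3 ∧ Closed S 3 ≤ Pont3 K ⊔ Bd S 4 := by
  constructor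
  · intro f hf
    obtain ⟨c, hc, hd⟩ := exists_closed_subgroup S hf
    have := cmap_Pont2_Bd S.subtype (S := S) (fun x => x.2) (h.two hc)
    rw [← sub_sub_cancel (cmap S.subtype c) f]
    exact sub_mem this (AddSubgroup.mem_sup_right hd)
  · intro f hf
    obtain ⟨c, hc, hd⟩ := exists_closed_subgroup S hf
    have := cmap_Pont3_Bd S.subtype (S := S) (fun x => x.2) (h.three hc)
    rw [← sub_sub_cancel (cmap S.subtype c) f]
    exact sub_mem this (AddSubgroup.mem_sup_right hd)

lemma PontGen.of_fg (h : ∀ S : Subgroup K, S.FG → PontGen S) : PontGen K := by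
  constructor
  · intro f hf
    obtain ⟨t, -, ht⟩ := exists_finset_of_mem_coinv hf
    have h1 := (h _ ⟨t, rfl⟩).of_subgroup.1 (ht _ Subgroup.subset_closure)
    exact sup_le_sup_left (Bd_mono le_top) _ h1
  · intro f hf
    obtain ⟨t, -, ht⟩ := exists_finset_of_mem_coinv hf
    have h1 := (h _ ⟨t, rfl⟩).of_subgroup.2 (ht _ Subgroup.subset_closure)
    exact sup_le_sup_left (Bd_mono le_top) _ h1

end Hom

section Comm

variable {H : Type*} [CommGroup H]

lemma exists_pont₁ (c : Ch H 2) : ∃ s, c - pont₁ s ∈ Bd (⊤ : Subgroup H) 2 := by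
  induction c using fab_ind with
  | h0 =>
    refine ⟨1, ?_⟩
    have := pont₁_mul (1 : H) 1
    rwa [mul_one, sub_self] at this
  | h1 l =>
    refine ⟨(l 0)⁻¹ * l 1, ?_⟩
    have := of_smul_sub_mem_coinv (S := (⊤ : Subgroup H)) (s := l 0) trivial ![1, (l 0)⁻¹ * l 1]
    have e : l 0 • ![1, (l 0)⁻¹ * l 1] = l := by
      funext i; fin_cases i <;> simp
    rw [e] at this
    exact coinv_le_Bd this
  | hn c h =>
    obtain ⟨s, hs⟩ := h
    refine ⟨s⁻¹, ?_⟩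
    have h1 := pont₁_mul s s⁻¹
    have h2 := pont₁_mul (1 : H) 1
    rw [mul_one, sub_self, zero_sub, neg_mem_iff] at h2
    rw [mul_inv_cancel] at h1
    have : -c - pont₁ s⁻¹ = -(c - pont₁ s) + (pont₁ 1 - pont₁ s - pont₁ s⁻¹) - pont₁ 1 := by abel
    rw [this]
    exact sub_mem (add_mem (neg_mem hs) h1) h2
  | ha x y hx hy =>
    obtain ⟨s, hs⟩ := hx
    obtain ⟨t, ht⟩ := hy
    refine ⟨s * t, ?_⟩
    have : x + y - pont₁ (s * t) =
      (x - pont₁ s) + (y - pont₁ t) - (pont₁ (s * t) - pont₁ s - pont₁ t) := by abel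
    rw [this]
    exact sub_mem (add_mem hs ht) (pont₁_mul s t)

lemma pont₂_closed (s t : H) : pont₂ s t ∈ Closed (⊤ : Subgroup H) 2 :=
  pr_closed s (pont₁_closed (Subgroup.mem_top t))

lemma pont₃_closed (r s t : H) : pont₃ r s t ∈ Closed (⊤ : Subgroup H) 3 :=
  pr_closed r (pont₂_closed s t)

lemma Pont2_le_Closed : Pont2 H ≤ Closed ⊤ 2 := by
  refine (AddSubgroup.closure_le _).2 ?_
  rintro _ ⟨p, rfl⟩
  exact pont₂_closed _ _

lemma pr_Pont2 (r : H) {c : Ch H 3} (hc : c ∈ Pont2 H) : pr r 3 c ∈ Pont3 H := by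
  suffices Pont2 H ≤ (Pont3 H).comap (pr r 3) from this hc
  refine (AddSubgroup.closure_le _).2 ?_
  rintro _ ⟨p, rfl⟩
  exact AddSubgroup.subset_closure (Or.inl ⟨(r, p.1, p.2), rfl⟩)

lemma bd_pr_sub {n : ℕ} {S : Subgroup H} (t : H) {c : Ch H (n + 1)} (hc : c ∈ Closed S n) :
    bd (n + 1) (pr t (n + 1) c) - (tr t c - c) ∈ coinv S _ := by
  rw [bd_prism, cmap_mul_right, cmap_id, sub_sub_cancel_left]
  exact neg_mem (pr_coinv t hc)

/-- One Gysin step: if the residue of a cycle is homologous to `c`, then the cycle is homologous to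
the sum of the Pontryagin product with `c` and a cycle of the smaller group. -/
lemma gysin_step {n : ℕ} {S : Subgroup H} {t : H} {f : Ch H (n + 3)} {h c : Ch H (n + 2)}
    (hf : bd (n + 2) f - (tr t h - h) ∈ coinv S (Fin (n + 2) → H)) (hc : c ∈ Closed S (n + 1))
    (hhc : h - c ∈ Bd S (n + 2)) :
    ∃ k, f - pr t (n + 2) c - (tr t k - k) ∈ Closed S (n + 2) := by
  obtain ⟨k, hk⟩ := mem_Bd.1 hhc
  refine ⟨k, ?_⟩
  have h1 := tr_coinv (S := S) (x := t) (fun s hs => by simpa [mul_comm t s] using hs) hk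
  rw [mem_Closed]
  have h2 := bd_pr_sub t hc
  convert add_mem (sub_mem hf h2) (sub_mem h1 hk) using 1
  simp only [map_sub, bd_cmap]
  abel

lemma PontGen.prod_int (hH : PontGen H) : PontGen (H × Multiplicative ℤ) := by
  let K := H × Multiplicative ℤ
  let S : Subgroup K := (MonoidHom.inl H (Multiplicative ℤ)).range
  let t : K := (1, Multiplicative.ofAdd 1)
  let k : K → ℤ := fun g => Multiplicative.toAdd g.2
  have hk : ∀ s ∈ S, ∀ g, k (s * g) = k g := by
    rintro _ ⟨s, rfl⟩ g
    exact congrArg Multiplicative.toAdd (one_mul g.2)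
  have hkt : ∀ g, k (t * g) = k g + 1 := fun g => add_comm _ _
  have hS' : ∀ x ∈ (⊤ : Subgroup K), ∃ s ∈ S, ∃ j : ℤ, x = s * t ^ j := by
    rintro ⟨x, j⟩ -
    refine ⟨(x, 1), ⟨x, rfl⟩, Multiplicative.toAdd j, ?_⟩
    have h1 : (t ^ Multiplicative.toAdd j).1 = 1 := (Prod.pow_fst t _).trans (one_zpow _)
    have h2 : (t ^ Multiplicative.toAdd j).2 = j :=
      (Prod.pow_snd t _).trans (by rw [← ofAdd_zsmul, zsmul_one]; rfl)
    refine Prod.ext ?_ ?_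
    · exact (mul_one x).symm.trans (congrArg (x * ·) h1.symm)
    · exact (one_mul j).symm.trans (congrArg ((1 : Multiplicative ℤ) * ·) h2.symm)
  have hN : ∀ x ∈ (⊤ : Subgroup K), ∀ s ∈ S, x * s * x⁻¹ ∈ S := fun x _ s hs => by
    rwa [mul_comm x s, mul_inv_cancel_right]
  have hS : PontGen S := hH.congr (MonoidHom.ofInjective (f := MonoidHom.inl H (Multiplicative ℤ))
    (fun a b h => (Prod.mk.inj h).1))
  have red : ∀ {m : ℕ} {c k : Ch K m} {J : AddSubgroup (Ch K m)},
      c - (tr t k - k) ∈ J ⊔ Bd S m → c ∈ J ⊔ Bd ⊤ m := by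
    intro m c k J h
    rw [← sub_add_cancel c (tr t k - k)]
    exact add_mem (sup_le_sup_left (Bd_mono le_top) _ h)
      (AddSubgroup.mem_sup_right (coinv_le_Bd (tr_sub_mem_coinv (Subgroup.mem_top t) k)))
  constructor
  · intro f hf
    obtain ⟨h, hh, hfh⟩ := gysin hN trivial hS' k hk hkt hf
    obtain ⟨h', -, hd⟩ := exists_closed_subgroup S hh
    obtain ⟨s, hs⟩ := exists_pont₁ h'
    have hs' := (equivar_hom S.subtype (S := ⊤) (S' := S) fun x _ => x.2).cmap_Bd hs
    rw [map_sub, cmap_pont₁] at hs'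
    have h1 : h - pont₁ (S.subtype s) ∈ Bd S 2 := by
      convert sub_mem hs' hd using 1; abel
    obtain ⟨k, hk⟩ := gysin_step hfh (pont₁_closed s.2) h1
    have h2 := hS.of_subgroup.1 hk
    have h3 := red h2
    rw [← sub_add_cancel f (pont₂ t (S.subtype s))]
    exact add_mem h3 (AddSubgroup.mem_sup_left (AddSubgroup.subset_closure ⟨(t, S.subtype s), rfl⟩))
  · intro f hf
    obtain ⟨h, hh, hfh⟩ := gysin hN trivial hS' k hk hkt hf
    obtain ⟨h', hh', hd⟩ := exists_closed_subgroup S hh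
    obtain ⟨y, hy, z, hz, rfl⟩ := AddSubgroup.mem_sup.1 (hS.two hh')
    have hz' := (equivar_hom S.subtype (S := ⊤) (S' := S) fun x _ => x.2).cmap_Bd hz
    have h1 : h - cmap S.subtype y ∈ Bd S 3 := by
      rw [map_add] at hd
      convert sub_mem hz' hd using 1; abel
    have hy' := (equivar_hom S.subtype (S := ⊤) (S' := S) fun x _ => x.2).cmap_Closed
      (Pont2_le_Closed hy)
    obtain ⟨k, hk⟩ := gysin_step hfh hy' h1
    have h2 := hS.of_subgroup.2 hk
    have h3 := red h2
    rw [← sub_add_cancel f (pr t 3 (cmap S.subtype y))]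
    exact add_mem h3 (AddSubgroup.mem_sup_left (pr_Pont2 t (cmap_Pont2 _ hy)))

end Comm

theorem zmod_closed (n : ℕ) :
    (n ≠ 0 → Closed (⊤ : Subgroup (Multiplicative (ZMod n))) 2 ≤ Bd ⊤ 3) ∧
      ∀ f ∈ Closed (⊤ : Subgroup (Multiplicative (ZMod n))) 3, n ≠ 0 →
        ∃ m : ℤ, f - m • rho (Multiplicative.ofAdd (1 : ZMod n)) n ∈ Bd ⊤ 4 := by
  rcases eq_or_ne n 0 with h0 | h0
  · exact ⟨fun h => absurd h0 h, fun _ _ h => absurd h0 h⟩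
  have : NeZero n := ⟨h0⟩
  let K := Multiplicative (ZMod n)
  let t : K := Multiplicative.ofAdd 1
  let k : K → ℕ := fun g => (-Multiplicative.toAdd g).val
  have hN : ∀ x ∈ (⊤ : Subgroup K), ∀ s ∈ (⊥ : Subgroup K), x * s * x⁻¹ ∈ (⊥ : Subgroup K) :=
    fun x _ s hs => by rwa [mul_comm x s, mul_inv_cancel_right]
  have hS' : ∀ x ∈ (⊤ : Subgroup K), ∃ s ∈ (⊥ : Subgroup K), ∃ j : ℤ, x = s * t ^ j := fun x _ => by
    refine ⟨1, one_mem _, ((Multiplicative.toAdd x).val : ℤ), ?_⟩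
    rw [one_mul, zpow_natCast]
    show x = Multiplicative.ofAdd (((Multiplicative.toAdd x).val) • (1 : ZMod n))
    rw [nsmul_one, ZMod.natCast_zmod_val]
    rfl
  have hn : ∀ g, k g < n := fun g => ZMod.val_lt _
  have hk : ∀ s ∈ (⊥ : Subgroup K), ∀ g, k (s * g) = k g := fun s hs g => by
    rw [Subgroup.mem_bot.1 hs, one_mul]
  have hkt0 : ∀ g, -Multiplicative.toAdd g = -Multiplicative.toAdd (t * g) + 1 := fun g => by
    show -Multiplicative.toAdd g = -(1 + Multiplicative.toAdd g) + 1
    ring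
  have hval : ∀ g, k g = (k (t * g) + 1) % n := fun g => by
    show (-Multiplicative.toAdd g).val = _
    rw [hkt0, ZMod.val_add, ZMod.val_one_eq_one_mod, Nat.add_mod_mod]
  have hkt : ∀ g, 0 < k g → k (t * g) + 1 = k g := fun g hg => by
    have h1 := hn (t * g)
    have h2 := hval g
    rcases Nat.lt_or_ge (k (t * g) + 1) n with h | h
    · rw [Nat.mod_eq_of_lt h] at h2; exact h2.symm
    · rw [show k (t * g) + 1 = n by omega, Nat.mod_self] at h2; omega
  have hkt' : ∀ g, k g = 0 → k (t * g) + 1 = n := fun g hg => by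
    have h1 := hn (t * g)
    have h2 := hval g
    rcases Nat.lt_or_ge (k (t * g) + 1) n with h | h
    · rw [Nat.mod_eq_of_lt h] at h2; omega
    · omega
  have htn : t ^ n = 1 := by
    show Multiplicative.ofAdd (n • (1 : ZMod n)) = 1
    rw [nsmul_one, ZMod.natCast_self]
    rfl
  constructor
  · intro _ f hf
    obtain ⟨h, hh, hfh⟩ := cyclic_homology_two k hN trivial hS' hn hk hkt hkt' htn hf
    obtain ⟨d, rfl⟩ := exists_bd_of_bd_eq_zero _ (mem_coinv_bot hh)
    have h1 := mem_coinv_bot hfh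
    rw [← bd_cmap, ← map_sub, ← map_sub] at h1
    obtain ⟨e, he⟩ := exists_bd_of_bd_eq_zero _ h1
    rw [← sub_add_cancel f (tr t d - d), ← he]
    exact add_mem (bd_mem_Bd e) (coinv_le_Bd (tr_sub_mem_coinv (Subgroup.mem_top t) d))
  · intro f hf _
    exact cyclic_homology_three k hN trivial hS' hn hk hkt hkt' htn 0
      (fun _ _ _ => rfl) (fun _ => rfl) (fun c hc _ => closed_bot_le hc) closed_bot_le
      closed_bot_le bot_le hf

lemma zmod_ofAdd_one_pow (n : ℕ) : Multiplicative.ofAdd (1 : ZMod n) ^ n = 1 := by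
  rw [← ofAdd_nsmul, nsmul_one, ZMod.natCast_self]
  rfl

lemma pontGen_zmod (n : ℕ) [NeZero n] : PontGen (Multiplicative (ZMod n)) where
  two := ((zmod_closed n).1 (NeZero.ne n)).trans le_sup_right
  three f hf := by
    obtain ⟨m, hm⟩ := (zmod_closed n).2 f hf (NeZero.ne n)
    rw [← sub_add_cancel f (m • rho (Multiplicative.ofAdd (1 : ZMod n)) n)]
    refine add_mem (AddSubgroup.mem_sup_right hm) (AddSubgroup.mem_sup_left (zsmul_mem ?_ m))
    exact AddSubgroup.subset_closure
      (Or.inr ⟨_, n, Nat.pos_of_ne_zero (NeZero.ne n), zmod_ofAdd_one_pow n, rfl⟩)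

lemma PontGen.prod_pi {H : Type*} [CommGroup H] (hH : PontGen H) (n : ℕ) :
    PontGen (H × (Fin n → Multiplicative ℤ)) := by
  induction n with
  | zero => exact hH.congr (MulEquiv.prodUnique).symm
  | succ n ih =>
    refine (ih.prod_int).congr
      { toFun := fun x => (x.1.1, Fin.cons x.2 x.1.2)
        invFun := fun x => ((x.1, Fin.tail x.2), x.2 0)
        left_inv := fun x => by simp
        right_inv := fun x => by simp
        map_mul' := fun x y => ?_ }
    ext i
    · rfl
    · refine Fin.cases ?_ (fun i => ?_) i <;> simp

/-- An abelian group all of whose finite subgroups are cyclic has low dimensional homology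
generated by Pontryagin products and cyclic groups. -/
theorem pontGen_of_isCyclic {H : Type*} [CommGroup H]
    (hc : ∀ S : Subgroup H, Finite S → IsCyclic S) : PontGen H := by
  refine PontGen.of_fg fun S hS => ?_
  have : Group.FG S := (Group.fg_iff_subgroup_fg S).2 hS
  obtain ⟨ι, j, _, _, p, hp, e, ⟨φ⟩⟩ := CommGroup.equiv_free_prod_prod_multiplicative_zmod S
  let C := (i : ι) → Multiplicative (ZMod (p i ^ e i))
  have hne : ∀ i, NeZero (p i ^ e i) := fun i => ⟨pow_ne_zero _ (hp i).ne_zero⟩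
  have hfin : ∀ i, Finite (Multiplicative (ZMod (p i ^ e i))) := fun i =>
    Finite.of_equiv (ZMod (p i ^ e i)) Multiplicative.ofAdd
  have : Finite C := Pi.finite
  let f : C →* H := S.subtype.comp (φ.symm.toMonoidHom.comp (MonoidHom.inr _ _))
  have hf : Function.Injective f := fun a b h => by
    have := φ.symm.injective (S.subtype_injective h)
    exact (Prod.mk.inj this).2
  have hcyc : IsCyclic C := by
    have : Finite f.range := Finite.of_surjective _ f.rangeRestrict_surjective
    have := hc f.range this
    exact isCyclic_of_injective f.rangeRestrict (MonoidHom.rangeRestrict_injective_iff.2 hf)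
  have hC : PontGen C := by
    have : NeZero (Nat.card C) := ⟨Nat.card_pos.ne'⟩
    exact (pontGen_zmod _).congr (zmodCyclicMulEquiv hcyc)
  refine (hC.prod_pi (Fintype.card j)).congr ?_
  have e1 : (Fin (Fintype.card j) → Multiplicative ℤ) ≃* (j → Multiplicative ℤ) :=
    { Equiv.arrowCongr (Fintype.equivFin j).symm (Equiv.refl _) with map_mul' := fun _ _ => rfl }
  exact (MulEquiv.prodComm.trans (e1.prodCongr (MulEquiv.refl C))).trans φ.symm

end PontryaginGeneration

section UniquelyDivisible

open FreeAbelianGroup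

variable {H : Type*} [CommGroup H]

lemma pr_one_Bd {n : ℕ} {c : Ch H (n + 1)} (hc : c ∈ Closed ⊤ n) :
    pr 1 (n + 1) c ∈ Bd (⊤ : Subgroup H) (n + 2) := by
  have := pr_mul 1 1 hc
  rwa [mul_one, sub_self, zero_sub, neg_mem_iff] at this

lemma pr_pow {n : ℕ} (r : H) (a : ℕ) {c : Ch H (n + 1)} (hc : c ∈ Closed ⊤ n) :
    pr (r ^ a) (n + 1) c - a • pr r (n + 1) c ∈ Bd (⊤ : Subgroup H) (n + 2) := by
  induction a with
  | zero => simpa using pr_one_Bd hc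
  | succ a ih =>
    have h := pr_mul (r ^ a) r hc
    rw [← pow_succ] at h
    have : pr (r ^ (a + 1)) (n + 1) c - (a + 1) • pr r (n + 1) c =
      (pr (r ^ (a + 1)) (n + 1) c - pr (r ^ a) (n + 1) c - pr r (n + 1) c) +
        (pr (r ^ a) (n + 1) c - a • pr r (n + 1) c) := by rw [succ_nsmul]; abel
    rw [this]
    exact add_mem h ih

lemma pont₁_pow (r : H) (a : ℕ) : pont₁ (r ^ a) - a • pont₁ r ∈ Bd (⊤ : Subgroup H) 2 := by
  induction a with
  | zero =>
    have := pont₁_mul (1 : H) 1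
    rw [mul_one, sub_self, zero_sub, neg_mem_iff] at this
    simpa using this
  | succ a ih =>
    have h := pont₁_mul (r ^ a) r
    rw [← pow_succ] at h
    have : pont₁ (r ^ (a + 1)) - (a + 1) • pont₁ r =
      (pont₁ (r ^ (a + 1)) - pont₁ (r ^ a) - pont₁ r) + (pont₁ (r ^ a) - a • pont₁ r) := by
      rw [succ_nsmul]; abel
    rw [this]
    exact add_mem h ih

lemma pont₂_pow (r s : H) (a : ℕ) :
    pont₂ (r ^ a) (s ^ a) - a ^ 2 • pont₂ r s ∈ Bd (⊤ : Subgroup H) 3 := by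
  have h1 := pr_pow r a (pont₁_closed (Subgroup.mem_top (s ^ a)))
  have h2 := nsmul_mem (pr_Bd r (pont₁_pow s a)) a
  rw [map_sub, map_nsmul, smul_sub, smul_smul, ← pow_two] at h2
  simpa [pont₂] using add_mem h1 h2

lemma pont₃_pow (r s t : H) (a : ℕ) :
    pont₃ (r ^ a) (s ^ a) (t ^ a) - a ^ 3 • pont₃ r s t ∈ Bd (⊤ : Subgroup H) 4 := by
  have h1 := pr_pow r a (pont₂_closed (s ^ a) (t ^ a))
  have h2 := nsmul_mem (pr_Bd r (pont₂_pow s t a)) a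
  rw [map_sub, map_nsmul, smul_sub, smul_smul, ← pow_succ'] at h2
  simpa [pont₃] using add_mem h1 h2

/-- In degree `q`, the power map acts as multiplication by the `q`-th power of the exponent. -/
def PowActs (H : Type*) [CommGroup H] (q : ℕ) : Prop :=
  ∀ (a : ℕ) (c : Ch H (q + 1)), c ∈ Closed ⊤ q →
    cmap (powMonoidHom a) c - a ^ q • c ∈ Bd (⊤ : Subgroup H) (q + 1)

lemma equivar_pow (a : ℕ) : Equivar (⊤ : Subgroup H) ⊤ (powMonoidHom a : H →* H) :=
  equivar_hom _ fun _ _ => Subgroup.mem_top _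

lemma powActs_one : PowActs H 1 := by
  intro a c _
  obtain ⟨s, hs⟩ := exists_pont₁ c
  have h1 := (equivar_pow a).cmap_Bd hs
  rw [map_sub, cmap_pont₁, powMonoidHom_apply] at h1
  have h2 := nsmul_mem hs a
  have h3 := pont₁_pow s a
  have : cmap (powMonoidHom a) c - a ^ 1 • c = (cmap (powMonoidHom a) c - pont₁ (s ^ a)) +
      (pont₁ (s ^ a) - a • pont₁ s) - a • (c - pont₁ s) := by
    rw [pow_one, smul_sub]; abel
  rw [this]
  exact sub_mem (add_mem h1 h3) h2

lemma powActs_of_span {q : ℕ} (J : Set (Ch H (q + 1)))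
    (hJ : Closed (⊤ : Subgroup H) q ≤ AddSubgroup.closure J ⊔ Bd ⊤ (q + 1))
    (h : ∀ a : ℕ, ∀ c ∈ J, cmap (powMonoidHom a) c - a ^ q • c ∈ Bd (⊤ : Subgroup H) (q + 1)) :
    PowActs H q := by
  intro a c hc
  let f : Ch H (q + 1) →+ Ch H (q + 1) := cmap (powMonoidHom a) - (a ^ q) • AddMonoidHom.id _
  have hf : ∀ c, f c = cmap (powMonoidHom a) c - a ^ q • c := fun _ => rfl
  suffices AddSubgroup.closure J ⊔ Bd ⊤ (q + 1) ≤ (Bd (⊤ : Subgroup H) (q + 1)).comap f from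
    this (hJ hc)
  refine sup_le ((AddSubgroup.closure_le _).2 fun x hx => ?_) fun x hx => ?_
  · exact h a x hx
  · exact sub_mem ((equivar_pow a).cmap_Bd hx) (nsmul_mem hx _)

lemma powActs_two (hH : PontGen H) : PowActs H 2 := by
  refine powActs_of_span _ hH.two ?_
  rintro a _ ⟨p, rfl⟩
  rw [cmap_pont₂]
  exact pont₂_pow p.1 p.2 a

lemma rho_one_Bd (n : ℕ) : rho (1 : H) n ∈ Bd (⊤ : Subgroup H) 4 :=
  Bd_mono bot_le (closed_bot_le (rho_closed (one_pow n) (one_mem _)))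

lemma powActs_three (hH : PontGen H) (ht : ∀ (t : H) (n : ℕ), 0 < n → t ^ n = 1 → t = 1) :
    PowActs H 3 := by
  refine powActs_of_span _ hH.three ?_
  rintro a _ (⟨p, rfl⟩ | ⟨t, n, hn, htn, rfl⟩)
  · rw [cmap_pont₃]
    exact pont₃_pow p.1 p.2.1 p.2.2 a
  · obtain rfl := ht t n hn htn
    exact sub_mem ((equivar_pow a).cmap_Bd (rho_one_Bd n)) (nsmul_mem (rho_one_Bd n) _)

lemma PowActs.injective {q : ℕ} (h : PowActs H (q + 1)) {a : ℕ}
    (ha : Function.Bijective (powMonoidHom a : H →* H)) {c : Ch H (q + 2)}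
    (hc : c ∈ Closed ⊤ (q + 1)) (hac : a • c ∈ Bd (⊤ : Subgroup H) (q + 2)) :
    c ∈ Bd (⊤ : Subgroup H) (q + 2) := by
  let e := MulEquiv.ofBijective _ ha
  have h1 := h a c hc
  have h2 : a ^ (q + 1) • c ∈ Bd (⊤ : Subgroup H) (q + 2) := by
    rw [pow_succ, mul_smul]; exact nsmul_mem hac _
  have h3 := add_mem h1 h2
  rw [sub_add_cancel] at h3
  have h4 := (equivar_hom (S := ⊤) (S' := ⊤) e.symm.toMonoidHom fun _ _ => Subgroup.mem_top _).cmap_Bd h3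
  rw [cmap_cmap] at h4
  have : (e.symm.toMonoidHom : H → H) ∘ (powMonoidHom a : H → H) = id := by
    funext x; exact e.symm_apply_apply x
  rwa [this, cmap_id] at h4

lemma PowActs.surjective {q : ℕ} (h : PowActs H (q + 1)) {a : ℕ}
    (ha : Function.Bijective (powMonoidHom a : H →* H)) {c : Ch H (q + 2)}
    (hc : c ∈ Closed ⊤ (q + 1)) :
    ∃ d ∈ Closed (⊤ : Subgroup H) (q + 1), c - a • d ∈ Bd (⊤ : Subgroup H) (q + 2) := by
  let e := MulEquiv.ofBijective _ ha
  have h4 := (equivar_hom (S := ⊤) (S' := ⊤) e.symm.toMonoidHom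
    fun _ _ => Subgroup.mem_top _).cmap_Closed hc
  refine ⟨_, nsmul_mem h4 (a ^ q), ?_⟩
  have h1 := h a _ h4
  rw [cmap_cmap] at h1
  have : (powMonoidHom a : H → H) ∘ (e.symm.toMonoidHom : H → H) = id := by
    funext x; exact e.apply_symm_apply x
  rw [this, cmap_id] at h1
  rwa [smul_smul, ← pow_succ']

end UniquelyDivisible

section AffineGroup

open FreeAbelianGroup

/-- An extension of the multiplicative group by the additive group on which it acts by scaling. -/
structure AffineData (Q : Type*) [Group Q] where
  ι : Multiplicative ℂ →* Q
  φ : Q →* ℂˣ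
  s : ℂˣ →* Q
  ι_injective : Function.Injective ι
  φ_s : ∀ u, φ (s u) = u
  φ_eq_one : ∀ g, φ g = 1 ↔ g ∈ ι.range
  act : ∀ u x, s u * ι (.ofAdd x) * (s u)⁻¹ = ι (.ofAdd (u * x))

lemma exists_hom_retraction {H K : Type*} [Group H] [Group K] {f : H →* K}
    (hf : Function.Injective f) : ∃ r : K → H, Equivar f.range ⊤ r ∧
      ∀ (n : ℕ) (c : Ch K (n + 1)), c ∈ Closed f.range n →
        cmap f (cmap r c) - c ∈ Bd f.range (n + 1) := by
  obtain ⟨ρ, hρ, -⟩ := exists_retraction f.range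
  let e := MonoidHom.ofInjective hf
  have he : ∀ x, f (e.symm x) = x := fun x => congrArg Subtype.val (e.apply_symm_apply x)
  have h1 : ∀ s (hs : s ∈ f.range) a, e.symm (ρ (s * a)) = e.symm ⟨s, hs⟩ * e.symm (ρ a) :=
    fun s hs a => by rw [← map_mul]; exact congrArg e.symm (hρ ⟨s, hs⟩ a)
  refine ⟨fun x => e.symm (ρ x), fun s hs => ⟨e.symm ⟨s, hs⟩, Subgroup.mem_top _, h1 s hs⟩,
    fun n c hc => ?_⟩
  have h2 : Equivar₂ f.range f.range id (f ∘ fun x => e.symm (ρ x)) := fun s hs =>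
    ⟨s, hs, fun _ => rfl, fun a => by
      simp only [Function.comp_apply]
      rw [h1 s hs, map_mul, he]⟩
  have := h2.cmap_sub_cmap_mem_Bd hc
  rwa [cmap_id, ← cmap_cmap] at this

lemma pontGen_multiplicative_complex : PontGen (Multiplicative ℂ) := by
  refine pontGen_of_isCyclic fun S hS => ?_
  have : Subsingleton S := by
    refine ⟨fun a b => ?_⟩
    have key : ∀ a : S, a = 1 := fun a => by
      obtain ⟨n, hn, h⟩ := isOfFinOrder_iff_pow_eq_one.1 (isOfFinOrder_of_finite a)
      have h1 : n • (Multiplicative.toAdd (a : Multiplicative ℂ)) = 0 :=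
        congrArg (fun x : S => Multiplicative.toAdd (x : Multiplicative ℂ)) h
      have h2 := (smul_eq_zero.1 h1).resolve_left hn.ne'
      exact Subtype.ext h2
    exact (key a).trans (key b).symm
  infer_instance

lemma powActs_multiplicative_complex {q : ℕ} (hq : q ≤ 2) :
    PowActs (Multiplicative ℂ) (q + 1) := by
  interval_cases q
  · exact powActs_one
  · exact powActs_two pontGen_multiplicative_complex
  · refine powActs_three pontGen_multiplicative_complex fun t n hn h => ?_
    have h1 : n • (Multiplicative.toAdd t) = 0 := h
    exact (smul_eq_zero.1 h1).resolve_left hn.ne'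

lemma bijective_pow_multiplicative_complex {a : ℕ} (ha : a ≠ 0) :
    Function.Bijective (powMonoidHom a : Multiplicative ℂ →* Multiplicative ℂ) := by
  have ha' : (a : ℂ) ≠ 0 := Nat.cast_ne_zero.2 ha
  constructor
  · intro x y h
    have h1 : a • (Multiplicative.toAdd x) = a • (Multiplicative.toAdd y) := congrArg Multiplicative.toAdd h
    rw [nsmul_eq_mul, nsmul_eq_mul] at h1
    exact Multiplicative.toAdd.injective (mul_left_cancel₀ ha' h1)
  · intro x
    refine ⟨Multiplicative.ofAdd ((a : ℂ)⁻¹ * Multiplicative.toAdd x), ?_⟩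
    show a • ((a : ℂ)⁻¹ * Multiplicative.toAdd x) = Multiplicative.toAdd x
    rw [nsmul_eq_mul, mul_inv_cancel_left₀ ha']

namespace AffineData

variable {Q : Type*} [Group Q] (D : AffineData Q) {n q : ℕ}

/-- The translation subgroup. -/
abbrev N : Subgroup Q := D.ι.range

/-- The unit `2`. -/
abbrev two : ℂˣ := Units.mk0 2 two_ne_zero

/-- Scaling by two. -/
def t : Q := D.s two

/-- The subgroup generated by translations and scaling by two. -/
def R : Subgroup Q := (Subgroup.zpowers two).comap D.φ

/-- The projection to the torus. -/
def σ : Q →* Q := D.s.comp D.φ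

lemma N_le_R : D.N ≤ D.R := fun g hg => by
  show D.φ g ∈ Subgroup.zpowers two
  rw [(D.φ_eq_one g).2 hg]; exact one_mem _

lemma t_mem_R : D.t ∈ D.R := by
  show D.φ (D.s two) ∈ Subgroup.zpowers two
  rw [D.φ_s]; exact Subgroup.mem_zpowers _

lemma conj_N (x : Q) {g : Q} (hg : g ∈ D.N) : x * g * x⁻¹ ∈ D.N := by
  rw [← D.φ_eq_one] at hg ⊢
  rw [map_mul, map_mul, hg, map_inv, mul_one, mul_inv_cancel]

lemma conj_R (x : Q) {g : Q} (hg : g ∈ D.R) : x * g * x⁻¹ ∈ D.R := by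
  show D.φ (x * g * x⁻¹) ∈ Subgroup.zpowers two
  rw [map_mul, map_mul, map_inv, mul_comm (D.φ x), mul_inv_cancel_right]; exact hg

lemma σ_div_mem (b : Q) : D.σ b * b⁻¹ ∈ D.N := by
  rw [← D.φ_eq_one, map_mul, map_inv, σ, MonoidHom.comp_apply, D.φ_s, mul_inv_cancel]

lemma tr_t {h : Ch Q (q + 2)} (hq : q ≤ 2) (hh : h ∈ Closed D.N (q + 1)) :
    tr D.t h - 2 ^ (q + 1) • h ∈ Bd D.N (q + 2) := by
  obtain ⟨r, hr, hr'⟩ := exists_hom_retraction D.ι_injective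
  obtain ⟨c, hc, hd⟩ : ∃ c ∈ Closed ⊤ (q + 1), cmap D.ι c - h ∈ Bd D.N (q + 2) :=
    ⟨_, hr.cmap_Closed hh, hr' _ _ hh⟩
  have hι : Equivar ⊤ D.N D.ι := equivar_hom D.ι fun x _ => MonoidHom.mem_range.2 ⟨x, rfl⟩
  have e1 := (equivar_tr (S := D.N) (g := D.t) fun s hs => D.conj_N _ hs).cmap_Bd hd
  have e2 := hι.cmap_Bd
    (powActs_multiplicative_complex hq 2 c hc)
  have e3 := tr_sub_conj_mem_Bd (S := D.N) (g := D.t) (fun s hs => D.conj_N _ hs)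
    (hι.cmap_Closed hc)
  have e4 : cmap (MulAut.conj D.t) (cmap D.ι c) = cmap D.ι (cmap (powMonoidHom 2) c) := by
    rw [cmap_cmap, cmap_cmap]
    congr 2
    funext x
    refine (D.act two (Multiplicative.toAdd x)).trans (congrArg D.ι ?_)
    show 2 * Multiplicative.toAdd x = 2 • Multiplicative.toAdd x
    rw [nsmul_eq_mul]; norm_num
  rw [e4] at e3
  rw [map_sub, map_nsmul] at e2
  rw [map_sub] at e1
  have e5 := nsmul_mem hd (2 ^ (q + 1))
  rw [smul_sub] at e5
  convert sub_mem (add_mem (add_mem e2 e3) e5) e1 using 1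
  abel

lemma smul_injective {h : Ch Q (q + 2)} {a : ℕ} (ha : a ≠ 0) (hq : q ≤ 2)
    (hh : h ∈ Closed D.N (q + 1)) (h2 : a • h ∈ Bd D.N (q + 2)) : h ∈ Bd D.N (q + 2) := by
  obtain ⟨r, hr, hr'⟩ := exists_hom_retraction D.ι_injective
  have hι : Equivar ⊤ D.N D.ι := equivar_hom D.ι fun x _ => MonoidHom.mem_range.2 ⟨x, rfl⟩
  have h3 := hr.cmap_Bd h2
  rw [map_nsmul] at h3
  have h4 := hι.cmap_Bd ((powActs_multiplicative_complex hq).injective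
    (bijective_pow_multiplicative_complex ha) (hr.cmap_Closed hh) h3)
  rw [← sub_sub_cancel (cmap D.ι (cmap r h)) h]
  exact sub_mem h4 (hr' _ _ hh)

lemma smul_surjective {h : Ch Q (q + 2)} {a : ℕ} (ha : a ≠ 0) (hq : q ≤ 2)
    (hh : h ∈ Closed D.N (q + 1)) : ∃ d ∈ Closed D.N (q + 1), h - a • d ∈ Bd D.N (q + 2) := by
  obtain ⟨r, hr, hr'⟩ := exists_hom_retraction D.ι_injective
  have hι : Equivar ⊤ D.N D.ι := equivar_hom D.ι fun x _ => MonoidHom.mem_range.2 ⟨x, rfl⟩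
  obtain ⟨d, hd, h1⟩ := (powActs_multiplicative_complex hq).surjective
    (bijective_pow_multiplicative_complex ha) (hr.cmap_Closed hh)
  refine ⟨_, hι.cmap_Closed hd, ?_⟩
  have h2 := hι.cmap_Bd h1
  rw [map_sub, map_nsmul] at h2
  convert sub_mem h2 (hr' _ _ hh) using 1
  abel

/-- The homology of the group generated by translations and scaling by two vanishes. -/
lemma closed_R_le (hn : n ≤ 1) : Closed D.R (n + 2) ≤ Bd D.R (n + 3) := by
  intro f hf
  let k : Q → ℤ := fun g => ⌊Real.logb 2 ‖(D.φ g : ℂ)‖⌋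
  have hk : ∀ s ∈ D.N, ∀ g, k (s * g) = k g := fun s hs g => by
    simp only [k]
    rw [map_mul, (D.φ_eq_one s).2 hs, one_mul]
  have hkt : ∀ g, k (D.t * g) = k g + 1 := fun g => by
    simp only [k]
    rw [map_mul, t, D.φ_s, Units.val_mul, Units.val_mk0, norm_mul, Complex.norm_ofNat,
      Real.logb_mul two_ne_zero (norm_ne_zero_iff.2 (Units.ne_zero _)),
      Real.logb_self_eq_one one_lt_two, add_comm, Int.floor_add_one]
  have hS' : ∀ x ∈ D.R, ∃ s ∈ D.N, ∃ j : ℤ, x = s * D.t ^ j := fun x hx => by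
    obtain ⟨j, hj⟩ := Subgroup.mem_zpowers_iff.1 (show D.φ x ∈ Subgroup.zpowers two from hx)
    refine ⟨x * (D.t ^ j)⁻¹, ?_, j, (inv_mul_cancel_right x _).symm⟩
    rw [← D.φ_eq_one, map_mul, map_inv, map_zpow, t, D.φ_s, hj, mul_inv_cancel]
  obtain ⟨h, hh, hfh⟩ := gysin (fun x _ s hs => D.conj_N x hs) D.t_mem_R hS' k hk hkt hf
  have h1 : tr D.t h - h ∈ Bd D.N (n + 2) := by
    rw [← sub_sub_cancel (bd (n + 2) f) (tr D.t h - h)]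
    exact sub_mem (bd_mem_Bd f) (coinv_le_Bd hfh)
  have h2 := D.smul_injective (a := 2 ^ (n + 1) - 1)
    (by have := Nat.one_lt_two_pow (n := n + 1) (by omega); omega) (by omega) hh (by
      have e : (2 ^ (n + 1) - 1) • h = (tr D.t h - h) - (tr D.t h - 2 ^ (n + 1) • h) := by
        rw [sub_nsmul _ Nat.one_le_two_pow, one_smul]; abel
      rw [e]
      exact sub_mem h1 (D.tr_t (by omega) hh))
  obtain ⟨d, hd⟩ := mem_Bd.1 h2
  have h3 : f - (tr D.t d - d) ∈ Closed D.N (n + 2) := by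
    have h4 := tr_coinv (S := D.N) (x := D.t) (fun s hs => D.conj_N _ hs) hd
    rw [mem_Closed]
    convert add_mem hfh (sub_mem h4 hd) using 1
    simp only [map_sub, bd_cmap]
    abel
  obtain ⟨y, hy, hfy⟩ := D.smul_surjective (a := 2 ^ (n + 2) - 1) 
    (by have := Nat.one_lt_two_pow (n := n + 2) (by omega); omega) (by omega) h3
  have h5 := D.tr_t (by omega) hy
  have h6 : (f - (tr D.t d - d)) - (tr D.t y - y) ∈ Bd D.N (n + 3) := by
    rw [sub_nsmul _ Nat.one_le_two_pow, one_smul] at hfy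
    convert sub_mem hfy h5 using 1
    abel
  have e : f = ((f - (tr D.t d - d)) - (tr D.t y - y)) + (tr D.t d - d) + (tr D.t y - y) := by abel
  rw [e]
  exact add_mem (add_mem (Bd_mono D.N_le_R h6)
    (coinv_le_Bd (tr_sub_mem_coinv D.t_mem_R d))) (coinv_le_Bd (tr_sub_mem_coinv D.t_mem_R y))

lemma pont₁_mul_of_mem {G : Type*} [Group G] {S : Subgroup G} {a : G} (ha : a ∈ S) (b : G) :
    pont₁ (a * b) - pont₁ a - pont₁ b ∈ Bd S 2 := by
  have h1 : bd 2 (of ![1, a, a * b]) = tr a (pont₁ b) - pont₁ (a * b) + pont₁ a := by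
    rw [pont₁, ← of_smul_eq_tr, show a • ![1, b] = ![a, a * b] by
      funext i; fin_cases i <;> simp]
    simp [pont₁]
    abel
  have h2 := bd_mem_Bd (S := S) (of ![1, a, a * b])
  rw [h1] at h2
  convert sub_mem (coinv_le_Bd (tr_sub_mem_coinv ha (pont₁ b))) h2 using 1
  abel

lemma pont₁_translation {g : Q} (hg : g ∈ D.N) : pont₁ g ∈ Bd D.R 2 := by
  obtain ⟨x, rfl⟩ := hg
  have e : D.t * D.ι x = D.ι x * D.ι x * D.t := by
    rw [← mul_inv_eq_iff_eq_mul, ← map_mul]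
    refine (D.act two (Multiplicative.toAdd x)).trans (congrArg D.ι ?_)
    exact two_mul (Multiplicative.toAdd x)
  have hx : D.ι x ∈ D.R := D.N_le_R (MonoidHom.mem_range.2 ⟨x, rfl⟩)
  have h1 := pont₁_mul_of_mem D.t_mem_R (D.ι x)
  have h2 := pont₁_mul_of_mem (mul_mem hx hx) D.t
  have h3 := pont₁_mul_of_mem hx (D.ι x)
  rw [e] at h1
  convert sub_mem h1 (add_mem h2 h3) using 1
  abel

lemma cmap_σ_tr (b : Q) {m : ℕ} (c : Ch Q m) :
    cmap D.σ (tr b c) - tr b (cmap D.σ c) ∈ coinv D.R (Fin m → Q) := by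
  have : cmap D.σ (tr b c) = tr (D.σ b * b⁻¹) (tr b (cmap D.σ c)) := by
    rw [cmap_tr (fun a => map_mul D.σ b a), tr_tr, inv_mul_cancel_right]
  rw [this]
  exact tr_sub_mem_coinv (D.N_le_R (D.σ_div_mem b)) _

lemma tr_coinv_R (b : Q) {m : ℕ} {c : Ch Q m} (hc : c ∈ coinv D.R (Fin m → Q)) :
    tr b c ∈ coinv D.R (Fin m → Q) := tr_coinv (fun _ hs => D.conj_R b hs) hc

/-- Inductive construction of a chain homotopy between the projection to the torus and the
identity. -/
lemma exists_homotopy_step (P : Ch Q q →+ Ch Q (q + 1)) (hP : ∀ b c, P (tr b c) = tr b (P c))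
    (h : ∀ l : Fin (q + 1) → Q, l 0 = 1 →
      cmap D.σ (of l) - of l - P (bd q (of l)) ∈ Bd D.R (q + 1)) :
    ∃ P' : Ch Q (q + 1) →+ Ch Q (q + 2), (∀ b c, P' (tr b c) = tr b (P' c)) ∧
      ∀ c, cmap D.σ c - c - P (bd q c) - bd (q + 1) (P' c) ∈ coinv D.R (Fin (q + 1) → Q) := by
  choose k hk using fun l hl => mem_Bd.1 (h l hl)
  have hnorm : ∀ l : Fin (q + 1) → Q, ((l 0)⁻¹ • l) 0 = 1 := fun l => inv_mul_cancel (l 0)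
  let P' : Ch Q (q + 1) →+ Ch Q (q + 2) :=
    FreeAbelianGroup.lift fun l => tr (l 0) (k ((l 0)⁻¹ • l) (hnorm l))
  have hP' : ∀ l, P' (of l) = tr (l 0) (k ((l 0)⁻¹ • l) (hnorm l)) := fun l =>
    FreeAbelianGroup.lift_apply_of _ _
  refine ⟨P', fun b c => ?_, fun c => ?_⟩
  · have : P'.comp (tr b) = (tr b).comp P' := by
      ext l
      simp only [AddMonoidHom.comp_apply]
      rw [← of_smul_eq_tr, hP', hP', tr_tr]
      have e : ((b • l) 0)⁻¹ • b • l = (l 0)⁻¹ • l := by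
        rw [show (b • l) 0 = b * l 0 from rfl, mul_inv_rev, smul_smul, inv_mul_cancel_right]
      congr 2
    exact DFunLike.congr_fun this c
  · let f : Ch Q (q + 1) →+ Ch Q (q + 1) := cmap D.σ - AddMonoidHom.id _ - P.comp (bd q) -
      (bd (q + 1)).comp P'
    show f c ∈ _
    refine map_mem_of_gen f _ (fun l => ?_) c
    show cmap D.σ (of l) - of l - P (bd q (of l)) - bd (q + 1) (P' (of l)) ∈ _
    have h1 := D.tr_coinv_R (l 0) (hk _ (hnorm l))
    have h2 := D.cmap_σ_tr (l 0) (of ((l 0)⁻¹ • l))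
    have e : of l = tr (l 0) (of ((l 0)⁻¹ • l)) := by
      rw [← of_smul_eq_tr, smul_inv_smul]
    rw [hP']
    convert add_mem h1 h2 using 1
    rw [← e]
    simp only [map_sub, ← bd_cmap, ← hP, ← e]
    abel


/-- Low dimensional cycles are homologous to their projection to the torus. -/
theorem cmap_σ_sub_mem_Bd {c : Ch Q (q + 1)} (hq2 : q = 2 ∨ q = 3) (hc : c ∈ Closed ⊤ q) :
    cmap D.σ c - c ∈ Bd (⊤ : Subgroup Q) (q + 1) := by
  have lower : ∀ {q : ℕ} {P : Ch Q q →+ Ch Q (q + 1)} {P' : Ch Q (q + 1) →+ Ch Q (q + 2)}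
      (_ : ∀ c, cmap D.σ c - c - P (bd q c) - bd (q + 1) (P' c) ∈ coinv D.R (Fin (q + 1) → Q))
      (c : Ch Q (q + 2)), cmap D.σ c - c - P' (bd (q + 1) c) ∈ Closed D.R (q + 1) := by
    intro q P P' h c
    have h1 := h (bd (q + 1) c)
    rw [bd_bd, map_zero, sub_zero] at h1
    rw [mem_Closed]
    simpa only [map_sub, bd_cmap] using h1
  have final : ∀ {q : ℕ} {P : Ch Q q →+ Ch Q (q + 1)} {P' : Ch Q (q + 1) →+ Ch Q (q + 2)}
      (_ : ∀ b c, P (tr b c) = tr b (P c))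
      (_ : ∀ c, cmap D.σ c - c - P (bd q c) - bd (q + 1) (P' c) ∈ coinv D.R (Fin (q + 1) → Q))
      (c : Ch Q (q + 1)), bd q c ∈ coinv (⊤ : Subgroup Q) (Fin q → Q) → cmap D.σ c - c ∈ Bd (⊤ : Subgroup Q) (q + 1) := by
    intro q P P' hP h c hc
    have h1 : P (bd q c) ∈ coinv (⊤ : Subgroup Q) (Fin (q + 1) → Q) := by
      refine coinv_le_of_tr P _ (fun s hs b => ?_) hc
      rw [hP]; exact tr_sub_mem_coinv hs _
    have h2 := coinv_mono (le_top : D.R ≤ ⊤) (h c)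
    convert add_mem (add_mem (coinv_le_Bd h2) (coinv_le_Bd h1)) (bd_mem_Bd (P' c)) using 1
    abel
  obtain ⟨P₁, hP₁, h₁⟩ := D.exists_homotopy_step (q := 1) 0 (fun _ _ => by simp) (fun l hl => by
    have el : l = ![1, l 1] := by funext i; fin_cases i <;> simp [hl]
    have hν := D.σ_div_mem (l 1)
    have h1 := pont₁_mul_of_mem (D.N_le_R hν) (l 1)
    rw [inv_mul_cancel_right] at h1
    have h2 : cmap D.σ (of l) = pont₁ (D.σ (l 1)) := by
      rw [el]; exact cmap_pont₁ D.σ (l 1)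
    have h3 : of l = pont₁ (l 1) := congrArg of el
    rw [AddMonoidHom.zero_apply, sub_zero, h2, h3]
    convert add_mem h1 (D.pont₁_translation hν) using 1
    abel)
  obtain ⟨P₂, hP₂, h₂⟩ := D.exists_homotopy_step P₁ hP₁
    (fun l _ => D.closed_R_le (n := 0) (Nat.zero_le _) (lower h₁ _))
  obtain ⟨P₃, hP₃, h₃⟩ := D.exists_homotopy_step P₂ hP₂
    (fun l _ => D.closed_R_le (n := 1) le_rfl (lower h₂ _))
  rcases hq2 with rfl | rfl
  · exact final hP₁ h₂ c hc
  · exact final hP₂ h₃ c hc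

end AffineData

end AffineGroup

section DoubleComplex

open FreeAbelianGroup

variable (G X : Type) [Group G] [MulAction G X]

/-- Chains on pairs consisting of a tuple of group elements and a tuple of points. -/
abbrev DC (p q : ℕ) : Type := FreeAbelianGroup ((Fin p → G) × (Fin q → X))

variable {G X} {p q : ℕ}

def box : Ch G p →+ Ch X q →+ DC G X p q := lift fun a => FreeAbelianGroup.map (Prod.mk a)

@[simp] lemma box_of (a : Fin p → G) (x : Fin q → X) : box (of a) (of x) = of (a, x) := by
  simp [box, lift_apply_of, map_of_apply]

lemma dc_ext {A : Type*} [AddCommGroup A] {f g : Ch G p →+ Ch X q →+ A}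
    (h : ∀ a x, f (of a) (of x) = g (of a) (of x)) (c : Ch G p) (d : Ch X q) : f c d = g c d := by
  have : f = g := by ext a x; exact h a x
  rw [this]

def dMd (p q : ℕ) : DC G X p (q + 1) →+ DC G X p q :=
  lift fun ax => box (of ax.1) (bd q (of ax.2))

def dFd (p q : ℕ) : DC G X (p + 1) q →+ DC G X p q :=
  lift fun ax => box (bd p (of ax.1)) (of ax.2)

lemma dMd_of (a : Fin p → G) (x : Fin (q + 1) → X) :
    dMd p q (of (a, x)) = box (of a) (bd q (of x)) := lift_apply_of _ _

lemma dFd_of (a : Fin (p + 1) → G) (x : Fin q → X) :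
    dFd p q (of (a, x)) = box (bd p (of a)) (of x) := lift_apply_of _ _

lemma dMd_box (c : Ch G p) (d : Ch X (q + 1)) : dMd p q (box c d) = box c (bd q d) :=
  dc_ext (f := (AddMonoidHom.compHom (dMd p q)).comp box)
    (g := ((AddMonoidHom.compHom.flip (bd q)).comp box)) (fun a x => by simp [dMd_of]) c d

lemma dFd_box (c : Ch G (p + 1)) (d : Ch X q) : dFd p q (box c d) = box (bd p c) d :=
  dc_ext (f := (AddMonoidHom.compHom (dFd p q)).comp box)
    (g := box.comp (bd p)) (fun a x => by simp [dFd_of]) c d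

lemma dMd_dFd (c : DC G X (p + 1) (q + 1)) : dMd p q (dFd p (q + 1) c) = dFd p q (dMd (p + 1) q c) := by
  refine DFunLike.congr_fun (f := (dMd p q).comp (dFd p (q + 1)))
    (g := (dFd p q).comp (dMd (p + 1) q)) ?_ c
  ext ⟨a, x⟩
  simp [dMd_of, dFd_of, dMd_box, dFd_box]

lemma dMd_dMd (c : DC G X p (q + 2)) : dMd p q (dMd p (q + 1) c) = 0 := by
  refine DFunLike.congr_fun (f := (dMd p q).comp (dMd p (q + 1))) (g := 0) ?_ c
  ext ⟨a, x⟩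
  simp [dMd_of, dMd_box]

lemma dFd_dFd (c : DC G X (p + 2) q) : dFd p q (dFd (p + 1) q c) = 0 := by
  refine DFunLike.congr_fun (f := (dFd p q).comp (dFd (p + 1) q)) (g := 0) ?_ c
  ext ⟨a, x⟩
  simp [dFd_of, dFd_box]

/-- The diagonal coinvariants. -/
abbrev dco (G X : Type) [Group G] [MulAction G X] (p q : ℕ) : AddSubgroup (DC G X p q) :=
  coinv (⊤ : Subgroup G) ((Fin p → G) × (Fin q → X))

lemma box_smul (s : G) (c : Ch G p) (d : Ch X q) :
    box (tr s c) (cmap (s • ·) d) = FreeAbelianGroup.map (s • ·) (box c d) :=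
  dc_ext (f := ((AddMonoidHom.compHom.flip (cmap (s • ·))).comp (box.comp (tr s))))
    (g := (AddMonoidHom.compHom (FreeAbelianGroup.map (s • ·))).comp box)
    (fun a x => by simp [map_of_apply]; rfl) c d

lemma box_smul_sub (s : G) (c : Ch G p) (d : Ch X q) :
    box (tr s c) (cmap (s • ·) d) - box c d ∈ dco G X p q := by
  rw [box_smul]
  exact sub_map_mem_coinv _ (fun b => ⟨s, Subgroup.mem_top _, rfl⟩) _

lemma dMd_coinv {c : DC G X p (q + 1)} (hc : c ∈ dco G X p (q + 1)) : dMd p q c ∈ dco G X p q := by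
  refine coinv_le_comap (dMd p q) _ (fun s _ b => ?_) hc
  have := box_smul_sub s (of b.1) (bd q (of b.2))
  rw [← bd_cmap] at this
  convert this using 1
  simp only [← dMd_box, cmap_of, box_of]
  rfl

lemma dFd_coinv {c : DC G X (p + 1) q} (hc : c ∈ dco G X (p + 1) q) : dFd p q c ∈ dco G X p q := by
  refine coinv_le_comap (dFd p q) _ (fun s _ b => ?_) hc
  have := box_smul_sub s (bd p (of b.1)) (of b.2)
  rw [tr, ← bd_cmap] at this
  convert this using 1
  simp only [← dFd_box, cmap_of, box_of]
  rfl

/-- Chains supported on injective tuples of points avoiding a given set. -/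
def InjC (Y : Set X) (q : ℕ) : AddSubgroup (Ch X q) :=
  AddSubgroup.closure {c | ∃ x : Fin q → X, Function.Injective x ∧ (∀ i, x i ∉ Y) ∧ c = of x}

lemma injective_vecCons {x : X} {l : Fin q → X} :
    Function.Injective (Matrix.vecCons x l) ↔ (∀ i, l i ≠ x) ∧ Function.Injective l := by
  rw [Matrix.vecCons, Fin.cons_injective_iff]
  simp

lemma cone_mem_InjC {Y : Set X} {v : X} (hv : v ∉ Y) {c : Ch X q} (hc : c ∈ InjC (insert v Y) q) :
    cone v c ∈ InjC Y (q + 1) := by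
  induction hc using AddSubgroup.closure_induction with
  | mem c hc =>
    obtain ⟨x, hx, hY, rfl⟩ := hc
    refine AddSubgroup.subset_closure ⟨Matrix.vecCons v x, injective_vecCons.2
      ⟨fun i h => hY i (by simp [h]), hx⟩, fun i => ?_, cone_of _ _⟩
    refine Fin.cases hv (fun j h => hY j (by simp at h; simp [h])) i
  | zero => simp
  | add x y _ _ hx hy => rw [map_add]; exact add_mem hx hy
  | neg x _ hx => rw [map_neg]; exact neg_mem hx

lemma InjC_mono {Y Y' : Set X} (h : Y ⊆ Y') : InjC Y' q ≤ InjC Y q :=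
  AddSubgroup.closure_mono fun _ ⟨x, h1, h2, e⟩ => ⟨x, h1, fun i hi => h2 i (h hi), e⟩

lemma bd_mem_InjC {Y : Set X} {c : Ch X (q + 1)} (hc : c ∈ InjC Y (q + 1)) : bd q c ∈ InjC Y q := by
  induction q generalizing Y with
  | zero =>
    refine AddSubgroup.closure_le (InjC Y 0 |>.comap (bd 0)) |>.2 ?_ hc
    rintro _ ⟨x, hx, hY, rfl⟩
    obtain ⟨v, l, rfl⟩ := exists_vecCons x
    refine AddSubgroup.subset_closure ⟨l, (injective_vecCons.1 hx).2, fun i => i.elim0, ?_⟩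
    simp
  | succ q ih =>
    refine AddSubgroup.closure_le (InjC Y (q + 1) |>.comap (bd (q + 1))) |>.2 ?_ hc
    rintro _ ⟨x, hx, hY, rfl⟩
    obtain ⟨v, l, rfl⟩ := exists_vecCons x
    obtain ⟨h1, h2⟩ := injective_vecCons.1 hx
    have hl : of l ∈ InjC (insert v Y) (q + 1) := AddSubgroup.subset_closure
      ⟨l, h2, fun i => by
        rintro (h | h)
        exacts [h1 i h, hY i.succ (by simpa using h)], rfl⟩
    simp only [SetLike.mem_coe, AddSubgroup.mem_comap, bd_succ_of]
    exact sub_mem (InjC_mono (Set.subset_insert _ _) hl)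
      (cone_mem_InjC (hY 0) (ih hl))

/-- Chains supported on injective tuples of points. -/
def Inj (G X : Type) [Group G] [MulAction G X] (p q : ℕ) : AddSubgroup (DC G X p q) :=
  AddSubgroup.closure {c | ∃ a x, Function.Injective x ∧ c = of (a, x)}

lemma of_mem_Inj (a : Fin p → G) {x : Fin q → X} (hx : Function.Injective x) :
    of (a, x) ∈ Inj G X p q := AddSubgroup.subset_closure ⟨a, x, hx, rfl⟩

lemma Inj_le_comap {A : Type*} [AddCommGroup A] (f : DC G X p q →+ A) (J : AddSubgroup A)
    (h : ∀ a x, Function.Injective x → f (of (a, x)) ∈ J) {c : DC G X p q} (hc : c ∈ Inj G X p q) :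
    f c ∈ J := by
  refine AddSubgroup.closure_le (J.comap f) |>.2 ?_ hc
  rintro _ ⟨a, x, hx, rfl⟩
  exact h a x hx

lemma box_mem_Inj {c : Ch G p} {d : Ch X q} {Y : Set X} (hd : d ∈ InjC Y q) : box c d ∈ Inj G X p q := by
  refine map_mem_of_gen (box.flip d) _ (fun a => ?_) c
  refine AddSubgroup.closure_le ((Inj G X p q).comap (box (of a))) |>.2 ?_ hd
  rintro _ ⟨x, hx, -, rfl⟩
  simpa using of_mem_Inj a hx

lemma of_mem_InjC {x : Fin q → X} (hx : Function.Injective x) : of x ∈ InjC ∅ q :=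
  AddSubgroup.subset_closure ⟨x, hx, fun _ => Set.notMem_empty _, rfl⟩

lemma dMd_mem_Inj {c : DC G X p (q + 1)} (hc : c ∈ Inj G X p (q + 1)) : dMd p q c ∈ Inj G X p q :=
  Inj_le_comap _ _ (fun a x hx => by
    rw [dMd_of]; exact box_mem_Inj (bd_mem_InjC (of_mem_InjC hx))) hc

lemma dFd_mem_Inj {c : DC G X (p + 1) q} (hc : c ∈ Inj G X (p + 1) q) : dFd p q c ∈ Inj G X p q :=
  Inj_le_comap _ _ (fun a x hx => by
    rw [dFd_of]; exact box_mem_Inj (of_mem_InjC hx)) hc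

/-- The double complex of coinvariants. -/
def KC (G X : Type) [Group G] [MulAction G X] (p q : ℕ) : Type :=
  ↥(Inj G X p q) ⧸ (dco G X p q).addSubgroupOf (Inj G X p q)

instance : AddCommGroup (KC G X p q) :=
  inferInstanceAs (AddCommGroup (↥(Inj G X p q) ⧸ (dco G X p q).addSubgroupOf (Inj G X p q)))

def kmk {c : DC G X p q} (hc : c ∈ Inj G X p q) : KC G X p q :=
  QuotientAddGroup.mk' ((dco G X p q).addSubgroupOf (Inj G X p q)) ⟨c, hc⟩

lemma exists_kmk (x : KC G X p q) : ∃ (c : DC G X p q) (hc : c ∈ Inj G X p q), x = kmk hc := by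
  obtain ⟨c, rfl⟩ := QuotientAddGroup.mk'_surjective _ x
  exact ⟨c.1, c.2, rfl⟩

lemma kmk_add {c d : DC G X p q} (hc : c ∈ Inj G X p q) (hd : d ∈ Inj G X p q) :
    kmk (add_mem hc hd) = kmk hc + kmk hd := map_add _ (⟨c, hc⟩ : Inj G X p q) ⟨d, hd⟩

lemma kmk_sub {c d : DC G X p q} (hc : c ∈ Inj G X p q) (hd : d ∈ Inj G X p q) :
    kmk (sub_mem hc hd) = kmk hc - kmk hd := map_sub _ (⟨c, hc⟩ : Inj G X p q) ⟨d, hd⟩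

lemma kmk_neg {c : DC G X p q} (hc : c ∈ Inj G X p q) :
    kmk (neg_mem hc) = -kmk hc := map_neg _ (⟨c, hc⟩ : Inj G X p q)

lemma kmk_eq_zero {c : DC G X p q} {hc : c ∈ Inj G X p q} : kmk hc = 0 ↔ c ∈ dco G X p q := by
  exact (QuotientAddGroup.eq_zero_iff (N := (dco G X p q).addSubgroupOf (Inj G X p q))
    (⟨c, hc⟩ : Inj G X p q)).trans AddSubgroup.mem_addSubgroupOf

lemma kmk_eq {c d : DC G X p q} {hc : c ∈ Inj G X p q} {hd : d ∈ Inj G X p q} :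
    kmk hc = kmk hd ↔ c - d ∈ dco G X p q := by
  rw [← sub_eq_zero, ← kmk_sub, kmk_eq_zero]

def klift {A : Type*} [AddCommGroup A] (f : DC G X p q →+ A)
    (hf : ∀ c ∈ Inj G X p q, c ∈ dco G X p q → f c = 0) : KC G X p q →+ A :=
  QuotientAddGroup.lift _ (f.comp (Inj G X p q).subtype) fun c hc =>
    hf c.1 c.2 (AddSubgroup.mem_addSubgroupOf.1 hc)

lemma kc_hom_ext {A : Type*} [AddCommGroup A] {f g : KC G X p q →+ A}
    (h : ∀ a x (hx : Function.Injective x),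
      f (kmk (of_mem_Inj a hx)) = g (kmk (of_mem_Inj a hx))) : f = g := by
  have key : ∀ c (hc : c ∈ Inj G X p q), f (kmk hc) = g (kmk hc) := fun c hc => by
    induction hc using AddSubgroup.closure_induction with
    | mem c hc => obtain ⟨a, x, hx, rfl⟩ := hc; exact h a x hx
    | zero =>
      have : kmk (zero_mem (Inj G X p q)) = 0 := kmk_eq_zero.2 (zero_mem _)
      exact (congrArg f this).trans ((map_zero f).trans ((map_zero g).symm.trans (congrArg g this.symm)))
    | add c d hc hd h1 h2 =>
      have := kmk_add (hc : c ∈ Inj G X p q) (hd : d ∈ Inj G X p q)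
      refine (congrArg f this).trans (Eq.trans ?_ (congrArg g this.symm))
      rw [map_add, map_add, h1, h2]
    | neg c hc h1 =>
      have := kmk_neg (hc : c ∈ Inj G X p q)
      refine (congrArg f this).trans (Eq.trans ?_ (congrArg g this.symm))
      rw [map_neg, map_neg, h1]
  ext x
  obtain ⟨c, hc, rfl⟩ := exists_kmk x
  exact key c hc

def dM (p q : ℕ) : KC G X p (q + 1) →+ KC G X p q :=
  QuotientAddGroup.map _ _ (((dMd p q).comp (Inj G X p (q + 1)).subtype).codRestrict (Inj G X p q)
    fun c => dMd_mem_Inj c.2) fun c hc => by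
      rw [AddSubgroup.mem_addSubgroupOf] at hc
      exact AddSubgroup.mem_comap.2 (AddSubgroup.mem_addSubgroupOf.2 (dMd_coinv hc))

def dF (p q : ℕ) : KC G X (p + 1) q →+ KC G X p q :=
  QuotientAddGroup.map _ _ (((dFd p q).comp (Inj G X (p + 1) q).subtype).codRestrict (Inj G X p q)
    fun c => dFd_mem_Inj c.2) fun c hc => by
      rw [AddSubgroup.mem_addSubgroupOf] at hc
      exact AddSubgroup.mem_comap.2 (AddSubgroup.mem_addSubgroupOf.2 (dFd_coinv hc))

lemma dM_kmk {c : DC G X p (q + 1)} (hc : c ∈ Inj G X p (q + 1)) :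
    dM p q (kmk hc) = kmk (dMd_mem_Inj hc) := rfl

lemma dF_kmk {c : DC G X (p + 1) q} (hc : c ∈ Inj G X (p + 1) q) :
    dF p q (kmk hc) = kmk (dFd_mem_Inj hc) := rfl

lemma kmk_congr {c d : DC G X p q} (h : c = d) (hc : c ∈ Inj G X p q) :
    kmk hc = kmk (h ▸ hc : d ∈ Inj G X p q) := by subst h; rfl

@[simp] lemma dM_dM (x : KC G X p (q + 2)) : dM p q (dM p (q + 1) x) = 0 := by
  obtain ⟨c, hc, rfl⟩ := exists_kmk x
  exact (kmk_congr (dMd_dMd c) _).trans (kmk_eq_zero.2 (zero_mem _))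

@[simp] lemma dF_dF (x : KC G X (p + 2) q) : dF p q (dF (p + 1) q x) = 0 := by
  obtain ⟨c, hc, rfl⟩ := exists_kmk x
  exact (kmk_congr (dFd_dFd c) _).trans (kmk_eq_zero.2 (zero_mem _))

lemma dM_dF (x : KC G X (p + 1) (q + 1)) : dM p q (dF p (q + 1) x) = dF p q (dM (p + 1) q x) := by
  obtain ⟨c, hc, rfl⟩ := exists_kmk x
  exact kmk_congr (dMd_dFd c) _

end DoubleComplex

section Exactness

open FreeAbelianGroup

variable {G X : Type} [Group G] [MulAction G X] {p q : ℕ}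

/-- Move every injective generator into a standard position. -/
def nrm (γ : (Fin p → G) × (Fin q → X) → G) : DC G X p q →+ DC G X p q :=
  lift fun b => if Function.Injective b.2 then of ((γ b)⁻¹ • b) else 0

lemma nrm_of (γ : (Fin p → G) × (Fin q → X) → G) (a : Fin p → G) {x : Fin q → X}
    (hx : Function.Injective x) : nrm γ (of (a, x)) = of ((γ (a, x))⁻¹ • (a, x)) := by
  rw [nrm, lift_apply_of]; exact if_pos hx

lemma injective_smul_iff (k : G) (x : Fin q → X) :
    Function.Injective (k • x) ↔ Function.Injective x :=
  Function.Injective.of_comp_iff (MulAction.injective k) x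

lemma nrm_coinv (γ : (Fin p → G) × (Fin q → X) → G)
    (hγ : ∀ k b, Function.Injective b.2 → γ (k • b) = k * γ b) {c : DC G X p q}
    (hc : c ∈ dco G X p q) : nrm γ c = 0 := by
  refine coinv_le_ker _ (fun s _ b => ?_) hc
  rw [nrm, lift_apply_of, lift_apply_of]
  by_cases h : Function.Injective b.2
  · rw [if_pos h, if_pos (show Function.Injective (s • b).2 from (injective_smul_iff s b.2).2 h), hγ s b h, mul_inv_rev, smul_smul,
      inv_mul_cancel_right]
  · rw [if_neg h, if_neg (show ¬ Function.Injective (s • b).2 from mt (injective_smul_iff s b.2).1 h)]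

lemma nrm_sub (γ : (Fin p → G) × (Fin q → X) → G) {c : DC G X p q} (hc : c ∈ Inj G X p q) :
    nrm γ c - c ∈ dco G X p q := by
  refine Inj_le_comap (nrm γ - AddMonoidHom.id _) _ (fun a x hx => ?_) hc
  rw [AddMonoidHom.sub_apply, nrm_of γ a hx]
  exact of_smul_sub_mem_coinv (Subgroup.mem_top _) _

lemma nrm_mem_Inj (γ : (Fin p → G) × (Fin q → X) → G) {c : DC G X p q} (hc : c ∈ Inj G X p q) :
    nrm γ c ∈ Inj G X p q :=
  Inj_le_comap (nrm γ) _ (fun a x hx => by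
    rw [nrm_of γ a hx]
    exact of_mem_Inj _ ((injective_smul_iff _ x).2 hx)) hc

def coneM (v : X) : DC G X p q →+ DC G X p (q + 1) :=
  lift fun b => box (of b.1) (cone v (of b.2))

def coneF (g : G) : DC G X p q →+ DC G X (p + 1) q :=
  lift fun b => box (cone g (of b.1)) (of b.2)

lemma coneM_of (v : X) (a : Fin p → G) (x : Fin q → X) :
    coneM v (of (a, x)) = of (a, Matrix.vecCons v x) := by
  simp [coneM, lift_apply_of]

lemma coneM_box (v : X) (c : Ch G p) (d : Ch X q) : coneM v (box c d) = box c (cone v d) :=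
  dc_ext (f := (AddMonoidHom.compHom (coneM v)).comp box)
    (g := ((AddMonoidHom.compHom.flip (cone v)).comp box)) (fun a x => by simp [coneM_of]) c d

lemma coneF_of (g : G) (a : Fin p → G) (x : Fin q → X) :
    coneF g (of (a, x)) = of (Matrix.vecCons g a, x) := by
  simp [coneF, lift_apply_of]

lemma coneF_box (g : G) (c : Ch G p) (d : Ch X q) : coneF g (box c d) = box (cone g c) d :=
  dc_ext (f := (AddMonoidHom.compHom (coneF g)).comp box)
    (g := box.comp (cone g)) (fun a x => by simp [coneF_of]) c d

lemma coneF_mem_Inj (g : G) {c : DC G X p q} (hc : c ∈ Inj G X p q) :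
    coneF g c ∈ Inj G X (p + 1) q :=
  Inj_le_comap (coneF g) _ (fun a x hx => by
    rw [coneF_of]; exact of_mem_Inj _ hx) hc

lemma exists_fresh {c : DC G X p q} (hc : c ∈ Inj G X p q) :
    ∃ F : Finset X, ∀ v ∉ F, coneM v c ∈ Inj G X p (q + 1) := by
  induction hc using AddSubgroup.closure_induction with
  | mem c hc =>
    obtain ⟨a, x, hx, rfl⟩ := hc
    refine ⟨Finset.univ.image x, fun v hv => ?_⟩
    rw [coneM_of]
    refine of_mem_Inj _ (injective_vecCons.2 ⟨fun i h => hv ?_, hx⟩)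
    exact Finset.mem_image.2 ⟨i, Finset.mem_univ _, h⟩
  | zero => exact ⟨∅, fun v _ => by rw [map_zero]; exact zero_mem _⟩
  | add c d _ _ h1 h2 =>
    obtain ⟨F, hF⟩ := h1
    obtain ⟨F', hF'⟩ := h2
    refine ⟨F ∪ F', fun v hv => ?_⟩
    rw [Finset.mem_union, not_or] at hv
    rw [map_add]
    exact add_mem (hF v hv.1) (hF' v hv.2)
  | neg c _ h1 =>
    obtain ⟨F, hF⟩ := h1
    exact ⟨F, fun v hv => by rw [map_neg]; exact neg_mem (hF v hv)⟩

lemma dMd_coneM (v : X) (c : DC G X p (q + 1)) :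
    dMd p (q + 1) (coneM v c) = c - coneM v (dMd p q c) := by
  refine DFunLike.congr_fun (f := (dMd p (q + 1)).comp (coneM v))
    (g := AddMonoidHom.id _ - (coneM v).comp (dMd p q)) ?_ c
  ext ⟨a, x⟩
  simp [coneM_of, dMd_of, coneM_box]

lemma dFd_coneF (g : G) (c : DC G X (p + 1) q) :
    dFd (p + 1) q (coneF g c) = c - coneF g (dFd p q c) := by
  refine DFunLike.congr_fun (f := (dFd (p + 1) q).comp (coneF g))
    (g := AddMonoidHom.id _ - (coneF g).comp (dFd p q)) ?_ c
  ext ⟨a, x⟩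
  simp [coneF_of, dFd_of, coneF_box]

lemma dMd_coneM_zero (v : X) (c : DC G X p 0) : dMd p 0 (coneM v c) = c := by
  refine DFunLike.congr_fun (f := (dMd p 0).comp (coneM v)) (g := AddMonoidHom.id _) ?_ c
  ext ⟨a, x⟩
  simp [coneM_of, dMd_of]

lemma dFd_coneF_zero (g : G) (c : DC G X 0 q) : dFd 0 q (coneF g c) = c := by
  refine DFunLike.congr_fun (f := (dFd 0 q).comp (coneF g)) (g := AddMonoidHom.id _) ?_ c
  ext ⟨a, x⟩
  simp [coneF_of, dFd_of]

lemma dM_surj [Nonempty X] (x : KC G X p 0) : ∃ y : KC G X p 1, dM p 0 y = x := by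
  obtain ⟨c, hc, rfl⟩ := exists_kmk x
  obtain ⟨v⟩ := ‹Nonempty X›
  have h : coneM v c ∈ Inj G X p 1 := Inj_le_comap (coneM v) _ (fun a x _ => by
    rw [coneM_of]; exact of_mem_Inj _ (Function.injective_of_subsingleton _)) hc
  exact ⟨kmk h, (dM_kmk h).trans (kmk_congr (dMd_coneM_zero v c) _)⟩

lemma dF_surj (x : KC G X 0 q) : ∃ y : KC G X 1 q, dF 0 q y = x := by
  obtain ⟨c, hc, rfl⟩ := exists_kmk x
  exact ⟨kmk (coneF_mem_Inj 1 hc), (dF_kmk _).trans (kmk_congr (dFd_coneF_zero 1 c) _)⟩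

/-- The standard position with first group element equal to `1`. -/
def fstElt (b : (Fin (p + 1) → G) × (Fin q → X)) : G := b.1 0

lemma nrm_box_fstElt (a : Fin (p + 1) → G) {d : Ch X q} (hd : d ∈ InjC ∅ q) :
    nrm fstElt (box (of a) d) = box (of ((a 0)⁻¹ • a)) (cmap ((a 0)⁻¹ • ·) d) := by
  induction hd using AddSubgroup.closure_induction with
  | mem c hc =>
    obtain ⟨x, hx, -, rfl⟩ := hc
    rw [box_of, nrm_of _ _ hx, cmap_of, box_of]
    rfl
  | zero => simp
  | add c d _ _ h1 h2 => simp only [map_add, h1, h2]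
  | neg c _ h1 => simp only [map_neg, h1]

lemma dMd_nrm_fstElt {c : DC G X (p + 1) (q + 1)} (hc : c ∈ Inj G X (p + 1) (q + 1)) :
    dMd (p + 1) q (nrm fstElt c) = nrm fstElt (dMd (p + 1) q c) := by
  rw [← sub_eq_zero]
  have := Inj_le_comap ((dMd (p + 1) q).comp (nrm fstElt) - (nrm fstElt).comp (dMd (p + 1) q)) ⊥
    (fun a x hx => ?_) hc
  · exact this
  · rw [AddSubgroup.mem_bot, AddMonoidHom.sub_apply, sub_eq_zero, AddMonoidHom.comp_apply,
      AddMonoidHom.comp_apply, ← box_of, nrm_box_fstElt a (of_mem_InjC hx), dMd_box, dMd_box,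
      nrm_box_fstElt a (bd_mem_InjC (of_mem_InjC hx)), bd_cmap]

lemma dM_exact [Infinite X] (x : KC G X (p + 1) (q + 1)) (h : dM (p + 1) q x = 0) :
    ∃ y, dM (p + 1) (q + 1) y = x := by
  obtain ⟨c, hc, rfl⟩ := exists_kmk x
  rw [dM_kmk, kmk_eq_zero] at h
  have h1 : dMd (p + 1) q (nrm fstElt c) = 0 :=
    (dMd_nrm_fstElt hc).trans (nrm_coinv _ (fun k b _ => rfl) h)
  obtain ⟨F, hF⟩ := exists_fresh (nrm_mem_Inj fstElt hc)
  obtain ⟨v, hv⟩ := Infinite.exists_notMem_finset F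
  refine ⟨kmk (hF v hv), (dM_kmk _).trans ((kmk_congr ?_ _).trans
    (kmk_eq.2 (nrm_sub fstElt hc) : kmk (nrm_mem_Inj fstElt hc) = kmk hc))⟩
  rw [dMd_coneM, h1, map_zero, sub_zero]

/-- A choice of standard positions for a free action on injective tuples. -/
lemma exists_position (hfree : ∀ (x : Fin q → X) (g : G), Function.Injective x → g • x = x → g = 1) :
    ∃ γ : (Fin q → X) → G, ∀ k x, Function.Injective x → γ (k • x) = k * γ x := by
  have h1 : ∀ x : Fin q → X, ∃ g : G, g • (Quotient.mk (MulAction.orbitRel G _) x).out = x :=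
    fun x => by
      have := Quotient.exact (Quotient.out_eq (Quotient.mk (MulAction.orbitRel G _) x))
      obtain ⟨g, hg⟩ := this
      exact ⟨g⁻¹, by rw [← hg]; simp⟩
  choose γ hγ using h1
  refine ⟨γ, fun k x hx => ?_⟩
  have e : Quotient.mk (MulAction.orbitRel G (Fin q → X)) (k • x) = Quotient.mk _ x :=
    Quotient.sound ⟨k, rfl⟩
  have h2 := hγ (k • x)
  rw [e] at h2
  set y := (Quotient.mk (MulAction.orbitRel G (Fin q → X)) x).out
  have h3 := hγ x
  have hy : Function.Injective y := by
    rw [← h3] at hx; exact (injective_smul_iff _ _).1 hx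
  have := hfree y ((k * γ x)⁻¹ * γ (k • x)) hy (by
    rw [mul_smul, h2, mul_inv_rev, mul_smul, inv_smul_smul, inv_smul_eq_iff, h3])
  rw [inv_mul_eq_one] at this
  exact this.symm

lemma nrm_box_snd (γ : (Fin q → X) → G) (c : Ch G p) {x : Fin q → X} (hx : Function.Injective x) :
    nrm (fun b => γ b.2) (box c (of x)) = box (tr (γ x)⁻¹ c) (of ((γ x)⁻¹ • x)) := by
  induction c using fab_ind with
  | h0 => simp
  | h1 a => rw [box_of, nrm_of _ _ hx, cmap_of, box_of]; rfl
  | hn x hx => simp only [map_neg, AddMonoidHom.neg_apply, hx]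
  | ha x y hx hy => simp only [map_add, AddMonoidHom.add_apply, hx, hy]

lemma dFd_nrm_snd (γ : (Fin q → X) → G) {c : DC G X (p + 1) q} (hc : c ∈ Inj G X (p + 1) q) :
    dFd p q (nrm (fun b => γ b.2) c) = nrm (fun b => γ b.2) (dFd p q c) := by
  rw [← sub_eq_zero]
  have := Inj_le_comap ((dFd p q).comp (nrm fun b => γ b.2) -
    (nrm fun b => γ b.2).comp (dFd p q)) ⊥ (fun a x hx => ?_) hc
  · exact this
  · rw [AddSubgroup.mem_bot, AddMonoidHom.sub_apply, sub_eq_zero, AddMonoidHom.comp_apply,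
      AddMonoidHom.comp_apply, ← box_of, nrm_box_snd γ _ hx, dFd_box, dFd_box, nrm_box_snd γ _ hx,
      bd_cmap]

lemma dF_exact (hfree : ∀ (x : Fin q → X) (g : G), Function.Injective x → g • x = x → g = 1)
    (x : KC G X (p + 1) q) (h : dF p q x = 0) : ∃ y, dF (p + 1) q y = x := by
  obtain ⟨c, hc, rfl⟩ := exists_kmk x
  rw [dF_kmk, kmk_eq_zero] at h
  obtain ⟨γ, hγ⟩ := exists_position hfree
  have h1 : dFd p q (nrm (fun b => γ b.2) c) = 0 :=
    (dFd_nrm_snd γ hc).trans (nrm_coinv _ (fun k b hb => hγ k b.2 hb) h)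
  have h2 := nrm_mem_Inj (fun b => γ b.2) hc
  refine ⟨kmk (coneF_mem_Inj 1 h2), (dF_kmk _).trans ((kmk_congr ?_ _).trans
    (kmk_eq.2 (nrm_sub (fun b => γ b.2) hc) : kmk h2 = kmk hc))⟩
  rw [dFd_coneF, h1, map_zero, sub_zero]

end Exactness

section Columns

open FreeAbelianGroup

variable {G X : Type} [Group G] [MulAction G X] {p q : ℕ} (y : Fin q → X)

/-- The inclusion of chains on the group as the part of a column over a fixed tuple of points. -/
def jmap : Ch G p →+ DC G X p q := box.flip (of y)

lemma jmap_eq (c : Ch G p) : jmap y c = box c (of y) := rfl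

variable {y}

lemma jmap_mem_Inj (hy : Function.Injective y) (c : Ch G p) : jmap y c ∈ Inj G X p q :=
  box_mem_Inj (of_mem_InjC hy)

lemma dFd_jmap (c : Ch G (p + 1)) : dFd p q (jmap y c) = jmap y (bd p c) := dFd_box _ _

lemma jmap_tr (g : G) (c : Ch G p) : jmap (g • y) (tr g c) - jmap y c ∈ dco G X p q := by
  have := box_smul_sub g c (of y)
  rwa [cmap_of] at this

lemma jmap_coinv {c : Ch G p} (hc : c ∈ coinv (MulAction.stabilizer G y) (Fin p → G)) :
    jmap y c ∈ dco G X p q := by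
  refine coinv_le_of_tr (jmap y) _ (fun s hs b => ?_) hc
  have := jmap_tr (y := y) s b
  rwa [show s • y = y from hs] at this

/-- The chain in a column over a fixed injective tuple of points. -/
def jK (hy : Function.Injective y) : Ch G p →+ KC G X p q :=
  AddMonoidHom.mk' (fun c => kmk (jmap_mem_Inj hy c)) fun c d => by
    rw [← kmk_add (jmap_mem_Inj hy c) (jmap_mem_Inj hy d)]
    exact kmk_congr (map_add _ _ _) _

lemma jK_eq_zero (hy : Function.Injective y) {c : Ch G p}
    (hc : c ∈ coinv (MulAction.stabilizer G y) (Fin p → G)) : jK hy c = 0 :=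
  kmk_eq_zero.2 (jmap_coinv hc)

lemma dF_jK (hy : Function.Injective y) (c : Ch G (p + 1)) : dF p q (jK hy c) = jK hy (bd p c) :=
  kmk_congr (dFd_jmap c) _

lemma jK_Bd (hy : Function.Injective y) {c : Ch G p} (hc : c ∈ Bd (MulAction.stabilizer G y) p) :
    ∃ d : KC G X (p + 1) q, jK hy c = dF p q d := by
  obtain ⟨d, hd⟩ := mem_Bd.1 hc
  refine ⟨jK hy d, ?_⟩
  rw [dF_jK, ← sub_eq_zero, ← map_sub]
  exact jK_eq_zero hy hd

lemma jK_tr (hy : Function.Injective y) (g : G) (c : Ch G p) :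
    jK ((injective_smul_iff g y).2 hy) (tr g c) = jK hy c :=
  kmk_eq.2 (jmap_tr g c)

/-- If the action is transitive on injective tuples, a column computes the homology of a
stabiliser. -/
theorem exists_jK_eq (hy : Function.Injective y)
    (htr : ∀ x : Fin q → X, Function.Injective x → ∃ g : G, g • y = x)
    (x : KC G X (p + 1) q) : ∃ c : Ch G (p + 1), x = jK hy c ∧
      (dF p q x = 0 → c ∈ Closed (MulAction.stabilizer G y) p) := by
  have htr' : ∀ x : Fin q → X, ∃ g : G, Function.Injective x → g • y = x := fun x => by
    by_cases hx : Function.Injective x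
    · obtain ⟨g, hg⟩ := htr x hx
      exact ⟨g, fun _ => hg⟩
    · exact ⟨1, fun h => absurd h hx⟩
  choose h hh using htr'
  let n : ∀ p, DC G X p q →+ Ch G p := fun p =>
    lift fun b => if Function.Injective b.2 then of ((h b.2)⁻¹ • b.1) else 0
  have n_of : ∀ p (a : Fin p → G) x, Function.Injective x → n p (of (a, x)) = of ((h x)⁻¹ • a) :=
    fun p a x hx => by
      rw [show n p (of (a, x)) = _ from lift_apply_of _ _]; exact if_pos hx
  have n_box : ∀ p (c : Ch G p) x, Function.Injective x → n p (box c (of x)) = tr (h x)⁻¹ c :=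
    fun p c x hx => by
      induction c using fab_ind with
      | h0 => simp
      | h1 a => rw [box_of, n_of p a x hx, of_smul_eq_tr]
      | hn c hc => simp only [map_neg, AddMonoidHom.neg_apply, hc]
      | ha c d hc hd => simp only [map_add, AddMonoidHom.add_apply, hc, hd]
  have n_coinv : ∀ p c, c ∈ dco G X p q → n p c ∈ coinv (MulAction.stabilizer G y) (Fin p → G) := by
    intro p c hc
    refine coinv_le_comap (n p) _ (fun s _ b => ?_) hc
    obtain ⟨a, x⟩ := b
    by_cases hx : Function.Injective x
    · have hx' := (injective_smul_iff s x).2 hx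
      have e1 := hh x hx
      have e2 := hh (s • x) hx'
      rw [show s • (a, x) = (s • a, s • x) from rfl, n_of _ _ _ hx, n_of _ _ _ hx',
        show (h (s • x))⁻¹ • s • a = ((h (s • x))⁻¹ * s * h x) • (h x)⁻¹ • a by
          simp only [smul_smul]; congr 1; group]
      refine of_smul_sub_mem_coinv ?_ _
      rw [MulAction.mem_stabilizer_iff, mul_smul, e1, mul_smul, inv_smul_eq_iff, e2]
    · have hx' := mt (injective_smul_iff s x).1 hx
      have z1 : n p (of (a, x)) = 0 := (lift_apply_of _ _).trans (if_neg hx)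
      have z2 : n p (of (s • (a, x))) = 0 := (lift_apply_of _ _).trans (if_neg hx')
      rw [z1, z2, sub_zero]
      exact zero_mem _
  have n_dF : ∀ c ∈ Inj G X (p + 1) q, n p (dFd p q c) - bd p (n (p + 1) c) = 0 := fun c hc => by
    refine AddSubgroup.mem_bot.1 (Inj_le_comap ((n p).comp (dFd p q) - (bd p).comp (n (p + 1))) ⊥
      (fun a x hx => ?_) hc)
    rw [AddSubgroup.mem_bot, AddMonoidHom.sub_apply, sub_eq_zero, AddMonoidHom.comp_apply,
      AddMonoidHom.comp_apply, dFd_of, n_box _ _ _ hx, n_of _ _ _ hx, of_smul_eq_tr, bd_cmap]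
  have j_n : ∀ c ∈ Inj G X (p + 1) q, jmap y (n (p + 1) c) - c ∈ dco G X (p + 1) q := fun c hc => by
    refine Inj_le_comap ((jmap y).comp (n (p + 1)) - AddMonoidHom.id _) _ (fun a x hx => ?_) hc
    have := jmap_tr (y := x) (h x)⁻¹ (of a)
    rw [show (h x)⁻¹ • x = y from inv_smul_eq_iff.2 (hh x hx).symm] at this
    rw [AddMonoidHom.sub_apply, AddMonoidHom.comp_apply, n_of _ _ _ hx, of_smul_eq_tr]
    simpa [jmap_eq] using this
  obtain ⟨c, hc, rfl⟩ := exists_kmk x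
  refine ⟨n (p + 1) c, (kmk_eq.2 (j_n c hc)).symm, fun hd => ?_⟩
  rw [dF_kmk, kmk_eq_zero] at hd
  rw [mem_Closed, ← sub_eq_zero.1 (n_dF c hc)]
  exact n_coinv p _ hd

end Columns

section Zigzag

variable {G X : Type} [Group G] [MulAction G X]

/-- The zigzag relation between three-dimensional group chains and quadruples of points. -/
def Zig (a : KC G X 4 0) (p : KC G X 0 4) : Prop :=
  ∃ (a0 : KC G X 4 1) (a1 : KC G X 3 2) (a2 : KC G X 2 3) (a3 : KC G X 1 4),
    dM 4 0 a0 = a ∧ dF 3 1 a0 = dM 3 1 a1 ∧ dF 2 2 a1 = dM 2 2 a2 ∧ dF 1 3 a2 = dM 1 3 a3 ∧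
      dF 0 4 a3 = p

lemma Zig.add {a a' : KC G X 4 0} {p p' : KC G X 0 4} (h : Zig a p) (h' : Zig a' p') :
    Zig (a + a') (p + p') := by
  obtain ⟨a0, a1, a2, a3, h1, h2, h3, h4, h5⟩ := h
  obtain ⟨b0, b1, b2, b3, k1, k2, k3, k4, k5⟩ := h'
  refine ⟨a0 + b0, a1 + b1, a2 + b2, a3 + b3, ?_, ?_, ?_, ?_, ?_⟩ <;> simp only [map_add, *]

lemma Zig.neg {a : KC G X 4 0} {p : KC G X 0 4} (h : Zig a p) : Zig (-a) (-p) := by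
  obtain ⟨a0, a1, a2, a3, h1, h2, h3, h4, h5⟩ := h
  refine ⟨-a0, -a1, -a2, -a3, ?_, ?_, ?_, ?_, ?_⟩ <;> simp only [map_neg, *]

lemma Zig.dF_eq_zero {a : KC G X 4 0} {p : KC G X 0 4} (h : Zig a p) : dF 3 0 a = 0 := by
  obtain ⟨a0, a1, a2, a3, h1, h2, h3, h4, h5⟩ := h
  rw [← h1, ← dM_dF, h2, dM_dM]

lemma exists_zig [Infinite X] (a : KC G X 4 0) (h : dF 3 0 a = 0) : ∃ p, Zig a p := by
  obtain ⟨a0, h0⟩ := dM_surj a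
  obtain ⟨a1, h1⟩ := dM_exact (dF 3 1 a0) (by rw [dM_dF, h0, h])
  obtain ⟨a2, h2⟩ := dM_exact (dF 2 2 a1) (by rw [dM_dF, h1, dF_dF])
  obtain ⟨a3, h3⟩ := dM_exact (dF 1 3 a2) (by rw [dM_dF, h2, dF_dF])
  exact ⟨dF 0 4 a3, a0, a1, a2, a3, h0, h1.symm, h2.symm, h3.symm, rfl⟩

lemma zig_dF [Infinite X] {b : KC G X 5 0} {p : KC G X 0 4} (h : Zig (dF 4 0 b) p) :
    ∃ e, p = dM 0 4 e := by
  obtain ⟨a0, a1, a2, a3, h1, h2, h3, h4, h5⟩ := h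
  obtain ⟨b0, e0⟩ := dM_surj b
  obtain ⟨b1, e1⟩ := dM_exact (a0 - dF 4 1 b0) (by rw [map_sub, dM_dF, e0, h1, sub_self])
  obtain ⟨b2, e2⟩ := dM_exact (a1 - dF 3 2 b1)
    (by rw [map_sub, dM_dF, e1, map_sub, dF_dF, h2, sub_zero, sub_self])
  obtain ⟨b3, e3⟩ := dM_exact (a2 - dF 2 3 b2)
    (by rw [map_sub, dM_dF, e2, map_sub, dF_dF, h3, sub_zero, sub_self])
  obtain ⟨b4, e4⟩ := dM_exact (a3 - dF 1 4 b3)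
    (by rw [map_sub, dM_dF, e3, map_sub, dF_dF, h4, sub_zero, sub_self])
  exact ⟨dF 0 5 b4, by rw [dM_dF, e4, map_sub, dF_dF, sub_zero, h5]⟩

lemma zig_dM {c : KC G X 4 1} (hc : dF 3 1 c = 0) : Zig (dM 4 0 c) 0 :=
  ⟨c, 0, 0, 0, rfl, by rw [hc, map_zero], by simp, by simp, by simp⟩

lemma Zig.exists_of_eq_dM {a : KC G X 4 0} {e : KC G X 0 5} (h : Zig a (dM 0 4 e))
    (hfree : ∀ q, 3 ≤ q → ∀ (x : Fin q → X) (g : G), Function.Injective x → g • x = x → g = 1)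
    (hswap : ∀ x : KC G X 3 2, dF 2 2 x = 0 → ∃ b, dM 3 1 (x - dF 3 2 b) = 0) :
    ∃ c : KC G X 4 1, dF 3 1 c = 0 ∧ dM 4 0 c = a := by
  obtain ⟨a0, a1, a2, a3, h1, h2, h3, h4, h5⟩ := h
  obtain ⟨e', rfl⟩ := dF_surj e
  obtain ⟨b, hb⟩ := dF_exact (hfree 4 (by norm_num)) (a3 - dM 1 4 e')
    (by rw [map_sub, h5, ← dM_dF, sub_self])
  obtain ⟨b', hb'⟩ := dF_exact (hfree 3 le_rfl) (a2 - dM 2 3 b)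
    (by rw [map_sub, h4, ← dM_dF, hb, map_sub, dM_dM, sub_zero, sub_self])
  obtain ⟨b'', hb''⟩ := hswap (a1 - dM 3 2 b')
    (by rw [map_sub, h3, ← dM_dF, hb', map_sub, dM_dM, sub_zero, sub_self])
  refine ⟨a0 - dM 4 1 b'', ?_, by rw [map_sub, h1, dM_dM, sub_zero]⟩
  rw [map_sub, map_sub, dM_dM, sub_zero, sub_eq_zero] at hb''
  rw [map_sub, h2, hb'', dM_dF, sub_self]

lemma exists_zig_of_functionals {W : Type*} [AddCommGroup W] (Ψ₀ : KC G X 0 4 →+ W)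
    (Ψ₁ : KC G X 1 3 →+ W) (Ψ₂ : KC G X 2 2 →+ W) (Ψ₃ : KC G X 3 1 →+ W)
    (h01 : ∀ x, Ψ₀ (dF 0 4 x) = Ψ₁ (dM 1 3 x)) (h12 : ∀ x, Ψ₁ (dF 1 3 x) = Ψ₂ (dM 2 2 x))
    (h23 : ∀ x, Ψ₂ (dF 2 2 x) = Ψ₃ (dM 3 1 x))
    (hfree : ∀ (x : Fin 3 → X) (g : G), Function.Injective x → g • x = x → g = 1)
    (hlift : ∀ x : KC G X 2 3, dF 1 2 (dM 2 2 x) = 0 → ∃ y, dF 2 2 y = dM 2 2 x)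
    (hdet : ∀ x : KC G X 3 1, dF 2 1 x = 0 → Ψ₃ x = 0 → ∃ y, dF 3 1 y = x)
    {p : KC G X 0 4} (hp : dM 0 3 p = 0) (hp' : Ψ₀ p = 0) : ∃ a, Zig a p := by
  obtain ⟨a3, e3⟩ := dF_surj p
  obtain ⟨a2, e2⟩ := dF_exact hfree (dM 1 3 a3) (by rw [← dM_dF, e3, hp])
  obtain ⟨a1, e1⟩ := hlift a2 (by rw [← dM_dF, e2, dM_dM])
  obtain ⟨a0, e0⟩ := hdet (dM 3 1 a1) (by rw [← dM_dF, e1, dM_dM])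
    (by rw [← h23, e1, ← h12, e2, ← h01, e3, hp'])
  exact ⟨dM 4 0 a0, a0, a1, a2, a3, rfl, e0, e1, e2, e3⟩

lemma Zig.functional_eq_zero {W : Type*} [AddCommGroup W] (Ψ₀ : KC G X 0 4 →+ W)
    (Ψ₁ : KC G X 1 3 →+ W) (Ψ₂ : KC G X 2 2 →+ W) (Ψ₃ : KC G X 3 1 →+ W)
    (h01 : ∀ x, Ψ₀ (dF 0 4 x) = Ψ₁ (dM 1 3 x)) (h12 : ∀ x, Ψ₁ (dF 1 3 x) = Ψ₂ (dM 2 2 x))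
    (h23 : ∀ x, Ψ₂ (dF 2 2 x) = Ψ₃ (dM 3 1 x)) (h3 : ∀ x, Ψ₃ (dF 3 1 x) = 0)
    {a : KC G X 4 0} {p : KC G X 0 4} (h : Zig a p) : Ψ₀ p = 0 := by
  obtain ⟨a0, a1, a2, a3, h1, e0, e1, e2, e3⟩ := h
  rw [← e3, h01, ← e2, h12, ← e1, h23, ← e0, h3]

end Zigzag

section ProjectiveLine

/-- The complex projective line. -/
abbrev P1 : Type := Projectivization ℂ (Fin 2 → ℂ)

/-- The determinant of two plane vectors. -/
def det2 (v w : Fin 2 → ℂ) : ℂ := v 0 * w 1 - v 1 * w 0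

lemma det2_smul_left (a : ℂ) (v w : Fin 2 → ℂ) : det2 (a • v) w = a * det2 v w := by
  simp [det2]; ring

lemma det2_smul_right (a : ℂ) (v w : Fin 2 → ℂ) : det2 v (a • w) = a * det2 v w := by
  simp [det2]; ring

lemma det2_swap (v w : Fin 2 → ℂ) : det2 w v = -det2 v w := by simp only [det2]; ring

lemma eq_smul_of_det2_eq_zero {v w : Fin 2 → ℂ} (hv : v ≠ 0) (h : det2 v w = 0) :
    ∃ a : ℂ, a • v = w := by
  rw [det2, sub_eq_zero] at h
  by_cases h0 : v 0 = 0
  · have h1 : v 1 ≠ 0 := fun h1 => hv (by ext i; fin_cases i <;> simp [h0, h1])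
    refine ⟨w 1 / v 1, ?_⟩
    ext i
    fin_cases i
    · simp only [h0, zero_mul, zero_eq_mul, h1, false_or] at h
      simp [h, h0]
    · simp [h1]
  · refine ⟨w 0 / v 0, ?_⟩
    ext i
    fin_cases i
    · simp [h0]
    · simp only [Pi.smul_apply, smul_eq_mul, Fin.mk_one]
      field_simp
      linear_combination -h

lemma mk_eq_mk_iff_det2 {v w : Fin 2 → ℂ} (hv : v ≠ 0) (hw : w ≠ 0) :
    Projectivization.mk ℂ v hv = Projectivization.mk ℂ w hw ↔ det2 v w = 0 := by
  rw [Projectivization.mk_eq_mk_iff']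
  constructor
  · rintro ⟨a, rfl⟩
    rw [det2_smul_left, det2]
    ring
  · intro h
    refine eq_smul_of_det2_eq_zero hw ?_
    rw [det2_swap, h, neg_zero]

lemma det2_rep_eq_zero {x y : P1} : det2 x.rep y.rep = 0 ↔ x = y := by
  rw [← mk_eq_mk_iff_det2 x.rep_nonzero y.rep_nonzero, x.mk_rep, y.mk_rep]

lemma det2_mulVec (A : SL2C) (v w : Fin 2 → ℂ) :
    det2 (A.1.mulVec v) (A.1.mulVec w) = det2 v w := by
  have h := A.2
  rw [Matrix.det_fin_two] at h
  simp only [det2, Matrix.mulVec, dotProduct, Fin.sum_univ_two]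
  linear_combination (v 0 * w 1 - v 1 * w 0) * h

lemma mulVec_ne_zero (A : SL2C) {v : Fin 2 → ℂ} (hv : v ≠ 0) : A.1.mulVec v ≠ 0 := by
  intro h
  have h2 := fun w => det2_mulVec A v w
  simp only [h] at h2
  apply hv
  have h0 := h2 ![0, 1]
  have h1 := h2 ![1, 0]
  simp [det2] at h0 h1
  ext i
  fin_cases i <;> simp [h0.symm, h1]

/-- The projection to `PSL(2,ℂ)`. -/
def prj : SL2C →* PSL2C := QuotientGroup.mk' _

lemma prj_surjective : Function.Surjective prj := QuotientGroup.mk'_surjective _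

lemma prj_eq_one_iff {A : SL2C} : prj A = 1 ↔ A.1 = 1 ∨ A.1 = -1 := by
  rw [prj, QuotientGroup.mk'_apply, QuotientGroup.eq_one_iff,
    Matrix.SpecialLinearGroup.mem_center_iff]
  constructor
  · rintro ⟨r, hr, h⟩
    rw [Fintype.card_fin, sq_eq_one_iff] at hr
    rcases hr with rfl | rfl
    · exact Or.inl (by rw [← h, map_one])
    · exact Or.inr (by rw [← h, map_neg, map_one])
  · rintro (h | h)
    · exact ⟨1, by simp, by rw [h, map_one]⟩
    · exact ⟨-1, by simp, by rw [h, map_neg, map_one]⟩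

lemma prj_eq_iff {A B : SL2C} : prj A = prj B ↔ A.1 = B.1 ∨ A.1 = -B.1 := by
  rw [← mul_inv_eq_one, ← map_inv, ← map_mul, prj_eq_one_iff]
  have key : ∀ M : Matrix (Fin 2) (Fin 2) ℂ, (A * B⁻¹).1 = M ↔ A.1 = M * B.1 := by
    intro M
    constructor
    · rintro rfl
      rw [← Matrix.SpecialLinearGroup.coe_mul, inv_mul_cancel_right]
    · intro h
      rw [Matrix.SpecialLinearGroup.coe_mul, h, mul_assoc, ← Matrix.SpecialLinearGroup.coe_mul,
        mul_inv_cancel, Matrix.SpecialLinearGroup.coe_one, mul_one]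
  rw [key, key, one_mul, neg_mul, one_mul]

instance : MulAction PSL2C P1 :=
  inferInstanceAs (MulAction (Matrix.ProjectiveSpecialLinearGroup (Fin 2) ℂ) P1)

lemma prj_smul_mk (A : SL2C) {v : Fin 2 → ℂ} (hv : v ≠ 0) :
    prj A • (Projectivization.mk ℂ v hv : P1) =
      Projectivization.mk ℂ (A.1.mulVec v) (mulVec_ne_zero A hv) := rfl

/-- The matrix with given columns. -/
def colSL (v w : Fin 2 → ℂ) (h : det2 v w = 1) : SL2C :=
  ⟨!![v 0, w 0; v 1, w 1], by rw [Matrix.det_fin_two_of, ← h, det2]; ring⟩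

lemma colSL_mulVec {v w : Fin 2 → ℂ} (h : det2 v w = 1) (x : Fin 2 → ℂ) :
    (colSL v w h).1.mulVec x = x 0 • v + x 1 • w := by
  ext i
  fin_cases i <;> simp [colSL, Matrix.mulVec, dotProduct, Fin.sum_univ_two] <;> ring

/-- The point of the projective line with coordinate `z`. -/
def pz (z : ℂ) : P1 := Projectivization.mk ℂ ![z, 1] (fun h => one_ne_zero (congrFun h 1))

/-- The point at infinity. -/
def pinf : P1 := Projectivization.mk ℂ ![1, 0] (fun h => one_ne_zero (congrFun h 0))

lemma pz_injective : Function.Injective pz := fun z w h => by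
  rw [pz, pz, mk_eq_mk_iff_det2] at h
  simpa [det2, sub_eq_zero] using h

lemma pinf_ne_pz (z : ℂ) : pinf ≠ pz z := fun h => by
  rw [pz, pinf, mk_eq_mk_iff_det2] at h
  simp [det2] at h

instance : Infinite P1 := Infinite.of_injective pz pz_injective

lemma prj_smul_pinf {A : SL2C} : prj A • pinf = pinf ↔ A.1 1 0 = 0 := by
  rw [pinf, prj_smul_mk, mk_eq_mk_iff_det2]
  simp [det2, Matrix.mulVec, dotProduct, Fin.sum_univ_two]

lemma prj_smul_pz_zero {A : SL2C} : prj A • pz 0 = pz 0 ↔ A.1 0 1 = 0 := by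
  rw [pz, prj_smul_mk, mk_eq_mk_iff_det2]
  simp [det2, Matrix.mulVec, dotProduct, Fin.sum_univ_two]

lemma prj_smul_pz_one {A : SL2C} (h1 : A.1 1 0 = 0) (h2 : A.1 0 1 = 0) :
    prj A • pz 1 = pz 1 ↔ A.1 0 0 = A.1 1 1 := by
  rw [pz, prj_smul_mk, mk_eq_mk_iff_det2]
  simp [det2, Matrix.mulVec, dotProduct, Fin.sum_univ_two, h1, h2, sub_eq_zero]

lemma exists_smul_pinf (x : P1) : ∃ g : PSL2C, g • pinf = x := by
  induction x using Projectivization.ind with | _ v hv =>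
  have h : ∃ w, det2 v w = 1 := by
    by_cases h0 : v 0 = 0
    · have h1 : v 1 ≠ 0 := fun h1 => hv (by ext i; fin_cases i <;> simp [h0, h1])
      exact ⟨![-(v 1)⁻¹, 0], by simp [det2, h1]⟩
    · exact ⟨![0, (v 0)⁻¹], by simp [det2, h0]⟩
  obtain ⟨w, hw⟩ := h
  refine ⟨prj (colSL v w hw), ?_⟩
  rw [pinf, prj_smul_mk, mk_eq_mk_iff_det2, colSL_mulVec]
  simp [det2]; ring

lemma exists_smul_pair {x y : P1} (hxy : x ≠ y) : ∃ g : PSL2C, g • pinf = x ∧ g • pz 0 = y := by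
  have hd := mt det2_rep_eq_zero.1 hxy
  have h : det2 x.rep ((det2 x.rep y.rep)⁻¹ • y.rep) = 1 := by
    rw [det2_smul_right, inv_mul_cancel₀ hd]
  refine ⟨prj (colSL _ _ h), ?_, ?_⟩
  · conv_rhs => rw [← x.mk_rep]
    rw [pinf, prj_smul_mk, mk_eq_mk_iff_det2, colSL_mulVec]
    simp [det2]; ring
  · conv_rhs => rw [← y.mk_rep]
    rw [pz, prj_smul_mk, mk_eq_mk_iff_det2, colSL_mulVec]
    simp [det2]; ring

/-- Diagonal matrices. -/
def dg (a b : ℂ) (h : a * b = 1) : SL2C := ⟨!![a, 0; 0, b], by rw [Matrix.det_fin_two_of, h]; ring⟩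

lemma dg_mul {a b c d : ℂ} (h : a * b = 1) (h' : c * d = 1) :
    (dg a b h * dg c d h').1 = !![a * c, 0; 0, b * d] := by
  rw [Matrix.SpecialLinearGroup.coe_mul]
  simp [dg]

/-- A square root in `ℂˣ`. -/
def usqrt (u : ℂˣ) : ℂ := Classical.choose (IsAlgClosed.exists_pow_nat_eq (u : ℂ) two_pos)

lemma usqrt_sq (u : ℂˣ) : usqrt u ^ 2 = u :=
  Classical.choose_spec (IsAlgClosed.exists_pow_nat_eq (u : ℂ) two_pos)

lemma usqrt_ne_zero (u : ℂˣ) : usqrt u ≠ 0 := fun h => u.ne_zero (by rw [← usqrt_sq, h]; simp)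

/-- The diagonal torus: `tor u` acts on the projective line by `z ↦ u z`. -/
def tor : ℂˣ →* PSL2C where
  toFun u := prj (dg (usqrt u) (usqrt u)⁻¹ (mul_inv_cancel₀ (usqrt_ne_zero u)))
  map_one' := by
    rw [prj_eq_one_iff]
    have h := usqrt_sq 1
    rw [Units.val_one, sq_eq_one_iff] at h
    rcases h with h | h
    · left; simp [dg, h, Matrix.one_fin_two]
    · right; ext i j; fin_cases i <;> fin_cases j <;> simp [dg, h, inv_neg]
  map_mul' u v := by
    rw [← map_mul, prj_eq_iff, dg_mul]
    have h : usqrt (u * v) = usqrt u * usqrt v ∨ usqrt (u * v) = -(usqrt u * usqrt v) := by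
      rw [← sq_eq_sq_iff_eq_or_eq_neg, mul_pow, usqrt_sq, usqrt_sq, usqrt_sq, Units.val_mul]
    rcases h with h | h
    · left; simp [dg, h, mul_comm]
    · right; ext i j; fin_cases i <;> fin_cases j <;> simp [dg, h, mul_comm, inv_neg]

lemma prj_dg {a b : ℂ} (h : a * b = 1) (u : ℂˣ) (hu : a ^ 2 = u) : prj (dg a b h) = tor u := by
  have hb : b = a⁻¹ := eq_inv_of_mul_eq_one_right h
  subst hb
  refine prj_eq_iff.2 ?_
  rw [← usqrt_sq, sq_eq_sq_iff_eq_or_eq_neg] at hu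
  rcases hu with h | h
  · left; simp [dg, h]
  · right; ext i j; fin_cases i <;> fin_cases j <;> simp [dg, h, inv_neg]

lemma tor_smul_pz (u : ℂˣ) (z : ℂ) : tor u • pz z = pz (u * z) := by
  change prj _ • _ = _
  rw [pz, pz, prj_smul_mk, mk_eq_mk_iff_det2]
  have := usqrt_ne_zero u
  simp [det2, Matrix.mulVec, dotProduct, Fin.sum_univ_two, dg, ← usqrt_sq]
  field_simp
  ring

lemma tor_smul_pinf (u : ℂˣ) : tor u • pinf = pinf := prj_smul_pinf.2 (by simp [dg])

lemma tor_injective : Function.Injective tor := fun u v h => by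
  have h1 := tor_smul_pz u 1
  rw [h, tor_smul_pz] at h1
  exact Units.ext (by simpa using (pz_injective h1).symm)

lemma exists_smul_triple {x y z : P1} (hxy : x ≠ y) (hxz : x ≠ z) (hyz : y ≠ z) :
    ∃ g : PSL2C, g • pinf = x ∧ g • pz 0 = y ∧ g • pz 1 = z := by
  obtain ⟨g, rfl, rfl⟩ := exists_smul_pair hxy
  obtain ⟨k, hk⟩ : ∃ k : ℂˣ, g⁻¹ • z = pz k := by
    have h1 : g⁻¹ • z ≠ pinf := fun h => hxz (by rw [← h, smul_inv_smul])
    have h2 : g⁻¹ • z ≠ pz 0 := fun h => hyz (by rw [← h, smul_inv_smul])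
    generalize g⁻¹ • z = y at h1 h2 ⊢
    induction y using Projectivization.ind with | _ v hv =>
    rw [Ne, pinf, mk_eq_mk_iff_det2] at h1
    rw [Ne, pz, mk_eq_mk_iff_det2] at h2
    simp [det2] at h1 h2
    refine ⟨Units.mk0 (v 0 / v 1) (div_ne_zero h2 h1), ?_⟩
    rw [pz, mk_eq_mk_iff_det2]
    simp [det2]; field_simp; ring
  refine ⟨g * tor k, ?_, ?_, ?_⟩
  · rw [mul_smul, tor_smul_pinf]
  · rw [mul_smul, tor_smul_pz, mul_zero]
  · rw [mul_smul, tor_smul_pz, mul_one, ← hk, smul_inv_smul]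

lemma eq_one_of_smul_three {g : PSL2C} {x y z : P1} (hxy : x ≠ y) (hxz : x ≠ z) (hyz : y ≠ z)
    (hx : g • x = x) (hy : g • y = y) (hz : g • z = z) : g = 1 := by
  obtain ⟨k, rfl, rfl, rfl⟩ := exists_smul_triple hxy hxz hyz
  have hc : ∀ p : P1, g • k • p = k • p → (k⁻¹ * g * k) • p = p := fun p h => by
    rw [mul_smul, mul_smul, h, inv_smul_smul]
  obtain ⟨A, hA⟩ := prj_surjective (k⁻¹ * g * k)
  have h1 := hc _ hx
  have h2 := hc _ hy
  have h3 := hc _ hz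
  rw [← hA] at h1 h2 h3
  rw [prj_smul_pinf] at h1
  rw [prj_smul_pz_zero] at h2
  rw [prj_smul_pz_one h1 h2] at h3
  have hd := A.2
  rw [Matrix.det_fin_two, h1, h2, h3, mul_zero, sub_zero, ← sq, sq_eq_one_iff] at hd
  have : prj A = 1 := by
    rw [prj_eq_one_iff]
    rcases hd with hd | hd
    · left; ext i j; fin_cases i <;> fin_cases j <;> simp [h1, h2, h3, hd]
    · right; ext i j; fin_cases i <;> fin_cases j <;> simp [h1, h2, h3, hd]
  rw [this] at hA
  have := congrArg (fun t => k * t * k⁻¹) hA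
  simpa [mul_assoc] using this.symm

lemma free_of_three_le (q : ℕ) (hq : 3 ≤ q) (x : Fin q → P1) (g : PSL2C)
    (hx : Function.Injective x) (h : g • x = x) : g = 1 := by
  have hi : ∀ i j : Fin q, i.1 ≠ j.1 → x i ≠ x j := fun i j hij e => hij (congrArg _ (hx e))
  exact eq_one_of_smul_three (x := x ⟨0, by omega⟩) (y := x ⟨1, by omega⟩) (z := x ⟨2, by omega⟩)
    (hi _ _ (by simp)) (hi _ _ (by simp)) (hi _ _ (by simp))
    (congrFun h _) (congrFun h _) (congrFun h _)

end ProjectiveLine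

section Inversion

variable {H : Type*} [CommGroup H]

lemma pr_inv {n : ℕ} (r : H) {c : Ch H (n + 1)} (hc : c ∈ Closed ⊤ n) :
    pr r⁻¹ (n + 1) c + pr r (n + 1) c ∈ Bd (⊤ : Subgroup H) (n + 2) := by
  have h1 := pr_mul r⁻¹ r hc
  rw [inv_mul_cancel] at h1
  convert sub_mem (pr_one_Bd hc) h1 using 1
  abel

lemma pont₁_inv (r : H) : pont₁ r⁻¹ + pont₁ r ∈ Bd (⊤ : Subgroup H) 2 := by
  have h1 := pont₁_mul r⁻¹ r
  have h2 := pont₁_mul (1 : H) 1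
  rw [mul_one, sub_self, zero_sub, neg_mem_iff] at h2
  rw [inv_mul_cancel] at h1
  convert sub_mem h2 h1 using 1
  abel

lemma pont₂_inv (r s : H) : pont₂ r⁻¹ s⁻¹ - pont₂ r s ∈ Bd (⊤ : Subgroup H) 3 := by
  have h1 := pr_inv r (pont₁_closed (Subgroup.mem_top s⁻¹))
  have h2 := pr_Bd r (pont₁_inv s)
  rw [map_add] at h2
  simp only [pont₂]
  convert sub_mem h1 h2 using 1
  abel

lemma pont₃_inv (r s t : H) : pont₃ r⁻¹ s⁻¹ t⁻¹ + pont₃ r s t ∈ Bd (⊤ : Subgroup H) 4 := by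
  have h1 := pr_inv r (pont₂_closed s⁻¹ t⁻¹)
  have h2 := pr_Bd r (pont₂_inv s t)
  rw [map_sub] at h2
  simp only [pont₃]
  convert sub_mem h1 h2 using 1
  abel

lemma pont₃_mul (r r' s t : H) :
    pont₃ (r * r') s t - pont₃ r s t - pont₃ r' s t ∈ Bd (⊤ : Subgroup H) 4 :=
  pr_mul r r' (pont₂_closed s t)

end Inversion

section Torus

open FreeAbelianGroup

lemma exists_sq (u : ℂˣ) : ∃ v : ℂˣ, v ^ 2 = u :=
  ⟨Units.mk0 (usqrt u) (usqrt_ne_zero u), Units.ext (by simp [usqrt_sq])⟩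

lemma pontGen_units : PontGen ℂˣ := pontGen_of_isCyclic fun _ _ => inferInstance

/-- The Weyl element. -/
def weyl : PSL2C := prj (colSL ![0, -1] ![1, 0] (by simp [det2]))

lemma weyl_smul_pinf : weyl • pinf = pz 0 := by
  rw [weyl, pinf, pz, prj_smul_mk, mk_eq_mk_iff_det2, colSL_mulVec]
  simp [det2]

lemma weyl_smul_pz_zero : weyl • pz 0 = pinf := by
  rw [weyl, pinf, pz, prj_smul_mk, mk_eq_mk_iff_det2, colSL_mulVec]
  simp [det2]

lemma weyl_conj (u : ℂˣ) : weyl * tor u * weyl⁻¹ = tor u⁻¹ := by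
  have hu := usqrt_ne_zero u
  rw [mul_inv_eq_iff_eq_mul, ← prj_dg (inv_mul_cancel₀ hu) u⁻¹ (by simp [usqrt_sq])]
  change prj _ * prj _ = _ * prj _
  rw [← map_mul, ← map_mul]
  congr 1
  ext i j
  rw [Matrix.SpecialLinearGroup.coe_mul, Matrix.SpecialLinearGroup.coe_mul]
  fin_cases i <;> fin_cases j <;> simp [dg, colSL, Matrix.mul_apply, Fin.sum_univ_two]

/-- The pair of points fixed by the torus. -/
def base₂ : Fin 2 → P1 := ![pinf, pz 0]

lemma base₂_injective : Function.Injective base₂ := by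
  intro i j h
  fin_cases i <;> fin_cases j
  · rfl
  · exact absurd h (pinf_ne_pz 0)
  · exact absurd h.symm (pinf_ne_pz 0)
  · rfl

lemma mem_stab₂ {g : PSL2C} : g ∈ MulAction.stabilizer PSL2C base₂ ↔ g ∈ tor.range := by
  rw [MulAction.mem_stabilizer_iff]
  constructor
  · intro h
    have h0 : g • pinf = pinf := congrFun h 0
    have h1 : g • pz 0 = pz 0 := congrFun h 1
    obtain ⟨A, rfl⟩ := prj_surjective g
    rw [prj_smul_pinf] at h0
    rw [prj_smul_pz_zero] at h1
    have hd := A.2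
    rw [Matrix.det_fin_two, h0, mul_zero, sub_zero] at hd
    have ha : A.1 0 0 ^ 2 ≠ 0 := pow_ne_zero _ (left_ne_zero_of_mul_eq_one hd)
    refine MonoidHom.mem_range.2 ⟨Units.mk0 _ ha, ?_⟩
    rw [← prj_dg hd (Units.mk0 _ ha) rfl]
    congr 1
    ext i j
    fin_cases i <;> fin_cases j <;> simp [dg, h0, h1]
  · rintro ⟨u, rfl⟩
    funext i
    fin_cases i
    · exact tor_smul_pinf u
    · exact (tor_smul_pz u 0).trans (by rw [mul_zero]; rfl)

lemma stab₂_eq : MulAction.stabilizer PSL2C base₂ = tor.range := by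
  ext g; exact mem_stab₂

lemma base₂_transitive (x : Fin 2 → P1) (hx : Function.Injective x) : ∃ g : PSL2C, g • base₂ = x := by
  obtain ⟨g, h0, h1⟩ := exists_smul_pair (hx.ne (show (0 : Fin 2) ≠ 1 by decide))
  refine ⟨g, ?_⟩
  funext i
  fin_cases i
  · exact h0
  · exact h1

lemma weyl_smul_base₂ : weyl • base₂ = ![pz 0, pinf] := by
  funext i
  fin_cases i
  · exact weyl_smul_pinf
  · exact weyl_smul_pz_zero

lemma weyl_conj_mem : ∀ g ∈ tor.range, weyl * g * weyl⁻¹ ∈ tor.range := by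
  rintro _ ⟨u, rfl⟩
  exact MonoidHom.mem_range.2 ⟨u⁻¹, (weyl_conj u).symm⟩

lemma cmap_conj_tor {n : ℕ} (c : Ch ℂˣ n) :
    cmap (MulAut.conj weyl) (cmap tor c) = cmap tor (cmap (fun u => u⁻¹) c) := by
  rw [cmap_cmap, cmap_cmap]
  congr 2
  funext u
  exact weyl_conj u

lemma tor_Bd {n : ℕ} {c : Ch ℂˣ n} (hc : c ∈ Bd ⊤ n) : cmap tor c ∈ Bd tor.range n :=
  (equivar_hom (S' := tor.range) tor fun u _ => MonoidHom.mem_range.2 ⟨u, rfl⟩).cmap_Bd hc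

lemma tor_Closed {n : ℕ} {c : Ch ℂˣ (n + 1)} (hc : c ∈ Closed ⊤ n) :
    cmap tor c ∈ Closed tor.range n :=
  (equivar_hom (S' := tor.range) tor fun u _ => MonoidHom.mem_range.2 ⟨u, rfl⟩).cmap_Closed hc

/-- Closed chains for the torus come from closed chains on `ℂˣ`. -/
lemma exists_closed_units {n : ℕ} {c : Ch PSL2C (n + 1)} (hc : c ∈ Closed tor.range n) :
    ∃ d ∈ Closed (⊤ : Subgroup ℂˣ) n, c - cmap tor d ∈ Bd tor.range (n + 1) := by
  obtain ⟨r, hr, h⟩ := exists_hom_retraction tor_injective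
  refine ⟨cmap r c, hr.cmap_Closed hc, ?_⟩
  rw [← neg_sub]
  exact neg_mem (h n c hc)

/-- Two-dimensional torus cycles are, up to boundaries, twice a cycle fixed by inversion. -/
lemma exists_half_two {d : Ch ℂˣ 3} (hd : d ∈ Closed (⊤ : Subgroup ℂˣ) 2) :
    ∃ e ∈ Closed (⊤ : Subgroup ℂˣ) 2, d - 2 • e ∈ Bd ⊤ 3 ∧
      cmap (fun u => u⁻¹) e - e ∈ Bd (⊤ : Subgroup ℂˣ) 3 := by
  obtain ⟨y, hy, z, hz, rfl⟩ := AddSubgroup.mem_sup.1 (pontGen_units.two hd)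
  suffices ∃ e ∈ Closed (⊤ : Subgroup ℂˣ) 2, y - 2 • e ∈ Bd ⊤ 3 ∧
      cmap (fun u => u⁻¹) e - e ∈ Bd (⊤ : Subgroup ℂˣ) 3 by
    obtain ⟨e, h1, h2, h3⟩ := this
    refine ⟨e, h1, ?_, h3⟩
    convert add_mem h2 hz using 1
    abel
  clear hd
  induction hy using AddSubgroup.closure_induction with
  | mem x hx =>
    obtain ⟨⟨s, t⟩, rfl⟩ := hx
    obtain ⟨s, rfl⟩ := exists_sq s
    obtain ⟨t, rfl⟩ := exists_sq t
    refine ⟨2 • pont₂ s t, nsmul_mem (pont₂_closed s t) 2, ?_, ?_⟩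
    · rw [smul_smul]
      exact pont₂_pow s t 2
    · have h1 : cmap (fun u : ℂˣ => u⁻¹) (pont₂ s t) = pont₂ s⁻¹ t⁻¹ :=
        cmap_pont₂ (invMonoidHom (α := ℂˣ)) s t
      rw [map_nsmul, h1, ← smul_sub]
      exact nsmul_mem (pont₂_inv s t) 2
  | zero => exact ⟨0, zero_mem _, by simp, by simp⟩
  | add x y _ _ hx hy =>
    obtain ⟨e, h1, h2, h3⟩ := hx
    obtain ⟨f, k1, k2, k3⟩ := hy
    refine ⟨e + f, add_mem h1 k1, ?_, ?_⟩
    · convert add_mem h2 k2 using 1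
      rw [smul_add]; abel
    · convert add_mem h3 k3 using 1
      rw [map_add]; abel
  | neg x _ hx =>
    obtain ⟨e, h1, h2, h3⟩ := hx
    refine ⟨-e, neg_mem h1, ?_, ?_⟩
    · convert neg_mem h2 using 1
      rw [smul_neg]; abel
    · convert neg_mem h3 using 1
      rw [map_neg]; abel

lemma dM_jK_pair {p : ℕ} {x y : P1} (h : Function.Injective ![x, y])
    (h' : Function.Injective ![y, x]) (c : Ch PSL2C p) :
    dM p 1 (jK h c) + dM p 1 (jK h' c) = 0 := by
  refine (kmk_add _ _).symm.trans (kmk_eq_zero.2 ?_)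
  show dMd p 1 (box c (of ![x, y])) + dMd p 1 (box c (of ![y, x])) ∈ _
  rw [dMd_box, dMd_box, ← map_add]
  have e : bd 1 (of ![x, y]) + bd 1 (of ![y, x]) = 0 := by simp [bd_succ_of, bd_zero_of]
  rw [e, map_zero]
  exact zero_mem _

lemma jK_weyl {p : ℕ} (h' : Function.Injective ![pz 0, pinf]) (c : Ch PSL2C p) :
    jK base₂_injective (tr weyl c) = jK h' c := by
  have e : weyl • ![pz 0, pinf] = base₂ := by
    funext i
    fin_cases i
    · exact weyl_smul_pz_zero
    · exact weyl_smul_pinf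
  have h := jK_tr h' weyl c
  have key : ∀ (y : Fin 2 → P1) (hy : Function.Injective y), y = base₂ →
      jK hy (tr weyl c) = jK base₂_injective (tr weyl c) := by
    rintro y hy rfl; rfl
  rw [← h, key _ _ e]

theorem exists_dM_sub_dF_eq_zero (x : KC PSL2C P1 3 2) (hx : dF 2 2 x = 0) :
    ∃ b, dM 3 1 (x - dF 3 2 b) = 0 := by
  obtain ⟨c, rfl, hc⟩ := exists_jK_eq base₂_injective base₂_transitive x
  have hc' := hc hx
  rw [stab₂_eq] at hc'
  obtain ⟨d, hd, h1⟩ := exists_closed_units hc'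
  obtain ⟨e, he, h2, h3⟩ := exists_half_two hd
  have h4 := tor_Bd h2
  rw [map_sub, map_nsmul] at h4
  have h5 := tor_Bd h3
  rw [map_sub, ← cmap_conj_tor] at h5
  have h6 := tr_sub_conj_mem_Bd weyl_conj_mem (tor_Closed he)
  set f := cmap tor e
  have h7 : c - (f + tr weyl f) ∈ Bd (MulAction.stabilizer PSL2C base₂) 3 := by
    rw [stab₂_eq]
    convert sub_mem (sub_mem (add_mem h1 h4) h5) h6 using 1
    rw [two_nsmul]; abel
  obtain ⟨b, hb⟩ := jK_Bd base₂_injective h7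
  refine ⟨b, ?_⟩
  have hs : Function.Injective ![pz 0, pinf] := by
    have := (injective_smul_iff weyl base₂).2 base₂_injective
    rwa [weyl_smul_base₂] at this
  rw [← hb, ← map_sub, sub_sub_cancel, map_add, jK_weyl hs, map_add]
  exact dM_jK_pair base₂_injective hs f

end Torus

section Borel

open FreeAbelianGroup

/-- The point at infinity as a tuple. -/
def base₁ : Fin 1 → P1 := ![pinf]

lemma base₁_injective : Function.Injective base₁ := Function.injective_of_subsingleton _

lemma base₁_transitive (x : Fin 1 → P1) (_ : Function.Injective x) : ∃ g : PSL2C, g • base₁ = x := by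
  obtain ⟨g, h0⟩ := exists_smul_pinf (x 0)
  refine ⟨g, ?_⟩
  funext i
  fin_cases i
  exact h0

/-- The stabiliser of infinity. -/
abbrev Borel : Subgroup PSL2C := MulAction.stabilizer PSL2C base₁

lemma mem_Borel {g : PSL2C} : g ∈ Borel ↔ g • pinf = pinf := by
  rw [MulAction.mem_stabilizer_iff]
  refine ⟨fun h => congrFun h 0, fun h => ?_⟩
  funext i
  fin_cases i
  exact h

/-- Unipotent matrices. -/
def ut (x : ℂ) : SL2C := ⟨!![1, x; 0, 1], by simp [Matrix.det_fin_two_of]⟩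

/-- Translations of the projective line. -/
def trans : Multiplicative ℂ →* PSL2C where
  toFun x := prj (ut x.toAdd)
  map_one' := by
    rw [prj_eq_one_iff]
    left
    simp [ut, Matrix.one_fin_two]
  map_mul' x y := by
    rw [← map_mul]
    congr 1
    ext i j
    rw [Matrix.SpecialLinearGroup.coe_mul]
    fin_cases i <;> fin_cases j <;> simp [ut, Matrix.mul_apply, Fin.sum_univ_two, add_comm]

lemma trans_smul_pz (x : Multiplicative ℂ) (z : ℂ) : trans x • pz z = pz (z + x.toAdd) := by
  change prj _ • _ = _
  rw [pz, pz, prj_smul_mk, mk_eq_mk_iff_det2]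
  simp [det2, Matrix.mulVec, dotProduct, Fin.sum_univ_two, ut]

lemma trans_injective : Function.Injective trans := fun u v h => by
  have h1 := trans_smul_pz u 0
  rw [h, trans_smul_pz, zero_add, zero_add] at h1
  exact Multiplicative.toAdd.injective (pz_injective h1).symm

lemma trans_mem_Borel (x : Multiplicative ℂ) : trans x ∈ Borel :=
  mem_Borel.2 (prj_smul_pinf.2 (by simp [ut]))

lemma tor_mem_Borel (u : ℂˣ) : tor u ∈ Borel := mem_Borel.2 (tor_smul_pinf u)

lemma exists_borel_lift (g : Borel) : ∃ A : SL2C, prj A = g ∧ A.1 1 0 = 0 := by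
  obtain ⟨A, hA⟩ := prj_surjective g
  exact ⟨A, hA, prj_smul_pinf.1 (by rw [hA]; exact mem_Borel.1 g.2)⟩

/-- An upper triangular lift of an element of the Borel subgroup. -/
def blift (g : Borel) : SL2C := Classical.choose (exists_borel_lift g)

lemma prj_blift (g : Borel) : prj (blift g) = g := (Classical.choose_spec (exists_borel_lift g)).1

lemma blift_zero (g : Borel) : (blift g).1 1 0 = 0 :=
  (Classical.choose_spec (exists_borel_lift g)).2

lemma blift_mul (g : Borel) : (blift g).1 0 0 * (blift g).1 1 1 = 1 := by
  have := (blift g).2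
  rwa [Matrix.det_fin_two, blift_zero, mul_zero, sub_zero] at this

lemma blift_sq {g : Borel} {A : SL2C} (h : prj A = g) (i j : Fin 2) :
    (blift g).1 i j ^ 2 = A.1 i j ^ 2 := by
  rw [← prj_blift, prj_eq_iff] at h
  rcases h with h | h <;> simp [h]

/-- The character of the Borel subgroup. -/
def bchar : Borel →* ℂˣ where
  toFun g := Units.mk0 ((blift g).1 0 0 ^ 2) (pow_ne_zero _ (left_ne_zero_of_mul_eq_one (blift_mul g)))
  map_one' := Units.ext (by
    rw [Units.val_mk0, blift_sq (A := 1) (map_one _)]; simp)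
  map_mul' g h := Units.ext (by
    have e : prj (blift g * blift h) = ↑(g * h) := by
      rw [map_mul, prj_blift, prj_blift]; rfl
    rw [Units.val_mul, Units.val_mk0, Units.val_mk0, Units.val_mk0, blift_sq e]
    simp [Matrix.mul_apply, Fin.sum_univ_two, blift_zero, mul_pow])

lemma bchar_eq {g : Borel} {A : SL2C} (h : prj A = g) : (bchar g : ℂ) = A.1 0 0 ^ 2 := blift_sq h 0 0

/-- The Borel subgroup is the affine group of `ℂ`. -/
def borelData : AffineData Borel where
  ι := trans.codRestrict Borel trans_mem_Borel
  φ := bchar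
  s := tor.codRestrict Borel tor_mem_Borel
  ι_injective := fun x y h => trans_injective (congrArg Subtype.val h)
  φ_s u := Units.ext (by
    rw [bchar_eq (A := dg (usqrt u) (usqrt u)⁻¹ (mul_inv_cancel₀ (usqrt_ne_zero u))) rfl]
    simp [dg, usqrt_sq])
  φ_eq_one g := by
    constructor
    · intro h
      have h1 : (blift g).1 0 0 ^ 2 = 1 := congrArg Units.val h
      have h2 := blift_mul g
      refine MonoidHom.mem_range.2 ⟨.ofAdd ((blift g).1 0 1 * (blift g).1 0 0), Subtype.ext ?_⟩
      change prj (ut _) = _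
      rw [← prj_blift g, prj_eq_iff]
      rw [sq_eq_one_iff] at h1
      rcases h1 with h1 | h1
      · left
        rw [h1, one_mul] at h2
        ext i j
        fin_cases i <;> fin_cases j <;> simp [ut, h1, h2, blift_zero]
      · right
        rw [h1, neg_one_mul, neg_eq_iff_eq_neg] at h2
        ext i j
        fin_cases i <;> fin_cases j <;> simp [ut, h1, h2, blift_zero]
    · rintro ⟨x, rfl⟩
      refine Units.ext ((bchar_eq rfl).trans ?_)
      simp [ut]
  act u x := Subtype.ext (by
    have hu := usqrt_ne_zero u
    change prj _ * prj _ * (prj _)⁻¹ = prj _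
    rw [mul_inv_eq_iff_eq_mul, ← map_mul, ← map_mul]
    congr 1
    ext i j
    rw [Matrix.SpecialLinearGroup.coe_mul, Matrix.SpecialLinearGroup.coe_mul]
    fin_cases i <;> fin_cases j <;>
      simp [ut, dg, Matrix.mul_apply, Fin.sum_univ_two, ← usqrt_sq]
    field_simp)

/-- The span of the classes of finite cyclic subgroups of the torus. -/
def RhoSpan : AddSubgroup (Ch PSL2C 4) :=
  AddSubgroup.closure {c | ∃ (t : ℂˣ) (n : ℕ), 0 < n ∧ t ^ n = 1 ∧ c = rho (tor t) n}

lemma cmap_tor_pont₃_Bd (r s t : ℂˣ) : cmap tor (pont₃ r s t) ∈ Bd (⊤ : Subgroup PSL2C) 4 := by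
  have up : ∀ {c : Ch ℂˣ 4}, c ∈ Bd ⊤ 4 → cmap tor c ∈ Bd (⊤ : Subgroup PSL2C) 4 :=
    fun h => Bd_mono le_top (tor_Bd h)
  have two : ∀ r, 2 • cmap tor (pont₃ r s t) ∈ Bd (⊤ : Subgroup PSL2C) 4 := fun r => by
    have h1 := up (pont₃_inv r s t)
    have hc : cmap tor (pont₃ r s t) ∈ Closed (⊤ : Subgroup PSL2C) 3 :=
      Closed_mono le_top (tor_Closed (pont₃_closed r s t))
    have h2 := tr_sub_conj_mem_Bd (S := ⊤) (g := weyl) (fun _ _ => Subgroup.mem_top _) hc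
    have h3 := coinv_le_Bd (tr_sub_mem_coinv (S := ⊤) (s := weyl) (Subgroup.mem_top _)
      (cmap tor (pont₃ r s t)))
    have h4 : cmap (fun u : ℂˣ => u⁻¹) (pont₃ r s t) = pont₃ r⁻¹ s⁻¹ t⁻¹ :=
      cmap_pont₃ (invMonoidHom (α := ℂˣ)) r s t
    rw [cmap_conj_tor, h4] at h2
    rw [map_add] at h1
    convert add_mem (sub_mem h2 h3) h1 using 1
    rw [two_nsmul]; abel
  obtain ⟨r, rfl⟩ := exists_sq r
  have h1 := up (pont₃_mul r r s t)
  rw [← sq, map_sub, map_sub] at h1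
  convert add_mem h1 (two r) using 1
  rw [two_nsmul]; abel

/-- The image of the three-dimensional homology of the Borel subgroup. -/
theorem closed_Borel_le : Closed Borel 3 ≤ RhoSpan ⊔ Bd ⊤ 4 := by
  intro c hc
  obtain ⟨c', hc', h1⟩ := exists_closed_subgroup Borel hc
  have h2 := borelData.cmap_σ_sub_mem_Bd (Or.inr rfl) hc'
  have h3 : cmap Borel.subtype (cmap borelData.σ c' - c') ∈ Bd Borel 4 :=
    (equivar_hom Borel.subtype fun s _ => s.2).cmap_Bd h2
  have h4 : cmap Borel.subtype (cmap borelData.σ c') = cmap tor (cmap bchar c') := by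
    rw [cmap_cmap, cmap_cmap]; rfl
  have h5 : cmap bchar c' ∈ Closed (⊤ : Subgroup ℂˣ) 3 := (equivar_top bchar).cmap_Closed hc'
  have h6 : ∀ d ∈ Pont3 ℂˣ, cmap tor d ∈ RhoSpan ⊔ Bd ⊤ 4 := by
    intro d hd
    suffices Pont3 ℂˣ ≤ (RhoSpan ⊔ Bd ⊤ 4).comap (cmap tor) from this hd
    refine (AddSubgroup.closure_le _).2 ?_
    rintro _ (⟨p, rfl⟩ | ⟨t, n, hn, ht, rfl⟩)
    · exact AddSubgroup.mem_sup_right (cmap_tor_pont₃_Bd _ _ _)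
    · exact AddSubgroup.mem_sup_left (AddSubgroup.subset_closure ⟨t, n, hn, ht, cmap_rho tor t n⟩)
  obtain ⟨y, hy, z, hz, e⟩ := AddSubgroup.mem_sup.1 (pontGen_units.three h5)
  rw [map_sub, h4, ← e, map_add] at h3
  have h7 := AddSubgroup.mem_sup_right (S := RhoSpan) (Bd_mono (le_top (a := Borel)) (add_mem h3 h1))
  have h8 := AddSubgroup.mem_sup_right (S := RhoSpan) (Bd_mono (le_top (a := tor.range)) (tor_Bd hz))
  convert sub_mem (add_mem (h6 y hy) h8) h7 using 1
  abel

lemma rho_mem_Closed_Borel {t : ℂˣ} {n : ℕ} (h : t ^ n = 1) : rho (tor t) n ∈ Closed Borel 3 :=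
  rho_closed (by rw [← map_pow, h, map_one]) (tor_mem_Borel t)

end Borel

section Functionals

open FreeAbelianGroup

variable {G X : Type} [Group G] [MulAction G X] {p q : ℕ} {A : Type*} [AddCommGroup A]

/-- The functional on the double complex given by an invariant function. -/
def kfun (ψ : (Fin p → G) → (Fin q → X) → A) (h : ∀ (g : G) a x, ψ (g • a) (g • x) = ψ a x) :
    KC G X p q →+ A :=
  klift (lift fun w => ψ w.1 w.2) fun _ _ hc => coinv_le_ker _ (fun s _ b => by
    rw [lift_apply_of, lift_apply_of]; exact h s b.1 b.2) hc

variable (ψ : (Fin p → G) → (Fin q → X) → A) (h : ∀ (g : G) a x, ψ (g • a) (g • x) = ψ a x)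

lemma kfun_of (a : Fin p → G) {x : Fin q → X} (hx : Function.Injective x) :
    kfun ψ h (kmk (of_mem_Inj a hx)) = ψ a x := lift_apply_of _ _

lemma lift_box_left (a : Fin p → G) (c : Ch X q) :
    lift (fun w : (Fin p → G) × (Fin q → X) => ψ w.1 w.2) (box (of a) c) = lift (ψ a) c := by
  have : (lift (fun w : (Fin p → G) × (Fin q → X) => ψ w.1 w.2)).comp (box (of a)) =
      lift (ψ a) := by
    ext x; simp
  exact DFunLike.congr_fun this c

lemma lift_box_right (c : Ch G p) (x : Fin q → X) :
    lift (fun w : (Fin p → G) × (Fin q → X) => ψ w.1 w.2) (box c (of x)) =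
      lift (fun a => ψ a x) c := by
  have : (lift (fun w : (Fin p → G) × (Fin q → X) => ψ w.1 w.2)).comp (box.flip (of x)) =
      lift (fun a => ψ a x) := by
    ext a; simp
  exact DFunLike.congr_fun this c

lemma kfun_dM (a : Fin p → G) {x : Fin (q + 1) → X} (hx : Function.Injective x) :
    kfun ψ h (dM p q (kmk (of_mem_Inj a hx))) = lift (ψ a) (bd q (of x)) := by
  refine Eq.trans ?_ (lift_box_left ψ a _)
  rw [← dMd_of]
  rfl

lemma kfun_dF (a : Fin (p + 1) → G) {x : Fin q → X} (hx : Function.Injective x) :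
    kfun ψ h (dF p q (kmk (of_mem_Inj a hx))) = lift (fun a => ψ a x) (bd p (of a)) := by
  refine Eq.trans ?_ (lift_box_right ψ _ x)
  rw [← dFd_of]
  rfl

lemma kfun_jK {y : Fin q → X} (hy : Function.Injective y) (c : Ch G p) :
    kfun ψ h (jK hy c) = lift (fun a => ψ a y) c := lift_box_right ψ c y

end Functionals

section Scaling

lemma exists_scale (h : PSL2C) (y : P1) : ∃ a : ℂˣ,
    (a : ℂ) • (Function.surjInv prj_surjective h).1.mulVec y.rep = (h • y).rep := by
  set A := Function.surjInv prj_surjective h with hA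
  have e : prj A = h := Function.surjInv_eq _ h
  have h1 : h • y = Projectivization.mk ℂ (A.1.mulVec y.rep) (mulVec_ne_zero A y.rep_nonzero) := by
    rw [← prj_smul_mk A y.rep_nonzero, y.mk_rep, e]
  have h2 := (h • y).mk_rep.trans h1
  rw [Projectivization.mk_eq_mk_iff] at h2
  obtain ⟨a, ha⟩ := h2
  exact ⟨a, ha⟩

/-- The factor by which a lift of `h` distorts the chosen representatives. -/
def scale (h : PSL2C) (y : P1) : ℂˣ := Classical.choose (exists_scale h y)

lemma scale_spec (h : PSL2C) (y : P1) :
    (scale h y : ℂ) • (Function.surjInv prj_surjective h).1.mulVec y.rep = (h • y).rep :=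
  Classical.choose_spec (exists_scale h y)

lemma scale_eq {h : PSL2C} {A : SL2C} (hA : prj A = h) : ∃ e : ℂˣ, (e = 1 ∨ e = -1) ∧
    ∀ (y : P1) (a : ℂ), a • A.1.mulVec y.rep = (h • y).rep → a = e * scale h y := by
  have key : ∀ (e : ℂˣ) (_ : A.1 = ((e⁻¹ : ℂˣ) : ℂ) • (Function.surjInv prj_surjective h).1) (y : P1)
      (a : ℂ), a • A.1.mulVec y.rep = (h • y).rep → a = e * scale h y := by
    intro e he y a ha
    rw [he, Matrix.smul_mulVec, smul_smul, ← scale_spec] at ha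
    have := smul_left_injective ℂ (mulVec_ne_zero _ y.rep_nonzero) ha
    rw [← this, mul_comm a, ← mul_assoc, Units.mul_inv, one_mul]
  have h1 := Function.surjInv_eq prj_surjective h
  rw [← hA, eq_comm, prj_eq_iff, hA] at h1
  rcases h1 with h1 | h1
  · exact ⟨1, Or.inl rfl, key 1 (by simp [h1])⟩
  · exact ⟨-1, Or.inr rfl, key (-1) (by simp [h1])⟩

lemma scale_mul (h' h : PSL2C) : ∃ e : ℂˣ, (e = 1 ∨ e = -1) ∧
    ∀ y : P1, scale h' (h • y) * scale h y = e * scale (h' * h) y := by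
  have h1 : prj (Function.surjInv prj_surjective h' * Function.surjInv prj_surjective h) = h' * h := by
    rw [map_mul, Function.surjInv_eq prj_surjective, Function.surjInv_eq prj_surjective]
  obtain ⟨e, he, hs⟩ := scale_eq h1
  refine ⟨e, he, fun y => Units.ext ?_⟩
  rw [Units.val_mul, Units.val_mul]
  apply hs
  rw [mul_smul h' h y, ← scale_spec h', ← scale_spec h, Matrix.mulVec_smul, smul_smul,
    Matrix.SpecialLinearGroup.coe_mul, Matrix.mulVec_mulVec]

lemma det2_scale (h : PSL2C) (x y : P1) :
    det2 (h • x).rep (h • y).rep = scale h x * scale h y * det2 x.rep y.rep := by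
  rw [← scale_spec, ← scale_spec, det2_smul_left, det2_smul_right, det2_mulVec]
  ring

lemma scale_tor (u : ℂˣ) : ∃ e : ℂˣ, (e = 1 ∨ e = -1) ∧
    (e * scale (tor u) pinf : ℂ) = (usqrt u)⁻¹ ∧ (e * scale (tor u) (pz 0) : ℂ) = usqrt u := by
  have hu := usqrt_ne_zero u
  obtain ⟨e, he, hs⟩ := scale_eq (prj_dg (mul_inv_cancel₀ hu) u (usqrt_sq u))
  have e1 : pinf.rep 1 = 0 := by
    have := (mk_eq_mk_iff_det2 (pinf.rep_nonzero) (w := ![1, 0])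
      (fun h => one_ne_zero (congrFun h 0))).1 pinf.mk_rep
    simpa [det2] using this
  have e2 : (pz 0).rep 0 = 0 := by
    have := (mk_eq_mk_iff_det2 ((pz 0).rep_nonzero) (w := ![0, 1])
      (fun h => one_ne_zero (congrFun h 1))).1 (pz 0).mk_rep
    simpa [det2] using this
  refine ⟨e, he, (hs _ _ ?_).symm, (hs _ _ ?_).symm⟩
  · rw [tor_smul_pinf]
    ext i
    fin_cases i <;> simp [dg, dotProduct, Fin.sum_univ_two, e1, hu]
  · rw [tor_smul_pz, mul_zero]
    ext i
    fin_cases i <;> simp [dg, dotProduct, Fin.sum_univ_two, e2, hu]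

end Scaling

section Wedge

/-- Logarithms modulo `πi`. -/
abbrev LogMod : Type := ℂ ⧸ AddSubgroup.zmultiples (Cpi * I)

/-- The logarithm modulo `πi`. -/
def logm (z : ℂ) : LogMod := QuotientAddGroup.mk' _ (Complex.log z)

lemma logm_eq {z w : ℂ} (hz : z ≠ 0) (h : exp w = z ∨ exp w = -z) :
    logm z = QuotientAddGroup.mk' (AddSubgroup.zmultiples (Cpi * I)) w := by
  rw [logm, QuotientAddGroup.mk'_eq_mk']
  have key : ∃ n : ℤ, w = Complex.log z + n * (Cpi * I) := by
    rcases h with h | h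
    · rw [← exp_log hz, exp_eq_exp_iff_exists_int] at h
      obtain ⟨n, hn⟩ := h
      exact ⟨2 * n, by rw [hn, Cpi]; push_cast; ring⟩
    · rw [← neg_one_mul, ← exp_pi_mul_I, ← exp_log hz, ← exp_add, exp_eq_exp_iff_exists_int] at h
      obtain ⟨n, hn⟩ := h
      exact ⟨2 * n + 1, by rw [hn, Cpi]; push_cast; ring⟩
  obtain ⟨n, rfl⟩ := key
  exact ⟨n * (Cpi * I), AddSubgroup.mem_zmultiples_iff.2 ⟨n, by simp⟩, rfl⟩

lemma logm_mul {z w : ℂ} (hz : z ≠ 0) (hw : w ≠ 0) : logm (z * w) = logm z + logm w := by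
  rw [logm_eq (mul_ne_zero hz hw) (w := Complex.log z + Complex.log w)
    (Or.inl (by rw [exp_add, exp_log hz, exp_log hw])), map_add]
  rfl

lemma logm_neg (z : ℂ) : logm (-z) = logm z := by
  by_cases hz : z = 0
  · rw [hz, neg_zero]
  · exact logm_eq (neg_ne_zero.2 hz) (Or.inr (by rw [exp_log hz, neg_neg]))

lemma logm_one : logm 1 = 0 := by rw [logm, log_one, map_zero]

lemma logm_sign {e : ℂˣ} (he : e = 1 ∨ e = -1) : logm e = 0 := by
  rcases he with rfl | rfl
  · exact logm_one
  · rw [Units.val_neg, logm_neg]; exact logm_one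

lemma logm_inv {z : ℂ} (hz : z ≠ 0) : logm z⁻¹ = -logm z := by
  rw [eq_neg_iff_add_eq_zero, ← logm_mul (inv_ne_zero hz) hz, inv_mul_cancel₀ hz, logm_one]

lemma logm_div {z w : ℂ} (hz : z ≠ 0) (hw : w ≠ 0) : logm (z / w) = logm z - logm w := by
  rw [div_eq_mul_inv, logm_mul hz (inv_ne_zero hw), logm_inv hw, sub_eq_add_neg]

/-- The wedge product as a biadditive map. -/
def wedgeHom : ℂ →+ ℂ →+ L2C :=
  AddMonoidHom.mk' (fun a => AddMonoidHom.mk' (wedge a) fun b c => by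
    have h := (exteriorPower.ιMulti ℤ 2 (M := ℂ)).map_update_add ![a, 0] 1 b c
    have e : ∀ x, Function.update ![a, (0 : ℂ)] 1 x = ![a, x] := fun x => by
      ext i; fin_cases i <;> simp
    rw [e, e, e] at h
    exact h) fun a b => by
    ext c : 1
    have h := (exteriorPower.ιMulti ℤ 2 (M := ℂ)).map_update_add ![0, c] 0 a b
    have e : ∀ x, Function.update ![(0 : ℂ), c] 0 x = ![x, c] := fun x => by
      ext i; fin_cases i <;> simp
    rw [e, e, e] at h
    exact h

lemma wedgeHom_apply (a b : ℂ) : wedgeHom a b = wedge a b := rfl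

lemma wedge_self (a : ℂ) : wedge a a = 0 :=
  (exteriorPower.ιMulti ℤ 2 (M := ℂ)).map_eq_zero_of_eq ![a, a] (i := 0) (j := 1) rfl (by decide)

lemma wedge_swap (a b : ℂ) : wedge b a = -wedge a b := by
  have h := wedge_self (a + b)
  simp only [← wedgeHom_apply, map_add, AddMonoidHom.add_apply] at h ⊢
  simp only [wedgeHom_apply, wedge_self, zero_add, add_zero] at h ⊢
  rwa [← eq_neg_iff_add_eq_zero] at h

/-- The second exterior power of `ℂ` modulo `ℂ ∧ πi`. -/
abbrev LogWedge : Type := L2C ⧸ (wedgeHom (Cpi * I)).range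

/-- The wedge product of logarithms modulo `πi`. -/
def lw : LogMod →+ LogMod →+ LogWedge :=
  QuotientAddGroup.lift _ (AddMonoidHom.mk' (fun a => QuotientAddGroup.lift _
    ((QuotientAddGroup.mk' (wedgeHom (Cpi * I)).range).comp (wedgeHom a)) fun b hb => by
      obtain ⟨n, rfl⟩ := AddSubgroup.mem_zmultiples_iff.1 hb
      refine (QuotientAddGroup.eq_zero_iff _).2 (AddMonoidHom.mem_range.2 ⟨-(n • a), ?_⟩)
      rw [map_neg, map_zsmul, map_zsmul, wedgeHom_apply, wedgeHom_apply, wedge_swap, smul_neg,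
        neg_neg]) fun a b => by
      ext c
      exact congrArg (QuotientAddGroup.mk' _) (DFunLike.congr_fun (map_add wedgeHom a b) c)) fun b hb => by
      obtain ⟨n, rfl⟩ := AddSubgroup.mem_zmultiples_iff.1 hb
      ext c
      refine (QuotientAddGroup.eq_zero_iff _).2 (AddMonoidHom.mem_range.2 ⟨n • c, ?_⟩)
      rw [map_zsmul, map_zsmul]
      rfl

lemma lw_mk (a b : ℂ) : lw (QuotientAddGroup.mk' _ a) (QuotientAddGroup.mk' _ b) =
    QuotientAddGroup.mk' (wedgeHom (Cpi * I)).range (wedge a b) := rfl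

lemma lw_self (a : LogMod) : lw a a = 0 := by
  obtain ⟨a, rfl⟩ := QuotientAddGroup.mk'_surjective _ a
  rw [lw_mk, wedge_self, map_zero]

lemma lw_swap (a b : LogMod) : lw b a = -lw a b := by
  obtain ⟨a, rfl⟩ := QuotientAddGroup.mk'_surjective _ a
  obtain ⟨b, rfl⟩ := QuotientAddGroup.mk'_surjective _ b
  rw [lw_mk, lw_mk, wedge_swap, map_neg]

end Wedge

section Functionals

open FreeAbelianGroup

/-- The distance function of two points. -/
def dl (x y : P1) : LogMod := logm (det2 x.rep y.rep)

/-- The logarithm of the scaling factor. -/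
def sl (h : PSL2C) (y : P1) : LogMod := logm (scale h y)

lemma sl_mul (h' h : PSL2C) (y : P1) : sl (h' * h) y = sl h' (h • y) + sl h y := by
  obtain ⟨e, he, hs⟩ := scale_mul h' h
  rw [sl, sl, sl, ← logm_mul (Units.ne_zero _) (Units.ne_zero _), ← Units.val_mul, hs, Units.val_mul,
    logm_mul (Units.ne_zero _) (Units.ne_zero _), logm_sign he, zero_add]

lemma dl_smul (h : PSL2C) {x y : P1} (hxy : x ≠ y) :
    dl (h • x) (h • y) = dl x y + sl h x + sl h y := by
  have h0 : det2 x.rep y.rep ≠ 0 := fun h => hxy (det2_rep_eq_zero.1 h)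
  rw [dl, det2_scale, logm_mul (mul_ne_zero (Units.ne_zero _) (Units.ne_zero _)) h0,
    logm_mul (Units.ne_zero _) (Units.ne_zero _), dl, sl, sl]
  abel

lemma sl_tor (u : ℂˣ) : sl (tor u) pinf = -logm (usqrt u) := by
  obtain ⟨e, he, h1, -⟩ := scale_tor u
  rw [← logm_inv (usqrt_ne_zero u), ← h1, logm_mul (Units.ne_zero _) (Units.ne_zero _),
    logm_sign he, zero_add, sl]

/-- The distance seen from `g`. -/
def dg' (g : PSL2C) (x y : P1) : LogMod := dl (g⁻¹ • x) (g⁻¹ • y)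

/-- The change of scale between two frames. -/
def sg (g g' : PSL2C) (x : P1) : LogMod := sl (g'⁻¹ * g) (g⁻¹ • x)

lemma dg'_smul (s g : PSL2C) (x y : P1) : dg' (s * g) (s • x) (s • y) = dg' g x y := by
  simp only [dg', mul_inv_rev, smul_smul, inv_mul_cancel_right]

lemma sg_smul (s g g' : PSL2C) (x : P1) : sg (s * g) (s * g') (s • x) = sg g g' x := by
  simp only [sg, mul_inv_rev, smul_smul, inv_mul_cancel_right, ← mul_assoc]

lemma sg_trans (g g' g'' : PSL2C) (x : P1) : sg g g'' x = sg g g' x + sg g' g'' x := by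
  rw [sg, sg, sg, add_comm, show g''⁻¹ * g = (g''⁻¹ * g') * (g'⁻¹ * g) by group, sl_mul, smul_smul]
  congr 3
  group

lemma dg'_eq (g g' : PSL2C) {x y : P1} (hxy : x ≠ y) :
    dg' g' x y = dg' g x y + sg g g' x + sg g g' y := by
  rw [sg, sg, dg', dg']
  have h := dl_smul (g'⁻¹ * g) (x := g⁻¹ • x) (y := g⁻¹ • y)
    (fun h => hxy (MulAction.injective _ h))
  rwa [smul_smul, smul_smul, mul_inv_cancel_right] at h

/-- The logarithm of the cross ratio. -/
def crl (x : Fin 4 → P1) : LogMod :=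
  dl (x 0) (x 3) + dl (x 1) (x 2) - dl (x 0) (x 2) - dl (x 1) (x 3)

/-- The logarithm of the complementary cross ratio. -/
def crl' (x : Fin 4 → P1) : LogMod :=
  dl (x 0) (x 1) + dl (x 2) (x 3) - dl (x 0) (x 2) - dl (x 1) (x 3)

lemma crl_smul (g : PSL2C) {x : Fin 4 → P1} (hx : Function.Injective x) :
    crl (g • x) = crl x := by
  simp only [crl, Pi.smul_apply]
  rw [dl_smul, dl_smul, dl_smul, dl_smul]
  · abel
  all_goals exact hx.ne (by decide)

lemma crl'_smul (g : PSL2C) {x : Fin 4 → P1} (hx : Function.Injective x) :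
    crl' (g • x) = crl' x := by
  simp only [crl', Pi.smul_apply]
  rw [dl_smul, dl_smul, dl_smul, dl_smul]
  · abel
  all_goals exact hx.ne (by decide)

/-- The Dehn invariant of an ideal tetrahedron. -/
def dehn₀ : KC PSL2C P1 0 4 →+ LogWedge :=
  kfun (fun _ x => if Function.Injective x then lw (crl x) (crl' x) else 0) fun g _ x => by
    by_cases h : Function.Injective x
    · rw [if_pos h, if_pos ((injective_smul_iff g x).2 h), crl_smul g h, crl'_smul g h]
    · rw [if_neg h, if_neg (fun h' => h ((injective_smul_iff g x).1 h'))]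

/-- The first lift of the Dehn invariant. -/
def dehn₁ : KC PSL2C P1 1 3 →+ LogWedge :=
  kfun (fun a x => lw (dg' (a 0) (x 0) (x 1)) (dg' (a 0) (x 1) (x 2)) +
    lw (dg' (a 0) (x 1) (x 2)) (dg' (a 0) (x 0) (x 2)) +
    lw (dg' (a 0) (x 0) (x 2)) (dg' (a 0) (x 0) (x 1))) fun g a x => by
      simp only [Pi.smul_apply, smul_eq_mul, dg'_smul]

/-- The second lift of the Dehn invariant. -/
def dehn₂ : KC PSL2C P1 2 2 →+ LogWedge :=
  kfun (fun a x => lw (dg' (a 0) (x 0) (x 1)) (sg (a 0) (a 1) (x 1) - sg (a 0) (a 1) (x 0)) +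
    lw (sg (a 0) (a 1) (x 0)) (sg (a 0) (a 1) (x 1))) fun g a x => by
      simp only [Pi.smul_apply, smul_eq_mul, dg'_smul, sg_smul]

/-- The third lift of the Dehn invariant. -/
def dehn₃ : KC PSL2C P1 3 1 →+ LogWedge :=
  kfun (fun a x => lw (sg (a 0) (a 1) (x 0)) (sg (a 1) (a 2) (x 0))) fun g a x => by
      simp only [Pi.smul_apply, smul_eq_mul, sg_smul]

lemma exists_eq_cons₄ {α : Type*} (x : Fin 4 → α) : ∃ a b c d, x = ![a, b, c, d] :=
  ⟨x 0, x 1, x 2, x 3, by ext i; fin_cases i <;> rfl⟩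

lemma exists_eq_cons₃ {α : Type*} (x : Fin 3 → α) : ∃ a b c, x = ![a, b, c] :=
  ⟨x 0, x 1, x 2, by ext i; fin_cases i <;> rfl⟩

lemma exists_eq_cons₂ {α : Type*} (x : Fin 2 → α) : ∃ a b, x = ![a, b] :=
  ⟨x 0, x 1, by ext i; fin_cases i <;> rfl⟩

lemma exists_eq_cons₁ {α : Type*} (x : Fin 1 → α) : ∃ a, x = ![a] :=
  ⟨x 0, by ext i; fin_cases i; rfl⟩

lemma dehn₀_dF (x : KC PSL2C P1 1 4) : dehn₀ (dF 0 4 x) = dehn₁ (dM 1 3 x) := by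
  suffices dehn₀.comp (dF 0 4) = dehn₁.comp (dM 1 3) from DFunLike.congr_fun this x
  refine kc_hom_ext fun a x hx => ?_
  rw [AddMonoidHom.comp_apply, AddMonoidHom.comp_apply, dehn₀, dehn₁, kfun_dF _ _ _ hx,
    kfun_dM _ _ _ hx]
  obtain ⟨g, rfl⟩ := exists_eq_cons₁ a
  have e1 : crl x = crl (g⁻¹ • x) := (crl_smul _ hx).symm
  have e2 : crl' x = crl' (g⁻¹ • x) := (crl'_smul _ hx).symm
  simp only [bd_zero_of, lift_apply_of, if_pos hx, e1, e2]
  obtain ⟨x₀, x₁, x₂, x₃, rfl⟩ := exists_eq_cons₄ x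
  simp only [bd_succ_of, bd_zero_of, map_sub, cone_of, lift_apply_of, crl, crl', Pi.smul_apply,
    Matrix.cons_val, dg']
  generalize dl (g⁻¹ • x₀) (g⁻¹ • x₁) = d01
  generalize dl (g⁻¹ • x₀) (g⁻¹ • x₂) = d02
  generalize dl (g⁻¹ • x₀) (g⁻¹ • x₃) = d03
  generalize dl (g⁻¹ • x₁) (g⁻¹ • x₂) = d12
  generalize dl (g⁻¹ • x₁) (g⁻¹ • x₃) = d13
  generalize dl (g⁻¹ • x₂) (g⁻¹ • x₃) = d23
  simp only [map_add, AddMonoidHom.add_apply, AddMonoidHom.sub_apply, lw_self]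
  simp only [lw_swap d01 d02, lw_swap d01 d03, lw_swap d01 d12, lw_swap d01 d13, lw_swap d02 d03,
    lw_swap d02 d12, lw_swap d02 d23, lw_swap d02 d13, lw_swap d03 d13, lw_swap d03 d23,
    lw_swap d12 d13, lw_swap d12 d23, lw_swap d13 d23]
  abel

lemma dehn₁_dF (x : KC PSL2C P1 2 3) : dehn₁ (dF 1 3 x) = dehn₂ (dM 2 2 x) := by
  suffices dehn₁.comp (dF 1 3) = dehn₂.comp (dM 2 2) from DFunLike.congr_fun this x
  refine kc_hom_ext fun a x hx => ?_
  rw [AddMonoidHom.comp_apply, AddMonoidHom.comp_apply, dehn₁, dehn₂, kfun_dF _ _ _ hx,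
    kfun_dM _ _ _ hx]
  obtain ⟨g, g', rfl⟩ := exists_eq_cons₂ a
  have h01 := dg'_eq g g' (hx.ne (show (0 : Fin 3) ≠ 1 by decide))
  have h02 := dg'_eq g g' (hx.ne (show (0 : Fin 3) ≠ 2 by decide))
  have h12 := dg'_eq g g' (hx.ne (show (1 : Fin 3) ≠ 2 by decide))
  obtain ⟨x₀, x₁, x₂, rfl⟩ := exists_eq_cons₃ x
  simp only [Matrix.cons_val] at h01 h02 h12
  simp only [bd_succ_of, bd_zero_of, map_sub, cone_of, lift_apply_of, 
    Matrix.cons_val, h01, h02, h12]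
  generalize dg' g x₀ x₁ = d01
  generalize dg' g x₀ x₂ = d02
  generalize dg' g x₁ x₂ = d12
  generalize sg g g' x₀ = a0
  generalize sg g g' x₁ = a1
  generalize sg g g' x₂ = a2
  simp only [map_add, AddMonoidHom.add_apply, AddMonoidHom.sub_apply, lw_self]
  simp only [lw_swap d01 d02, lw_swap d01 d12, lw_swap d02 d12, lw_swap a0 a1, lw_swap a0 a2, lw_swap a1 a2,
    lw_swap d01 a0, lw_swap d01 a1, lw_swap d01 a2,
    lw_swap d02 a0, lw_swap d02 a1, lw_swap d02 a2, lw_swap d12 a0, lw_swap d12 a1, lw_swap d12 a2]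
  abel

lemma dehn₂_dF (x : KC PSL2C P1 3 2) : dehn₂ (dF 2 2 x) = dehn₃ (dM 3 1 x) := by
  suffices dehn₂.comp (dF 2 2) = dehn₃.comp (dM 3 1) from DFunLike.congr_fun this x
  refine kc_hom_ext fun a x hx => ?_
  rw [AddMonoidHom.comp_apply, AddMonoidHom.comp_apply, dehn₂, dehn₃, kfun_dF _ _ _ hx,
    kfun_dM _ _ _ hx]
  obtain ⟨g, g', g'', rfl⟩ := exists_eq_cons₃ a
  have h01 := dg'_eq g g' (hx.ne (show (0 : Fin 2) ≠ 1 by decide))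
  obtain ⟨x₀, x₁, rfl⟩ := exists_eq_cons₂ x
  simp only [Matrix.cons_val] at h01
  simp only [bd_succ_of, bd_zero_of, map_sub, cone_of, lift_apply_of,
    Matrix.cons_val, h01, sg_trans g g' g'']
  generalize dg' g x₀ x₁ = d01
  generalize sg g g' x₀ = a0
  generalize sg g g' x₁ = a1
  generalize sg g' g'' x₀ = b0
  generalize sg g' g'' x₁ = b1
  simp only [map_add, AddMonoidHom.add_apply, AddMonoidHom.sub_apply, lw_self]
  simp only [lw_swap a0 a1, lw_swap a0 b0, lw_swap a0 b1, lw_swap a1 b0, lw_swap a1 b1, lw_swap b0 b1,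
    lw_swap d01 a0, lw_swap d01 a1, lw_swap d01 b0, lw_swap d01 b1]
  abel

lemma dehn₃_dF (x : KC PSL2C P1 4 1) : dehn₃ (dF 3 1 x) = 0 := by
  suffices dehn₃.comp (dF 3 1) = 0 from DFunLike.congr_fun this x
  refine kc_hom_ext fun a x hx => ?_
  rw [AddMonoidHom.comp_apply, dehn₃, kfun_dF _ _ _ hx]
  obtain ⟨g, g', g'', g₃, rfl⟩ := exists_eq_cons₄ a
  simp only [bd_succ_of, bd_zero_of, map_sub, cone_of, lift_apply_of,
    Matrix.cons_val, sg_trans g g' g'', sg_trans g' g'' g₃, map_add, AddMonoidHom.add_apply,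
    AddMonoidHom.zero_apply]
  abel

end Functionals

section Columns

open FreeAbelianGroup

lemma triple_sub_mem (a : Fin 0 → PSL2C) {x y : Fin 3 → P1} (hx : Function.Injective x)
    (hy : Function.Injective y) : of (a, x) - of (a, y) ∈ dco PSL2C P1 0 3 := by
  have key : ∀ x : Fin 3 → P1, Function.Injective x →
      of (a, x) - of (a, ![pinf, pz 0, pz 1]) ∈ dco PSL2C P1 0 3 := fun x hx => by
    obtain ⟨g, h0, h1, h2⟩ := exists_smul_triple (hx.ne (show (0 : Fin 3) ≠ 1 by decide))
      (hx.ne (show (0 : Fin 3) ≠ 2 by decide)) (hx.ne (show (1 : Fin 3) ≠ 2 by decide))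
    have e : g • (a, ![pinf, pz 0, pz 1]) = (a, x) := by
      refine Prod.ext (Subsingleton.elim _ _) ?_
      funext i
      fin_cases i
      exacts [h0, h1, h2]
    rw [← e]
    exact of_smul_sub_mem_coinv (Subgroup.mem_top _) _
  simpa using sub_mem (key x hx) (key y hy)

lemma dM_zero_three (p : KC PSL2C P1 0 4) : dM 0 3 p = 0 := by
  suffices dM 0 3 = (0 : KC PSL2C P1 0 4 →+ _) from DFunLike.congr_fun this p
  refine kc_hom_ext fun a x hx => kmk_eq_zero.2 ?_
  change dMd 0 3 (of (a, x)) ∈ dco PSL2C P1 0 3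
  rw [dMd_of]
  obtain ⟨x₀, x₁, x₂, x₃, rfl⟩ := exists_eq_cons₄ x
  have inj : ∀ (f : Fin 3 → Fin 4), Function.Injective f → Function.Injective (![x₀, x₁, x₂, x₃] ∘ f) :=
    fun f hf => hx.comp hf
  have i0 := inj ![1, 2, 3] (by decide)
  have i1 := inj ![0, 2, 3] (by decide)
  have i2 := inj ![0, 1, 3] (by decide)
  have i3 := inj ![0, 1, 2] (by decide)
  convert add_mem (triple_sub_mem a i0 i1) (triple_sub_mem a i2 i3) using 1
  simp only [bd_succ_of, bd_zero_of, map_sub, cone_of, box_of, comp_cons]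
  have e : ![x₀, x₁, x₂, x₃] ∘ (![] : Fin 0 → Fin 4) = ![] := Subsingleton.elim _ _
  simp [e]
  abel

/-- The torus component of a chain over pairs of points. -/
def torPart : KC PSL2C P1 2 2 →+ Additive ℂˣ :=
  kfun (fun a x => .ofMul (scale ((a 1)⁻¹ * a 0) ((a 0)⁻¹ • x 0) /
    scale ((a 1)⁻¹ * a 0) ((a 0)⁻¹ • x 1))) fun g a x => by
      simp only [Pi.smul_apply, smul_eq_mul, mul_inv_rev, smul_smul, mul_assoc, inv_mul_cancel_left,
        inv_mul_cancel, mul_one]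

lemma torPart_dM (x : KC PSL2C P1 2 3) : torPart (dM 2 2 x) = 0 := by
  suffices torPart.comp (dM 2 2) = 0 from DFunLike.congr_fun this x
  refine kc_hom_ext fun a x hx => ?_
  rw [AddMonoidHom.comp_apply, torPart, kfun_dM _ _ _ hx]
  obtain ⟨x₀, x₁, x₂, rfl⟩ := exists_eq_cons₃ x
  simp only [bd_succ_of, bd_zero_of, map_sub, cone_of, lift_apply_of, Matrix.cons_val, ofMul_div,
    AddMonoidHom.zero_apply]
  abel

lemma torPart_dF (x : KC PSL2C P1 3 2) : torPart (dF 2 2 x) = 0 := by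
  suffices torPart.comp (dF 2 2) = 0 from DFunLike.congr_fun this x
  refine kc_hom_ext fun a x hx => ?_
  rw [AddMonoidHom.comp_apply, torPart, kfun_dF _ _ _ hx]
  obtain ⟨g, g', g'', rfl⟩ := exists_eq_cons₃ a
  have e : ∀ y, (g'⁻¹ * g) • g⁻¹ • y = g'⁻¹ • (y : P1) := fun y => by
    rw [smul_smul, mul_inv_cancel_right]
  obtain ⟨ε, -, h⟩ := scale_mul (g''⁻¹ * g') (g'⁻¹ * g)
  have h0 := h (g⁻¹ • x 0)
  have h1 := h (g⁻¹ • x 1)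
  rw [e, show g''⁻¹ * g' * (g'⁻¹ * g) = g''⁻¹ * g by group] at h0 h1
  simp only [bd_succ_of, bd_zero_of, map_sub, cone_of, lift_apply_of, Matrix.cons_val,
    AddMonoidHom.zero_apply]
  rw [← ofMul_div, ← ofMul_div, ofMul_eq_zero]
  have h2 : scale (g''⁻¹ * g) (g⁻¹ • x 0) = ε⁻¹ * (scale (g''⁻¹ * g') (g'⁻¹ • x 0) *
    scale (g'⁻¹ * g) (g⁻¹ • x 0)) := by rw [h0, inv_mul_cancel_left]
  have h3 : scale (g''⁻¹ * g) (g⁻¹ • x 1) = ε⁻¹ * (scale (g''⁻¹ * g') (g'⁻¹ • x 1) *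
    scale (g'⁻¹ * g) (g⁻¹ • x 1)) := by rw [h1, inv_mul_cancel_left]
  rw [h2, h3]
  generalize scale (g'⁻¹ * g) (g⁻¹ • x 0) = a
  generalize scale (g'⁻¹ * g) (g⁻¹ • x 1) = b
  generalize scale (g''⁻¹ * g') (g'⁻¹ • x 0) = c
  generalize scale (g''⁻¹ * g') (g'⁻¹ • x 1) = d
  apply Units.ext
  push_cast
  field_simp

lemma torPart_pont₁ (t : ℂˣ) : torPart (jK base₂_injective (cmap tor (pont₁ t))) = .ofMul t := by
  rw [torPart, kfun_jK]
  obtain ⟨e, -, h0, h1⟩ := scale_tor t⁻¹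
  have hu := usqrt_ne_zero t⁻¹
  simp only [pont₁, cmap_of, lift_apply_of]
  simp [base₂]
  rw [← map_inv, ← ofMul_div]
  refine congrArg Additive.ofMul (Units.ext ?_)
  rw [Units.val_div_eq_div_val, ← mul_div_mul_left _ _ e.ne_zero, h0, h1]
  rw [div_eq_mul_inv, ← mul_inv, ← sq, usqrt_sq]
  simp

lemma exists_dF_of_torPart {x : KC PSL2C P1 2 2} (hx : dF 1 2 x = 0) (h : torPart x = 0) :
    ∃ y, dF 2 2 y = x := by
  obtain ⟨c, rfl, hc⟩ := exists_jK_eq base₂_injective base₂_transitive x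
  have hc' := hc hx
  rw [stab₂_eq] at hc'
  obtain ⟨d, hd, h1⟩ := exists_closed_units hc'
  obtain ⟨t, ht⟩ := exists_pont₁ d
  have h2 := tor_Bd ht
  have h3 : c - cmap tor (pont₁ t) ∈ Bd (MulAction.stabilizer PSL2C base₂) 2 := by
    rw [stab₂_eq]
    convert add_mem h1 h2 using 1
    rw [map_sub]; abel
  obtain ⟨y, hy⟩ := jK_Bd base₂_injective h3
  have h4 := congrArg torPart hy
  rw [torPart_dF, map_sub, map_sub, h, torPart_pont₁, zero_sub, neg_eq_zero] at h4
  obtain rfl : t = 1 := h4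
  have h5 : pont₁ (1 : ℂˣ) ∈ Bd (⊤ : Subgroup ℂˣ) 2 := by
    have := pont₁_mul (1 : ℂˣ) 1
    rwa [mul_one, sub_self, zero_sub, neg_mem_iff] at this
  have h6 := tor_Bd h5
  rw [← stab₂_eq] at h6
  obtain ⟨z, hz⟩ := jK_Bd base₂_injective h6
  exact ⟨y + z, by rw [map_add, ← hy, ← hz, ← map_add, sub_add_cancel]⟩

/-- A bilinear alternating map induces a map on the exterior square. -/
def wedgeLift {A : Type*} [AddCommGroup A] (β : ℂ →+ ℂ →+ A) (h : ∀ a, β a a = 0) : L2C →+ A :=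
  (exteriorPower.alternatingMapLinearEquiv (R := ℤ) (M := ℂ) (n := 2) (N := A)
    { toFun := fun v => β (v 0) (v 1)
      map_update_add' := fun {inst} v i a b => by
        obtain rfl : inst = _ := Subsingleton.elim inst (instDecidableEqFin 2)
        fin_cases i <;> simp
      map_update_smul' := fun {inst} v i a b => by
        obtain rfl : inst = _ := Subsingleton.elim inst (instDecidableEqFin 2)
        fin_cases i
        · simp [-zsmul_eq_mul]
        · simp [-zsmul_eq_mul]
      map_eq_zero_of_eq' := fun v i j hv hij => by
        have e : v 0 = v 1 := by
          fin_cases i <;> fin_cases j <;> simp_all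
        simp [e, h] }).toAddMonoidHom

lemma wedgeLift_wedge {A : Type*} [AddCommGroup A] (β : ℂ →+ ℂ →+ A) (h : ∀ a, β a a = 0)
    (a b : ℂ) : wedgeLift β h (wedge a b) = β a b :=
  (exteriorPower.alternatingMapLinearEquiv_apply_ιMulti _ _)

/-- The exponential as a unit. -/
def expU (a : ℂ) : ℂˣ := Units.mk0 (exp a) (exp_ne_zero a)

lemma expU_add (a b : ℂ) : expU (a + b) = expU a * expU b := Units.ext (exp_add a b)

/-- The Pontryagin product of two exponentials modulo boundaries. -/
def expPont : ℂ →+ ℂ →+ Ch ℂˣ 3 ⧸ Bd (⊤ : Subgroup ℂˣ) 3 :=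
  AddMonoidHom.mk' (fun a => AddMonoidHom.mk' (fun b => QuotientAddGroup.mk'
    (Bd (⊤ : Subgroup ℂˣ) 3) (pont₂ (expU a) (expU b))) fun b c => by
      rw [← map_add, ← sub_eq_zero, ← map_sub]
      refine (QuotientAddGroup.eq_zero_iff _).2 ?_
      have := pr_Bd (expU a) (pont₁_mul (expU b) (expU c))
      rw [map_sub, map_sub, ← expU_add] at this
      rw [← sub_sub]
      exact this) fun a b => by
    ext c
    change QuotientAddGroup.mk' (Bd (⊤ : Subgroup ℂˣ) 3) _ = QuotientAddGroup.mk' _ _ +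
      QuotientAddGroup.mk' _ _
    rw [← map_add, ← sub_eq_zero, ← map_sub]
    refine (QuotientAddGroup.eq_zero_iff _).2 ?_
    have := pr_mul (expU a) (expU b) (pont₁_closed (Subgroup.mem_top (expU c)))
    rw [← expU_add] at this
    rw [← sub_sub]
    exact this

lemma expPont_apply (a b : ℂ) :
    expPont a b = QuotientAddGroup.mk' (Bd ⊤ 3) (pont₂ (expU a) (expU b)) := rfl

lemma expPont_pi (b : ℂ) : expPont (Cpi * I) b = 0 := by
  have h1 : expPont (Cpi * I) b = expPont (2 • (Cpi * I)) (b / 2) := by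
    rw [map_nsmul, AddMonoidHom.nsmul_apply, ← map_nsmul, nsmul_eq_mul]
    congr 1; push_cast; ring
  have h2 : expU (2 • (Cpi * I)) = 1 := Units.ext (by
    simp only [expU, Units.val_mk0, Units.val_one]
    rw [nsmul_eq_mul, ← exp_two_pi_mul_I, Cpi]; congr 1; push_cast; ring)
  rw [h1, expPont_apply, h2]
  exact (QuotientAddGroup.eq_zero_iff _).2 (pr_one_Bd (pont₁_closed (Subgroup.mem_top _)))

lemma expPont_self (a : ℂ) : expPont a a = 0 := by
  rw [expPont_apply, pont₂_self, map_zero]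

/-- The Pontryagin product of logarithms. -/
def pontLog : LogWedge →+ Ch ℂˣ 3 ⧸ Bd (⊤ : Subgroup ℂˣ) 3 :=
  QuotientAddGroup.lift _ (wedgeLift expPont expPont_self) fun x hx => by
      obtain ⟨b, rfl⟩ := AddMonoidHom.mem_range.1 hx
      exact (wedgeLift_wedge _ _ _ _).trans (expPont_pi b)

lemma expU_log (s : ℂˣ) : expU (Complex.log s) = s := Units.ext (exp_log s.ne_zero)

lemma pontLog_lw (s t : ℂˣ) :
    pontLog (lw (logm s) (logm t)) = QuotientAddGroup.mk' (Bd ⊤ 3) (pont₂ s t) := by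
  have : pontLog (lw (logm s) (logm t)) = expPont (Complex.log s) (Complex.log t) :=
    wedgeLift_wedge _ expPont_self _ _
  rw [this, expPont_apply, expU_log, expU_log]

lemma dehn₃_pont₂ (s t : ℂˣ) :
    2 • dehn₃ (jK base₁_injective (cmap tor (pont₂ s t))) = lw (logm s) (logm t) := by
  have key : ∀ u : ℂˣ, 2 • -logm (usqrt u⁻¹) = logm u := fun u => by
    rw [two_nsmul, ← neg_add, ← logm_mul (usqrt_ne_zero _) (usqrt_ne_zero _), ← sq, usqrt_sq,
      Units.val_inv_eq_inv_val, logm_inv u.ne_zero, neg_neg]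
  have e1 : ∀ u : ℂˣ, sg 1 (tor u) pinf = -logm (usqrt u⁻¹) := fun u => by
    rw [sg, inv_one, one_smul, mul_one, ← map_inv, sl_tor]
  have e2 : ∀ u v : ℂˣ, sg (tor u) (tor (v * u)) pinf = -logm (usqrt v⁻¹) := fun u v => by
    rw [sg, ← map_inv, ← map_inv, ← map_mul, tor_smul_pinf, mul_inv_rev, inv_mul_cancel_comm, sl_tor]
  rw [dehn₃, kfun_jK, pont₂_eq]
  simp only [map_sub, cmap_of, lift_apply_of]
  have e3 : tor ∘ ![1, s, t * s] = ![1, tor s, tor (t * s)] := by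
    ext i; fin_cases i <;> simp
  have e4 : tor ∘ ![1, t, t * s] = ![1, tor t, tor (s * t)] := by
    ext i; fin_cases i <;> simp [mul_comm]
  rw [e3, e4]
  simp only [base₁, Matrix.cons_val]
  rw [e1, e1, e2, e2, ← key s, ← key t]
  generalize -logm (usqrt s⁻¹) = a
  generalize -logm (usqrt t⁻¹) = b
  rw [lw_swap a b, sub_neg_eq_add]
  simp only [two_nsmul, map_add, AddMonoidHom.add_apply]

lemma exists_dF_of_dehn₃ {x : KC PSL2C P1 3 1} (hx : dF 2 1 x = 0) (h : dehn₃ x = 0) :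
    ∃ y, dF 3 1 y = x := by
  obtain ⟨c, rfl, hc⟩ := exists_jK_eq base₁_injective base₁_transitive x
  obtain ⟨c', hc', h1⟩ := exists_closed_subgroup Borel (hc hx)
  have h2 := borelData.cmap_σ_sub_mem_Bd (Or.inl rfl) hc'
  have h3 : cmap Borel.subtype (cmap borelData.σ c' - c') ∈ Bd Borel 3 :=
    (equivar_hom Borel.subtype fun s _ => s.2).cmap_Bd h2
  have h4 : cmap Borel.subtype (cmap borelData.σ c') = cmap tor (cmap bchar c') := by
    rw [cmap_cmap, cmap_cmap]; rfl
  have h5 : cmap bchar c' ∈ Closed (⊤ : Subgroup ℂˣ) 2 := (equivar_top bchar).cmap_Closed hc'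
  have tB : ∀ {d : Ch ℂˣ 3}, d ∈ Bd ⊤ 3 → cmap tor d ∈ Bd Borel 3 := fun hd =>
    (equivar_hom tor fun s _ => tor_mem_Borel s).cmap_Bd hd
  obtain ⟨y, hy, z, hz, e⟩ := AddSubgroup.mem_sup.1 (pontGen_units.two h5)
  have key : ∀ y ∈ Pont2 ℂˣ, pontLog (2 • dehn₃ (jK base₁_injective (cmap tor y))) =
      QuotientAddGroup.mk' _ y := by
    intro y hy
    let f := ((pontLog.comp (2 • dehn₃)).comp ((jK base₁_injective).comp (cmap tor)))
    suffices Pont2 ℂˣ ≤ f.eqLocus (QuotientAddGroup.mk' _) from this hy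
    refine (AddSubgroup.closure_le _).2 ?_
    rintro _ ⟨p, rfl⟩
    change pontLog (2 • dehn₃ (jK base₁_injective (cmap tor (pont₂ p.1 p.2)))) =
      QuotientAddGroup.mk' _ (pont₂ p.1 p.2)
    rw [dehn₃_pont₂, pontLog_lw]
  have h6 : cmap tor y - c ∈ Bd Borel 3 := by
    rw [map_sub, h4, ← e, map_add] at h3
    convert sub_mem (add_mem h3 h1) (tB hz) using 1
    abel
  obtain ⟨d, hd⟩ := jK_Bd base₁_injective h6
  have h7 : dehn₃ (jK base₁_injective (cmap tor y)) = 0 := by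
    have := congrArg dehn₃ hd
    rwa [dehn₃_dF, map_sub, map_sub, h, sub_zero] at this
  have h8 := key y hy
  rw [h7, smul_zero, map_zero, eq_comm, QuotientAddGroup.mk'_apply,
    QuotientAddGroup.eq_zero_iff] at h8
  obtain ⟨d', hd'⟩ := jK_Bd base₁_injective (tB h8)
  exact ⟨d' - d, by rw [map_sub, ← hd, ← hd', map_sub, sub_sub_cancel]⟩

end Columns

section CrossRatio

open FreeAbelianGroup

/-- The cross ratio of four points. -/
def crr (x : Fin 4 → P1) : ℂ :=
  det2 (x 0).rep (x 3).rep * det2 (x 1).rep (x 2).rep /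
    (det2 (x 0).rep (x 2).rep * det2 (x 1).rep (x 3).rep)

lemma crr_mk {v₀ v₁ v₂ v₃ : Fin 2 → ℂ} (h₀ : v₀ ≠ 0) (h₁ : v₁ ≠ 0) (h₂ : v₂ ≠ 0) (h₃ : v₃ ≠ 0) :
    crr ![.mk ℂ v₀ h₀, .mk ℂ v₁ h₁, .mk ℂ v₂ h₂, .mk ℂ v₃ h₃] =
      det2 v₀ v₃ * det2 v₁ v₂ / (det2 v₀ v₂ * det2 v₁ v₃) := by
  obtain ⟨a, ha⟩ := Projectivization.exists_smul_eq_mk_rep ℂ v₀ h₀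
  obtain ⟨b, hb⟩ := Projectivization.exists_smul_eq_mk_rep ℂ v₁ h₁
  obtain ⟨c, hc⟩ := Projectivization.exists_smul_eq_mk_rep ℂ v₂ h₂
  obtain ⟨d, hd⟩ := Projectivization.exists_smul_eq_mk_rep ℂ v₃ h₃
  simp only [crr, Matrix.cons_val, ← ha, ← hb, ← hc, ← hd, Units.smul_def, det2_smul_left,
    det2_smul_right]
  rw [← mul_div_mul_left (det2 v₀ v₃ * det2 v₁ v₂) _ (a * b * c * d).ne_zero]
  push_cast
  congr 1 <;> ring

lemma crr_smul (g : PSL2C) (x : Fin 4 → P1) : crr (g • x) = crr x := by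
  simp only [crr, Pi.smul_apply, det2_scale]
  rw [← mul_div_mul_left (det2 (x 0).rep (x 3).rep * _) _
    (scale g (x 0) * scale g (x 1) * scale g (x 2) * scale g (x 3)).ne_zero]
  push_cast
  congr 1 <;> ring

lemma crr_pinf (a b c : ℂ) : crr ![pinf, pz a, pz b, pz c] = (a - b) / (a - c) := by
  rw [pinf, pz, pz, pz, crr_mk]
  simp [det2]

lemma crr_pz (a b c d : ℂ) :
    crr ![pz a, pz b, pz c, pz d] = (a - d) * (b - c) / ((a - c) * (b - d)) := by
  rw [pz, pz, pz, pz, crr_mk]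
  simp [det2]

lemma one_sub_crr {x : Fin 4 → P1} (hx : Function.Injective x) :
    1 - crr x = det2 (x 0).rep (x 1).rep * det2 (x 2).rep (x 3).rep /
      (det2 (x 0).rep (x 2).rep * det2 (x 1).rep (x 3).rep) := by
  have h : ∀ {i j}, i ≠ j → det2 (x i).rep (x j).rep ≠ 0 := fun hij =>
    mt det2_rep_eq_zero.1 (hx.ne hij)
  rw [crr, eq_div_iff (mul_ne_zero (h (by decide)) (h (by decide))), sub_mul,
    div_mul_cancel₀ _ (mul_ne_zero (h (by decide)) (h (by decide)))]
  simp only [det2]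
  ring

lemma reg_crr {x : Fin 4 → P1} (hx : Function.Injective x) : Reg (crr x) := by
  have h : ∀ {i j}, i ≠ j → det2 (x i).rep (x j).rep ≠ 0 := fun hij =>
    mt det2_rep_eq_zero.1 (hx.ne hij)
  refine ⟨?_, fun h1 => ?_⟩
  · exact div_ne_zero (mul_ne_zero (h (by decide)) (h (by decide)))
      (mul_ne_zero (h (by decide)) (h (by decide)))
  · have := one_sub_crr hx
    rw [h1, sub_self] at this
    exact div_ne_zero (mul_ne_zero (h (by decide)) (h (by decide)))
      (mul_ne_zero (h (by decide)) (h (by decide))) this.symm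

lemma logm_crr {x : Fin 4 → P1} (hx : Function.Injective x) : logm (crr x) = crl x := by
  have h : ∀ {i j}, i ≠ j → det2 (x i).rep (x j).rep ≠ 0 := fun hij =>
    mt det2_rep_eq_zero.1 (hx.ne hij)
  rw [crr, logm_div, logm_mul, logm_mul, crl]
  · simp only [dl]; abel
  any_goals exact h (by decide)
  all_goals exact mul_ne_zero (h (by decide)) (h (by decide))

lemma logm_one_sub_crr {x : Fin 4 → P1} (hx : Function.Injective x) :
    logm (1 - crr x) = crl' x := by
  have h : ∀ {i j}, i ≠ j → det2 (x i).rep (x j).rep ≠ 0 := fun hij =>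
    mt det2_rep_eq_zero.1 (hx.ne hij)
  rw [one_sub_crr hx, logm_div, logm_mul, logm_mul, crl']
  · simp only [dl]; abel
  any_goals exact h (by decide)
  all_goals exact mul_ne_zero (h (by decide)) (h (by decide))

lemma exists_eq_pz {y : P1} (h : y ≠ pinf) : ∃ a, y = pz a := by
  induction y using Projectivization.ind with | _ v hv =>
  rw [Ne, pinf, mk_eq_mk_iff_det2] at h
  simp [det2] at h
  refine ⟨v 0 / v 1, ?_⟩
  rw [pz, mk_eq_mk_iff_det2]
  simp [det2]; field_simp; ring

lemma kmk_of_smul {p q : ℕ} (g : PSL2C) {a : Fin p → PSL2C} {x : Fin q → P1}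
    (hx : Function.Injective x) (hx' : Function.Injective (g • x)) :
    kmk (of_mem_Inj (g • a) hx') = kmk (of_mem_Inj a hx) :=
  kmk_eq.2 (of_smul_sub_mem_coinv (Subgroup.mem_top g) (a, x))

lemma kmk_of_congr {p q : ℕ} {a a' : Fin p → PSL2C} {x x' : Fin q → P1}
    (hx : Function.Injective x) (ha : a = a') (h : x = x') :
    kmk (of_mem_Inj a hx) = kmk (of_mem_Inj a' (h ▸ hx)) := by
  subst ha h; rfl

lemma injective_stdTet {z : ℂ} (hz : Reg z) : Function.Injective ![pinf, pz 0, pz z, pz 1] := by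
  have h1 := pz_injective.ne hz.1
  have h2 := pz_injective.ne hz.2
  have h3 := pz_injective.ne (zero_ne_one (α := ℂ))
  intro i j hij
  fin_cases i <;> fin_cases j <;> first | rfl | (exfalso; revert hij; simp [pinf_ne_pz,
    (pinf_ne_pz _).symm, h1, h2, h3, h1.symm, h2.symm, h3.symm])

/-- The ideal tetrahedron with the given cross ratio. -/
def stdTet (z : ℂ) : KC PSL2C P1 0 4 :=
  if h : Reg z then kmk (of_mem_Inj ![] (injective_stdTet h)) else 0

lemma kmk_eq_stdTet (a : Fin 0 → PSL2C) {x : Fin 4 → P1} (hx : Function.Injective x) :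
    kmk (of_mem_Inj a hx) = stdTet (crr x) := by
  have hr := reg_crr hx
  obtain ⟨g, h0, h1, h3⟩ := exists_smul_triple (hx.ne (show (0 : Fin 4) ≠ 1 by decide))
    (hx.ne (show (0 : Fin 4) ≠ 3 by decide)) (hx.ne (show (1 : Fin 4) ≠ 3 by decide))
  have hy : g⁻¹ • x 2 ≠ pinf := fun h =>
    hx.ne (show (2 : Fin 4) ≠ 0 by decide) (by rw [← h0, ← h, smul_inv_smul])
  obtain ⟨z, hz⟩ := exists_eq_pz hy
  have e : g⁻¹ • x = ![pinf, pz 0, pz z, pz 1] := by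
    funext i
    fin_cases i
    · exact inv_smul_eq_iff.2 h0.symm
    · exact inv_smul_eq_iff.2 h1.symm
    · exact hz
    · exact inv_smul_eq_iff.2 h3.symm
  have ez : crr x = z := by
    rw [← crr_smul g⁻¹, e, crr_pinf]; simp
  rw [ez] at hr ⊢
  rw [stdTet, dif_pos hr, ← kmk_of_smul g⁻¹ hx ((injective_smul_iff g⁻¹ x).2 hx)]
  exact kmk_of_congr ((injective_smul_iff g⁻¹ x).2 hx) (Subsingleton.elim _ _) e

lemma pbCls_eq {z : ℂ} (h : Reg z) : pbCls z = QuotientAddGroup.mk (pbGen z h) := dif_pos h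

lemma reg_ftTuple {x y : ℂ} (hx : Reg x) (hy : Reg y) (h : x ≠ y) (i : Fin 5) :
    Reg (ftTuple x y i) := by
  obtain ⟨hx0, hx1⟩ := hx
  obtain ⟨hy0, hy1⟩ := hy
  have a1 : 1 - x ≠ 0 := sub_ne_zero.2 hx1.symm
  have a2 : 1 - y ≠ 0 := sub_ne_zero.2 hy1.symm
  have a3 : x - 1 ≠ 0 := sub_ne_zero.2 hx1
  have a4 : y - 1 ≠ 0 := sub_ne_zero.2 hy1
  have e1 : 1 - x⁻¹ = (x - 1) / x := by field_simp
  have e2 : 1 - y⁻¹ = (y - 1) / y := by field_simp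
  fin_cases i
  · exact ⟨hx0, hx1⟩
  · exact ⟨hy0, hy1⟩
  · exact ⟨div_ne_zero hy0 hx0, fun e => h ((div_eq_one_iff_eq hx0).1 e).symm⟩
  · refine ⟨?_, fun e => ?_⟩
    · change (1 - x⁻¹) / (1 - y⁻¹) ≠ 0
      rw [e1, e2]
      positivity
    · change (1 - x⁻¹) / (1 - y⁻¹) = 1 at e
      rw [e1, e2] at e
      field_simp at e
      exact h (by linear_combination e)
  · refine ⟨div_ne_zero a1 a2, fun e => ?_⟩
    change (1 - x) / (1 - y) = 1 at e
    rw [div_eq_one_iff_eq a2] at e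
    exact h (by linear_combination -e)

lemma pbCls_five_term {x y : ℂ} (hx : Reg x) (hy : Reg y) (h : x ≠ y) :
    pbCls x - pbCls y + pbCls (y / x) - pbCls ((1 - x⁻¹) / (1 - y⁻¹)) +
      pbCls ((1 - x) / (1 - y)) = 0 := by
  have h2 := reg_ftTuple hx hy h 2
  have h3 := reg_ftTuple hx hy h 3
  have h4 := reg_ftTuple hx hy h 4
  simp only [ftTuple, Matrix.cons_val] at h2 h3 h4
  rw [pbCls_eq hx, pbCls_eq hy, pbCls_eq h2, pbCls_eq h3, pbCls_eq h4]
  exact (QuotientAddGroup.eq_zero_iff _).2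
    (AddSubgroup.subset_closure ⟨x, y, hx, hy, h, h2, h3, h4, rfl⟩)

/-- The cross ratio map to the pre-Bloch group. -/
def crossRatio : KC PSL2C P1 0 4 →+ PreBloch :=
  kfun (fun _ x => pbCls (crr x)) fun g _ x => by rw [crr_smul]

lemma crossRatio_kmk (a : Fin 0 → PSL2C) {x : Fin 4 → P1} (hx : Function.Injective x) :
    crossRatio (kmk (of_mem_Inj a hx)) = pbCls (crr x) := kfun_of _ _ _ hx

lemma crossRatio_stdTet {z : ℂ} (hz : Reg z) : crossRatio (stdTet z) = pbCls z := by
  rw [stdTet, dif_pos hz, crossRatio_kmk _ (injective_stdTet hz), crr_pinf]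
  simp

lemma crossRatio_surjective : Function.Surjective crossRatio := fun x => by
  obtain ⟨c, rfl⟩ := QuotientAddGroup.mk'_surjective _ x
  refine AddMonoidHom.mem_range.1 (map_mem_of_gen (QuotientAddGroup.mk' pbSub) crossRatio.range
    (fun z => AddMonoidHom.mem_range.2 ⟨stdTet z.1, ?_⟩) c)
  rw [crossRatio_stdTet z.2, pbCls_eq z.2]
  rfl

lemma ftTuple_crr {x y : ℂ} (hx : Reg x) (hy : Reg y) :
    crr ![pinf, pz 0, pz 1, pz x⁻¹] = x ∧ crr ![pinf, pz 0, pz 1, pz y⁻¹] = y ∧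
    crr ![pinf, pz 0, pz x⁻¹, pz y⁻¹] = y / x ∧
    crr ![pinf, pz 1, pz x⁻¹, pz y⁻¹] = (1 - x⁻¹) / (1 - y⁻¹) ∧
    crr ![pz 0, pz 1, pz x⁻¹, pz y⁻¹] = (1 - x) / (1 - y) := by
  obtain ⟨hx0, hx1⟩ := hx
  obtain ⟨hy0, hy1⟩ := hy
  have a2 : 1 - y ≠ 0 := sub_ne_zero.2 hy1.symm
  have a4 : y - 1 ≠ 0 := sub_ne_zero.2 hy1
  rw [crr_pinf, crr_pinf, crr_pinf, crr_pinf, crr_pz]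
  refine ⟨by simp, by simp, by simp [div_eq_mul_inv, mul_comm], rfl, ?_⟩
  have e2 : 1 - y⁻¹ = (y - 1) / y := by field_simp
  rw [e2]
  field_simp
  ring

lemma crossRatio_dM (w : KC PSL2C P1 0 5) : crossRatio (dM 0 4 w) = 0 := by
  suffices crossRatio.comp (dM 0 4) = 0 from DFunLike.congr_fun this w
  refine kc_hom_ext fun a x hx => ?_
  obtain ⟨g, h0, h1, h2⟩ := exists_smul_triple (hx.ne (show (0 : Fin 5) ≠ 1 by decide))
    (hx.ne (show (0 : Fin 5) ≠ 2 by decide)) (hx.ne (show (1 : Fin 5) ≠ 2 by decide))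
  have hx' := (injective_smul_iff g⁻¹ x).2 hx
  rw [← kmk_of_smul g⁻¹ hx hx', AddMonoidHom.comp_apply, crossRatio, kfun_dM _ _ _ hx']
  have e0 : (g⁻¹ • x) 0 = pinf := inv_smul_eq_iff.2 h0.symm
  have e1 : (g⁻¹ • x) 1 = pz 0 := inv_smul_eq_iff.2 h1.symm
  have e2 : (g⁻¹ • x) 2 = pz 1 := inv_smul_eq_iff.2 h2.symm
  generalize g⁻¹ • x = x at hx' e0 e1 e2
  have fin : ∀ i : Fin 5, i ≠ 0 → i ≠ 1 → i ≠ 2 → ∃ z, Reg z ∧ x i = pz z⁻¹ := fun i i0 i1 i2 => by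
    obtain ⟨z, hz⟩ := exists_eq_pz (e0 ▸ hx'.ne i0)
    refine ⟨z⁻¹, ⟨fun h => ?_, fun h => ?_⟩, by rw [hz, inv_inv]⟩
    · rw [inv_eq_zero.1 h, ← e1] at hz
      exact i1 (hx' hz)
    · rw [inv_eq_one.1 h, ← e2] at hz
      exact i2 (hx' hz)
  obtain ⟨u, hu, e3⟩ := fin 3 (by decide) (by decide) (by decide)
  obtain ⟨v, hv, e4⟩ := fin 4 (by decide) (by decide) (by decide)
  have huv : u ≠ v := fun h => hx'.ne (show (3 : Fin 5) ≠ 4 by decide) (by rw [e3, e4, h])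
  obtain rfl : x = ![pinf, pz 0, pz 1, pz u⁻¹, pz v⁻¹] := by
    funext i; fin_cases i <;> assumption
  obtain ⟨f0, f1, f2, f3, f4⟩ := ftTuple_crr hu hv
  simp only [bd_succ_of, bd_zero_of, map_sub, cone_of, lift_apply_of, f0, f1, f2, f3, f4,
    AddMonoidHom.zero_apply]
  rw [← pbCls_five_term hu hv huv]
  abel

/-- The inverse of the cross ratio map. -/
def crossRatioInv : PreBloch →+ KC PSL2C P1 0 4 ⧸ (dM (G := PSL2C) (X := P1) 0 4).range :=
  QuotientAddGroup.lift pbSub (lift fun z : RegT => QuotientAddGroup.mk' _ (stdTet z.1)) (by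
    intro c hc
    refine (AddSubgroup.closure_le (AddMonoidHom.ker _)).2 ?_ hc
    rintro _ ⟨x, y, hx, hy, h, h2, h3, h4, rfl⟩
    have inj : Function.Injective ![pinf, pz 0, pz 1, pz x⁻¹, pz y⁻¹] := by
      have n1 := pz_injective.ne (inv_ne_zero hx.1)
      have n2 := pz_injective.ne (inv_ne_zero hy.1)
      have n3 := pz_injective.ne (inv_ne_one.2 hx.2)
      have n4 := pz_injective.ne (inv_ne_one.2 hy.2)
      have n5 := pz_injective.ne (inv_injective.ne h)
      have n6 := pz_injective.ne (zero_ne_one (α := ℂ))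
      intro i j hij
      fin_cases i <;> fin_cases j <;> first | rfl | (exfalso; revert hij; simp [pinf_ne_pz,
        (pinf_ne_pz _).symm, n1, n2, n3, n4, n5, n6, n1.symm, n2.symm, n3.symm, n4.symm, n5.symm,
        n6.symm])
    have i' : ∀ f : Fin 4 → Fin 5, Function.Injective f →
        Function.Injective (![pinf, pz 0, pz 1, pz x⁻¹, pz y⁻¹] ∘ f) := fun f hf => inj.comp hf
    have c4 : ∀ a b c d : Fin 5, ![pinf, pz 0, pz 1, pz x⁻¹, pz y⁻¹] ∘ ![a, b, c, d] =
        ![![pinf, pz 0, pz 1, pz x⁻¹, pz y⁻¹] a, ![pinf, pz 0, pz 1, pz x⁻¹, pz y⁻¹] b,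
          ![pinf, pz 0, pz 1, pz x⁻¹, pz y⁻¹] c, ![pinf, pz 0, pz 1, pz x⁻¹, pz y⁻¹] d] :=
      fun a b c d => by ext i; fin_cases i <;> rfl
    have i0 := i' ![0, 1, 2, 3] (by decide)
    have i1 := i' ![0, 1, 2, 4] (by decide)
    have i2 := i' ![0, 1, 3, 4] (by decide)
    have i3 := i' ![0, 2, 3, 4] (by decide)
    have i4 := i' ![1, 2, 3, 4] (by decide)
    rw [c4] at i0 i1 i2 i3 i4
    obtain ⟨f0, f1, f2, f3, f4⟩ := ftTuple_crr hx hy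
    rw [SetLike.mem_coe, AddMonoidHom.mem_ker]
    simp only [map_add, map_sub, pbGen, lift_apply_of]
    rw [← map_sub, ← map_add, ← map_sub, ← map_add]
    refine (QuotientAddGroup.eq_zero_iff _).2 (AddMonoidHom.mem_range.2
      ⟨kmk (of_mem_Inj ![] inj), ?_⟩)
    have g0 := kmk_eq_stdTet ![] i0
    have g1 := kmk_eq_stdTet ![] i1
    have g2 := kmk_eq_stdTet ![] i2
    have g3 := kmk_eq_stdTet ![] i3
    have g4 := kmk_eq_stdTet ![] i4
    simp only [Matrix.cons_val] at g0 g1 g2 g3 g4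
    rw [f0] at g0
    rw [f1] at g1
    rw [f2] at g2
    rw [f3] at g3
    rw [f4] at g4
    rw [← g0, ← g1, ← g2, ← g3, ← g4, dM_kmk, ← kmk_sub, ← kmk_add, ← kmk_sub, ← kmk_add]
    refine kmk_eq.2 ?_
    convert (dco PSL2C P1 0 4).zero_mem using 1
    rw [sub_eq_zero]
    rw [dMd_of]
    simp only [bd_succ_of, bd_zero_of, map_sub, cone_of, box_of]
    abel)

lemma crossRatioInv_crossRatio (w : KC PSL2C P1 0 4) :
    crossRatioInv (crossRatio w) = QuotientAddGroup.mk' _ w := by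
  suffices crossRatioInv.comp crossRatio = QuotientAddGroup.mk' _ from DFunLike.congr_fun this w
  refine kc_hom_ext fun a x hx => ?_
  rw [AddMonoidHom.comp_apply, crossRatio_kmk _ hx, kmk_eq_stdTet _ hx, pbCls_eq (reg_crr hx)]
  exact lift_apply_of _ _

lemma exists_dM_of_crossRatio {w : KC PSL2C P1 0 4} (h : crossRatio w = 0) :
    ∃ e, dM 0 4 e = w := by
  have := crossRatioInv_crossRatio w
  rw [h, map_zero, eq_comm] at this
  exact AddMonoidHom.mem_range.1 ((QuotientAddGroup.eq_zero_iff _).1 this)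

/-- The Dehn invariant on the pre-Bloch group, modulo torsion. -/
def dehnP : PreBloch →+ LogWedge :=
  QuotientAddGroup.lift pbSub (lift fun z : RegT => lw (logm z.1) (logm (1 - z.1))) (by
    intro c hc
    refine (AddSubgroup.closure_le (AddMonoidHom.ker _)).2 ?_ hc
    rintro _ ⟨x, y, hx, hy, h, h2, h3, h4, rfl⟩
    have hx0 := hx.1
    have hx1 := hx.2
    have hy0 := hy.1
    have hy1 := hy.2
    have a1 : 1 - x ≠ 0 := sub_ne_zero.2 hx1.symm
    have a2 : 1 - y ≠ 0 := sub_ne_zero.2 hy1.symm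
    have a5 : x - y ≠ 0 := sub_ne_zero.2 h
    have e2 : 1 - y / x = (x - y) / x := by field_simp
    have e3 : (1 - x⁻¹) / (1 - y⁻¹) = (y * (1 - x)) / (x * (1 - y)) := by
      have a4 : y - 1 ≠ 0 := sub_ne_zero.2 hy1
      rw [show 1 - x⁻¹ = (x - 1) / x by field_simp, show 1 - y⁻¹ = (y - 1) / y by field_simp]
      field_simp
      ring
    have e3' : 1 - (y * (1 - x)) / (x * (1 - y)) = (x - y) / (x * (1 - y)) := by
      field_simp
      ring
    have e4 : 1 - (1 - x) / (1 - y) = (x - y) / (1 - y) := by field_simp; ring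
    rw [SetLike.mem_coe, AddMonoidHom.mem_ker]
    simp only [map_add, map_sub, pbGen, lift_apply_of]
    rw [e2, e3, e3', e4, logm_div hy0 hx0, logm_div a5 hx0,
      logm_div (mul_ne_zero hy0 a1) (mul_ne_zero hx0 a2), logm_div a5 (mul_ne_zero hx0 a2),
      logm_mul hy0 a1, logm_mul hx0 a2, logm_div a1 a2, logm_div a5 a2]
    generalize logm x = X
    generalize logm y = Y
    generalize logm (1 - x) = U
    generalize logm (1 - y) = V
    generalize logm (x - y) = Z
    simp only [map_add, map_sub, AddMonoidHom.add_apply, AddMonoidHom.sub_apply, lw_self]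
    simp only [lw_swap X Y, lw_swap X U, lw_swap X V, lw_swap X Z, lw_swap Y U, lw_swap Y V,
      lw_swap Y Z, lw_swap U V, lw_swap U Z, lw_swap V Z]
    abel)

lemma dehnP_pbCls {z : ℂ} (h : Reg z) : dehnP (pbCls z) = lw (logm z) (logm (1 - z)) := by
  rw [pbCls_eq h]
  exact lift_apply_of _ _

lemma dehnP_crossRatio (w : KC PSL2C P1 0 4) : dehnP (crossRatio w) = dehn₀ w := by
  suffices dehnP.comp crossRatio = dehn₀ from DFunLike.congr_fun this w
  refine kc_hom_ext fun a x hx => ?_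
  rw [AddMonoidHom.comp_apply, crossRatio_kmk _ hx, dehnP_pbCls (reg_crr hx), logm_crr hx,
    logm_one_sub_crr hx, dehn₀]
  refine Eq.trans ?_ (kfun_of (fun _ x => _) _ a hx).symm
  exact (if_pos hx).symm

end CrossRatio

section BarComplex

open FreeAbelianGroup

variable {G : Type} [Group G]

/-- The passage from homogeneous to inhomogeneous chains. -/
def inhom (n : ℕ) : Ch G (n + 1) →+ FreeAbelianGroup (Fin n → G) :=
  FreeAbelianGroup.map fun g i => (g i.castSucc)⁻¹ * g i.succ

/-- A section of the passage from homogeneous to inhomogeneous chains. -/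
def hom' (n : ℕ) : FreeAbelianGroup (Fin n → G) →+ Ch G (n + 1) :=
  FreeAbelianGroup.map Fin.partialProd

lemma inhom_of {n : ℕ} (g : Fin (n + 1) → G) :
    inhom n (of g) = of fun i => (g i.castSucc)⁻¹ * g i.succ := map_of_apply _

lemma inhom_hom' {n : ℕ} (c : FreeAbelianGroup (Fin n → G)) : inhom n (hom' n c) = c := by
  have : (inhom n).comp (hom' n) = AddMonoidHom.id (FreeAbelianGroup (Fin n → G)) := by
    ext f
    rw [AddMonoidHom.comp_apply, hom', map_of_apply, inhom_of]
    simp only [Fin.partialProd_right_inv, AddMonoidHom.id_apply]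
  exact DFunLike.congr_fun this c

lemma hom'_inhom_sub_mem {n : ℕ} (c : Ch G (n + 1)) :
    hom' n (inhom n c) - c ∈ coinv (⊤ : Subgroup G) (Fin (n + 1) → G) := by
  refine map_mem_of_gen ((hom' n).comp (inhom n) - AddMonoidHom.id _) _ (fun g => ?_) c
  rw [AddMonoidHom.sub_apply, AddMonoidHom.comp_apply, inhom_of, hom', map_of_apply,
    AddMonoidHom.id_apply, ← neg_sub, neg_mem_iff]
  have h := of_smul_sub_mem_coinv (Subgroup.mem_top (g 0))
    (Fin.partialProd fun i : Fin n => (g i.castSucc)⁻¹ * g i.succ)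
  rwa [Fin.partialProd_left_inv] at h

lemma inhom_eq_zero {n : ℕ} {c : Ch G (n + 1)} :
    inhom n c = 0 ↔ c ∈ coinv (⊤ : Subgroup G) (Fin (n + 1) → G) := by
  constructor
  · intro h
    have := hom'_inhom_sub_mem c
    rwa [h, map_zero, zero_sub, neg_mem_iff] at this
  · refine fun h => coinv_le_ker _ (fun s _ b => ?_) h
    rw [inhom_of, inhom_of]
    congr 1
    ext i
    simp [mul_assoc]

lemma inhom_bd_three (c : Ch PSL2C 4) : inhom 2 (bd 3 c) = d3 (inhom 3 c) := by
  have : (inhom 2).comp (bd 3) = d3.comp (inhom (G := PSL2C) 3) := by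
    ext x
    obtain ⟨a, y, rfl⟩ := exists_vecCons x
    obtain ⟨b, c, d, rfl⟩ := exists_eq_cons₃ y
    simp only [AddMonoidHom.comp_apply, bd_succ_of, bd_zero_of, map_sub, cone_of, inhom_of, d3,
      lift_apply_of, comp_cons]
    rw [show ∀ p q r s : FreeAbelianGroup (Fin 2 → PSL2C), p - q + r - s = p - (q - (r - s)) by
      intros; abel]
    congr 1
    · congr 1; ext i; fin_cases i <;> simp
    congr 1
    · congr 1; ext i; fin_cases i <;> simp [mul_assoc]
    congr 1
    · congr 1; ext i; fin_cases i <;> simp [mul_assoc]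
    · congr 1; ext i; fin_cases i <;> simp [mul_assoc]
  exact DFunLike.congr_fun this c

lemma inhom_bd_four (c : Ch PSL2C 5) : inhom 3 (bd 4 c) = d4 (inhom 4 c) := by
  have : (inhom 3).comp (bd 4) = d4.comp (inhom (G := PSL2C) 4) := by
    ext x
    obtain ⟨a, y, rfl⟩ := exists_vecCons x
    obtain ⟨b, c, d, e, rfl⟩ := exists_eq_cons₄ y
    simp only [AddMonoidHom.comp_apply, bd_succ_of, bd_zero_of, map_sub, cone_of, inhom_of, d4,
      lift_apply_of, comp_cons]
    rw [show ∀ p q r s t : FreeAbelianGroup (Fin 3 → PSL2C),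
      p - q + r - s + t = p - (q - (r - (s - t))) by intros; abel]
    congr 1
    · congr 1; ext i; fin_cases i <;> simp
    congr 1
    · congr 1; ext i; fin_cases i <;> simp [mul_assoc]
    congr 1
    · congr 1; ext i; fin_cases i <;> simp [mul_assoc]
    congr 1
    · congr 1; ext i; fin_cases i <;> simp [mul_assoc]
    · congr 1; ext i; fin_cases i <;> simp [mul_assoc]
  exact DFunLike.congr_fun this c

lemma mem_Closed_iff_d3 {c : Ch PSL2C 4} :
    c ∈ Closed (⊤ : Subgroup PSL2C) 3 ↔ d3 (inhom 3 c) = 0 := by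
  rw [mem_Closed, ← inhom_bd_three, inhom_eq_zero]

lemma mem_Bd_iff_d4 {c : Ch PSL2C 4} :
    c ∈ Bd (⊤ : Subgroup PSL2C) 4 ↔ inhom 3 c ∈ d4.range := by
  rw [mem_Bd]
  constructor
  · rintro ⟨d, hd⟩
    rw [← inhom_eq_zero, map_sub, sub_eq_zero, inhom_bd_four] at hd
    exact AddMonoidHom.mem_range.2 ⟨_, hd.symm⟩
  · rintro ⟨e, he⟩
    refine ⟨hom' 4 e, ?_⟩
    rw [← inhom_eq_zero, map_sub, inhom_bd_four, inhom_hom', he, sub_self]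

/-- The third homology class of a homogeneous cycle. -/
def hcl : ↥(Closed (⊤ : Subgroup PSL2C) 3) →+ H3PSL2C :=
  (QuotientAddGroup.mk' ((d4.range).addSubgroupOf d3.ker)).comp
    (((inhom 3).comp (Closed (⊤ : Subgroup PSL2C) 3).subtype).codRestrict d3.ker
      fun c => AddMonoidHom.mem_ker.2 (mem_Closed_iff_d3.1 c.2))

lemma hcl_eq_zero {c : ↥(Closed (⊤ : Subgroup PSL2C) 3)} :
    hcl c = 0 ↔ c.1 ∈ Bd (⊤ : Subgroup PSL2C) 4 := by
  rw [mem_Bd_iff_d4]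
  exact (QuotientAddGroup.eq_zero_iff _).trans AddSubgroup.mem_addSubgroupOf

lemma hom'_closed {x : FreeAbelianGroup (Fin 3 → PSL2C)} (hx : x ∈ d3.ker) :
    hom' 3 x ∈ Closed (⊤ : Subgroup PSL2C) 3 := by
  rw [mem_Closed_iff_d3, inhom_hom']
  exact hx

lemma hcl_surjective : Function.Surjective hcl := fun x => by
  obtain ⟨x, rfl⟩ := QuotientAddGroup.mk_surjective x
  refine ⟨⟨hom' 3 x.1, hom'_closed x.2⟩, ?_⟩
  refine congrArg (QuotientAddGroup.mk' ((d4.range).addSubgroupOf d3.ker)) (Subtype.ext ?_)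
  exact inhom_hom' x.1

end BarComplex

section PreBlochMap

open FreeAbelianGroup

/-- The empty tuple of points. -/
def base₀ : Fin 0 → P1 := ![]

lemma base₀_injective : Function.Injective base₀ := Function.injective_of_subsingleton _

lemma stab₀_eq : MulAction.stabilizer PSL2C base₀ = ⊤ :=
  eq_top_iff.2 fun _ _ => MulAction.mem_stabilizer_iff.2 (Subsingleton.elim _ _)

lemma jK₀_eq_zero {p : ℕ} {c : Ch PSL2C p} :
    jK base₀_injective c = 0 ↔ c ∈ coinv (⊤ : Subgroup PSL2C) (Fin p → PSL2C) := by
  constructor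
  · intro h
    have := kfun_jK (fun a (_ : Fin 0 → P1) =>
      QuotientAddGroup.mk' (coinv (⊤ : Subgroup PSL2C) (Fin p → PSL2C)) (of a))
      (fun g a _ => by
        rw [← sub_eq_zero, ← map_sub]
        exact (QuotientAddGroup.eq_zero_iff _).2 (of_smul_sub_mem_coinv (Subgroup.mem_top g) a))
      base₀_injective c
    rw [h, map_zero] at this
    refine (QuotientAddGroup.eq_zero_iff c).1 (this.trans ?_).symm
    have key : lift (fun a => QuotientAddGroup.mk' (coinv (⊤ : Subgroup PSL2C) (Fin p → PSL2C))
        (of a)) = QuotientAddGroup.mk' (coinv (⊤ : Subgroup PSL2C) (Fin p → PSL2C)) := by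
      ext a
      exact lift_apply_of _ _
    exact DFunLike.congr_fun key c
  · exact fun h => jK_eq_zero base₀_injective (by rwa [stab₀_eq])

lemma dF_jK₀ {c : Ch PSL2C 4} (hc : c ∈ Closed (⊤ : Subgroup PSL2C) 3) :
    dF 3 0 (jK base₀_injective c) = 0 := by
  rw [dF_jK, jK₀_eq_zero]
  exact hc

lemma exists_jK₀_eq (x : KC PSL2C P1 4 0) (hx : dF 3 0 x = 0) :
    ∃ c ∈ Closed (⊤ : Subgroup PSL2C) 3, x = jK base₀_injective c := by
  obtain ⟨c, h, h'⟩ := exists_jK_eq base₀_injective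
    (fun x _ => ⟨1, Subsingleton.elim _ _⟩) x
  refine ⟨c, ?_, h⟩
  have := h' hx
  rwa [stab₀_eq] at this

lemma dM_jK_base₁ (c : Ch PSL2C 4) : dM 4 0 (jK base₁_injective c) = jK base₀_injective c := by
  have h : dMd 4 0 (jmap base₁ c) = jmap base₀ c := by
    rw [jmap_eq, dMd_box, base₁, bd_zero_of]
    rfl
  exact kmk_congr h _

lemma Zig.crossRatio_eq {a : KC PSL2C P1 4 0} {b : KC PSL2C P1 5 0} {p p' : KC PSL2C P1 0 4}
    (h : Zig a p) (h' : Zig (a + dF 4 0 b) p') : crossRatio p' = crossRatio p := by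
  have h1 := h'.add h.neg
  rw [add_neg_cancel_comm, ← sub_eq_add_neg] at h1
  obtain ⟨e, he⟩ := zig_dF h1
  rw [← sub_eq_zero, ← map_sub, he, crossRatio_dM]

lemma exists_crossRatio_zig (x : ↥d3.ker) :
    ∃ z, ∀ p, Zig (jK base₀_injective (hom' 3 x.1)) p → crossRatio p = z := by
  obtain ⟨p, hp⟩ := exists_zig (jK base₀_injective (hom' 3 x.1)) (dF_jK₀ (hom'_closed x.2))
  exact ⟨crossRatio p, fun p' hp' => hp.crossRatio_eq (b := 0) (by rwa [map_zero, add_zero])⟩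

/-- The map to the pre-Bloch group on cycles of the bar complex. -/
def blochAux : ↥d3.ker →+ PreBloch :=
  AddMonoidHom.mk' (fun x => Classical.choose (exists_crossRatio_zig x)) fun x y => by
    obtain ⟨p, hp⟩ := exists_zig (jK base₀_injective (hom' 3 x.1)) (dF_jK₀ (hom'_closed x.2))
    obtain ⟨q, hq⟩ := exists_zig (jK base₀_injective (hom' 3 y.1)) (dF_jK₀ (hom'_closed y.2))
    rw [← Classical.choose_spec (exists_crossRatio_zig x) p hp,
      ← Classical.choose_spec (exists_crossRatio_zig y) q hq,
      ← Classical.choose_spec (exists_crossRatio_zig (x + y)) (p + q)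
        (by rw [AddSubgroup.coe_add, map_add, map_add]; exact hp.add hq), map_add]

lemma blochAux_eq {x : ↥d3.ker} {p : KC PSL2C P1 0 4}
    (h : Zig (jK base₀_injective (hom' 3 x.1)) p) : blochAux x = crossRatio p :=
  (Classical.choose_spec (exists_crossRatio_zig x) p h).symm

lemma blochAux_eq_zero {x : ↥d3.ker} (h : x ∈ (d4.range).addSubgroupOf d3.ker) :
    blochAux x = 0 := by
  obtain ⟨p, hp⟩ := exists_zig (jK base₀_injective (hom' 3 x.1)) (dF_jK₀ (hom'_closed x.2))
  have h1 : hom' 3 x.1 ∈ Bd (⊤ : Subgroup PSL2C) 4 := by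
    rw [mem_Bd_iff_d4, inhom_hom']
    exact h
  rw [← stab₀_eq] at h1
  obtain ⟨b, hb⟩ := jK_Bd base₀_injective h1
  have h2 : Zig (0 : KC PSL2C P1 4 0) 0 := by
    have := zig_dM (G := PSL2C) (X := P1) (c := 0) (map_zero _)
    rwa [map_zero] at this
  rw [blochAux_eq hp, h2.crossRatio_eq (b := b) (by rwa [zero_add, ← hb]), map_zero]

/-- The map from the third homology of `PSL(2,ℂ)` to the pre-Bloch group. -/
def blochMap : H3PSL2C →+ PreBloch :=
  QuotientAddGroup.lift _ blochAux fun _ h => blochAux_eq_zero h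

lemma blochMap_hcl {c : ↥(Closed (⊤ : Subgroup PSL2C) 3)} {p : KC PSL2C P1 0 4}
    (h : Zig (jK base₀_injective c.1) p) : blochMap (hcl c) = crossRatio p := by
  refine blochAux_eq (x := ⟨inhom 3 c.1, AddMonoidHom.mem_ker.2 (mem_Closed_iff_d3.1 c.2)⟩) ?_
  have := jK₀_eq_zero.2 (hom'_inhom_sub_mem c.1)
  rw [map_sub, sub_eq_zero] at this
  rwa [this]

lemma dehnP_blochMap (x : H3PSL2C) : dehnP (blochMap x) = 0 := by
  obtain ⟨c, rfl⟩ := hcl_surjective x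
  obtain ⟨p, hp⟩ := exists_zig _ (dF_jK₀ c.2)
  rw [blochMap_hcl hp, dehnP_crossRatio]
  exact hp.functional_eq_zero dehn₀ dehn₁ dehn₂ dehn₃ dehn₀_dF dehn₁_dF dehn₂_dF dehn₃_dF

theorem exists_blochMap_eq {z : PreBloch} (hz : dehnP z = 0) : ∃ x, blochMap x = z := by
  obtain ⟨p, rfl⟩ := crossRatio_surjective z
  rw [dehnP_crossRatio] at hz
  obtain ⟨a, ha⟩ := exists_zig_of_functionals dehn₀ dehn₁ dehn₂ dehn₃ dehn₀_dF dehn₁_dF dehn₂_dF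
    (free_of_three_le 3 le_rfl)
    (fun x hx => exists_dF_of_torPart hx (torPart_dM x))
    (fun x hx h => exists_dF_of_dehn₃ hx h) (dM_zero_three p) hz
  obtain ⟨c, hc, rfl⟩ := exists_jK₀_eq a ha.dF_eq_zero
  exact ⟨hcl ⟨c, hc⟩, blochMap_hcl ha⟩

theorem mem_of_blochMap_eq_zero {c : ↥(Closed (⊤ : Subgroup PSL2C) 3)}
    (h : blochMap (hcl c) = 0) : c.1 ∈ RhoSpan ⊔ Bd ⊤ 4 := by
  obtain ⟨p, hp⟩ := exists_zig _ (dF_jK₀ c.2)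
  rw [blochMap_hcl hp] at h
  obtain ⟨e, rfl⟩ := exists_dM_of_crossRatio h
  obtain ⟨x, hx, hxc⟩ := hp.exists_of_eq_dM free_of_three_le exists_dM_sub_dF_eq_zero
  obtain ⟨b, rfl, hb⟩ := exists_jK_eq base₁_injective base₁_transitive x
  rw [dM_jK_base₁, ← sub_eq_zero, ← map_sub, jK₀_eq_zero] at hxc
  have h1 := closed_Borel_le (hb hx)
  have h2 := AddSubgroup.mem_sup_right (S := RhoSpan) (coinv_le_Bd hxc)
  rw [← sub_sub_cancel b c.1]
  exact sub_mem h1 h2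

lemma rho_mem_Closed_top {t : ℂˣ} {n : ℕ} (h : t ^ n = 1) :
    rho (tor t) n ∈ Closed (⊤ : Subgroup PSL2C) 3 :=
  Closed_mono le_top (rho_mem_Closed_Borel h)

theorem blochMap_of_mem_Borel {c : ↥(Closed (⊤ : Subgroup PSL2C) 3)} (h : c.1 ∈ Closed Borel 3) :
    blochMap (hcl c) = 0 := by
  have h1 : dF 3 1 (jK base₁_injective c.1) = 0 :=
    (dF_jK _ _).trans (jK_eq_zero _ h)
  have h2 := zig_dM h1
  rw [dM_jK_base₁] at h2
  exact (blochMap_hcl h2).trans (map_zero _)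

/-- The homology class supported on a finite cyclic subgroup of the torus. -/
def rhoCl (t : ℂˣ) (n : ℕ) (h : t ^ n = 1) : H3PSL2C := hcl ⟨rho (tor t) n, rho_mem_Closed_top h⟩

theorem blochMap_rhoCl {t : ℂˣ} {n : ℕ} (h : t ^ n = 1) : blochMap (rhoCl t n h) = 0 :=
  blochMap_of_mem_Borel (rho_mem_Closed_Borel h)

end PreBlochMap

section CyclicClasses

open FreeAbelianGroup

variable {G : Type*} [Group G] {m : ℕ}

lemma nm_sub_nsmul_mem (t : G) (n : ℕ) (c : Ch G m) :
    nm t n c - n • c ∈ coinv (⊤ : Subgroup G) (Fin m → G) := by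
  rw [nm_apply, ← Finset.card_range n, ← Finset.sum_const, Finset.card_range,
    ← Finset.sum_sub_distrib]
  exact sum_mem fun i _ => tr_sub_mem_coinv (Subgroup.mem_top _) c

lemma nsmul_rho_mem_Bd {t : G} {n : ℕ} (ht : t ^ n = 1) : n • rho t n ∈ Bd (⊤ : Subgroup G) 4 := by
  obtain ⟨d, hd⟩ := exists_bd_of_bd_eq_zero (nm t n (rho t n))
    (by rw [bd_nm, bd_rho ht, nm_tr_sub, ht, tr_one, sub_self])
  have := sub_mem (bd_mem_Bd d) (coinv_le_Bd (nm_sub_nsmul_mem t n (rho t n)))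
  rwa [hd, sub_sub_cancel] at this

lemma nm_mul (t : G) (k n : ℕ) (c : Ch G m) : nm t (k * n) c = nm (t ^ k) n (nm t k c) := by
  induction n with
  | zero => simp [nm_apply]
  | succ n ih =>
    rw [nm_apply, Nat.mul_succ, Finset.sum_range_add, ← nm_apply, ih, nm_apply (t ^ k) (n + 1),
      Finset.sum_range_succ, ← nm_apply (t ^ k) n, nm_apply t k c, map_sum (tr ((t ^ k) ^ n))]
    simp only [tr_tr, ← pow_mul, ← pow_add]

lemma nsmul_rho_sub_mem_Bd {t : G} {k n : ℕ} (ht : t ^ (k * n) = 1) :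
    k • rho t (k * n) - rho (t ^ k) n ∈ Bd (⊤ : Subgroup G) 4 := by
  have hs : (t ^ k) ^ n = 1 := by rw [← pow_mul, ht]
  obtain ⟨k₁, h₁⟩ := exists_bd_of_bd_eq_zero (pont₁ (t ^ k) - nm t k (pont₁ t))
    (by rw [map_sub, bd_nm, bd_pont₁, bd_pont₁, nm_tr_sub, sub_self])
  obtain ⟨k₂, h₂⟩ := exists_bd_of_bd_eq_zero
    (rhoAux (t ^ k) n - rhoAux t (k * n) - nm (t ^ k) n k₁)
    (by rw [map_sub, map_sub, bd_nm, bd_rhoAux hs, bd_rhoAux ht, h₁, nm_mul, ← map_sub, sub_self])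
  have h₃ : tr (t ^ k) (nm (t ^ k) n k₁) - nm (t ^ k) n k₁ = 0 := by
    rw [tr_nm_sub, hs, tr_one, sub_self]
  obtain ⟨k₃, h₄⟩ := exists_bd_of_bd_eq_zero
    (rho (t ^ k) n - nm t k (rho t (k * n)) - (tr (t ^ k) k₂ - k₂)) (by
      rw [map_sub, map_sub, map_sub, bd_nm, bd_cmap, bd_rho hs, bd_rho ht, h₂, nm_tr_sub,
        map_sub, map_sub]
      rw [← h₃]
      abel)
  have h₅ := add_mem (add_mem (bd_mem_Bd (S := (⊤ : Subgroup G)) k₃)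
    (coinv_le_Bd (nm_sub_nsmul_mem t k (rho t (k * n)))))
    (coinv_le_Bd (tr_sub_mem_coinv (Subgroup.mem_top (t ^ k)) k₂))
  rw [h₄] at h₅
  rw [← neg_mem_iff]
  convert h₅ using 1
  abel

end CyclicClasses

section Theta

/-- A compatible system of divisions gives a homomorphism from the rational numbers. -/
lemma exists_rat_hom {A : Type*} [AddCommGroup A] (r : ℕ → A)
    (hr : ∀ k n, k ≠ 0 → n ≠ 0 → k • r (k * n) = r n) :
    ∃ θ : ℚ →+ A, ∀ (a : ℤ) (n : ℕ), n ≠ 0 → θ (a / n) = a • r n := by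
  have key : ∀ (a b : ℤ) (n m : ℕ), n ≠ 0 → m ≠ 0 → (a : ℚ) / n = b / m → a • r n = b • r m := by
    intro a b n m hn hm h
    have hn' : (n : ℚ) ≠ 0 := by exact_mod_cast hn
    have hm' : (m : ℚ) ≠ 0 := by exact_mod_cast hm
    rw [div_eq_div_iff hn' hm'] at h
    have h' : a * m = b * n := by exact_mod_cast h
    rw [← hr m n hm hn, ← hr n m hn hm, ← natCast_zsmul, ← natCast_zsmul, smul_smul, smul_smul, h',
      mul_comm n m]
  have key' : ∀ (q : ℚ) (a : ℤ) (n : ℕ), n ≠ 0 → q = a / n → q.num • r q.den = a • r n :=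
    fun q a n hn h => key _ _ _ _ q.den_nz hn (by rw [Rat.num_div_den, h])
  refine ⟨AddMonoidHom.mk' (fun q => q.num • r q.den) fun p q => ?_, fun a n hn => ?_⟩
  · have hp : (p.den : ℚ) ≠ 0 := by exact_mod_cast p.den_nz
    have hq : (q.den : ℚ) ≠ 0 := by exact_mod_cast q.den_nz
    rw [key' (p + q) (p.num * q.den + q.num * p.den) (p.den * q.den)
      (mul_ne_zero p.den_nz q.den_nz) (by
        push_cast
        rw [add_div, mul_div_mul_right _ _ hq, mul_comm (p.den : ℚ), mul_div_mul_right _ _ hp,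
          Rat.num_div_den, Rat.num_div_den]),
      key' p (p.num * q.den) (p.den * q.den) (mul_ne_zero p.den_nz q.den_nz) (by
        push_cast; rw [mul_div_mul_right _ _ hq, Rat.num_div_den]),
      key' q (q.num * p.den) (p.den * q.den) (mul_ne_zero p.den_nz q.den_nz) (by
        push_cast; rw [mul_comm (p.den : ℚ), mul_div_mul_right _ _ hp, Rat.num_div_den]), add_smul]
  · exact key' _ a n hn rfl

/-- A primitive root of unity. -/
def zt (n : ℕ) : ℂˣ := Units.mk0 (exp (2 * Real.pi * I / n)) (exp_ne_zero _)

lemma zt_pow (n : ℕ) : zt n ^ n = 1 := by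
  rcases eq_or_ne n 0 with rfl | h
  · simp
  · ext
    simp only [zt, Units.val_pow_eq_pow_val, Units.val_mk0, Units.val_one]
    exact (isPrimitiveRoot_exp n h).pow_eq_one

lemma zt_mul_pow {k n : ℕ} (hk : k ≠ 0) : zt (k * n) ^ k = zt n := by
  have hk' : (k : ℂ) ≠ 0 := by exact_mod_cast hk
  ext
  simp only [zt, Units.val_pow_eq_pow_val, Units.val_mk0]
  rw [← exp_nat_mul]
  congr 1
  push_cast
  rcases eq_or_ne n 0 with rfl | h
  · simp
  · have h' : (n : ℂ) ≠ 0 := by exact_mod_cast h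
    field_simp

lemma tor_mem_Bd {n : ℕ} {c : Ch ℂˣ n} (hc : c ∈ Bd (⊤ : Subgroup ℂˣ) n) :
    cmap tor c ∈ Bd (⊤ : Subgroup PSL2C) n := Bd_mono le_top (tor_Bd hc)

lemma exists_zsmul_rho {t : ℂˣ} {n : ℕ} (hn : n ≠ 0) (ht : t ^ n = 1) :
    ∃ m : ℤ, rho t n - m • rho (zt n) n ∈ Bd (⊤ : Subgroup ℂˣ) 4 := by
  have hprim : IsPrimitiveRoot (zt n : ℂ) n := isPrimitiveRoot_exp n hn
  have : NeZero n := ⟨hn⟩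
  obtain ⟨i, -, hi⟩ := hprim.eq_pow_of_pow_eq_one
    (show (t : ℂ) ^ n = 1 by rw [← Units.val_pow_eq_pow_val, ht, Units.val_one])
  have hi' : zt n ^ i = t := by ext; simpa using hi
  let f : Multiplicative (ZMod n) →* ℂˣ := AddMonoidHom.toMultiplicativeLeft
    (ZMod.lift n ⟨(zmultiplesHom (Additive ℂˣ)) (Additive.ofMul (zt n)), by
      rw [zmultiplesHom_apply, natCast_zsmul, ← ofMul_pow, zt_pow, ofMul_one]⟩)
  have hf : f (Multiplicative.ofAdd 1) = zt n := by
    have h1 := ZMod.lift_coe n (⟨(zmultiplesHom (Additive ℂˣ)) (Additive.ofMul (zt n)), by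
      rw [zmultiplesHom_apply, natCast_zsmul, ← ofMul_pow, zt_pow, ofMul_one]⟩ :
        {f : ℤ →+ Additive ℂˣ // f n = 0}) 1
    rw [Int.cast_one] at h1
    refine (congrArg Additive.toMul h1).trans ?_
    simp
  have hft : f (Multiplicative.ofAdd 1 ^ i) = t := by rw [map_pow, hf, hi']
  obtain ⟨m, hm⟩ := (zmod_closed n).2 (rho (Multiplicative.ofAdd 1 ^ i) n)
    (rho_closed (by rw [← pow_mul, mul_comm, pow_mul, zmod_ofAdd_one_pow, one_pow])
      (Subgroup.mem_top _)) hn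
  refine ⟨m, ?_⟩
  have := (equivar_top f).cmap_Bd hm
  rwa [map_sub, map_zsmul, cmap_rho, cmap_rho, hft, hf] at this

lemma hcl_add_eq {c d : Ch PSL2C 4} (hc : c ∈ Closed (⊤ : Subgroup PSL2C) 3)
    (hd : d ∈ Closed (⊤ : Subgroup PSL2C) 3) (k : ℤ) :
    hcl ⟨c, hc⟩ = k • hcl ⟨d, hd⟩ ↔ c - k • d ∈ Bd (⊤ : Subgroup PSL2C) 4 := by
  rw [← map_zsmul, ← sub_eq_zero, ← map_sub, hcl_eq_zero]
  rfl

/-- The standard torsion classes. -/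
def rhoStd (n : ℕ) : H3PSL2C := rhoCl (zt n) n (zt_pow n)

lemma rhoStd_mul {k n : ℕ} (hk : k ≠ 0) : k • rhoStd (k * n) = rhoStd n := by
  have h := nsmul_rho_sub_mem_Bd (zt_pow (k * n))
  rw [zt_mul_pow hk, ← neg_mem_iff, neg_sub] at h
  have h' := tor_mem_Bd h
  rw [map_sub, map_nsmul, cmap_rho, cmap_rho, ← natCast_zsmul] at h'
  rw [← natCast_zsmul]
  exact ((hcl_add_eq _ _ k).2 h').symm

lemma zsmul_rhoStd_eq_zero {n : ℕ} {k : ℤ} :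
    k • rhoStd n = 0 ↔ k • rho (tor (zt n)) n ∈ Bd (⊤ : Subgroup PSL2C) 4 := by
  rw [rhoStd, rhoCl, ← map_zsmul, hcl_eq_zero]
  rfl

lemma rhoStd_one : rhoStd 1 = 0 := by
  have h := tor_mem_Bd (nsmul_rho_mem_Bd (zt_pow 1))
  rw [one_smul, cmap_rho] at h
  rw [← one_zsmul (rhoStd 1), zsmul_rhoStd_eq_zero, one_zsmul]
  exact h

theorem exists_theta : ∃ θ : ℚ →+ H3PSL2C, θ.range = blochMap.ker ∧ θ 1 = 0 ∧
    ∀ (a : ℤ) (n : ℕ), n ≠ 0 → θ (a / n) = a • rhoStd n := by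
  obtain ⟨θ, hθ⟩ := exists_rat_hom rhoStd fun k n hk _ => rhoStd_mul hk
  refine ⟨θ, le_antisymm ?_ fun x hx => ?_, ?_, hθ⟩
  · rintro _ ⟨q, rfl⟩
    rw [AddMonoidHom.mem_ker, ← Rat.num_div_den q, hθ _ _ q.den_nz, map_zsmul, rhoStd,
      blochMap_rhoCl, smul_zero]
  · obtain ⟨c, rfl⟩ := hcl_surjective x
    have h1 := mem_of_blochMap_eq_zero hx
    have h2 : RhoSpan ⊔ Bd ⊤ 4 ≤ (θ.range.comap hcl).map (Closed (⊤ : Subgroup PSL2C) 3).subtype := by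
      refine sup_le ((AddSubgroup.closure_le _).2 ?_) fun d hd => ?_
      · rintro _ ⟨t, n, hn, ht, rfl⟩
        refine ⟨⟨rho (tor t) n, rho_mem_Closed_top ht⟩, ?_, rfl⟩
        obtain ⟨m, hm⟩ := exists_zsmul_rho hn.ne' ht
        have h' := tor_mem_Bd hm
        rw [map_sub, map_zsmul, cmap_rho, cmap_rho] at h'
        refine AddMonoidHom.mem_range.2 ⟨m / n, ?_⟩
        rw [hθ _ _ hn.ne']
        exact ((hcl_add_eq _ _ m).2 h').symm
      · refine ⟨⟨d, Bd_le_Closed hd⟩, ?_, rfl⟩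
        refine AddMonoidHom.mem_range.2 ⟨0, ?_⟩
        rw [map_zero, hcl_eq_zero.2 hd]
    obtain ⟨c', hc', e⟩ := h2 h1
    rwa [show c' = c from Subtype.ext e] at hc'
  · have := hθ 1 1 one_ne_zero
    simpa [rhoStd_one] using this

end Theta

section CyclicCocycle

open FreeAbelianGroup

variable {C : Type*} [CommGroup C] {N : ℕ}

/-- The homogeneous three-cochain `χ ∪ β`. -/
def cupCochain (χ : C → ZMod N) (β : C → C → ℤ) : Ch C 4 →+ ZMod N :=
  lift fun g => χ ((g 0)⁻¹ * g 1) * β ((g 1)⁻¹ * g 2) ((g 2)⁻¹ * g 3)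

lemma cupCochain_of (χ : C → ZMod N) (β : C → C → ℤ) (a b c d : C) :
    cupCochain χ β (of ![a, b, c, d]) = χ (a⁻¹ * b) * β (b⁻¹ * c) (c⁻¹ * d) := by
  rw [cupCochain, lift_apply_of]
  rfl

lemma cupCochain_tr (χ : C → ZMod N) (β : C → C → ℤ) (g : C) (c : Ch C 4) :
    cupCochain χ β (tr g c) = cupCochain χ β c := by
  have : (cupCochain χ β).comp (tr g) = cupCochain χ β := by
    ext x
    obtain ⟨a, b, c, d, rfl⟩ := exists_eq_cons₄ x
    simp only [AddMonoidHom.comp_apply, cmap_of, comp_cons, Matrix.empty_eq]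
    rw [cupCochain_of, cupCochain_of]
    simp [mul_assoc]
  exact DFunLike.congr_fun this c

lemma cupCochain_bd (χ : C → ZMod N) (β : C → C → ℤ) (hχ : ∀ a b, χ (a * b) = χ a + χ b)
    (hβ : ∀ a b c, β b c - β (a * b) c + β a (b * c) - β a b = 0) (d : Ch C 5) :
    cupCochain χ β (bd 4 d) = 0 := by
  have : (cupCochain χ β).comp (bd 4) = 0 := by
    ext x
    obtain ⟨p, y, rfl⟩ := exists_vecCons x
    obtain ⟨a, b, c, d, rfl⟩ := exists_eq_cons₄ y
    simp only [AddMonoidHom.comp_apply, bd_succ_of, bd_zero_of, map_sub, cone_of, cupCochain_of,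
      AddMonoidHom.zero_apply]
    have h1 : p⁻¹ * b = (p⁻¹ * a) * (a⁻¹ * b) := by group
    have h2 := hβ (a⁻¹ * b) (b⁻¹ * c) (c⁻¹ * d)
    rw [show (a⁻¹ * b) * (b⁻¹ * c) = a⁻¹ * c by group,
      show (b⁻¹ * c) * (c⁻¹ * d) = b⁻¹ * d by group] at h2
    have h3 : ((β (b⁻¹ * c) (c⁻¹ * d) - β (a⁻¹ * c) (c⁻¹ * d) + β (a⁻¹ * b) (b⁻¹ * d) -
      β (a⁻¹ * b) (b⁻¹ * c) : ℤ) : ZMod N) = 0 := by rw [h2, Int.cast_zero]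
    rw [cupCochain_of, h1, hχ (p⁻¹ * a) (a⁻¹ * b)]
    push_cast at h3
    linear_combination -χ (p⁻¹ * a) * h3
  exact DFunLike.congr_fun this d

lemma cupCochain_rho (χ : C → ZMod N) (β : C → C → ℤ) (hχ : χ 1 = 0) (t : C) (n : ℕ) :
    cupCochain χ β (rho t n) = χ t * (∑ i ∈ Finset.range n, β (t ^ i) t : ℤ) := by
  rw [rho, rhoAux, nm_apply, map_sub (cone 1), map_sub]
  simp only [map_sum, pont₁, cmap_of, comp_cons, cone_of, Matrix.empty_eq, mul_one,
    cupCochain_of]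
  rw [show ∀ x y z : ZMod N, y = 0 → x = z → x - y = z by intros; simp_all]
  · refine Finset.sum_eq_zero fun i _ => ?_
    rw [inv_one, one_mul, hχ, zero_mul]
  · rw [Int.cast_sum, Finset.mul_sum]
    refine Finset.sum_congr rfl fun i _ => ?_
    simp [mul_assoc]

theorem exists_cyclic_cocycle [Finite C] [IsCyclic C] :
    ∃ φ : Ch C 4 →+ ZMod (Nat.card C), (∀ g c, φ (tr g c) = φ c) ∧ (∀ d, φ (bd 4 d) = 0) ∧
      ∀ (t : C) (n : ℕ), orderOf t = n → ∀ m : ℤ,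
        m • (φ (rho t n) + φ (rho t⁻¹ n)) = 0 → (n : ℤ) ∣ 2 * m := by
  have hN : Nat.card C ≠ 0 := Nat.card_pos.ne'
  have : NeZero (Nat.card C) := ⟨hN⟩
  have e : C ≃* Multiplicative (ZMod (Nat.card C)) := (zmodCyclicMulEquiv inferInstance).symm
  set N := Nat.card C
  set χ : C → ZMod N := fun c => Multiplicative.toAdd (e c) with hχ
  have hχm : ∀ a b, χ (a * b) = χ a + χ b := fun a b => by simp [hχ]
  have hχ1 : χ 1 = 0 := by simp [hχ]
  have hχp : ∀ (t : C) (i : ℤ), χ (t ^ i) = i * χ t := fun t i => by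
    simp [hχ]
  have hχi : ∀ t, χ t⁻¹ = -χ t := fun t => by simp [hχ]
  have hχ0 : ∀ t, χ t = 0 → t = 1 := fun t h => by
    have : e t = 1 := h
    simpa using this
  set v : C → ℤ := fun c => ((χ c).val : ℤ) with hv
  have hvχ : ∀ c, ((v c : ℤ) : ZMod N) = χ c := fun c => by simp [hv]
  have hdvd : ∀ a b, (N : ℤ) ∣ v a + v b - v (a * b) := fun a b => by
    rw [← ZMod.intCast_zmod_eq_zero_iff_dvd]
    push_cast
    rw [hvχ, hvχ, hvχ, hχm, sub_self]
  choose β hβ using hdvd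
  have hN' : (N : ℤ) ≠ 0 := by exact_mod_cast hN
  have hβc : ∀ a b c, β b c - β (a * b) c + β a (b * c) - β a b = 0 := fun a b c => by
    refine (mul_eq_zero.1 ?_).resolve_left hN'
    have h1 := hβ b c
    have h2 := hβ (a * b) c
    have h3 := hβ a (b * c)
    have h4 := hβ a b
    rw [mul_assoc] at h2
    linear_combination -h1 + h2 - h3 + h4
  have hsum : ∀ (t : C) (n : ℕ), t ^ n = 1 → N * ∑ i ∈ Finset.range n, β (t ^ i) t = n * v t := by
    intro t n ht
    rw [Finset.mul_sum]
    have : ∀ i ∈ Finset.range n, (N : ℤ) * β (t ^ i) t = v t - (v (t ^ (i + 1)) - v (t ^ i)) :=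
      fun i _ => by rw [← hβ, pow_succ]; ring
    rw [Finset.sum_congr rfl this, Finset.sum_sub_distrib, Finset.sum_range_sub (fun i => v (t ^ i)),
      ht, pow_zero, sub_self, sub_zero, Finset.sum_const, Finset.card_range, nsmul_eq_mul]
  refine ⟨cupCochain χ β, cupCochain_tr χ β, cupCochain_bd χ β hχm hβc, fun t n htn m hm => ?_⟩
  have ht : t ^ n = 1 := htn ▸ pow_orderOf_eq_one t
  rw [cupCochain_rho _ _ hχ1, cupCochain_rho _ _ hχ1, hχi] at hm
  have hk := hsum t n ht
  have hk' := hsum t⁻¹ n (by rw [inv_pow, ht, inv_one])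
  set k := ∑ i ∈ Finset.range n, β (t ^ i) t
  set k' := ∑ i ∈ Finset.range n, β (t⁻¹ ^ i) t⁻¹
  rcases eq_or_ne t 1 with h1 | h1
  · have : n = 1 := by rw [← htn, h1, orderOf_one]
    simp [this]
  have hn : 0 < n := htn ▸ orderOf_pos t
  have hvv : v t + v t⁻¹ = N := by
    have h2 : χ t ≠ 0 := fun h => h1 (hχ0 t h)
    have : NeZero (χ t) := ⟨h2⟩
    have h4 := ZMod.val_neg_of_ne_zero (χ t)
    have h5 := (ZMod.val_lt (χ t)).le
    simp only [hv, hχi, h4]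
    push_cast [h5]
    ring
  have hkk : k' = n - k := by
    refine mul_left_cancel₀ hN' ?_
    rw [hk', mul_sub, hk]
    linear_combination (n : ℤ) * hvv
  have hnχ : (n : ZMod N) * χ t = 0 := by
    have := hχp t n
    rw [zpow_natCast, ht, hχ1] at this
    exact_mod_cast this.symm
  have h3 : χ (t ^ (2 * m * k)) = 0 := by
    rw [hχp]
    rw [zsmul_eq_mul, hkk] at hm
    push_cast at hm ⊢
    linear_combination hm + m * hnχ
  have h4 : (n : ℤ) ∣ 2 * m * k := by
    rw [← htn]
    exact orderOf_dvd_iff_zpow_eq_one.2 (hχ0 _ h3)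
  refine IsCoprime.dvd_of_dvd_mul_right (Int.isCoprime_iff_gcd_eq_one.2 ?_) h4
  obtain ⟨n₁, hn₁⟩ := Int.gcd_dvd_left (n : ℤ) k
  obtain ⟨k₁, hk₁⟩ := Int.gcd_dvd_right (n : ℤ) k
  have hn0 : (n : ℤ) ≠ 0 := by exact_mod_cast hn.ne'
  have hd : ((Int.gcd n k : ℕ) : ℤ) ≠ 0 := by
    intro h
    rw [h, zero_mul] at hn₁
    exact hn0 hn₁
  have h5 : n₁ * v t = N * k₁ := by
    refine mul_left_cancel₀ hd ?_
    rw [← mul_assoc, ← hn₁, ← hk, mul_left_comm, ← hk₁]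
  have h6 : χ (t ^ n₁) = 0 := by
    rw [hχp, ← hvχ, ← Int.cast_mul, h5]
    simp
  have h7 : (n : ℤ) ∣ n₁ := by
    rw [← htn]
    exact orderOf_dvd_iff_zpow_eq_one.2 (hχ0 _ h6)
  have h8 : ((Int.gcd n k : ℕ) : ℤ) * n ∣ 1 * n := by
    rw [one_mul]
    nth_rewrite 3 [hn₁]
    exact mul_dvd_mul_left _ h7
  have h9 := (mul_dvd_mul_iff_right hn0).1 h8
  exact_mod_cast Int.eq_one_of_dvd_one (by positivity) h9

end CyclicCocycle

section FiniteProjectiveLine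

open FreeAbelianGroup

lemma cmap_rho_of_equivariant {H C : Type*} [Group H] [Group C] (f : H → C) (t : H) (z : C)
    (h1 : f 1 = 1) (hf : ∀ g, f (t * g) = z * f g) (n : ℕ) :
    cmap f (rho t n) = rho z n := by
  have hp : ∀ (i : ℕ) (g : H), f (t ^ i * g) = z ^ i * f g := fun i g => by
    induction i with
    | zero => simp
    | succ i ih => rw [pow_succ', mul_assoc, hf, ih, pow_succ', mul_assoc]
  have htr : ∀ {m : ℕ} (i : ℕ) (c : Ch H m), cmap f (tr (t ^ i) c) = tr (z ^ i) (cmap f c) :=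
    fun i c => by
      rw [tr, cmap_cmap, tr, cmap_cmap]
      exact congrArg (fun k => cmap k c) (funext fun g => hp i g)
  have h2 : cmap f (rhoAux t n) = rhoAux z n := by
    rw [rhoAux, cmap_cone, nm_apply, map_sum, h1, rhoAux, nm_apply]
    refine congrArg _ (Finset.sum_congr rfl fun i _ => ?_)
    rw [htr, pont₁, cmap_of, comp_cons, comp_cons, h1, ← mul_one t, hf, h1]
    simp [pont₁, Matrix.empty_eq]
  have h3 := htr 1 (rhoAux t n)
  rw [pow_one, pow_one] at h3
  rw [rho, cmap_cone, map_sub, h3, h2, h1, rho]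

lemma sum_eq_zero_of_orbit {C A : Type*} [Group C] [Fintype C] [AddCommGroup A] (s : C → A) (z : C)
    (h : ∀ a, ∑ i ∈ Finset.range (orderOf z), s (a * z ^ i) = 0) : ∑ a, s a = 0 := by
  have hb : Function.Bijective
      fun p : (C ⧸ Subgroup.zpowers z) × Subgroup.zpowers z => p.1.out * (p.2 : C) := by
    refine ⟨fun ⟨q, x⟩ ⟨q', x'⟩ hqx => ?_, fun a => ?_⟩
    · have hq : q = q' := by
        have := congrArg (QuotientGroup.mk (s := Subgroup.zpowers z)) hqx
        simpa using this
      subst hq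
      exact Prod.ext rfl (Subtype.ext (mul_left_cancel hqx))
    · refine ⟨(a, ⟨(a : C ⧸ Subgroup.zpowers z).out⁻¹ * a, ?_⟩), mul_inv_cancel_left _ _⟩
      exact QuotientGroup.eq.1 (QuotientGroup.out_eq' _)
  rw [← hb.sum_comp, Fintype.sum_prod_type]
  refine Finset.sum_eq_zero fun q _ => ?_
  have hq := h q.out
  rw [Finset.sum_range fun i => s (q.out * z ^ i),
    ← (finEquivZPowers (isOfFinOrder_of_finite z)).symm.sum_comp] at hq
  refine (Finset.sum_congr rfl fun x _ => ?_).trans hq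
  obtain ⟨i, rfl⟩ := (finEquivZPowers (isOfFinOrder_of_finite z)).surjective x
  rw [Equiv.symm_apply_apply, finEquivZPowers_apply]

variable {F : Type*} [Field F]

/-- The last nonvanishing coordinate of a vector. -/
def lastCoord (v : Fin 2 → F) : F := if v 1 = 0 then v 0 else v 1

lemma lastCoord_smul (c : F) (v : Fin 2 → F) : lastCoord (c • v) = c * lastCoord v := by
  rcases eq_or_ne c 0 with rfl | hc
  · simp [lastCoord]
  · simp only [lastCoord, Pi.smul_apply, smul_eq_mul, mul_eq_zero, hc, false_or]
    split_ifs <;> rfl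

lemma lastCoord_ne_zero {v : Fin 2 → F} (hv : v ≠ 0) : lastCoord v ≠ 0 := by
  rw [lastCoord]
  split_ifs with h
  · intro h0
    apply hv
    ext i
    fin_cases i
    exacts [h0, h]
  · exact h

/-- The square of the last nonvanishing coordinate of `B v`, as a unit. -/
def coordSq (v : Fin 2 → F) (B : Matrix.SpecialLinearGroup (Fin 2) F) : Fˣ :=
  if h : lastCoord (B.1.mulVec v) = 0 then 1 else Units.mk0 _ h ^ 2

lemma sl_mulVec_ne_zero (B : Matrix.SpecialLinearGroup (Fin 2) F) {v : Fin 2 → F} (hv : v ≠ 0) :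
    B.1.mulVec v ≠ 0 := fun h => hv <| by
  have : (B⁻¹ * B).1.mulVec v = 0 := by
    rw [Matrix.SpecialLinearGroup.coe_mul, ← Matrix.mulVec_mulVec, h, Matrix.mulVec_zero]
  simpa using this

lemma coordSq_val {v : Fin 2 → F} (hv : v ≠ 0) (B : Matrix.SpecialLinearGroup (Fin 2) F) :
    (coordSq v B : F) = lastCoord (B.1.mulVec v) ^ 2 := by
  rw [coordSq, dif_neg (lastCoord_ne_zero (sl_mulVec_ne_zero B hv))]
  simp

lemma coordSq_smul (c : Fˣ) {v : Fin 2 → F} (hv : v ≠ 0)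
    (B : Matrix.SpecialLinearGroup (Fin 2) F) :
    coordSq ((c : F) • v) B = c ^ 2 * coordSq v B := by
  ext
  have hc : (c : F) • v ≠ 0 := smul_ne_zero c.ne_zero hv
  rw [coordSq_val hc, Units.val_mul, coordSq_val hv, Matrix.mulVec_smul, lastCoord_smul, mul_pow]
  simp

lemma coordSq_mul {v : Fin 2 → F} (hv : v ≠ 0) {B B' A : Matrix.SpecialLinearGroup (Fin 2) F}
    (h : B'.1 = B.1 * A.1 ∨ B'.1 = -(B.1 * A.1)) : coordSq v B' = coordSq (A.1.mulVec v) B := by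
  ext
  rw [coordSq_val hv, coordSq_val (sl_mulVec_ne_zero A hv), Matrix.mulVec_mulVec]
  rcases h with h | h
  · rw [h]
  · rw [h, Matrix.neg_mulVec, ← neg_one_smul F, lastCoord_smul]
    ring

/-- Representatives of the points of the projective line. -/
def lineRep : Option F → Fin 2 → F
  | none => ![1, 0]
  | some a => ![a, 1]

/-- The point of the projective line spanned by a vector. -/
def linePt (v : Fin 2 → F) : Option F := if v 1 = 0 then none else some (v 0 / v 1)

lemma lineRep_ne_zero (y : Option F) : lineRep y ≠ 0 := by
  cases y
  · exact fun h => one_ne_zero (congrFun h 0)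
  · exact fun h => one_ne_zero (congrFun h 1)

lemma linePt_lineRep (y : Option F) : linePt (lineRep y) = y := by
  cases y <;> simp [linePt, lineRep]

lemma linePt_smul (c : Fˣ) (v : Fin 2 → F) : linePt ((c : F) • v) = linePt v := by
  simp [linePt, mul_div_mul_left]

lemma exists_smul_lineRep {v : Fin 2 → F} (hv : v ≠ 0) :
    ∃ c : Fˣ, v = (c : F) • lineRep (linePt v) := by
  refine ⟨Units.mk0 _ (lastCoord_ne_zero hv), ?_⟩
  ext i
  by_cases h : v 1 = 0 <;> fin_cases i <;> simp [lastCoord, linePt, lineRep, h, mul_div_cancel₀]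

variable {G H : Type*} [Group G] [Group H] (φ : H →* G)
  (red : H →* Matrix.SpecialLinearGroup (Fin 2) F)

lemma exists_equivariant_matrix (hφ : ∀ A, φ A = 1 → (red A).1 = 1 ∨ (red A).1 = -1) : ∃ b : G → Matrix.SpecialLinearGroup (Fin 2) F, ∀ A g,
    (b (φ A * g)).1 = (b g).1 * (red A)⁻¹.1 ∨ (b (φ A * g)).1 = -((b g).1 * (red A)⁻¹.1) := by
  obtain ⟨ρ, hρ, -⟩ := exists_retraction φ.range
  choose l hl using fun g => (ρ g).2
  refine ⟨fun g => (red (l g))⁻¹, fun A g => ?_⟩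
  have h1 : φ (A * l g * (l (φ A * g))⁻¹) = 1 := by
    have := congrArg Subtype.val (hρ ⟨φ A, ⟨A, rfl⟩⟩ g)
    rw [map_mul, map_mul, map_inv, hl, hl, this, Subgroup.coe_mul, mul_inv_cancel]
  have h2 : (red (l (φ A * g)))⁻¹ =
      (red (l g))⁻¹ * (red A)⁻¹ * red (A * l g * (l (φ A * g))⁻¹) := by
    simp only [map_mul, map_inv]
    group
  show (red (l (φ A * g)))⁻¹.1 = (red (l g))⁻¹.1 * (red A)⁻¹.1 ∨
    (red (l (φ A * g)))⁻¹.1 = -((red (l g))⁻¹.1 * (red A)⁻¹.1)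
  rw [h2, Matrix.SpecialLinearGroup.coe_mul, Matrix.SpecialLinearGroup.coe_mul]
  rcases hφ _ h1 with h | h
  · exact Or.inl (by rw [h, mul_one])
  · exact Or.inr (by rw [h, mul_neg, mul_one])

lemma linePt_mulVec_bijective [Finite F] (A : Matrix.SpecialLinearGroup (Fin 2) F) :
    Function.Bijective fun y : Option F => linePt (A.1.mulVec (lineRep y)) := by
  refine Finite.injective_iff_bijective.1 fun y y' h => ?_
  obtain ⟨c, hc⟩ := exists_smul_lineRep (sl_mulVec_ne_zero A (lineRep_ne_zero y))
  obtain ⟨c', hc'⟩ := exists_smul_lineRep (sl_mulVec_ne_zero A (lineRep_ne_zero y'))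
  have hcc : A.1.mulVec (lineRep y) = A.1.mulVec (((c * c'⁻¹ : Fˣ) : F) • lineRep y') := by
    rw [hc, Matrix.mulVec_smul, hc', smul_smul]
    have : linePt (A.1.mulVec (lineRep y)) = linePt (A.1.mulVec (lineRep y')) := h
    rw [this, Units.val_mul, mul_assoc, Units.inv_mul, mul_one]
  have hv := congrArg (A⁻¹).1.mulVec hcc
  rw [Matrix.mulVec_mulVec, Matrix.mulVec_mulVec, ← Matrix.SpecialLinearGroup.coe_mul,
    inv_mul_cancel, Matrix.SpecialLinearGroup.coe_one, Matrix.one_mulVec, Matrix.one_mulVec] at hv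
  rw [← linePt_lineRep y, hv, linePt_smul, linePt_lineRep]

/-- A functional on chains attached to a vector in the plane. -/
def planeFun {M : Type*} [AddCommGroup M] (ψ : Ch Fˣ 4 →+ M)
    (b : G → Matrix.SpecialLinearGroup (Fin 2) F) (v : Fin 2 → F) : Ch G 4 →+ M :=
  ψ.comp (cmap fun g => coordSq v (b g))

lemma apply_cmap_of_mul {M C : Type*} [AddCommGroup M] [CommGroup C] {ψ : Ch C 4 →+ M}
    (hψ : ∀ z c, ψ (tr z c) = ψ c) (z : C) {f f' : G → C} (hf : ∀ g, f' g = z * f g) (c : Ch G 4) :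
    ψ (cmap f' c) = ψ (cmap f c) := by
  rw [← hψ z (cmap f c), tr, cmap_cmap]
  exact congrArg (fun k => ψ (cmap k c)) (funext hf)

lemma apply_cmap_rho {M C : Type*} [AddCommGroup M] [CommGroup C] {ψ : Ch C 4 →+ M}
    (hψ : ∀ z c, ψ (tr z c) = ψ c) (t : G) (z : C) {f : G → C} (hf : ∀ g, f (t * g) = z * f g)
    (n : ℕ) : ψ (cmap f (rho t n)) = ψ (rho z n) := by
  rw [← apply_cmap_of_mul hψ (f 1)⁻¹ (f := f) (f' := fun g => (f 1)⁻¹ * f g) (fun _ => rfl),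
    cmap_rho_of_equivariant (fun g => (f 1)⁻¹ * f g) t z (inv_mul_cancel _) fun g => ?_]
  rw [hf, mul_left_comm]

section PlaneFun

variable {M : Type*} [AddCommGroup M] {ψ : Ch Fˣ 4 →+ M} {b : G → Matrix.SpecialLinearGroup (Fin 2) F}

lemma planeFun_bd (hψ : ∀ d, ψ (bd 4 d) = 0) (v : Fin 2 → F) (d : Ch G 5) :
    planeFun ψ b v (bd 4 d) = 0 := by
  rw [planeFun, AddMonoidHom.comp_apply, ← bd_cmap, hψ]

lemma planeFun_smul (hψ : ∀ z c, ψ (tr z c) = ψ c) {v : Fin 2 → F} (hv : v ≠ 0) (a : Fˣ)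
    (c : Ch G 4) : planeFun ψ b ((a : F) • v) c = planeFun ψ b v c :=
  apply_cmap_of_mul hψ (a ^ 2) (fun g => coordSq_smul a hv (b g)) c

lemma planeFun_linePt (hψ : ∀ z c, ψ (tr z c) = ψ c) {v : Fin 2 → F} (hv : v ≠ 0)
    (c : Ch G 4) : planeFun ψ b (lineRep (linePt v)) c = planeFun ψ b v c := by
  obtain ⟨a, ha⟩ := exists_smul_lineRep hv
  conv_rhs => rw [ha]
  exact (planeFun_smul hψ (lineRep_ne_zero _) a c).symm

lemma planeFun_tr {t : G} {A : Matrix.SpecialLinearGroup (Fin 2) F}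
    (hb : ∀ g, (b (t * g)).1 = (b g).1 * A.1 ∨ (b (t * g)).1 = -((b g).1 * A.1))
    {v : Fin 2 → F} (hv : v ≠ 0) (c : Ch G 4) :
    planeFun ψ b v (tr t c) = planeFun ψ b (A.1.mulVec v) c := by
  rw [planeFun, AddMonoidHom.comp_apply, tr, cmap_cmap]
  exact congrArg (fun k => ψ (cmap k c)) (funext fun g => coordSq_mul hv (hb g))

lemma planeFun_rho (hψ : ∀ z c, ψ (tr z c) = ψ c) {t : G} {A : Matrix.SpecialLinearGroup (Fin 2) F}
    (hb : ∀ g, (b (t * g)).1 = (b g).1 * A.1 ∨ (b (t * g)).1 = -((b g).1 * A.1))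
    {v : Fin 2 → F} (hv : v ≠ 0) (a : Fˣ) (ha : A.1.mulVec v = (a : F) • v) (n : ℕ) :
    planeFun ψ b v (rho t n) = ψ (rho (a ^ 2) n) :=
  apply_cmap_rho hψ t (a ^ 2)
    (fun g => by rw [coordSq_mul hv (hb g), ha, coordSq_smul a hv]) n

end PlaneFun

lemma diag_mulVec (p q x y : F) : (!![p, 0; 0, q]).mulVec ![x, y] = ![p * x, q * y] := by
  ext i
  fin_cases i <;> simp [Matrix.mulVec, dotProduct, Fin.sum_univ_two]

lemma sum_field_eq [Fintype F] {M : Type*} [AddCommGroup M] (s : F → M) :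
    ∑ a, s a = s 0 + ∑ a : Fˣ, s a := by
  rw [Fintype.sum_eq_add_sum_compl 0]
  congr 1
  refine (Finset.sum_nbij (fun a : Fˣ => (a : F)) (fun a _ => ?_) (fun a _ b _ h => Units.ext h)
    (fun a ha => ?_) fun _ _ => rfl).symm
  · simp
  · have ha' : a ≠ 0 := by simpa using ha
    exact ⟨Units.mk0 a ha', by simp, rfl⟩

lemma sum_planeFun_rho [Fintype F] {M : Type*} [AddCommGroup M] {ψ : Ch Fˣ 4 →+ M}
    {b : G → Matrix.SpecialLinearGroup (Fin 2) F} (hψ : ∀ z c, ψ (tr z c) = ψ c)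
    (hψbd : ∀ d, ψ (bd 4 d) = 0) {t : G} {A : Matrix.SpecialLinearGroup (Fin 2) F}
    (hb : ∀ g, (b (t * g)).1 = (b g).1 * A.1 ∨ (b (t * g)).1 = -((b g).1 * A.1)) (u : Fˣ)
    (hA : A.1 = !![(↑u⁻¹ : F), 0; 0, (u : F)]) {n : ℕ} (hn : orderOf (u ^ 2) = n) (htn : t ^ n = 1) :
    ∑ y : Option F, planeFun ψ b (lineRep y) (rho t n) =
      ψ (rho (u ^ 2)⁻¹ n) + ψ (rho (u ^ 2) n) := by
  have step : ∀ (a : Fˣ) c, planeFun ψ b (lineRep (some ((a * (u ^ 2)⁻¹ : Fˣ) : F))) c =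
      planeFun ψ b (lineRep (some (a : F))) (tr t c) := fun a c => by
    rw [planeFun_tr hb (lineRep_ne_zero _), ← planeFun_smul hψ (lineRep_ne_zero (some _)) u]
    congr 2
    rw [hA, lineRep, lineRep, diag_mulVec]
    ext i
    fin_cases i
    · simp
      field_simp
    · simp
  have hsum : ∑ a : Fˣ, planeFun ψ b (lineRep (some (a : F))) (rho t n) = 0 := by
    refine sum_eq_zero_of_orbit _ (u ^ 2)⁻¹ fun a => ?_
    obtain ⟨e, he⟩ := exists_bd_of_bd_eq_zero (nm t n (rho t n)) (by
      rw [bd_nm, bd_rho htn, nm_tr_sub, htn, tr_one, sub_self])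
    have h0 := planeFun_bd (b := b) hψbd (lineRep (some (a : F))) e
    rw [he, nm_apply, map_sum] at h0
    rw [orderOf_inv, hn]
    refine (Finset.sum_congr rfl fun i hi => ?_).trans h0
    clear h0 he e hi
    generalize rho t n = c
    induction i generalizing a with
    | zero => simp [tr_one]
    | succ i ih => rw [pow_succ', ← mul_assoc, ih, step, tr_tr, pow_succ']
  rw [Fintype.sum_option, sum_field_eq, hsum, add_zero,
    planeFun_rho hψ hb (lineRep_ne_zero _) u⁻¹, planeFun_rho hψ hb (lineRep_ne_zero _) u, inv_pow]
  · rw [hA, lineRep, diag_mulVec]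
    ext i
    fin_cases i <;> simp
  · rw [hA, lineRep, diag_mulVec]
    ext i
    fin_cases i <;> simp

variable [Finite F]

theorem dvd_of_rho_mem_coinv (hφ : ∀ A, φ A = 1 → (red A).1 = 1 ∨ (red A).1 = -1) (D : H) (u : Fˣ)
    (hD : (red D)⁻¹.1 = !![(↑u⁻¹ : F), 0; 0, (u : F)]) {n : ℕ} (hn : orderOf (u ^ 2) = n)
    (hDn : φ D ^ n = 1) {m : ℤ} {d : Ch G 5}
    (h : m • rho (φ D) n - bd 4 d ∈ coinv φ.range (Fin 4 → G)) : (n : ℤ) ∣ 2 * m := by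
  have := Fintype.ofFinite F
  obtain ⟨b, hb⟩ := exists_equivariant_matrix φ red hφ
  obtain ⟨ψ, hψtr, hψbd, hψ⟩ := exists_cyclic_cocycle (C := Fˣ)
  have hs := sum_planeFun_rho hψtr hψbd (fun g => hb D g) u hD hn hDn
  set Θ : Ch G 4 →+ ZMod (Nat.card Fˣ) := ∑ y : Option F, planeFun ψ b (lineRep y) with hΘd
  have hΘ : ∀ c, Θ c = ∑ y : Option F, planeFun ψ b (lineRep y) c :=
    fun c => AddMonoidHom.finsetSum_apply ..
  rw [← hΘ] at hs
  have hΘ0 : Θ (m • rho (φ D) n - bd 4 d) = 0 := by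
    refine (AddSubgroup.mem_bot).1 (coinv_le_of_tr Θ ⊥ ?_ h)
    rintro _ ⟨A, rfl⟩ c
    rw [AddSubgroup.mem_bot, sub_eq_zero, hΘ, hΘ,
      ← (linePt_mulVec_bijective (red A)⁻¹).sum_comp fun y => planeFun ψ b (lineRep y) c]
    refine Finset.sum_congr rfl fun y _ => ?_
    rw [planeFun_tr (fun g => hb A g) (lineRep_ne_zero y),
      planeFun_linePt hψtr (sl_mulVec_ne_zero _ (lineRep_ne_zero y))]
  have hbd0 : Θ (bd 4 d) = 0 := by
    rw [hΘ]
    exact Finset.sum_eq_zero fun y _ => planeFun_bd hψbd _ _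
  rw [map_sub, hbd0, sub_zero, map_zsmul, hs, add_comm] at hΘ0
  exact hψ (u ^ 2) n hn m hΘ0

end FiniteProjectiveLine

section Detection

lemma isJacobsonRing_int : IsJacobsonRing ℤ := by
  refine isJacobsonRing_iff_prime_eq.2 fun P hP => ?_
  rcases eq_or_ne P ⊥ with rfl | h
  · refine le_antisymm (fun x hx => ?_) bot_le
    have h1 := Ideal.mem_jacobson_bot.1 hx x
    rw [Ideal.mem_bot]
    rcases Int.isUnit_iff.1 h1 with h2 | h2 <;> nlinarith [mul_self_nonneg x]
  · have := hP.isMaximal h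
    exact Ideal.jacobson_eq_self_of_isMaximal

lemma finite_field_of_surjective {R : Type*} [CommRing R] [hR : Algebra.FiniteType ℤ R]
    (F : Type*) [Field F] (f : R →+* F) (hf : Function.Surjective f) : Finite F := by
  have : Algebra.FiniteType ℤ F := Algebra.FiniteType.of_surjective f.toIntAlgHom hf
  have := isJacobsonRing_int
  have hfin : Module.Finite ℤ F := finite_of_finite_type_of_isJacobsonRing ℤ F
  have hp : ∃ p : ℤ, p ≠ 0 ∧ (p : F) = 0 := by
    by_contra! hc
    have hinj : Function.Injective (algebraMap ℤ F) :=
      (injective_iff_map_eq_zero _).2 fun a ha => by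
        by_contra h0
        exact hc a h0 (by simpa using ha)
    exact Int.not_isField (isField_of_isIntegral_of_isField hinj (Field.toIsField F))
  obtain ⟨p, hp0, hp⟩ := hp
  refine Module.finite_of_fg_torsion F fun x => ⟨⟨p, mem_nonZeroDivisors_of_ne_zero hp0⟩, ?_⟩
  show p • x = 0
  rw [zsmul_eq_mul, hp, zero_mul]

lemma exists_residue_field (E : Finset ℂ) : ∃ R : Subring ℂ, (E : Set ℂ) ⊆ R ∧
    ∃ (F : Type) (_ : Field F) (_ : Finite F), Nonempty (R →+* F) := by
  let R := Algebra.adjoin ℤ (E : Set ℂ)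
  have hR : Algebra.FiniteType ℤ R := Algebra.FiniteType.adjoin_of_finite E.finite_toSet
  obtain ⟨m, hm⟩ := Ideal.exists_maximal R
  let hF : Field (R ⧸ m) := Ideal.Quotient.field m
  exact ⟨R.toSubring, Algebra.subset_adjoin, R ⧸ m, hF,
    finite_field_of_surjective (R := R) _ (Ideal.Quotient.mk m) Ideal.Quotient.mk_surjective,
    ⟨Ideal.Quotient.mk m⟩⟩

theorem dvd_of_zsmul_rhoStd_eq_zero {n : ℕ} (hn : n ≠ 0) {m : ℤ} (h : m • rhoStd n = 0) :
    (n : ℤ) ∣ 2 * m := by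
  obtain ⟨d, hd⟩ := mem_Bd.1 (zsmul_rhoStd_eq_zero.1 h)
  obtain ⟨T, -, hT⟩ := exists_finset_of_mem_coinv hd
  choose L hL using prj_surjective
  obtain ⟨u, w, huw, hu⟩ : ∃ u w : ℂ, u * w = 1 ∧ u ^ 2 = zt n :=
    ⟨_, _, mul_inv_cancel₀ (usqrt_ne_zero (zt n)), usqrt_sq _⟩
  obtain ⟨R, hR, F, _, _, ⟨red⟩⟩ := exists_residue_field
    ({u, w} ∪ (Finset.range n).image (fun i => ((zt n : ℂ) ^ i - 1)⁻¹) ∪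
      (T ×ˢ (Finset.univ : Finset (Fin 2 × Fin 2))).image fun p => (L p.1).1 p.2.1 p.2.2)
  have huR : u ∈ R := hR (by simp)
  have hwR : w ∈ R := hR (by simp)
  have hiR : ∀ i < n, ((zt n : ℂ) ^ i - 1)⁻¹ ∈ R := fun i hi =>
    hR (by
      rw [Finset.mem_coe, Finset.mem_union, Finset.mem_union]
      exact Or.inl (Or.inr (Finset.mem_image.2 ⟨i, Finset.mem_range.2 hi, rfl⟩)))
  have hTR : ∀ g ∈ T, ∀ i j, (L g).1 i j ∈ R := fun g hg i j =>
    hR (by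
      rw [Finset.mem_coe, Finset.mem_union]
      exact Or.inr (Finset.mem_image.2 ⟨(g, i, j), by simp [hg], rfl⟩))
  let ι := Matrix.SpecialLinearGroup.map (n := Fin 2) R.subtype
  have hι : ∀ A, (ι A).1 = A.1.map R.subtype := fun A => rfl
  have hinj : Function.Injective fun M : Matrix (Fin 2) (Fin 2) R => M.map R.subtype :=
    Matrix.map_injective Subtype.val_injective
  let D : Matrix.SpecialLinearGroup (Fin 2) R := ⟨!![⟨u, huR⟩, 0; 0, ⟨w, hwR⟩], by
    rw [Matrix.det_fin_two_of, mul_zero, sub_zero]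
    exact Subtype.ext huw⟩
  have huw' : red ⟨u, huR⟩ * red ⟨w, hwR⟩ = 1 := by
    rw [← map_mul, ← map_one red]
    exact congrArg red (Subtype.ext huw)
  let v : Fˣ := ⟨red ⟨u, huR⟩, red ⟨w, hwR⟩, huw', by rw [mul_comm, huw']⟩
  have hD : (prj.comp ι) D = tor (zt n) := by
    rw [MonoidHom.comp_apply, ← prj_dg huw (zt n) hu]
    congr 1
    ext i j
    rw [hι]
    fin_cases i <;> fin_cases j <;> simp [D, dg]
  have hpow : ∀ i, ((v ^ 2) ^ i : Fˣ) = red (⟨u, huR⟩ ^ (2 * i)) := fun i => by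
    rw [map_pow, pow_mul, Units.val_pow_eq_pow_val, Units.val_pow_eq_pow_val]
  have hval : ∀ i, ((⟨u, huR⟩ ^ (2 * i) : R) : ℂ) = (zt n : ℂ) ^ i := fun i => by
    rw [SubmonoidClass.coe_pow, pow_mul, hu]
  refine dvd_of_rho_mem_coinv (prj.comp ι) (Matrix.SpecialLinearGroup.map red) (fun A hA => ?_) D v
    ?_ ?_ ?_ (d := d) ?_
  · rcases prj_eq_one_iff.1 hA with h1 | h1
    · left
      have : A.1 = 1 := hinj (by simpa [hι] using h1)
      simp [this]
    · right
      have : A.1 = -1 := hinj (by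
        have h2 : A.1.map R.subtype = -1 := h1
        simp only [h2]
        ext i j
        fin_cases i <;> fin_cases j <;> simp)
      ext i j
      fin_cases i <;> fin_cases j <;> simp [this]
  · have hDr : (Matrix.SpecialLinearGroup.map red D).1 = !![(v : F), 0; 0, (↑v⁻¹ : F)] := by
      ext i j
      show red (D.1 i j) = _
      fin_cases i <;> fin_cases j <;> simp [D, v]
    rw [Matrix.SpecialLinearGroup.coe_inv, hDr, Matrix.adjugate_fin_two_of, neg_zero]
  · refine (orderOf_eq_iff (Nat.pos_of_ne_zero hn)).2 ⟨?_, fun i hi hi0 h1 => ?_⟩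
    · ext
      rw [hpow, Units.val_one, ← map_one red]
      refine congrArg red (Subtype.ext ?_)
      rw [hval, ← Units.val_pow_eq_pow_val, zt_pow]
      rfl
    · have hz : (zt n : ℂ) ^ i - 1 ≠ 0 := by
        rw [sub_ne_zero]
        exact (Complex.isPrimitiveRoot_exp n hn).pow_ne_one_of_pos_of_lt hi0.ne' hi
      have h2 : (⟨_, hiR i hi⟩ : R) * (⟨u, huR⟩ ^ (2 * i) - 1) = 1 := by
        apply Subtype.ext
        rw [Subring.coe_mul, AddSubgroupClass.coe_sub, hval]
        exact inv_mul_cancel₀ hz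
      have h3 := congrArg red h2
      rw [map_mul, map_sub, ← hpow, h1] at h3
      simp at h3
  · rw [hD, ← map_pow, zt_pow, map_one]
  · rw [hD]
    refine hT _ fun g hg => ⟨⟨Matrix.of fun i j => (⟨_, hTR g hg i j⟩ : R), ?_⟩, ?_⟩
    · apply Subtype.ext
      refine Eq.trans ?_ (L g).2
      rw [Matrix.det_fin_two, Matrix.det_fin_two]
      rfl
    · exact hL g

end Detection

section FiveTermLifts

/-- The tuples satisfying the linear relations which cut out the lifted five term relation. -/
def lin5 (a₀ c₀ a₁ c₁ c₂ : ℂ) : Fin 5 → ℂ × ℂ :=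
  ![(a₀, c₀), (a₁, c₁), (a₁ - a₀, c₂), (a₁ - a₀ + c₁ - c₀, c₂ - c₁), (c₁ - c₀, c₂ - c₁ - a₀)]

lemma liesOver_iff {w : ℂ × ℂ} {z : ℂ} :
    LiesOver w z ↔ Reg z ∧ exp (2 * w.1) = z ^ 2 ∧ exp (-(2 * w.2)) = (1 - z) ^ 2 := by
  have key : ∀ {b u : ℂ}, u ≠ 0 → (exp (2 * b) = u ^ 2 ↔ ∃ n : ℤ, b = log u + n * (Cpi * I)) := by
    intro b u hu
    have h2 : u ^ 2 = exp (2 * log u) := by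
      rw [two_mul, exp_add, exp_log hu, sq]
    rw [h2, exp_eq_exp_iff_exists_int]
    refine exists_congr fun n => ?_
    unfold Cpi
    constructor <;> intro h
    · linear_combination h / 2
    · linear_combination 2 * h
  refine and_congr_right fun hz => ?_
  have h1 : (1 : ℂ) - z ≠ 0 := sub_ne_zero.2 (Ne.symm hz.2)
  rw [show -(2 * w.2) = 2 * (-w.2) by ring, key hz.1, key h1]
  constructor
  · rintro ⟨p, q, h⟩
    refine ⟨⟨p, congrArg Prod.fst h⟩, -q, ?_⟩
    rw [h]; simp only [pt]; push_cast; ring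
  · rintro ⟨⟨p, hp⟩, q, hq⟩
    refine ⟨p, -q, Prod.ext hp ?_⟩
    simp only [pt]; push_cast; linear_combination -hq

/-- The function recovering the base coordinate of a point of the cover. -/
def zOf (w : ℂ × ℂ) : ℂ := (1 + exp (2 * w.1) - exp (-(2 * w.2))) / 2

lemma LiesOver.zOf_eq {w : ℂ × ℂ} {z : ℂ} (h : LiesOver w z) : zOf w = z := by
  obtain ⟨-, h1, h2⟩ := liesOver_iff.1 h
  rw [zOf, h1, h2]; ring

lemma LiesOver.mem_Cover {w : ℂ × ℂ} {z : ℂ} (h : LiesOver w z) : w ∈ Cover := ⟨z, h⟩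

lemma liesOver_of_mem {w : ℂ × ℂ} (h : w ∈ Cover) : LiesOver w (zOf w) := by
  obtain ⟨z, h⟩ := h
  have h' : LiesOver w z := h
  rwa [h'.zOf_eq]

lemma liesOver_pt {z : ℂ} (h : Reg z) (p q : ℤ) : LiesOver (pt z p q) z := ⟨h, p, q, rfl⟩

lemma exp_two_Cpi (n : ℤ) : exp (2 * (n * (Cpi * I))) = 1 :=
  exp_eq_one_iff.2 ⟨n, by unfold Cpi; ring⟩

lemma LiesOver.covAct {w : ℂ × ℂ} {z : ℂ} (h : LiesOver w z) (v : ℤ × ℤ) :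
    LiesOver (covAct v w) z := by
  rw [liesOver_iff] at h ⊢
  refine ⟨h.1, ?_, ?_⟩
  · simp only [ExtendedBloch.covAct]
    rw [mul_add, exp_add, exp_two_Cpi, mul_one, h.2.1]
  · simp only [ExtendedBloch.covAct]
    rw [mul_add, neg_add, exp_add, exp_neg (2 * (_ * _)), exp_two_Cpi, inv_one, mul_one, h.2.2]

lemma LiesOver.exists_covAct {w w' : ℂ × ℂ} {z : ℂ} (h : LiesOver w z) (h' : LiesOver w' z) :
    ∃ p q : ℤ, w' = (w.1 + p * (Cpi * I), w.2 + q * (Cpi * I)) := by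
  obtain ⟨-, p, q, rfl⟩ := h
  obtain ⟨-, p', q', rfl⟩ := h'
  refine ⟨p' - p, q' - q, ?_⟩
  simp only [pt]; push_cast
  refine Prod.ext ?_ ?_ <;> simp only <;> ring

variable {x y : ℂ}

lemma ft_three_eq (hx : Reg x) (hy : Reg y) :
    (1 - x⁻¹) / (1 - y⁻¹) = y / x * ((1 - x) / (1 - y)) := by
  have h1 := hx.1
  have h2 := hy.1
  have h3 : (1 : ℂ) - y ≠ 0 := sub_ne_zero.2 (Ne.symm hy.2)
  have h4 : y - 1 ≠ 0 := sub_ne_zero.2 hy.2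
  have h5 : (1 : ℂ) - y⁻¹ ≠ 0 := by
    rw [sub_ne_zero]; intro h; exact hy.2 (inv_eq_one.1 h.symm)
  field_simp
  ring

lemma ft_one_sub_three (hx : Reg x) (hy : Reg y) :
    1 - (1 - x⁻¹) / (1 - y⁻¹) = (1 - y / x) / (1 - y) := by
  rw [ft_three_eq hx hy]
  have h1 := hx.1
  have h3 : (1 : ℂ) - y ≠ 0 := sub_ne_zero.2 (Ne.symm hy.2)
  field_simp
  ring

lemma ft_one_sub_four (hx : Reg x) (hy : Reg y) :
    1 - (1 - x) / (1 - y) = x * ((1 - y / x) / (1 - y)) := by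
  have h1 := hx.1
  have h3 : (1 : ℂ) - y ≠ 0 := sub_ne_zero.2 (Ne.symm hy.2)
  field_simp
  ring

/-- The defining data of a lift of a five term tuple. -/
structure IsLift (x y a₀ c₀ a₁ c₁ c₂ : ℂ) : Prop where
  hx : Reg x
  hy : Reg y
  hne : x ≠ y
  ha₀ : exp (2 * a₀) = x ^ 2
  hc₀ : exp (-(2 * c₀)) = (1 - x) ^ 2
  ha₁ : exp (2 * a₁) = y ^ 2
  hc₁ : exp (-(2 * c₁)) = (1 - y) ^ 2
  hc₂ : exp (-(2 * c₂)) = (1 - y / x) ^ 2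

variable {a₀ c₀ a₁ c₁ c₂ : ℂ}

lemma IsLift.liesOver (h : IsLift x y a₀ c₀ a₁ c₁ c₂) (i : Fin 5) :
    LiesOver (lin5 a₀ c₀ a₁ c₁ c₂ i) (ftTuple x y i) := by
  obtain ⟨hx, hy, hne, ha₀, hc₀, ha₁, hc₁, hc₂⟩ := h
  have hr := reg_ftTuple hx hy hne i
  have h1 := hx.1
  have h2 := hy.1
  have h3 : (1 : ℂ) - y ≠ 0 := sub_ne_zero.2 (Ne.symm hy.2)
  have h4 : (1 : ℂ) - x ≠ 0 := sub_ne_zero.2 (Ne.symm hx.2)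
  have na₀ : exp (-(2 * a₀)) = (x ^ 2)⁻¹ := by rw [exp_neg, ha₀]
  have nc₀ : exp (2 * c₀) = ((1 - x) ^ 2)⁻¹ := by rw [← hc₀, exp_neg, inv_inv]
  have nc₁ : exp (2 * c₁) = ((1 - y) ^ 2)⁻¹ := by rw [← hc₁, exp_neg, inv_inv]
  rw [liesOver_iff]
  refine ⟨hr, ?_⟩
  have e3 := ft_three_eq hx hy
  have e3' := ft_one_sub_three hx hy
  have e4' := ft_one_sub_four hx hy
  fin_cases i
  · exact ⟨ha₀, hc₀⟩
  · exact ⟨ha₁, hc₁⟩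
  · refine ⟨?_, hc₂⟩
    change exp (2 * (a₁ - a₀)) = (y / x) ^ 2
    rw [show 2 * (a₁ - a₀) = 2 * a₁ + -(2 * a₀) by ring, exp_add, ha₁, na₀]
    ring
  · change exp (2 * (a₁ - a₀ + c₁ - c₀)) = ((1 - x⁻¹) / (1 - y⁻¹)) ^ 2 ∧
      exp (-(2 * (c₂ - c₁))) = (1 - (1 - x⁻¹) / (1 - y⁻¹)) ^ 2
    rw [e3', e3, show 2 * (a₁ - a₀ + c₁ - c₀) = 2 * a₁ + -(2 * a₀) + 2 * c₁ + -(2 * c₀) by ring,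
      show -(2 * (c₂ - c₁)) = -(2 * c₂) + 2 * c₁ by ring]
    simp only [exp_add, ha₁, na₀, nc₁, hc₀, hc₂]
    exact ⟨by field_simp, by field_simp⟩
  · change exp (2 * (c₁ - c₀)) = ((1 - x) / (1 - y)) ^ 2 ∧
      exp (-(2 * (c₂ - c₁ - a₀))) = (1 - (1 - x) / (1 - y)) ^ 2
    rw [e4', show 2 * (c₁ - c₀) = 2 * c₁ + -(2 * c₀) by ring,
      show -(2 * (c₂ - c₁ - a₀)) = -(2 * c₂) + 2 * c₁ + 2 * a₀ by ring]
    simp only [exp_add, ha₀, nc₁, hc₀, hc₂]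
    exact ⟨by field_simp, by field_simp⟩

lemma IsLift.mem_FTpre (h : IsLift x y a₀ c₀ a₁ c₁ c₂) : lin5 a₀ c₀ a₁ c₁ c₂ ∈ FTpre :=
  ⟨_, ⟨x, y, h.hx, h.hy, h.hne, rfl⟩, h.liesOver⟩

lemma isLift_of_liesOver (hx : Reg x) (hy : Reg y) (hne : x ≠ y) {u : Fin 5 → ℂ × ℂ}
    (h : ∀ i, LiesOver (u i) (ftTuple x y i)) :
    IsLift x y (u 0).1 (u 0).2 (u 1).1 (u 1).2 (u 2).2 :=
  have h' := fun i => (liesOver_iff.1 (h i)).2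
  ⟨hx, hy, hne, (h' 0).1, (h' 0).2, (h' 1).1, (h' 1).2, (h' 2).2⟩

/-- The linearisation of a tuple. -/
def linOf (u : Fin 5 → ℂ × ℂ) : Fin 5 → ℂ × ℂ := lin5 (u 0).1 (u 0).2 (u 1).1 (u 1).2 (u 2).2

lemma continuous_linOf (i : Fin 5) : Continuous fun u : Fin 5 → ℂ × ℂ => linOf u i := by
  unfold linOf lin5
  fin_cases i <;> exact Continuous.prodMk (by fun_prop) (by fun_prop)

lemma exp_eq_one_im {d : ℂ} (h : ∃ n : ℤ, d = n * (Cpi * I)) :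
    d.re = 0 ∧ d.im ∈ AddSubgroup.zmultiples Real.pi := by
  obtain ⟨n, rfl⟩ := h
  unfold Cpi
  refine ⟨by simp, n, by simp⟩

lemma sub_linOf_of_mem {u : Fin 5 → ℂ × ℂ} (hu : u ∈ FTpre) (i : Fin 5) :
    (∃ n : ℤ, (u i).1 - (linOf u i).1 = n * (Cpi * I)) ∧
      ∃ n : ℤ, (u i).2 - (linOf u i).2 = n * (Cpi * I) := by
  obtain ⟨v, ⟨x, y, hx, hy, hne, rfl⟩, h⟩ := hu
  obtain ⟨p, q, hpq⟩ := ((isLift_of_liesOver hx hy hne h).liesOver i).exists_covAct (h i)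
  rw [hpq]
  refine ⟨⟨p, ?_⟩, q, ?_⟩
  · simp only [linOf]; ring
  · simp only [linOf]; ring

lemma eq_zero_of_im_lt {d : ℂ} (h : exp d = 1) (h1 : -(2 * Real.pi) < d.im)
    (h2 : d.im < 2 * Real.pi) : d = 0 := by
  obtain ⟨n, rfl⟩ := exp_eq_one_iff.1 h
  have hp := Real.pi_pos
  have : ((n : ℂ) * (2 * Real.pi * I)).im = n * (2 * Real.pi) := by simp
  rw [this] at h1 h2
  have h3 : (-1 : ℝ) < n := by nlinarith
  have h4 : (n : ℝ) < 1 := by nlinarith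
  have h5 : n = 0 := by
    have : (-1 : ℤ) < n := by exact_mod_cast h3
    have : n < 1 := by exact_mod_cast h4
    omega
  simp [h5]

lemma log_im_of_UHP {z : ℂ} (h : 0 < z.im) :
    0 < (log z).im ∧ (log z).im < Real.pi ∧ -Real.pi < (log (1 - z)).im ∧
      (log (1 - z)).im < 0 := by
  have h1 : (1 - z).im < 0 := by simpa using h
  rw [log_im, log_im]
  refine ⟨?_, ?_, neg_pi_lt_arg _, arg_neg_iff.2 h1⟩
  · refine lt_of_le_of_ne (arg_nonneg_iff.2 h.le) fun h0 => ?_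
    have := (arg_eq_zero_iff.1 h0.symm).2
    exact h.ne' this
  · refine lt_of_le_of_ne (arg_le_pi _) fun h0 => ?_
    have := (arg_eq_pi_iff.1 h0).2
    exact h.ne' this

lemma reg_of_UHP {z : ℂ} (h : 0 < z.im) : Reg z :=
  ⟨fun h0 => by simp [h0] at h, fun h0 => by simp [h0] at h⟩

lemma log_add_eq {u v w : ℂ} (hu : u ≠ 0) (hv : v ≠ 0) (h : u * v = w)
    (h1 : -(2 * Real.pi) < (log u).im + (log v).im - (log w).im)
    (h2 : (log u).im + (log v).im - (log w).im < 2 * Real.pi) : log u + log v = log w := by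
  refine sub_eq_zero.1 (eq_zero_of_im_lt ?_ (by simpa using h1) (by simpa using h2))
  have hw : w ≠ 0 := h ▸ mul_ne_zero hu hv
  rw [exp_sub, exp_add, exp_log hu, exp_log hv, exp_log hw, h, div_self hw]

lemma linOf_pt_of_UHP (h : ∀ i, 0 < (ftTuple x y i).im) :
    linOf (fun i => pt (ftTuple x y i) 0 0) = fun i => pt (ftTuple x y i) 0 0 := by
  have hx : Reg x := reg_of_UHP (h 0)
  have hy : Reg y := reg_of_UHP (h 1)
  have e3 := ft_three_eq hx hy
  have e3' := ft_one_sub_three hx hy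
  have e4' := ft_one_sub_four hx hy
  have sx : (1 : ℂ) - x ≠ 0 := sub_ne_zero.2 (Ne.symm hx.2)
  have sy : (1 : ℂ) - y ≠ 0 := sub_ne_zero.2 (Ne.symm hy.2)
  have hp := Real.pi_pos
  obtain ⟨z₂, hz₂⟩ : ∃ z, z = y / x := ⟨_, rfl⟩
  obtain ⟨z₃, hz₃⟩ : ∃ z, z = (1 - x⁻¹) / (1 - y⁻¹) := ⟨_, rfl⟩
  obtain ⟨z₄, hz₄⟩ : ∃ z, z = (1 - x) / (1 - y) := ⟨_, rfl⟩
  have ht : ftTuple x y = ![x, y, z₂, z₃, z₄] := by rw [ftTuple, hz₂, hz₃, hz₄]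
  rw [← hz₃, ← hz₂, ← hz₄] at e3
  rw [← hz₃, ← hz₂] at e3'
  rw [← hz₄, ← hz₂, ← e3'] at e4'
  rw [ht] at h ⊢
  obtain ⟨x0, x1, x2, x3⟩ := log_im_of_UHP (h 0)
  obtain ⟨y0, y1, y2, y3⟩ := log_im_of_UHP (h 1)
  obtain ⟨u0, u1, u2, u3⟩ := log_im_of_UHP (h 2)
  obtain ⟨v0, v1, v2, v3⟩ := log_im_of_UHP (h 3)
  obtain ⟨w0, w1, w2, w3⟩ := log_im_of_UHP (h 4)
  have r2 : Reg z₂ := reg_of_UHP (h 2)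
  have r3 : Reg z₃ := reg_of_UHP (h 3)
  have r4 : Reg z₄ := reg_of_UHP (h 4)
  have s3 : (1 : ℂ) - z₃ ≠ 0 := sub_ne_zero.2 (Ne.symm r3.2)
  change 0 < (log x).im at x0
  change (log x).im < Real.pi at x1
  change -Real.pi < (log (1 - x)).im at x2
  change (log (1 - x)).im < 0 at x3
  change 0 < (log y).im at y0
  change (log y).im < Real.pi at y1
  change -Real.pi < (log (1 - y)).im at y2
  change (log (1 - y)).im < 0 at y3
  change 0 < (log z₂).im at u0
  change (log z₂).im < Real.pi at u1
  change -Real.pi < (log (1 - z₂)).im at u2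
  change (log (1 - z₂)).im < 0 at u3
  change 0 < (log z₃).im at v0
  change (log z₃).im < Real.pi at v1
  change -Real.pi < (log (1 - z₃)).im at v2
  change (log (1 - z₃)).im < 0 at v3
  change 0 < (log z₄).im at w0
  change (log z₄).im < Real.pi at w1
  change -Real.pi < (log (1 - z₄)).im at w2
  change (log (1 - z₄)).im < 0 at w3
  have l2 : log z₂ + log x = log y :=
    log_add_eq r2.1 hx.1 (by rw [hz₂, div_mul_cancel₀ _ hx.1]) (by linarith) (by linarith)
  have l4 : log z₄ + log (1 - y) = log (1 - x) :=
    log_add_eq r4.1 sy (by rw [hz₄, div_mul_cancel₀ _ sy]) (by linarith) (by linarith)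
  have l3 : log z₂ + log z₄ = log z₃ := log_add_eq r2.1 r4.1 e3.symm (by linarith) (by linarith)
  have m3 : log (1 - z₃) + log (1 - y) = log (1 - z₂) :=
    log_add_eq s3 sy (by rw [e3', div_mul_cancel₀ _ sy]) (by linarith) (by linarith)
  have m4 : log x + log (1 - z₃) = log (1 - z₄) :=
    log_add_eq hx.1 s3 e4'.symm (by linarith) (by linarith)
  funext i
  fin_cases i <;> refine Prod.ext ?_ ?_ <;> simp [linOf, lin5, pt]
  · linear_combination -l2
  · linear_combination l3 - l2 - l4
  · linear_combination m3
  · linear_combination -l4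
  · linear_combination m3 - m4

lemma linOf_basePt : linOf basePt = basePt := by
  refine linOf_pt_of_UHP fun i => ?_
  fin_cases i <;> simp [ftTuple, Complex.div_im, Complex.div_re, Complex.normSq_apply] <;> norm_num

lemma basePt_mem : basePt ∈ FTpre := by
  have h : ∀ i, Reg (ftTuple ((1 + I) / 4) I i) := by
    have h : ∀ i, 0 < (ftTuple ((1 + I) / 4) I i).im := by
      intro i
      fin_cases i <;> simp [ftTuple, Complex.div_im, Complex.div_re, Complex.normSq_apply] <;>
        norm_num
    exact fun i => reg_of_UHP (h i)
  refine ⟨_, ⟨(1 + I) / 4, I, h 0, h 1, ?_, rfl⟩, fun i => liesOver_pt (h i) 0 0⟩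
  intro h0
  have := congrArg Complex.re h0
  simp at this

lemma isDiscrete_zmultiples_pi : IsDiscrete (AddSubgroup.zmultiples Real.pi : Set ℝ) :=
  ⟨inferInstanceAs (DiscreteTopology (AddSubgroup.zmultiples Real.pi))⟩

lemma linOf_of_mem_FThat₀ {u : Fin 5 → ℂ × ℂ} (hu : u ∈ FThat₀) : linOf u = u := by
  have hsub : FThat₀ ⊆ FTpre := connectedComponentIn_subset _ _
  have hb : basePt ∈ FThat₀ := mem_connectedComponentIn basePt_mem
  have hc : IsPreconnected FThat₀ := isPreconnected_connectedComponentIn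
  have key : ∀ f : ℂ × ℂ →+ ℂ, Continuous f →
      (∀ v ∈ FTpre, ∀ i, ∃ n : ℤ, f (v i - linOf v i) = n * (Cpi * I)) →
      ∀ i, f (u i - linOf u i) = 0 := by
    intro f hf h i
    have h1 := hc.constant_of_mapsTo isDiscrete_zmultiples_pi
      (f := fun v => (f (v i - linOf v i)).im)
      (Continuous.continuousOn (by
        have := continuous_linOf i
        fun_prop))
      (fun v hv => (exp_eq_one_im (h v (hsub hv) i)).2) hu hb
    simp only [linOf_basePt, sub_self, map_zero, zero_im] at h1
    exact Complex.ext (exp_eq_one_im (h u (hsub hu) i)).1 h1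
  funext i
  refine (sub_eq_zero.1 (Prod.ext ?_ ?_)).symm
  · exact key (AddMonoidHom.fst ℂ ℂ) continuous_fst
      (fun v hv i => (sub_linOf_of_mem hv i).1) i
  · exact key (AddMonoidHom.snd ℂ ℂ) continuous_snd
      (fun v hv i => (sub_linOf_of_mem hv i).2) i

/-- Every lifted five term tuple satisfies the linear relations. -/
theorem exists_isLift_of_mem_FThat {u : Fin 5 → ℂ × ℂ} (hu : u ∈ FThat) :
    ∃ x y a₀ c₀ a₁ c₁ c₂, IsLift x y a₀ c₀ a₁ c₁ c₂ ∧ u = lin5 a₀ c₀ a₁ c₁ c₂ := by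
  obtain ⟨w, hw, v, hv, rfl⟩ := hu
  have hl := linOf_of_mem_FThat₀ hw
  obtain ⟨t, ⟨x, y, hx, hy, hne, rfl⟩, h⟩ := connectedComponentIn_subset _ _ hw
  refine ⟨x, y, _, _, _, _, _, isLift_of_liesOver hx hy hne fun i => (h i).covAct (v i), ?_⟩
  obtain ⟨p₀, p₁, q₀, q₁, q₂, rfl⟩ := hv
  funext i
  conv_lhs => rw [← hl]
  fin_cases i <;> refine Prod.ext ?_ ?_ <;> simp [linOf, lin5, covAct] <;> ring

/-! ### Existence of lifts along paths -/

lemma exists_log_lift (f : C(unitInterval, ℂ)) (hf : ∀ t, f t ≠ 0) (c : ℂ) (hc : exp c = f 0) :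
    ∃ g : C(unitInterval, ℂ), (∀ t, exp (g t) = f t) ∧ g 0 = c := by
  obtain ⟨Γ, h1, h2⟩ := isCoveringMap_exp.exists_path_lifts
    (⟨fun t => ⟨f t, hf t⟩, by fun_prop⟩ : C(unitInterval, {z : ℂ // z ≠ 0})) c
    (Subtype.ext hc.symm)
  exact ⟨Γ, fun t => congrArg Subtype.val (congrFun h1 t), h2⟩

/-- The configurations parametrising the five term relation. -/
def Conf : Set (ℂ × ℂ) := {p | Reg p.1 ∧ Reg p.2 ∧ p.1 ≠ p.2}

lemma isPathConnected_compl {s : Set ℂ} (hs : s.Finite) : IsPathConnected sᶜ :=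
  hs.countable.isPathConnected_compl_of_one_lt_rank (by rw [Complex.rank_real_complex]; norm_num)

/-- To propagate a property over all configurations it suffices to move one coordinate at a
time. -/
lemma conf_induction {Q : ℂ × ℂ → Prop} {p : ℂ × ℂ} (hp : p ∈ Conf) (h : Q p)
    (h₁ : ∀ x x' y, (x, y) ∈ Conf → (x', y) ∈ Conf → Q (x, y) → Q (x', y))
    (h₂ : ∀ x y y', (x, y) ∈ Conf → (x, y') ∈ Conf → Q (x, y) → Q (x, y'))
    {p' : ℂ × ℂ} (hp' : p' ∈ Conf) : Q p' := by
  obtain ⟨x, y⟩ := p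
  obtain ⟨x', y'⟩ := p'
  obtain ⟨t, ht⟩ := (isPathConnected_compl
    (Set.toFinite ({0, 1, y, y'} : Set ℂ))).nonempty
  simp only [Set.mem_compl_iff, Set.mem_insert_iff, Set.mem_singleton_iff, not_or] at ht
  have m1 : (t, y) ∈ Conf := ⟨⟨ht.1, ht.2.1⟩, hp.2.1, ht.2.2.1⟩
  have m2 : (t, y') ∈ Conf := ⟨⟨ht.1, ht.2.1⟩, hp'.2.1, ht.2.2.2⟩
  exact h₁ _ _ _ m2 hp' (h₂ _ _ _ m1 m2 (h₁ _ _ _ hp m1 h))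

lemma mem_compl_iff_left {t : ℂ} (hy : Reg y) : t ∈ ({0, 1, y} : Set ℂ)ᶜ ↔ (t, y) ∈ Conf := by
  simp only [Set.mem_compl_iff, Set.mem_insert_iff, Set.mem_singleton_iff, not_or]
  exact ⟨fun ht => ⟨⟨ht.1, ht.2.1⟩, hy, ht.2.2⟩, fun ht => ⟨ht.1.1, ht.1.2, ht.2.2⟩⟩

lemma mem_compl_iff_right {t : ℂ} (hx : Reg x) : t ∈ ({0, 1, x} : Set ℂ)ᶜ ↔ (x, t) ∈ Conf := by
  rw [mem_compl_iff_left hx]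
  exact ⟨fun h => ⟨h.2.1, h.1, h.2.2.symm⟩, fun h => ⟨h.2.1, h.1, h.2.2.symm⟩⟩

lemma joinedIn_conf {p p' : ℂ × ℂ} (hp : p ∈ Conf) (hp' : p' ∈ Conf) : JoinedIn Conf p p' := by
  refine conf_induction (Q := JoinedIn Conf p) hp (JoinedIn.refl hp) ?_ ?_ hp'
  · intro x x' y h h' hj
    refine hj.trans (((isPathConnected_compl (Set.toFinite _)).joinedIn x
      ((mem_compl_iff_left h.2.1).2 h) x' ((mem_compl_iff_left h.2.1).2 h')).map
        (f := fun t => (t, y)) (by fun_prop) |>.mono ?_)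
    rintro _ ⟨t, ht, rfl⟩
    exact (mem_compl_iff_left h.2.1).1 ht
  · intro x y y' h h' hj
    refine hj.trans (((isPathConnected_compl (Set.toFinite _)).joinedIn y
      ((mem_compl_iff_right h.1).2 h) y' ((mem_compl_iff_right h.1).2 h')).map
        (f := fun t => (x, t)) (by fun_prop) |>.mono ?_)
    rintro _ ⟨t, ht, rfl⟩
    exact (mem_compl_iff_right h.1).1 ht

lemma one_sub_div_ne_zero (hx : x ≠ 0) (hne : x ≠ y) : 1 - y / x ≠ 0 := by
  rw [sub_ne_zero]
  intro h
  exact hne ((eq_div_iff hx).1 h |>.symm ▸ (one_mul x).symm)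

lemma exists_lift_mem_FThat₀ (h : (x, y) ∈ Conf) :
    ∃ a₀ c₀ a₁ c₁ c₂, IsLift x y a₀ c₀ a₁ c₁ c₂ ∧ lin5 a₀ c₀ a₁ c₁ c₂ ∈ FThat₀ := by
  have hb : (((1 + I) / 4, I) : ℂ × ℂ) ∈ Conf := by
    refine ⟨⟨?_, ?_⟩, ⟨?_, ?_⟩, ?_⟩ <;> intro h0 <;> have h1 := congrArg Complex.re h0 <;>
      have h2 := congrArg Complex.im h0 <;> first | (norm_num at h1; done) | norm_num at h2
  obtain ⟨γ, hγ⟩ := joinedIn_conf hb h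
  have hγ0 : γ 0 = _ := γ.source
  have hγ1 : γ 1 = _ := γ.target
  have s : ∀ {z : ℂ}, Reg z → 1 - z ≠ 0 := fun hz => sub_ne_zero.2 (Ne.symm hz.2)
  have d := fun t => one_sub_div_ne_zero (hγ t).1.1 (hγ t).2.2
  obtain ⟨A₀, hA₀, iA₀⟩ := exists_log_lift ⟨fun t => (γ t).1, by fun_prop⟩
    (fun t => (hγ t).1.1) (log ((1 + I) / 4)) (by simp [hγ0, exp_log hb.1.1])
  obtain ⟨C₀, hC₀, iC₀⟩ := exists_log_lift ⟨fun t => 1 - (γ t).1, by fun_prop⟩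
    (fun t => s (hγ t).1) (log (1 - (1 + I) / 4)) (by simp [hγ0, exp_log (s hb.1)])
  obtain ⟨A₁, hA₁, iA₁⟩ := exists_log_lift ⟨fun t => (γ t).2, by fun_prop⟩
    (fun t => (hγ t).2.1.1) (log I) (by simp [hγ0, exp_log hb.2.1.1])
  obtain ⟨C₁, hC₁, iC₁⟩ := exists_log_lift ⟨fun t => 1 - (γ t).2, by fun_prop⟩
    (fun t => s (hγ t).2.1) (log (1 - I)) (by simp [hγ0, exp_log (s hb.2.1)])
  obtain ⟨C₂, hC₂, iC₂⟩ := exists_log_lift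
    ⟨fun t => 1 - (γ t).2 / (γ t).1, by
      have := fun t => (hγ t).1.1
      fun_prop (disch := assumption)⟩ d (log (1 - I / ((1 + I) / 4)))
    (by
      have := exp_log (one_sub_div_ne_zero hb.1.1 hb.2.2)
      simpa [hγ0] using this)
  have sq2 : ∀ {b u : ℂ}, exp b = u → exp (2 * b) = u ^ 2 := by
    rintro b u rfl
    rw [two_mul, exp_add, sq]
  have sq2' : ∀ {b u : ℂ}, exp b = u → exp (-(2 * -b)) = u ^ 2 := by
    rintro b u rfl
    rw [mul_neg, neg_neg, two_mul, exp_add, sq]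
  have hL : ∀ t, IsLift (γ t).1 (γ t).2 (A₀ t) (-C₀ t) (A₁ t) (-C₁ t) (-C₂ t) := fun t =>
    ⟨(hγ t).1, (hγ t).2.1, (hγ t).2.2, sq2 (hA₀ t), sq2' (hC₀ t), sq2 (hA₁ t), sq2' (hC₁ t),
      sq2' (hC₂ t)⟩
  have hcont : Continuous fun t => lin5 (A₀ t) (-C₀ t) (A₁ t) (-C₁ t) (-C₂ t) := by
    refine continuous_pi fun i => ?_
    unfold lin5
    fin_cases i <;> exact Continuous.prodMk (by fun_prop) (by fun_prop)
  have h0 : lin5 (A₀ 0) (-C₀ 0) (A₁ 0) (-C₁ 0) (-C₂ 0) = basePt := by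
    rw [← linOf_basePt, iA₀, iC₀, iA₁, iC₁, iC₂]
    simp [linOf, basePt, pt, ftTuple]
  have h1 := hL 1
  rw [hγ1] at h1
  refine ⟨_, _, _, _, _, h1, ?_⟩
  refine (isPreconnected_range hcont).subset_connectedComponentIn ⟨0, h0⟩ ?_ ⟨1, rfl⟩
  rintro _ ⟨t, rfl⟩
  exact (hL t).mem_FTpre

/-- Every tuple over `FT` satisfying the linear relations is a lifted five term tuple. -/
theorem IsLift.mem_FThat (h : IsLift x y a₀ c₀ a₁ c₁ c₂) : lin5 a₀ c₀ a₁ c₁ c₂ ∈ FThat := by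
  obtain ⟨a₀', c₀', a₁', c₁', c₂', h', hm⟩ := exists_lift_mem_FThat₀ (x := x) (y := y)
    ⟨h.hx, h.hy, h.hne⟩
  obtain ⟨p₀, q₀, e0⟩ := (h'.liesOver 0).exists_covAct (h.liesOver 0)
  obtain ⟨p₁, q₁, e1⟩ := (h'.liesOver 1).exists_covAct (h.liesOver 1)
  obtain ⟨p₂, q₂, e2⟩ := (h'.liesOver 2).exists_covAct (h.liesOver 2)
  obtain ⟨rfl, rfl⟩ := Prod.ext_iff.1 e0
  obtain ⟨rfl, rfl⟩ := Prod.ext_iff.1 e1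
  have e3 : c₂ = c₂' + q₂ * (Cpi * I) := (Prod.ext_iff.1 e2).2
  subst e3
  refine ⟨_, hm, _, ⟨p₀, p₁, q₀, q₁, q₂, rfl⟩, ?_⟩
  funext i
  fin_cases i <;> refine Prod.ext ?_ ?_ <;> simp [lin5, covAct] <;> ring

end FiveTermLifts

section ExtendedPreBloch

open FreeAbelianGroup

variable {x y z a c a₀ c₀ a₁ c₁ c₂ : ℂ}

/-- The class in `êP(ℂ)` of a point of the cover. -/
def ec (w : ℂ × ℂ) : EPreBloch :=
  if h : w ∈ Cover then QuotientAddGroup.mk (of ⟨w, h⟩) else 0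

lemma ec_of_mem {w : ℂ × ℂ} (h : w ∈ Cover) : ec w = QuotientAddGroup.mk (of ⟨w, h⟩) := dif_pos h

lemma LiesOver.shift {w : ℂ × ℂ} (h : LiesOver w z) (p q : ℤ) :
    LiesOver (w.1 + p * (Cpi * I), w.2 + q * (Cpi * I)) z := h.covAct (p, q)

lemma LiesOver.fst (h : LiesOver (a, c) z) : exp (2 * a) = z ^ 2 := (liesOver_iff.1 h).2.1

lemma LiesOver.snd (h : LiesOver (a, c) z) : exp (-(2 * c)) = (1 - z) ^ 2 := (liesOver_iff.1 h).2.2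

lemma IsLift.shift (h : IsLift x y a₀ c₀ a₁ c₁ c₂) (p₀ q₀ p₁ q₁ q₂ : ℤ) :
    IsLift x y (a₀ + p₀ * (Cpi * I)) (c₀ + q₀ * (Cpi * I)) (a₁ + p₁ * (Cpi * I))
      (c₁ + q₁ * (Cpi * I)) (c₂ + q₂ * (Cpi * I)) :=
  have h0 := (h.liesOver 0).shift p₀ q₀
  have h1 := (h.liesOver 1).shift p₁ q₁
  have h2 := (h.liesOver 2).shift 0 q₂
  ⟨h.hx, h.hy, h.hne, h0.fst, h0.snd, h1.fst, h1.snd, h2.snd⟩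

lemma exists_isLift (h : (x, y) ∈ Conf) : ∃ a₀ c₀ a₁ c₁ c₂, IsLift x y a₀ c₀ a₁ c₁ c₂ :=
  have ⟨a₀, c₀, a₁, c₁, c₂, h', _⟩ := exists_lift_mem_FThat₀ h
  ⟨a₀, c₀, a₁, c₁, c₂, h'⟩

/-- The alternating sum over a linear five term tuple. -/
def alt5 {A : Type*} [AddCommGroup A] (F : ℂ × ℂ → A) (a₀ c₀ a₁ c₁ c₂ : ℂ) : A :=
  F (a₀, c₀) - F (a₁, c₁) + F (a₁ - a₀, c₂) - F (a₁ - a₀ + c₁ - c₀, c₂ - c₁) +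
    F (c₁ - c₀, c₂ - c₁ - a₀)

lemma sum_five {A : Type*} [AddCommGroup A] (f : Fin 5 → A) :
    ∑ i : Fin 5, (-1 : ℤ) ^ (i : ℕ) • f i = f 0 - f 1 + f 2 - f 3 + f 4 := by
  simp only [Fin.sum_univ_five]
  norm_num
  abel

lemma ec_five (h : IsLift x y a₀ c₀ a₁ c₁ c₂) : alt5 ec a₀ c₀ a₁ c₁ c₂ = 0 := by
  have hc : ∀ i, lin5 a₀ c₀ a₁ c₁ c₂ i ∈ Cover := fun i => (h.liesOver i).mem_Cover
  have key : ((∑ i : Fin 5, (-1 : ℤ) ^ (i : ℕ) • of (⟨lin5 a₀ c₀ a₁ c₁ c₂ i, hc i⟩ : CoverT) :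
      FreeAbelianGroup CoverT) : EPreBloch) = 0 :=
    (QuotientAddGroup.eq_zero_iff _).2 (AddSubgroup.subset_closure
      (Or.inl ⟨_, h.mem_FThat, hc, rfl⟩))
  rw [sum_five] at key
  have e : ∀ i, ec (lin5 a₀ c₀ a₁ c₁ c₂ i) = QuotientAddGroup.mk (of ⟨_, hc i⟩) :=
    fun i => ec_of_mem (hc i)
  change ec (lin5 a₀ c₀ a₁ c₁ c₂ 0) - ec (lin5 a₀ c₀ a₁ c₁ c₂ 1) + ec (lin5 a₀ c₀ a₁ c₁ c₂ 2) -
    ec (lin5 a₀ c₀ a₁ c₁ c₂ 3) + ec (lin5 a₀ c₀ a₁ c₁ c₂ 4) = 0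
  rw [e, e, e, e, e]
  exact key

lemma ec_pt (hz : Reg z) (p q : ℤ) : ec (pt z p q) = QuotientAddGroup.mk (genOf z hz p q) :=
  ec_of_mem _

lemma pt_add (z : ℂ) (p q m n : ℤ) :
    ((pt z p q).1 + m * (Cpi * I), (pt z p q).2 + n * (Cpi * I)) = pt z (p + m) (q + n) := by
  refine Prod.ext ?_ ?_ <;> simp only [pt] <;> push_cast <;> ring

lemma ec_transfer {w : ℂ × ℂ} (h : LiesOver w z) (p q : ℤ) :
    ec (w.1 + p * (Cpi * I), w.2 + q * (Cpi * I)) + ec w =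
      ec (w.1 + p * (Cpi * I), w.2) + ec (w.1, w.2 + q * (Cpi * I)) := by
  obtain ⟨hz, m, n, rfl⟩ := h
  have e1 := pt_add z m n p 0
  have e2 := pt_add z m n 0 q
  simp only [Int.cast_zero, zero_mul, add_zero] at e1 e2
  rw [pt_add, e1, e2, ec_pt hz, ec_pt hz, ec_pt hz, ec_pt hz, ← sub_eq_zero, ← sub_sub]
  exact (QuotientAddGroup.eq_zero_iff _).2 (AddSubgroup.subset_closure
    (Or.inr ⟨z, hz, m + p, n + q, m, n, by abel⟩))

variable {A : Type*} [AddCommGroup A] {F : ℂ × ℂ → A}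

/-- A function on the cover satisfying the lifted five term and transfer relations. -/
structure IsExtBloch (F : ℂ × ℂ → A) : Prop where
  five : ∀ {x y a₀ c₀ a₁ c₁ c₂ : ℂ}, IsLift x y a₀ c₀ a₁ c₁ c₂ → alt5 F a₀ c₀ a₁ c₁ c₂ = 0
  transfer : ∀ {w : ℂ × ℂ} {z : ℂ}, LiesOver w z → ∀ p q : ℤ,
    F (w.1 + p * (Cpi * I), w.2 + q * (Cpi * I)) + F w =
      F (w.1 + p * (Cpi * I), w.2) + F (w.1, w.2 + q * (Cpi * I))

lemma IsExtBloch.lift_eq_zero (hF : IsExtBloch F) :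
    ∀ s ∈ relSub, lift (fun w : CoverT => F w.1) s = 0 := by
  intro s hs
  refine (AddSubgroup.closure_le (AddMonoidHom.ker _)).2 ?_ hs
  rintro s (⟨w, hw, hc, rfl⟩ | ⟨z, hz, p, q, p', q', rfl⟩) <;>
    rw [SetLike.mem_coe, AddMonoidHom.mem_ker]
  · obtain ⟨x, y, a₀, c₀, a₁, c₁, c₂, hl, rfl⟩ := exists_isLift_of_mem_FThat hw
    rw [sum_five]
    simp only [map_add, map_sub, lift_apply_of]
    exact hF.five hl
  · simp only [genOf, map_add, map_sub, lift_apply_of]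
    have h := hF.transfer (liesOver_pt hz p' q') (p - p') (q - q')
    have e1 := pt_add z p' q' (p - p') 0
    have e2 := pt_add z p' q' 0 (q - q')
    simp only [Int.cast_zero, zero_mul, add_zero, add_sub_cancel] at e1 e2
    rw [pt_add, e1, e2, add_sub_cancel, add_sub_cancel] at h
    rw [h]
    abel

/-- The homomorphism on `êP(ℂ)` induced by a function satisfying the relations. -/
def IsExtBloch.hom (hF : IsExtBloch F) : EPreBloch →+ A :=
  QuotientAddGroup.lift relSub (lift fun w : CoverT => F w.1) hF.lift_eq_zero

lemma IsExtBloch.hom_ec (hF : IsExtBloch F) {w : ℂ × ℂ} (h : w ∈ Cover) : hF.hom (ec w) = F w := by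
  rw [ec_of_mem h]
  exact lift_apply_of _ _

lemma ePreBloch_induction {p : EPreBloch → Prop} (e : EPreBloch) (h0 : p 0)
    (h1 : ∀ w ∈ Cover, p (ec w)) (hn : ∀ e, p e → p (-e))
    (ha : ∀ e e', p e → p e' → p (e + e')) : p e := by
  obtain ⟨s, rfl⟩ := QuotientAddGroup.mk_surjective e
  induction s using FreeAbelianGroup.induction_on with
  | zero => exact h0
  | of w => exact ec_of_mem w.2 ▸ h1 _ w.2
  | neg w h => exact hn _ h
  | add s t hs ht => exact ha _ _ hs ht

/-! ### The map `ν` -/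

lemma wedge_alt (a b : ℂ) : wedgeHom a b = -wedgeHom b a := wedge_swap b a

lemma isExtBloch_wedge : IsExtBloch fun w : ℂ × ℂ => wedgeHom w.1 w.2 := by
  have hs : ∀ a, wedgeHom a a = 0 := wedge_self
  constructor
  · intro x y a₀ c₀ a₁ c₁ c₂ _
    simp only [alt5, map_sub, map_add, AddMonoidHom.sub_apply, AddMonoidHom.add_apply, hs]
    rw [wedge_alt c₁ a₀, wedge_alt c₀ a₀]
    abel
  · intro w z _ p q
    have h : wedgeHom (p * (Cpi * I)) (q * (Cpi * I)) = 0 := by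
      rw [← zsmul_eq_mul, ← zsmul_eq_mul, map_zsmul, map_zsmul, AddMonoidHom.zsmul_apply, hs,
        smul_zero, smul_zero]
    simp only [map_add, AddMonoidHom.add_apply, h]
    abel

lemma nuHom_ec {w : ℂ × ℂ} (h : w ∈ Cover) : nuHom (ec w) = wedgeHom w.1 w.2 := by
  have e : nuHom = isExtBloch_wedge.hom := dif_pos isExtBloch_wedge.lift_eq_zero
  rw [e, isExtBloch_wedge.hom_ec h]

/-! ### Variation in the fibre -/

lemma exists_isLift_four (h : LiesOver (a, c) z) :
    ∃ x y a₀ c₀ a₁ c₁ c₂, IsLift x y a₀ c₀ a₁ c₁ c₂ ∧ a = c₁ - c₀ ∧ c = c₂ - c₁ - a₀ := by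
  have hz := h.1
  obtain ⟨y, hy⟩ := (isPathConnected_compl (Set.toFinite ({0, 1, 1 - z⁻¹} : Set ℂ))).nonempty
  simp only [Set.mem_compl_iff, Set.mem_insert_iff, Set.mem_singleton_iff, not_or] at hy
  have hy1 : (1 : ℂ) - y ≠ 0 := sub_ne_zero.2 (Ne.symm hy.2.1)
  have hz1 : (1 : ℂ) - z ≠ 0 := sub_ne_zero.2 (Ne.symm hz.2)
  have hx0 : 1 - z * (1 - y) ≠ 0 := by
    intro h0
    apply hy.2.2
    have := hz.1
    field_simp
    linear_combination h0
  have hl : exp (2 * log (1 - z * (1 - y))) = (1 - z * (1 - y)) ^ 2 := by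
    rw [two_mul, exp_add, exp_log hx0, sq]
  have hly := liesOver_pt (z := y) ⟨hy.1, hy.2.1⟩ 0 0
  have hc₁ : exp (-(2 * (pt y 0 0).2)) = (1 - y) ^ 2 := hly.snd
  refine ⟨1 - z * (1 - y), y, log (1 - z * (1 - y)), (pt y 0 0).2 - a, (pt y 0 0).1, (pt y 0 0).2,
    c + (pt y 0 0).2 + log (1 - z * (1 - y)), ⟨⟨hx0, ?_⟩, ⟨hy.1, hy.2.1⟩, ?_, hl, ?_, hly.fst,
    hc₁, ?_⟩, by ring, by ring⟩
  · intro h0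
    exact mul_ne_zero hz.1 hy1 (by linear_combination -h0)
  · intro h0
    exact mul_ne_zero hz1 hy1 (by linear_combination h0)
  · rw [show -(2 * ((pt y 0 0).2 - a)) = -(2 * (pt y 0 0).2) + 2 * a by ring, exp_add, hc₁, h.fst]
    ring
  · rw [show -(2 * (c + (pt y 0 0).2 + log (1 - z * (1 - y)))) = -(2 * c) + -(2 * (pt y 0 0).2) +
      -(2 * log (1 - z * (1 - y))) by ring, exp_add, exp_add, hc₁, h.snd,
      exp_neg (2 * log _), hl]
    field_simp
    ring

lemma exists_isLift_three (h : LiesOver (a, c) z) :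
    ∃ x y a₀ c₀ a₁ c₁ c₂, IsLift x y a₀ c₀ a₁ c₁ c₂ ∧ a = a₁ - a₀ + c₁ - c₀ ∧ c = c₂ - c₁ := by
  have hz := h.1
  obtain ⟨y, hy⟩ := (isPathConnected_compl (Set.toFinite ({0, 1, z / (z - 1)} : Set ℂ))).nonempty
  simp only [Set.mem_compl_iff, Set.mem_insert_iff, Set.mem_singleton_iff, not_or] at hy
  have hy0 := hy.1
  have hy1 : (1 : ℂ) - y ≠ 0 := sub_ne_zero.2 (Ne.symm hy.2.1)
  have hz1 : (1 : ℂ) - z ≠ 0 := sub_ne_zero.2 (Ne.symm hz.2)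
  have hz1' : z - 1 ≠ 0 := sub_ne_zero.2 hz.2
  have hw : y + z * (1 - y) ≠ 0 := by
    intro h0
    apply hy.2.2
    field_simp
    linear_combination -h0
  obtain ⟨x, hx⟩ : ∃ x, x = y / (y + z * (1 - y)) := ⟨_, rfl⟩
  have hx0 : x ≠ 0 := hx ▸ div_ne_zero hy0 hw
  have hxw : x * (y + z * (1 - y)) = y := by rw [hx, div_mul_cancel₀ _ hw]
  have hdiv : y / x = y + z * (1 - y) := by rw [div_eq_iff hx0, mul_comm, hxw]
  have e1 : 1 - x = x * z * (1 - y) / y := by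
    rw [eq_div_iff hy0]
    linear_combination -hxw
  have hl : exp (2 * log x) = x ^ 2 := by rw [two_mul, exp_add, exp_log hx0, sq]
  have hly := liesOver_pt (z := y) ⟨hy.1, hy.2.1⟩ 0 0
  have hc₁ : exp (-(2 * (pt y 0 0).2)) = (1 - y) ^ 2 := hly.snd
  have hc₁' : exp (-(2 * (pt y 0 0).1)) = (y ^ 2)⁻¹ := by
    have := hly.fst
    rw [exp_neg]
    exact congrArg _ this
  refine ⟨x, y, log x, (pt y 0 0).1 - log x + (pt y 0 0).2 - a, (pt y 0 0).1, (pt y 0 0).2,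
    c + (pt y 0 0).2, ⟨⟨hx0, ?_⟩, ⟨hy.1, hy.2.1⟩, ?_, hl, ?_, hly.fst, hc₁, ?_⟩, by ring, by ring⟩
  · rintro rfl
    exact mul_ne_zero hz.1 hy1 (by linear_combination hxw)
  · intro h0
    have : y + z * (1 - y) = 1 := by rw [← hdiv, h0, div_self hy0]
    exact mul_ne_zero hz1 hy1 (by linear_combination -this)
  · rw [show -(2 * ((pt y 0 0).1 - log x + (pt y 0 0).2 - a)) = -(2 * (pt y 0 0).1) + 2 * log x +
      -(2 * (pt y 0 0).2) + 2 * a by ring, exp_add, exp_add, exp_add, hc₁, hc₁', h.fst, hl, e1]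
    field_simp
  · rw [show -(2 * (c + (pt y 0 0).2)) = -(2 * c) + -(2 * (pt y 0 0).2) by ring, exp_add, hc₁,
      h.snd, hdiv]
    ring

/-- The variation of `ec` in the second fibre coordinate. -/
def dq (w : ℂ × ℂ) : EPreBloch := ec (w.1, w.2 + Cpi * I) - ec w

/-- The variation of `ec` in the first fibre coordinate. -/
def dp (w : ℂ × ℂ) : EPreBloch := ec (w.1 + Cpi * I, w.2) - ec w

lemma dq_shift {w : ℂ × ℂ} (h : LiesOver w z) (p : ℤ) :
    dq (w.1 + p * (Cpi * I), w.2) = dq w := by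
  have h1 := ec_transfer h p 1
  rw [Int.cast_one, one_mul] at h1
  rw [dq, dq, sub_eq_sub_iff_add_eq_add, h1, add_comm]

lemma dp_shift {w : ℂ × ℂ} (h : LiesOver w z) (q : ℤ) :
    dp (w.1, w.2 + q * (Cpi * I)) = dp w := by
  have h1 := ec_transfer h 1 q
  rw [Int.cast_one, one_mul] at h1
  rw [dp, dp, sub_eq_sub_iff_add_eq_add, h1]

lemma ec_five_q₂ (h : IsLift x y a₀ c₀ a₁ c₁ c₂) :
    dq (a₁ - a₀, c₂) - dq (a₁ - a₀ + c₁ - c₀, c₂ - c₁) + dq (c₁ - c₀, c₂ - c₁ - a₀) = 0 := by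
  have h1 := ec_five h
  have h2 := ec_five (h.shift 0 0 0 0 1)
  simp only [Int.cast_zero, zero_mul, add_zero, Int.cast_one, one_mul, alt5] at h1 h2
  rw [show c₂ + Cpi * I - c₁ - a₀ = c₂ - c₁ - a₀ + Cpi * I by ring,
    show c₂ + Cpi * I - c₁ = c₂ - c₁ + Cpi * I by ring] at h2
  rw [← sub_zero (0 : EPreBloch)]
  nth_rw 1 [← h2]
  rw [← h1]
  simp only [dq]
  abel

lemma dq_shift' (h : LiesOver (a, c) z) (q : ℤ) : dq (a, c + q * (Cpi * I)) = dq (a, c) := by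
  obtain ⟨x, y, a₀, c₀, a₁, c₁, c₂, hl, rfl, rfl⟩ := exists_isLift_four h
  have h1 := ec_five_q₂ hl
  have h2 := ec_five_q₂ (hl.shift (-q) 0 0 0 0)
  simp only [Int.cast_zero, zero_mul, add_zero, Int.cast_neg, neg_mul] at h2
  have e1 := dq_shift (hl.liesOver 2) q
  have e2 := dq_shift (hl.liesOver 3) q
  change dq (a₁ - a₀ + q * (Cpi * I), c₂) = dq (a₁ - a₀, c₂) at e1
  change dq (a₁ - a₀ + c₁ - c₀ + q * (Cpi * I), c₂ - c₁) = dq (a₁ - a₀ + c₁ - c₀, c₂ - c₁) at e2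
  rw [show a₁ - (a₀ + -(q * (Cpi * I))) = a₁ - a₀ + q * (Cpi * I) by ring,
    show a₁ - a₀ + q * (Cpi * I) + c₁ - c₀ = a₁ - a₀ + c₁ - c₀ + q * (Cpi * I) by ring,
    show c₂ - c₁ - (a₀ + -(q * (Cpi * I))) = c₂ - c₁ - a₀ + q * (Cpi * I) by ring, e1, e2, ← h1] at h2
  exact add_left_cancel h2

/-- The element `[z, 0, 1] - [z, 0, 0]`. -/
def Dq (z : ℂ) : EPreBloch := dq (pt z 0 0)

lemma dq_eq {w : ℂ × ℂ} (h : LiesOver w z) : dq w = Dq z := by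
  have h0 := liesOver_pt h.1 0 0
  obtain ⟨p, q, rfl⟩ := h0.exists_covAct h
  have h1 : LiesOver ((pt z 0 0).1 + p * (Cpi * I), (pt z 0 0).2) z := by
    simpa using h0.shift p 0
  rw [dq_shift' h1, dq_shift h0, Dq]

lemma Dq_five (h : (x, y) ∈ Conf) :
    Dq (y / x) + Dq ((1 - x) / (1 - y)) = Dq ((1 - x⁻¹) / (1 - y⁻¹)) := by
  obtain ⟨a₀, c₀, a₁, c₁, c₂, hl⟩ := exists_isLift h
  have h1 := ec_five_q₂ hl
  have e2 := dq_eq (hl.liesOver 2)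
  have e3 := dq_eq (hl.liesOver 3)
  have e4 := dq_eq (hl.liesOver 4)
  change dq (a₁ - a₀, c₂) = Dq (y / x) at e2
  change dq (a₁ - a₀ + c₁ - c₀, c₂ - c₁) = Dq ((1 - x⁻¹) / (1 - y⁻¹)) at e3
  change dq (c₁ - c₀, c₂ - c₁ - a₀) = Dq ((1 - x) / (1 - y)) at e4
  rw [e2, e3, e4] at h1
  rw [← sub_eq_zero, ← h1]
  abel

lemma Dq_mul {u v : ℂ} (hu : Reg u) (hv : Reg v) (huv : u * v ≠ 1) :
    Dq u + Dq v = Dq (u * v) := by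
  have h1 : u * v - 1 ≠ 0 := sub_ne_zero.2 huv
  have h2 : v - 1 ≠ 0 := sub_ne_zero.2 hv.2
  have h3 : u - 1 ≠ 0 := sub_ne_zero.2 hu.2
  have hu0 := hu.1
  have hv0 := hv.1
  have e2 : u * ((v - 1) / (u * v - 1)) / ((v - 1) / (u * v - 1)) = u := by field_simp
  have s1 : 1 - (v - 1) / (u * v - 1) = v * (u - 1) / (u * v - 1) := by
    rw [eq_div_iff h1, sub_mul, div_mul_cancel₀ _ h1]
    ring
  have s2 : 1 - u * ((v - 1) / (u * v - 1)) = (u - 1) / (u * v - 1) := by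
    rw [eq_div_iff h1, sub_mul, mul_assoc, div_mul_cancel₀ _ h1]
    ring
  have e4 : (1 - (v - 1) / (u * v - 1)) / (1 - u * ((v - 1) / (u * v - 1))) = v := by
    rw [s1, s2, div_div_div_cancel_right₀ h1, mul_div_cancel_right₀ _ h3]
  have hx : Reg ((v - 1) / (u * v - 1)) :=
    ⟨div_ne_zero h2 h1, fun h => by
      rw [h, sub_self] at s1
      exact div_ne_zero (mul_ne_zero hv0 h3) h1 s1.symm⟩
  have hy : Reg (u * ((v - 1) / (u * v - 1))) :=
    ⟨mul_ne_zero hu0 hx.1, fun h => by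
      rw [h, sub_self] at s2
      exact div_ne_zero h3 h1 s2.symm⟩
  have h := Dq_five (x := (v - 1) / (u * v - 1)) (y := u * ((v - 1) / (u * v - 1)))
    ⟨hx, hy, fun h => h3 (by
      have := hx.1
      have h' : (u - 1) * ((v - 1) / (u * v - 1)) = 0 := by linear_combination -h
      exact (mul_eq_zero.1 h').resolve_right this)⟩
  rwa [ft_three_eq hx hy, e2, e4] at h

/-- The extension of `Dq` by zero at `1`. -/
def Dq₁ (z : ℂ) : EPreBloch := if z = 1 then 0 else Dq z

lemma Dq₁_mul {u v : ℂ} (hu : u ≠ 0) (hv : v ≠ 0) : Dq₁ (u * v) = Dq₁ u + Dq₁ v := by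
  by_cases hu1 : u = 1
  · simp [Dq₁, hu1]
  by_cases hv1 : v = 1
  · simp [Dq₁, hv1]
  by_cases huv : u * v = 1
  · obtain ⟨w, hw⟩ := (isPathConnected_compl (Set.toFinite ({0, 1, v} : Set ℂ))).nonempty
    simp only [Set.mem_compl_iff, Set.mem_insert_iff, Set.mem_singleton_iff, not_or] at hw
    have hw' : u * w ≠ 1 := fun h => hw.2.2 (mul_left_cancel₀ hu (h.trans huv.symm))
    have h1 := Dq_mul ⟨hu, hu1⟩ ⟨hw.1, hw.2.1⟩ hw'
    have e : v * (u * w) = w := by rw [← mul_assoc, mul_comm v, huv, one_mul]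
    have h2 := Dq_mul (u := v) ⟨hv, hv1⟩ ⟨mul_ne_zero hu hw.1, hw'⟩ (by rw [e]; exact hw.2.1)
    rw [e, ← h1] at h2
    simp only [Dq₁, if_pos huv, if_neg hu1, if_neg hv1]
    refine (add_right_cancel (b := Dq w) ?_).symm
    rw [zero_add, show Dq u + Dq v + Dq w = Dq v + (Dq u + Dq w) by abel, h2]
  · simp only [Dq₁, if_neg hu1, if_neg hv1, if_neg huv]
    exact (Dq_mul ⟨hu, hu1⟩ ⟨hv, hv1⟩ huv).symm

/-- The homomorphism `a ↦ [eᵃ, 0, 1] - [eᵃ, 0, 0]`. -/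
def DE : ℂ →+ EPreBloch :=
  AddMonoidHom.mk' (fun a => Dq₁ (exp a)) fun a b => by
    rw [exp_add, Dq₁_mul (exp_ne_zero _) (exp_ne_zero _)]

lemma DE_apply (a : ℂ) : DE a = Dq₁ (exp a) := rfl

lemma DE_log (hz : Reg z) : DE (log z) = Dq z := by
  rw [DE_apply, exp_log hz.1, Dq₁, if_neg hz.2]

lemma ec_five_p₁ (h : IsLift x y a₀ c₀ a₁ c₁ c₂) :
    dp (a₁ - a₀, c₂) = dp (a₁, c₁) + dp (a₁ - a₀ + c₁ - c₀, c₂ - c₁) := by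
  have h1 := ec_five h
  have h2 := ec_five (h.shift 0 0 1 0 0)
  simp only [Int.cast_zero, zero_mul, add_zero, Int.cast_one, one_mul, alt5] at h1 h2
  rw [show a₁ + Cpi * I - a₀ + c₁ - c₀ = a₁ - a₀ + c₁ - c₀ + Cpi * I by ring,
    show a₁ + Cpi * I - a₀ = a₁ - a₀ + Cpi * I by ring, ← h1, ← sub_eq_zero] at h2
  rw [← sub_eq_zero, ← h2]
  simp only [dp]
  abel

lemma dp_shift' (h : LiesOver (a, c) z) (p : ℤ) : dp (a + p * (Cpi * I), c) = dp (a, c) := by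
  obtain ⟨x, y, a₀, c₀, a₁, c₁, c₂, hl, rfl, rfl⟩ := exists_isLift_three h
  have h1 := ec_five_p₁ hl
  have h2 := ec_five_p₁ (hl.shift 0 (-p) 0 0 0)
  simp only [Int.cast_zero, zero_mul, add_zero, Int.cast_neg, neg_mul] at h2
  rw [show a₁ - a₀ + c₁ - (c₀ + -(p * (Cpi * I))) = a₁ - a₀ + c₁ - c₀ + p * (Cpi * I) by ring,
    h1] at h2
  exact (add_left_cancel h2).symm

/-- The element `[z, 1, 0] - [z, 0, 0]`. -/
def Dp (z : ℂ) : EPreBloch := dp (pt z 0 0)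

lemma dp_eq {w : ℂ × ℂ} (h : LiesOver w z) : dp w = Dp z := by
  have h0 := liesOver_pt h.1 0 0
  obtain ⟨p, q, rfl⟩ := h0.exists_covAct h
  have h1 : LiesOver ((pt z 0 0).1, (pt z 0 0).2 + q * (Cpi * I)) z := by
    simpa using h0.shift 0 q
  rw [dp_shift' h1, dp_shift h0, Dp]

lemma Dp_five₁ (h : (x, y) ∈ Conf) : Dp (y / x) = Dp y + Dp ((1 - x⁻¹) / (1 - y⁻¹)) := by
  obtain ⟨a₀, c₀, a₁, c₁, c₂, hl⟩ := exists_isLift h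
  have h1 := ec_five_p₁ hl
  have e1 := dp_eq (hl.liesOver 1)
  have e2 := dp_eq (hl.liesOver 2)
  have e3 := dp_eq (hl.liesOver 3)
  change dp (a₁, c₁) = Dp y at e1
  change dp (a₁ - a₀, c₂) = Dp (y / x) at e2
  change dp (a₁ - a₀ + c₁ - c₀, c₂ - c₁) = Dp ((1 - x⁻¹) / (1 - y⁻¹)) at e3
  rwa [e1, e2, e3] at h1

lemma Dp_five₀ (h : (x, y) ∈ Conf) :
    Dp x - Dp (y / x) + Dp ((1 - x⁻¹) / (1 - y⁻¹)) - Dq ((1 - x) / (1 - y)) = 0 := by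
  obtain ⟨a₀, c₀, a₁, c₁, c₂, hl⟩ := exists_isLift h
  have h1 := ec_five hl
  have h2 := ec_five (hl.shift 1 0 0 0 0)
  have s := hl.shift 1 0 0 0 0
  have e0 := dp_eq (hl.liesOver 0)
  have e2 := dp_eq (s.liesOver 2)
  have e3 := dp_eq (s.liesOver 3)
  have e4 := dq_eq (s.liesOver 4)
  simp only [Int.cast_zero, zero_mul, add_zero, Int.cast_one, one_mul, alt5] at h1 h2 e2 e3 e4
  change dp (a₀, c₀) = Dp x at e0
  change dp (a₁ - (a₀ + Cpi * I), c₂) = Dp (y / x) at e2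
  change dp (a₁ - (a₀ + Cpi * I) + c₁ - c₀, c₂ - c₁) = Dp ((1 - x⁻¹) / (1 - y⁻¹)) at e3
  change dq (c₁ - c₀, c₂ - c₁ - (a₀ + Cpi * I)) = Dq ((1 - x) / (1 - y)) at e4
  rw [← e0, ← e2, ← e3, ← e4]
  simp only [dp, dq]
  rw [show a₁ - (a₀ + Cpi * I) + c₁ - c₀ + Cpi * I = a₁ - a₀ + c₁ - c₀ by ring,
    show a₁ - (a₀ + Cpi * I) + Cpi * I = a₁ - a₀ by ring,
    show c₂ - c₁ - (a₀ + Cpi * I) + Cpi * I = c₂ - c₁ - a₀ by ring]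
  rw [← sub_zero (0 : EPreBloch)]
  nth_rw 1 [← h2]
  rw [← h1]
  abel

lemma Dq₁_eq (hz : Reg z) : Dq₁ z = Dq z := if_neg hz.2

lemma Dq₁_div {u v : ℂ} (hu : u ≠ 0) (hv : v ≠ 0) : Dq₁ (u / v) = Dq₁ u - Dq₁ v := by
  rw [eq_sub_iff_add_eq, ← Dq₁_mul (div_ne_zero hu hv) hv, div_mul_cancel₀ _ hv]

lemma Dp_eq (hz : Reg z) : Dp z = Dq (1 - z) := by
  have s : ∀ {z : ℂ}, Reg z → 1 - z ≠ 0 := fun hz => sub_ne_zero.2 (Ne.symm hz.2)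
  have h1 : ∀ {x y : ℂ}, (x, y) ∈ Conf → Dp x - Dq₁ (1 - x) = Dp y - Dq₁ (1 - y) := by
    intro x y h
    have e1 := Dp_five₁ h
    have e0 := Dp_five₀ h
    have r : Reg ((1 - x) / (1 - y)) := reg_ftTuple h.1 h.2.1 h.2.2 4
    rw [e1, ← Dq₁_eq r, Dq₁_div (s h.1) (s h.2.1), ← sub_eq_zero] at e0
    rw [← sub_eq_zero, ← sub_eq_zero.1 e0]
    abel
  have h2 : ∀ {x y : ℂ}, Reg x → Reg y → Dp x - Dq₁ (1 - x) = Dp y - Dq₁ (1 - y) := by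
    intro x y hx hy
    by_cases h : x = y
    · rw [h]
    · exact h1 ⟨hx, hy, h⟩
  obtain ⟨y, hy⟩ := (isPathConnected_compl (Set.toFinite ({0, 1, z} : Set ℂ))).nonempty
  simp only [Set.mem_compl_iff, Set.mem_insert_iff, Set.mem_singleton_iff, not_or] at hy
  have hc : (z, y) ∈ Conf := ⟨hz, ⟨hy.1, hy.2.1⟩, Ne.symm hy.2.2⟩
  have e1 := Dp_five₁ hc
  have r2 : Reg (y / z) := reg_ftTuple hc.1 hc.2.1 hc.2.2 2
  have r3 : Reg ((1 - z⁻¹) / (1 - y⁻¹)) := reg_ftTuple hc.1 hc.2.1 hc.2.2 3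
  have e2 := h2 r2 hz
  have e3 := h2 r3 hz
  have e4 := h2 hc.2.1 hz
  rw [ft_one_sub_three hz hc.2.1, Dq₁_div (s r2) (s hc.2.1)] at e3
  have r : Reg (1 - z) := ⟨s hz, fun h => hz.1 (by linear_combination -h)⟩
  rw [← Dq₁_eq r, ← sub_eq_zero]
  have e5 : Dp (y / z) - Dq₁ (1 - y / z) = (Dp y - Dq₁ (1 - y)) +
      (Dp ((1 - z⁻¹) / (1 - y⁻¹)) - (Dq₁ (1 - y / z) - Dq₁ (1 - y))) := by
    rw [e1]
    abel
  rw [e2, e3, e4] at e5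
  exact left_eq_add.1 e5

end ExtendedPreBloch

section ExtendedToClassical

open FreeAbelianGroup

variable {x y z a b c a₀ c₀ a₁ c₁ c₂ : ℂ}

/-! ### The map to the classical pre-Bloch group -/

lemma LiesOver.shift_fst {w : ℂ × ℂ} (h : LiesOver w z) (p : ℤ) :
    LiesOver (w.1 + p * (Cpi * I), w.2) z := by
  simpa using h.shift p 0

lemma LiesOver.shift_snd {w : ℂ × ℂ} (h : LiesOver w z) (q : ℤ) :
    LiesOver (w.1, w.2 + q * (Cpi * I)) z := by
  simpa using h.shift 0 q

lemma isExtBloch_pbCls : IsExtBloch fun w : ℂ × ℂ => pbCls (zOf w) := by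
  constructor
  · intro x y a₀ c₀ a₁ c₁ c₂ h
    have e : ∀ i, zOf (lin5 a₀ c₀ a₁ c₁ c₂ i) = ftTuple x y i := fun i => (h.liesOver i).zOf_eq
    have k := pbCls_five_term h.hx h.hy h.hne
    change pbCls (ftTuple x y 0) - pbCls (ftTuple x y 1) + pbCls (ftTuple x y 2) -
      pbCls (ftTuple x y 3) + pbCls (ftTuple x y 4) = 0 at k
    rw [← e, ← e, ← e, ← e, ← e] at k
    exact k
  · intro w z h p q
    rw [(h.shift p q).zOf_eq, (h.shift_fst p).zOf_eq, (h.shift_snd q).zOf_eq, h.zOf_eq]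

/-- The map `êP(ℂ) → P(ℂ)` forgetting the logarithms. -/
def piE : EPreBloch →+ PreBloch := isExtBloch_pbCls.hom

lemma piE_ec {w : ℂ × ℂ} (h : LiesOver w z) : piE (ec w) = pbCls z := by
  rw [piE, isExtBloch_pbCls.hom_ec h.mem_Cover, h.zOf_eq]

lemma piE_surjective : Function.Surjective piE := by
  intro s
  obtain ⟨s, rfl⟩ := QuotientAddGroup.mk_surjective s
  induction s using FreeAbelianGroup.induction_on with
  | zero => exact ⟨0, map_zero _⟩
  | of z => exact ⟨ec (pt z 0 0), (piE_ec (liesOver_pt z.2 0 0)).trans (pbCls_eq z.2)⟩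
  | neg z h =>
    obtain ⟨e, he⟩ := h
    exact ⟨-e, by rw [map_neg, he]; rfl⟩
  | add s t hs ht =>
    obtain ⟨e, he⟩ := hs
    obtain ⟨e', he'⟩ := ht
    exact ⟨e + e', by rw [map_add, he, he']; rfl⟩

lemma reg_exp (h : exp a ≠ 1) : Reg (exp a) := ⟨exp_ne_zero a, h⟩

lemma piE_DE (a : ℂ) : piE (DE a) = 0 := by
  rw [DE_apply, Dq₁]
  split_ifs with h
  · exact map_zero _
  · have hp := liesOver_pt (reg_exp h) 0 0
    have h1 := hp.shift_snd 1
    rw [Int.cast_one, one_mul] at h1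
    rw [Dq, dq, map_sub, piE_ec hp, piE_ec h1, sub_self]

lemma Dq_mem (hz : Reg z) : Dq z ∈ DE.range := AddMonoidHom.mem_range.2 ⟨_, DE_log hz⟩

lemma Dp_mem (hz : Reg z) : Dp z ∈ DE.range := by
  rw [Dp_eq hz]
  exact Dq_mem ⟨sub_ne_zero.2 (Ne.symm hz.2), fun h => hz.1 (by linear_combination -h)⟩

lemma ec_shift_fst {w : ℂ × ℂ} (h : LiesOver w z) (p : ℤ) :
    ec (w.1 + p * (Cpi * I), w.2) = ec w + p • Dp z := by
  have key : ∀ p : ℤ, ec (w.1 + (p + 1 : ℤ) * (Cpi * I), w.2) =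
      ec (w.1 + p * (Cpi * I), w.2) + Dp z := by
    intro p
    rw [← dp_eq (h.shift_fst p), dp, Int.cast_add, Int.cast_one, add_mul, one_mul, ← add_assoc]
    abel
  induction p using Int.induction_on with
  | zero => simp
  | succ n ih => rw [key, ih, add_zsmul, one_zsmul, add_assoc]
  | pred n ih =>
    have := key (-(n : ℤ) - 1)
    rw [sub_add_cancel, ih] at this
    rw [← sub_eq_iff_eq_add.2 this, sub_zsmul, one_zsmul]
    abel

lemma ec_shift_snd {w : ℂ × ℂ} (h : LiesOver w z) (q : ℤ) :
    ec (w.1, w.2 + q * (Cpi * I)) = ec w + q • Dq z := by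
  have key : ∀ q : ℤ, ec (w.1, w.2 + (q + 1 : ℤ) * (Cpi * I)) =
      ec (w.1, w.2 + q * (Cpi * I)) + Dq z := by
    intro q
    rw [← dq_eq (h.shift_snd q), dq, Int.cast_add, Int.cast_one, add_mul, one_mul, ← add_assoc]
    abel
  induction q using Int.induction_on with
  | zero => simp
  | succ n ih => rw [key, ih, add_zsmul, one_zsmul, add_assoc]
  | pred n ih =>
    have := key (-(n : ℤ) - 1)
    rw [sub_add_cancel, ih] at this
    rw [← sub_eq_iff_eq_add.2 this, sub_zsmul, one_zsmul]
    abel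

lemma mk_ec_eq {w w' : ℂ × ℂ} (h : LiesOver w z) (h' : LiesOver w' z) :
    QuotientAddGroup.mk' DE.range (ec w) = QuotientAddGroup.mk' DE.range (ec w') := by
  obtain ⟨p, q, rfl⟩ := h'.exists_covAct h
  have e := ec_shift_snd (h'.shift_fst p) q
  rw [ec_shift_fst h'] at e
  rw [e, map_add, map_add, show QuotientAddGroup.mk' DE.range (q • Dq z) = 0 from
      (QuotientAddGroup.eq_zero_iff _).2 (zsmul_mem (Dq_mem h.1) q),
    show QuotientAddGroup.mk' DE.range (p • Dp z) = 0 from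
      (QuotientAddGroup.eq_zero_iff _).2 (zsmul_mem (Dp_mem h.1) p), add_zero, add_zero]

/-- The section of `piE` modulo the image of `DE`. -/
def secP : PreBloch →+ EPreBloch ⧸ DE.range :=
  QuotientAddGroup.lift pbSub (lift fun z : RegT => QuotientAddGroup.mk' DE.range (ec (pt z 0 0))) (by
    intro s hs
    refine (AddSubgroup.closure_le (AddMonoidHom.ker _)).2 ?_ hs
    rintro s ⟨x, y, hx, hy, h, h2, h3, h4, rfl⟩
    rw [SetLike.mem_coe, AddMonoidHom.mem_ker]
    obtain ⟨a₀, c₀, a₁, c₁, c₂, hl⟩ := exists_isLift (x := x) (y := y) ⟨hx, hy, h⟩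
    have k := congrArg (QuotientAddGroup.mk' DE.range) (ec_five hl)
    have e : ∀ i, QuotientAddGroup.mk' DE.range (ec (pt (ftTuple x y i) 0 0)) =
        QuotientAddGroup.mk' DE.range (ec (lin5 a₀ c₀ a₁ c₁ c₂ i)) := fun i =>
      mk_ec_eq (liesOver_pt (hl.liesOver i).1 0 0) (hl.liesOver i)
    simp only [alt5, map_add, map_sub, map_zero] at k
    simp only [pbGen, map_add, map_sub, lift_apply_of]
    refine Eq.trans ?_ k
    exact congrArg₂ _ (congrArg₂ _ (congrArg₂ _ (congrArg₂ _ (e 0) (e 1)) (e 2)) (e 3)) (e 4))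

lemma secP_piE (e : EPreBloch) : secP (piE e) = QuotientAddGroup.mk' DE.range e := by
  refine ePreBloch_induction (p := fun e => secP (piE e) = QuotientAddGroup.mk' DE.range e) e
    (by rw [map_zero, map_zero, map_zero]) (fun w hw => ?_)
    (fun e h => by rw [map_neg, map_neg, map_neg, h])
    fun e e' h h' => by rw [map_add, map_add, map_add, h, h']
  have h := liesOver_of_mem hw
  rw [piE_ec h, mk_ec_eq h (liesOver_pt h.1 0 0), pbCls_eq h.1]
  exact lift_apply_of _ _

lemma exists_DE_eq {e : EPreBloch} (h : piE e = 0) : ∃ a, DE a = e := by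
  have h1 := secP_piE e
  rw [h, map_zero] at h1
  exact AddMonoidHom.mem_range.1 ((QuotientAddGroup.eq_zero_iff _).1 h1.symm)

/-! ### Comparison of `ν` and the Dehn invariant -/

lemma nuHom_DE (a : ℂ) : nuHom (DE a) = wedgeHom a (Cpi * I) := by
  rw [DE_apply, Dq₁]
  split_ifs with h
  · obtain ⟨n, rfl⟩ := exp_eq_one_iff.1 h
    rw [map_zero, show (n : ℂ) * (2 * Real.pi * I) = (2 * n : ℤ) • (Cpi * I) by
      rw [zsmul_eq_mul]; push_cast [Cpi]; ring, map_zsmul, AddMonoidHom.zsmul_apply]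
    have h0 : wedgeHom (Cpi * I) (Cpi * I) = 0 := wedge_self _
    rw [h0, smul_zero]
  · have hp : LiesOver (a, (pt (exp a) 0 0).2) (exp a) := by
      have h0 := liesOver_iff.1 (liesOver_pt (reg_exp h) 0 0)
      exact liesOver_iff.2 ⟨h0.1, by rw [two_mul, exp_add, sq], h0.2.2⟩
    have h1 := hp.shift_snd 1
    rw [Int.cast_one, one_mul] at h1
    rw [← dq_eq hp, dq, map_sub, nuHom_ec hp.mem_Cover, nuHom_ec h1.mem_Cover, map_add,
      add_sub_cancel_left]

lemma exp_eq_or_neg (h : exp (2 * a) = z ^ 2) : exp a = z ∨ exp a = -z := by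
  rw [two_mul, exp_add, ← sq] at h
  exact sq_eq_sq_iff_eq_or_eq_neg.1 h

lemma dehnP_piE (e : EPreBloch) :
    dehnP (piE e) = -QuotientAddGroup.mk' (wedgeHom (Cpi * I)).range (nuHom e) := by
  refine ePreBloch_induction (p := fun e => dehnP (piE e) =
      -QuotientAddGroup.mk' (wedgeHom (Cpi * I)).range (nuHom e)) e
    (by rw [map_zero, map_zero, map_zero, map_zero, neg_zero]) (fun w hw => ?_)
    (fun e h => by rw [map_neg, map_neg, map_neg, map_neg, h])
    fun e e' h h' => by rw [map_add, map_add, map_add, map_add, h, h', neg_add]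
  have h := liesOver_of_mem hw
  have hz := (liesOver_iff.1 h)
  have h1 : exp (2 * -w.2) = (1 - zOf w) ^ 2 := by rw [← hz.2.2]; ring_nf
  rw [piE_ec h, dehnP_pbCls h.1, logm_eq h.1.1 (exp_eq_or_neg hz.2.1),
    logm_eq (sub_ne_zero.2 (Ne.symm h.1.2)) (exp_eq_or_neg h1), lw_mk, nuHom_ec hw, ← map_neg]
  exact congrArg _ (map_neg (wedgeHom w.1) w.2)

/-- The antisymmetrization of a product of two additive functions. -/
def detB (f g : ℂ →+ ℚ) : ℂ →+ ℂ →+ ℚ :=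
  AddMonoidHom.mk' (fun u => AddMonoidHom.mk' (fun v => f u * g v - f v * g u)
    fun v v' => by rw [map_add, map_add]; ring) fun u u' => by
      ext v
      change f (u + u') * g v - f v * g (u + u') = f u * g v - f v * g u + (f u' * g v - f v * g u')
      rw [map_add, map_add]
      ring

lemma detB_apply (f g : ℂ →+ ℚ) (u v : ℂ) : detB f g u v = f u * g v - f v * g u := rfl

lemma mul_eq_of_wedge_eq_zero (f g : ℂ →+ ℚ) (h : wedge a b = 0) : f a * g b - f b * g a = 0 := by
  have k := wedgeLift_wedge (detB f g) (fun u => by rw [detB_apply]; ring) a b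
  rw [h, map_zero, detB_apply] at k
  exact k.symm

lemma exists_rat_of_wedge_eq_zero (h : wedgeHom a (Cpi * I) = 0) :
    ∃ q : ℚ, a = q • (2 * Cpi * I) := by
  have hpi : (2 * Cpi * I : ℂ) ≠ 0 := by simp [Cpi, Real.pi_ne_zero]
  by_contra! hq
  have ha : a ∉ Submodule.span ℚ {2 * Cpi * I} := fun hm =>
    have ⟨q, h⟩ := Submodule.mem_span_singleton.1 hm
    hq q h.symm
  obtain ⟨f, hf, hfp⟩ := Submodule.exists_le_ker_of_notMem ha
  obtain ⟨g, hg, -⟩ := Submodule.exists_le_ker_of_notMem (p := (⊥ : Submodule ℚ ℂ)) (v := 2 * Cpi * I)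
    (by simpa using hpi)
  have hf0 : f (2 * Cpi * I) = 0 := hfp (Submodule.mem_span_singleton_self _)
  have h2 : wedge a (2 * Cpi * I) = 0 := by
    have : wedgeHom a (Cpi * I + Cpi * I) = 0 := by rw [map_add, h, add_zero]
    rwa [← two_mul, ← mul_assoc] at this
  have k := mul_eq_of_wedge_eq_zero f.toAddMonoidHom g.toAddMonoidHom h2
  change f a * g (2 * Cpi * I) - f (2 * Cpi * I) * g a = 0 at k
  rw [hf0, zero_mul, sub_zero] at k
  exact mul_ne_zero hf hg k

/-! ### The extended Bloch group -/

/-- The homomorphism `q ↦ DE (2πi q)` from `ℚ` to the extended Bloch group. -/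
def kapE : ℚ →+ EBloch :=
  AddMonoidHom.mk' (fun q => ⟨DE (q • (2 * Cpi * I)), by
    have h : wedgeHom (Cpi * I) (Cpi * I) = 0 := wedge_self _
    have e : q • (2 * Cpi * I) = (2 : ℤ) • q • (Cpi * I) := by
      rw [mul_assoc, smul_comm]; simp
    rw [EBloch, AddMonoidHom.mem_ker, nuHom_DE, e, map_zsmul, AddMonoidHom.zsmul_apply]
    have h3 : wedgeHom (q • (Cpi * I)) (Cpi * I) = 0 := by
      have hd : ((q.den : ℤ) : ℚ) ≠ 0 := by exact_mod_cast q.den_ne_zero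
      have e1 : q • (Cpi * I) = q.num • (((q.den : ℤ) : ℚ)⁻¹ • (Cpi * I)) := by
        rw [← Int.cast_smul_eq_zsmul ℚ, smul_smul]
        congr 1
        exact (Rat.num_div_den q).symm.trans (div_eq_mul_inv _ _)
      have e2 : Cpi * I = (q.den : ℤ) • (((q.den : ℤ) : ℚ)⁻¹ • (Cpi * I)) := by
        rw [← Int.cast_smul_eq_zsmul ℚ, smul_smul, mul_inv_cancel₀ hd, one_smul]
      have h0 : wedgeHom (((q.den : ℤ) : ℚ)⁻¹ • (Cpi * I)) (((q.den : ℤ) : ℚ)⁻¹ • (Cpi * I)) = 0 :=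
        wedge_self _
      rw [e1]
      nth_rw 2 [e2]
      rw [map_zsmul, map_zsmul, AddMonoidHom.zsmul_apply, h0, smul_zero, smul_zero]
    rw [h3, smul_zero]⟩) fun q r => Subtype.ext (by simp only [add_smul, map_add]; rfl)

lemma coe_kapE (q : ℚ) : (kapE q : EPreBloch) = DE (q • (2 * Cpi * I)) := rfl

lemma kapE_one : kapE 1 = 0 := by
  refine Subtype.ext ?_
  rw [coe_kapE, one_smul, DE_apply, Dq₁, Cpi, exp_two_pi_mul_I, if_pos rfl]
  rfl

lemma piE_kapE (q : ℚ) : piE (kapE q) = 0 := piE_DE _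

lemma exists_kapE_eq {e : EBloch} (h : piE e = 0) : ∃ q, kapE q = e := by
  obtain ⟨a, ha⟩ := exists_DE_eq h
  have h1 := nuHom_DE a
  rw [ha, AddMonoidHom.mem_ker.1 e.2] at h1
  obtain ⟨q, rfl⟩ := exists_rat_of_wedge_eq_zero h1.symm
  exact ⟨q, Subtype.ext ha⟩

lemma dehnP_piE_coe (e : EBloch) : dehnP (piE e) = 0 := by
  rw [dehnP_piE, AddMonoidHom.mem_ker.1 e.2, map_zero, neg_zero]

lemma exists_piE_eq {s : PreBloch} (h : dehnP s = 0) : ∃ e : EBloch, piE e = s := by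
  obtain ⟨e, rfl⟩ := piE_surjective s
  rw [dehnP_piE, neg_eq_zero] at h
  obtain ⟨b, hb⟩ := AddMonoidHom.mem_range.1 ((QuotientAddGroup.eq_zero_iff _).1 h)
  refine ⟨⟨e + DE b, ?_⟩, ?_⟩
  · rw [EBloch, AddMonoidHom.mem_ker, map_add, nuHom_DE, ← hb, wedge_alt b, add_neg_cancel]
  · rw [map_add, piE_DE, add_zero]

end ExtendedToClassical

section Dilogarithm

open Filter Topology

variable {x y z a b c a₀ c₀ a₁ c₁ c₂ : ℂ}

/-! ### The dilogarithm -/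

lemma dslope_exp_ne_zero (h : |z.im| < Real.pi) : dslope exp 0 z ≠ 0 := by
  by_cases hz : z = 0
  · rw [hz, dslope_same, Complex.deriv_exp, exp_zero]
    exact one_ne_zero
  · intro h0
    have h1 := sub_smul_dslope exp 0 z
    rw [h0, smul_zero, exp_zero, eq_comm, sub_eq_zero] at h1
    obtain ⟨h2, h3⟩ := abs_lt.1 h
    apply hz
    rw [← log_exp h2 h3.le, h1, log_one]

lemma exists_dilog : ∃ f : ℂ → ℂ, ∀ z, 1 - z ∈ slitPlane →
    ∃ d, HasDerivAt f d z ∧ z * d = -log (1 - z) := by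
  have hc : Convex ℝ {z : ℂ | |z.im| < Real.pi} := by
    have e : {z : ℂ | |z.im| < Real.pi} = imLm ⁻¹' Set.Ioo (-Real.pi) Real.pi := by
      ext z
      exact abs_lt (a := z.im)
    rw [e]
    exact (convex_Ioo _ _).linear_preimage _
  have ho : IsOpen {z : ℂ | |z.im| < Real.pi} :=
    isOpen_lt continuous_im.abs continuous_const
  have hd : DifferentiableOn ℂ (fun z => (dslope exp 0 z)⁻¹) {z : ℂ | |z.im| < Real.pi} := by
    refine DifferentiableOn.inv ?_ fun z hz => dslope_exp_ne_zero hz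
    exact (differentiableOn_dslope (ho.mem_nhds (by simp [Real.pi_pos]))).2
      differentiable_exp.differentiableOn
  obtain ⟨g, hg⟩ := hc.exists_forall_hasDerivWithinAt hd
  refine ⟨fun z => g (-log (1 - z)), fun z hz => ?_⟩
  have hz0 := slitPlane_ne_zero hz
  have hm : |(-log (1 - z)).im| < Real.pi := by
    rw [neg_im, abs_neg, log_im]
    exact abs_lt.2 ⟨neg_pi_lt_arg _, (arg_le_pi _).lt_of_ne (slitPlane_arg_ne_pi hz)⟩
  have h1 : HasDerivAt (fun z : ℂ => -log (1 - z)) (1 - z)⁻¹ z := by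
    have := ((((hasDerivAt_id z).const_sub 1).clog hz)).neg
    exact this.congr_deriv (by rw [neg_div, neg_neg, one_div, id])
  refine ⟨_, ((hg _ hm).hasDerivAt (ho.mem_nhds hm)).comp z h1, ?_⟩
  have h2 := sub_smul_dslope exp 0 (-log (1 - z))
  rw [sub_zero, exp_zero, exp_neg, exp_log hz0, smul_eq_mul] at h2
  have h3 := dslope_exp_ne_zero hm
  have h4 : z * (1 - z)⁻¹ = (1 - z)⁻¹ - 1 := by field_simp; ring
  rw [mul_left_comm, h4, ← h2, inv_mul_eq_div, mul_div_cancel_right₀ _ h3]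

/-- The dilogarithm, up to a constant, on the plane slit along `[1, ∞)`. -/
def li2 : ℂ → ℂ := Classical.choose exists_dilog

lemma hasDerivAt_li2 (h : 1 - z ∈ slitPlane) : ∃ d, HasDerivAt li2 d z ∧ z * d = -log (1 - z) :=
  Classical.choose_spec exists_dilog z h

lemma exists_reflection : ∃ k, ∀ z, z ∈ slitPlane → 1 - z ∈ slitPlane →
    li2 z + li2 (1 - z) + log z * log (1 - z) = k := by
  have ho : IsOpen (slitPlane ∩ (fun z => 1 - z) ⁻¹' slitPlane) :=
    isOpen_slitPlane.inter (isOpen_slitPlane.preimage (by fun_prop))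
  have hs : StarConvex ℝ ((1 / 2 : ℝ) : ℂ) (slitPlane ∩ (fun z => 1 - z) ⁻¹' slitPlane) := by
    have h := starConvex_ofReal_slitPlane (x := 1 / 2) (by norm_num)
    intro z hz s t hs ht hst
    refine ⟨h hz.1 hs ht hst, ?_⟩
    have e : 1 - (s • ((1 / 2 : ℝ) : ℂ) + t • z) = s • ((1 / 2 : ℝ) : ℂ) + t • (1 - z) := by
      have : (s : ℂ) + t = 1 := by exact_mod_cast hst
      simp only [real_smul]
      push_cast
      linear_combination -this
    rw [Set.mem_preimage, e]
    exact h hz.2 hs ht hst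
  have hd : ∀ z ∈ slitPlane ∩ (fun z => 1 - z) ⁻¹' slitPlane,
      HasDerivAt (fun z => li2 z + li2 (1 - z) + log z * log (1 - z)) 0 z := by
    rintro z ⟨h1, h2⟩
    obtain ⟨d, hd, e⟩ := hasDerivAt_li2 h2
    obtain ⟨d', hd', e'⟩ := hasDerivAt_li2 (z := 1 - z) (by rwa [sub_sub_cancel])
    have h3 := (hasDerivAt_id z).const_sub 1
    have h4 := (hd.add (hd'.comp z h3)).add
      ((hasDerivAt_log h1).mul (h3.clog h2))
    refine h4.congr_deriv ?_
    have hz := slitPlane_ne_zero h1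
    have hz' : 1 - z ≠ 0 := slitPlane_ne_zero h2
    rw [sub_sub_cancel] at e'
    rw [mul_comm, ← eq_div_iff hz] at e
    rw [mul_comm, ← eq_div_iff hz'] at e'
    rw [e, e']
    simp only [id]
    field_simp
    ring
  obtain ⟨k, hk⟩ := ho.exists_is_const_of_deriv_eq_zero
    (hs.isPathConnected ⟨by norm_num [mem_slitPlane_iff], by norm_num [mem_slitPlane_iff]⟩).isConnected.isPreconnected
    (fun z hz => (hd z hz).differentiableAt.differentiableWithinAt) fun z hz => (hd z hz).deriv
  exact ⟨k, fun z h1 h2 => hk z ⟨h1, h2⟩⟩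

/-! ### The lifted Rogers dilogarithm -/

/-- `ℂ` modulo `π²/2`. -/
abbrev HalfMod : Type := ℂ ⧸ AddSubgroup.zmultiples (Cpi ^ 2 / 2)

/-- The projection to `ℂ` modulo `π²/2`. -/
def hm : ℂ →+ HalfMod := QuotientAddGroup.mk' _

lemma hm_eq_zero : hm a = 0 ↔ ∃ n : ℤ, a = n * (Cpi ^ 2 / 2) := by
  rw [hm, QuotientAddGroup.mk'_apply, QuotientAddGroup.eq_zero_iff, AddSubgroup.mem_zmultiples_iff]
  simp only [zsmul_eq_mul, eq_comm]

lemma hm_eq (n : ℤ) (h : a - b = n * (Cpi ^ 2 / 2)) : hm a = hm b := by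
  rw [← sub_eq_zero, ← map_sub]
  exact hm_eq_zero.2 ⟨n, h⟩

/-- The Rogers dilogarithm on the part of the cover over `ℂ ∖ [1, ∞)`. -/
def rog₁ (w : ℂ × ℂ) : ℂ := li2 (zOf w) + w.1 * w.2 / 2 + w.1 * log (1 - zOf w)

/-- The Rogers dilogarithm modulo `π²/2` on the cover. -/
def rog (w : ℂ × ℂ) : HalfMod :=
  if 1 - zOf w ∈ slitPlane then hm (rog₁ w)
  else hm (Classical.choose exists_reflection - rog₁ (-w.2, -w.1))

lemma LiesOver.swap (h : LiesOver (a, c) z) : LiesOver (-c, -a) (1 - z) := by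
  have h1 := liesOver_iff.1 h
  refine liesOver_iff.2 ⟨⟨sub_ne_zero.2 (Ne.symm h.1.2), fun h2 => h.1.1 (by linear_combination -h2)⟩,
    ?_, ?_⟩
  · rw [← h1.2.2]
    ring_nf
  · rw [sub_sub_cancel, ← h1.2.1]
    ring_nf

lemma rog_eq (h : LiesOver (a, c) z) (hz : 1 - z ∈ slitPlane) : rog (a, c) = hm (rog₁ (a, c)) :=
  if_pos (by rwa [h.zOf_eq])

lemma rog_eq' (h : LiesOver (a, c) z) (hz : z ∈ slitPlane) :
    rog (a, c) = hm (Classical.choose exists_reflection - rog₁ (-c, -a)) := by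
  by_cases h1 : 1 - z ∈ slitPlane
  · rw [rog_eq h h1]
    have k := Classical.choose_spec exists_reflection z hz h1
    have e : rog₁ (a, c) + rog₁ (-c, -a) =
        Classical.choose exists_reflection + (a - log z) * (c + log (1 - z)) := by
      simp only [rog₁]
      rw [h.zOf_eq, h.swap.zOf_eq, sub_sub_cancel]
      linear_combination k
    obtain ⟨-, p, q, hw⟩ := h
    rw [pt, Prod.mk.injEq] at hw
    refine hm_eq (-(2 * p * q)) ?_
    push_cast
    rw [hw.1, hw.2] at e ⊢
    linear_combination e + p * q * Cpi ^ 2 * I_sq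
  · exact if_neg (by rwa [h.zOf_eq])

lemma Reg.mem_slitPlane (z : ℂ) : 1 - z ∈ slitPlane ∨ z ∈ slitPlane := by
  rcases le_or_gt z.re 0 with h | h
  · exact Or.inl (mem_slitPlane_iff.2 (Or.inl (by simp; linarith)))
  · exact Or.inr (mem_slitPlane_iff.2 (Or.inl h))

lemma rog_shift (h : LiesOver (a, c) z) (p q : ℤ) :
    rog (a + p * (Cpi * I), c + q * (Cpi * I)) = rog (a, c) + hm (Cpi * I / 2 * (q * a - p * c)) := by
  have key : ∀ {a c z : ℂ} (_ : LiesOver (a, c) z) (_ : 1 - z ∈ slitPlane) (p q : ℤ),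
      hm (rog₁ (a + p * (Cpi * I), c + q * (Cpi * I))) =
        hm (rog₁ (a, c)) + hm (Cpi * I / 2 * (q * a - p * c)) := by
    intro a c z h hz p q
    have e : zOf (a + p * (Cpi * I), c + q * (Cpi * I)) = z := (h.shift p q).zOf_eq
    simp only [rog₁]
    rw [e, h.zOf_eq, ← map_add]
    obtain ⟨-, m, n, hw⟩ := h
    rw [pt, Prod.mk.injEq] at hw
    refine hm_eq (-(p * q) - 2 * p * n) ?_
    push_cast
    rw [hw.1, hw.2]
    linear_combination (p * q / 2 + p * n) * Cpi ^ 2 * I_sq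
  have hs : LiesOver (a + p * (Cpi * I), c + q * (Cpi * I)) z := h.shift p q
  rcases Reg.mem_slitPlane z with hz | hz
  · rw [rog_eq hs hz, rog_eq h hz, key h hz]
  · have k := key h.swap (by rwa [sub_sub_cancel]) (-q) (-p)
    rw [rog_eq' hs hz, rog_eq' h hz, map_sub, map_sub, sub_add, sub_right_inj, ← sub_eq_zero]
    rw [← sub_eq_zero] at k
    rw [← k]
    push_cast
    rw [show -(c + q * (Cpi * I)) = -c + -q * (Cpi * I) by ring,
      show -(a + p * (Cpi * I)) = -a + -p * (Cpi * I) by ring,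
      show Cpi * I / 2 * (-p * -c - -q * -a) = -(Cpi * I / 2 * (q * a - p * c)) by ring, map_neg]
    abel

/-- A pair of functions lifts holomorphically to the cover near `t₀`. -/
structure IsGerm (α γ α' γ' : ℂ → ℂ) (t₀ : ℂ) : Prop where
  liesOver : ∀ᶠ t in 𝓝 t₀, ∃ z, LiesOver (α t, γ t) z
  fst : ∀ᶠ t in 𝓝 t₀, HasDerivAt α (α' t) t
  snd : ∀ᶠ t in 𝓝 t₀, HasDerivAt γ (γ' t) t

/-- `rog` is locally represented by a function with the expected derivative. -/
def HasRep (α γ α' γ' : ℂ → ℂ) (t₀ : ℂ) : Prop :=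
  ∃ r : ℂ → ℂ, (∀ᶠ t in 𝓝 t₀, rog (α t, γ t) = hm (r t)) ∧
    ∀ᶠ t in 𝓝 t₀, HasDerivAt r ((γ t * α' t - α t * γ' t) / 2) t

variable {α γ α' γ' : ℂ → ℂ} {t₀ : ℂ}

lemma hasDerivAt_zOf_comp {t d d' : ℂ} (h : ∀ᶠ s in 𝓝 t, ∃ z, LiesOver (α s, γ s) z)
    (hα : HasDerivAt α d t) (hγ : HasDerivAt γ d' t) :
    HasDerivAt (fun s => zOf (α s, γ s)) (d * zOf (α t, γ t)) t ∧
      d * zOf (α t, γ t) = d' * (1 - zOf (α t, γ t)) := by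
  have e1 : HasDerivAt (fun s => exp (2 * α s)) (exp (2 * α t) * (2 * d)) t :=
    (hα.const_mul 2).cexp
  have e2 : HasDerivAt (fun s => exp (-(2 * γ s))) (exp (-(2 * γ t)) * -(2 * d')) t :=
    ((hγ.const_mul 2).neg).cexp
  have e3 : HasDerivAt (fun s => zOf (α s, γ s)) _ t := ((e1.const_add 1).sub e2).div_const 2
  obtain ⟨D, hD⟩ : ∃ D, HasDerivAt (fun s => zOf (α s, γ s)) D t := ⟨_, e3⟩
  have h0 : ∀ᶠ s in 𝓝 t, LiesOver (α s, γ s) (zOf (α s, γ s)) :=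
    h.mono fun s ⟨z, hs⟩ => by rwa [hs.zOf_eq]
  have ht := h0.self_of_nhds
  have hz := ht.1.1
  have hz1 : 1 - zOf (α t, γ t) ≠ 0 := sub_ne_zero.2 (Ne.symm ht.1.2)
  have k1 := (e1.congr_of_eventuallyEq (h0.mono fun s hs => hs.fst.symm)).unique (hD.pow 2)
  have k2 := (e2.congr_of_eventuallyEq (h0.mono fun s hs => hs.snd.symm)).unique
    ((hD.const_sub 1).pow 2)
  rw [ht.fst] at k1
  rw [ht.snd] at k2
  have j1 : D = d * zOf (α t, γ t) := by
    refine mul_left_cancel₀ (mul_ne_zero two_ne_zero hz) ?_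
    simp at k1
    linear_combination -k1
  have j2 : D = d' * (1 - zOf (α t, γ t)) := by
    refine mul_left_cancel₀ (mul_ne_zero two_ne_zero hz1) ?_
    simp at k2
    linear_combination -k2
  exact ⟨j1 ▸ hD, j1 ▸ j2⟩

lemma IsGerm.hasRep_of_mem (h : IsGerm α γ α' γ' t₀) (h0 : 1 - zOf (α t₀, γ t₀) ∈ slitPlane) :
    ∃ r : ℂ → ℂ, (∀ᶠ t in 𝓝 t₀, hm (rog₁ (α t, γ t)) = hm (r t) ∧ 1 - zOf (α t, γ t) ∈ slitPlane) ∧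
      ∀ᶠ t in 𝓝 t₀, HasDerivAt r ((γ t * α' t - α t * γ' t) / 2) t := by
  have h1 := hasDerivAt_zOf_comp h.liesOver h.fst.self_of_nhds h.snd.self_of_nhds
  have h2 : ∀ᶠ t in 𝓝 t₀, 1 - zOf (α t, γ t) ∈ slitPlane :=
    (h1.1.continuousAt.const_sub 1).eventually (isOpen_slitPlane.mem_nhds h0)
  refine ⟨fun t => rog₁ (α t, γ t), h2.mono fun t ht => ⟨rfl, ht⟩, ?_⟩
  filter_upwards [h.liesOver.eventually_nhds, h.fst, h.snd, h2] with t e0 e1 e2 e3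
  obtain ⟨k1, k2⟩ := hasDerivAt_zOf_comp e0 e1 e2
  obtain ⟨d, hd, hd'⟩ := hasDerivAt_li2 e3
  have k3 := ((hd.comp t k1).add ((e1.mul e2).div_const 2)).add (e1.mul ((k1.const_sub 1).clog e3))
  refine k3.congr_deriv ?_
  have hz1 := slitPlane_ne_zero e3
  rw [k2]
  rw [neg_div, mul_div_assoc, div_self hz1, ← k2]
  linear_combination α' t * hd'

lemma IsGerm.hasRep (h : IsGerm α γ α' γ' t₀) : HasRep α γ α' γ' t₀ := by
  rcases Reg.mem_slitPlane (zOf (α t₀, γ t₀)) with h0 | h0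
  · obtain ⟨r, h1, h2⟩ := h.hasRep_of_mem h0
    refine ⟨r, ?_, h2⟩
    filter_upwards [h1, h.liesOver] with t ht ⟨z, hz⟩
    rw [← ht.1, rog_eq hz (by rw [← hz.zOf_eq]; exact ht.2)]
  · have hg : IsGerm (fun t => -γ t) (fun t => -α t) (fun t => -γ' t) (fun t => -α' t) t₀ :=
      ⟨h.liesOver.mono fun t ⟨z, hz⟩ => ⟨_, hz.swap⟩, h.snd.mono fun t ht => ht.neg,
        h.fst.mono fun t ht => ht.neg⟩
    have e : ∀ {t z : ℂ}, LiesOver (α t, γ t) z → 1 - zOf (-γ t, -α t) = z := fun h => by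
      rw [h.swap.zOf_eq, sub_sub_cancel]
    obtain ⟨z₀, hz₀⟩ := h.liesOver.self_of_nhds
    obtain ⟨r, h1, h2⟩ := hg.hasRep_of_mem (by rwa [e hz₀, ← hz₀.zOf_eq])
    refine ⟨fun t => Classical.choose exists_reflection - r t, ?_, ?_⟩
    · filter_upwards [h1, h.liesOver] with t ht ⟨z, hz⟩
      rw [rog_eq' hz (by rw [← e hz]; exact ht.2), map_sub, map_sub, ht.1]
    · filter_upwards [h2] with t ht
      exact (ht.const_sub _).congr_deriv (by ring)

/-! ### The five term relation -/

lemma alt5_rog_shift (h : IsLift x y a₀ c₀ a₁ c₁ c₂) (p₀ q₀ p₁ q₁ q₂ : ℤ) :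
    alt5 rog (a₀ + p₀ * (Cpi * I)) (c₀ + q₀ * (Cpi * I)) (a₁ + p₁ * (Cpi * I))
      (c₁ + q₁ * (Cpi * I)) (c₂ + q₂ * (Cpi * I)) = alt5 rog a₀ c₀ a₁ c₁ c₂ := by
  have e0 := rog_shift (h.liesOver 0) p₀ q₀
  have e1 := rog_shift (h.liesOver 1) p₁ q₁
  have e2 := rog_shift (h.liesOver 2) (p₁ - p₀) q₂
  have e3 := rog_shift (h.liesOver 3) (p₁ - p₀ + q₁ - q₀) (q₂ - q₁)
  have e4 := rog_shift (h.liesOver 4) (q₁ - q₀) (q₂ - q₁ - p₀)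
  push_cast at e2 e3 e4
  rw [alt5, show a₁ + p₁ * (Cpi * I) - (a₀ + p₀ * (Cpi * I)) + (c₁ + q₁ * (Cpi * I)) -
      (c₀ + q₀ * (Cpi * I)) = a₁ - a₀ + c₁ - c₀ + (p₁ - p₀ + q₁ - q₀) * (Cpi * I) by ring,
    show a₁ + p₁ * (Cpi * I) - (a₀ + p₀ * (Cpi * I)) = a₁ - a₀ + (p₁ - p₀) * (Cpi * I) by ring,
    show c₂ + q₂ * (Cpi * I) - (c₁ + q₁ * (Cpi * I)) - (a₀ + p₀ * (Cpi * I)) =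
      c₂ - c₁ - a₀ + (q₂ - q₁ - p₀) * (Cpi * I) by ring,
    show c₂ + q₂ * (Cpi * I) - (c₁ + q₁ * (Cpi * I)) = c₂ - c₁ + (q₂ - q₁) * (Cpi * I) by ring,
    show c₁ + q₁ * (Cpi * I) - (c₀ + q₀ * (Cpi * I)) = c₁ - c₀ + (q₁ - q₀) * (Cpi * I) by ring]
  refine (congrArg₂ _ (congrArg₂ _ (congrArg₂ _ (congrArg₂ _ e0 e1) e2) e3) e4).trans ?_
  rw [← sub_eq_zero, alt5]
  refine Eq.trans ?_ (map_zero hm)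
  rw [show (0 : ℂ) = Cpi * I / 2 * (q₀ * a₀ - p₀ * c₀) - Cpi * I / 2 * (q₁ * a₁ - p₁ * c₁) +
    Cpi * I / 2 * (q₂ * (a₁ - a₀) - (p₁ - p₀) * c₂) -
    Cpi * I / 2 * ((q₂ - q₁) * (a₁ - a₀ + c₁ - c₀) - (p₁ - p₀ + q₁ - q₀) * (c₂ - c₁)) +
    Cpi * I / 2 * ((q₂ - q₁ - p₀) * (c₁ - c₀) - (q₁ - q₀) * (c₂ - c₁ - a₀)) by ring]
  simp only [map_add, map_sub hm]
  generalize hm _ = u0, hm _ = u1, hm _ = u2, hm _ = u3, hm _ = u4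
  abel

lemma IsLift.alt5_rog_eq {a₀' c₀' a₁' c₁' c₂' : ℂ} (h : IsLift x y a₀ c₀ a₁ c₁ c₂)
    (h' : IsLift x y a₀' c₀' a₁' c₁' c₂') :
    alt5 rog a₀' c₀' a₁' c₁' c₂' = alt5 rog a₀ c₀ a₁ c₁ c₂ := by
  obtain ⟨p₀, q₀, e0⟩ := (h.liesOver 0).exists_covAct (h'.liesOver 0)
  obtain ⟨p₁, q₁, e1⟩ := (h.liesOver 1).exists_covAct (h'.liesOver 1)
  obtain ⟨p₂, q₂, e2⟩ := (h.liesOver 2).exists_covAct (h'.liesOver 2)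
  obtain ⟨rfl, rfl⟩ := Prod.ext_iff.1 e0
  obtain ⟨rfl, rfl⟩ := Prod.ext_iff.1 e1
  have e3 : c₂' = c₂ + q₂ * (Cpi * I) := (Prod.ext_iff.1 e2).2
  subst e3
  exact alt5_rog_shift h p₀ q₀ p₁ q₁ q₂

lemma exists_rog_value : ∃ V : ℂ × ℂ → HalfMod, ∀ {x y a₀ c₀ a₁ c₁ c₂ : ℂ},
    IsLift x y a₀ c₀ a₁ c₁ c₂ → alt5 rog a₀ c₀ a₁ c₁ c₂ = V (x, y) := by
  have : ∀ p : ℂ × ℂ, ∃ v : HalfMod, ∀ {a₀ c₀ a₁ c₁ c₂ : ℂ},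
      IsLift p.1 p.2 a₀ c₀ a₁ c₁ c₂ → alt5 rog a₀ c₀ a₁ c₁ c₂ = v := fun p => by
    by_cases hp : p ∈ Conf
    · obtain ⟨a₀, c₀, a₁, c₁, c₂, h⟩ := exists_isLift hp
      exact ⟨_, fun h' => h.alt5_rog_eq h'⟩
    · exact ⟨0, fun h => (hp ⟨h.hx, h.hy, h.hne⟩).elim⟩
  choose V hV using this
  exact ⟨V, fun h => hV (_, _) h⟩

lemma exists_log_germ {f f' : ℂ → ℂ} (hf : ∀ᶠ t in 𝓝 t₀, HasDerivAt f (f' t) t) (h0 : f t₀ ≠ 0)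
    (h : exp (2 * a) = f t₀ ^ 2) : ∃ α α' : ℂ → ℂ, α t₀ = a ∧
      (∀ᶠ t in 𝓝 t₀, exp (2 * α t) = f t ^ 2) ∧ ∀ᶠ t in 𝓝 t₀, HasDerivAt α (α' t) t := by
  have h1 : ∀ᶠ t in 𝓝 t₀, f t / f t₀ ∈ slitPlane :=
    (hf.self_of_nhds.continuousAt.div_const _).eventually
      (isOpen_slitPlane.mem_nhds (by simp [div_self h0]))
  refine ⟨fun t => a + log (f t / f t₀), fun t => f' t / f t₀ / (f t / f t₀), ?_, ?_, ?_⟩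
  · simp [div_self h0]
  · filter_upwards [h1] with t ht
    rw [mul_add, exp_add, two_mul (log _), exp_add, exp_log (slitPlane_ne_zero ht), h]
    field_simp
  · filter_upwards [h1, hf] with t ht hd
    exact ((hd.div_const _).clog ht).const_add a

lemma exists_log_germ_neg {f f' : ℂ → ℂ} (hf : ∀ᶠ t in 𝓝 t₀, HasDerivAt f (f' t) t)
    (h0 : f t₀ ≠ 0) (h : exp (-(2 * c)) = f t₀ ^ 2) : ∃ γ γ' : ℂ → ℂ, γ t₀ = c ∧
      (∀ᶠ t in 𝓝 t₀, exp (-(2 * γ t)) = f t ^ 2) ∧ ∀ᶠ t in 𝓝 t₀, HasDerivAt γ (γ' t) t := by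
  obtain ⟨α, α', h1, h2, h3⟩ := exists_log_germ (a := -c) hf h0 (by rw [mul_neg, h])
  exact ⟨fun t => -α t, fun t => -α' t, by simp [h1],
    h2.mono fun t ht => by rw [mul_neg, neg_neg, ht], h3.mono fun t ht => ht.neg⟩

lemma exists_isLift_germ {X Y X' Y' : ℂ → ℂ} (hX : ∀ᶠ t in 𝓝 t₀, HasDerivAt X (X' t) t)
    (hY : ∀ᶠ t in 𝓝 t₀, HasDerivAt Y (Y' t) t) (hc : ∀ᶠ t in 𝓝 t₀, (X t, Y t) ∈ Conf) :
    ∃ α₀ γ₀ α₁ γ₁ γ₂ α₀' γ₀' α₁' γ₁' γ₂' : ℂ → ℂ,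
      (∀ᶠ t in 𝓝 t₀, IsLift (X t) (Y t) (α₀ t) (γ₀ t) (α₁ t) (γ₁ t) (γ₂ t)) ∧
      (∀ᶠ t in 𝓝 t₀, HasDerivAt α₀ (α₀' t) t) ∧ (∀ᶠ t in 𝓝 t₀, HasDerivAt γ₀ (γ₀' t) t) ∧
      (∀ᶠ t in 𝓝 t₀, HasDerivAt α₁ (α₁' t) t) ∧ (∀ᶠ t in 𝓝 t₀, HasDerivAt γ₁ (γ₁' t) t) ∧
      ∀ᶠ t in 𝓝 t₀, HasDerivAt γ₂ (γ₂' t) t := by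
  have h0 := hc.self_of_nhds
  obtain ⟨a₀, c₀, a₁, c₁, c₂, h⟩ := exists_isLift h0
  have s : ∀ {z : ℂ}, Reg z → 1 - z ≠ 0 := fun hz => sub_ne_zero.2 (Ne.symm hz.2)
  obtain ⟨α₀, α₀', -, k0, d0⟩ := exists_log_germ hX h.hx.1 h.ha₀
  obtain ⟨γ₀, γ₀', -, k1, d1⟩ := exists_log_germ_neg (f := fun t => 1 - X t)
    (hX.mono fun t ht => ht.const_sub 1) (s h.hx) h.hc₀
  obtain ⟨α₁, α₁', -, k2, d2⟩ := exists_log_germ hY h.hy.1 h.ha₁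
  obtain ⟨γ₁, γ₁', -, k3, d3⟩ := exists_log_germ_neg (f := fun t => 1 - Y t)
    (hY.mono fun t ht => ht.const_sub 1) (s h.hy) h.hc₁
  obtain ⟨γ₂, γ₂', -, k4, d4⟩ := exists_log_germ_neg (f := fun t => 1 - Y t / X t)
    (f' := fun t => -((Y' t * X t - Y t * X' t) / X t ^ 2))
    (by filter_upwards [hX, hY, hc] with t e1 e2 e3 using (e2.div e1 e3.1.1).const_sub 1)
    (one_sub_div_ne_zero h.hx.1 h.hne) h.hc₂
  refine ⟨α₀, γ₀, α₁, γ₁, γ₂, α₀', γ₀', α₁', γ₁', γ₂', ?_, d0, d1, d2, d3, d4⟩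
  filter_upwards [hc, k0, k1, k2, k3, k4] with t e e0 e1 e2 e3 e4
  exact ⟨e.1, e.2.1, e.2.2, e0, e1, e2, e3, e4⟩

lemma eventually_alt5_rog_eq {X Y X' Y' : ℂ → ℂ} (hX : ∀ᶠ t in 𝓝 t₀, HasDerivAt X (X' t) t)
    (hY : ∀ᶠ t in 𝓝 t₀, HasDerivAt Y (Y' t) t) (hc : ∀ᶠ t in 𝓝 t₀, (X t, Y t) ∈ Conf)
    {V : ℂ × ℂ → HalfMod} (hV : ∀ {x y a₀ c₀ a₁ c₁ c₂ : ℂ},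
      IsLift x y a₀ c₀ a₁ c₁ c₂ → alt5 rog a₀ c₀ a₁ c₁ c₂ = V (x, y)) :
    ∀ᶠ t in 𝓝 t₀, V (X t₀, Y t₀) = V (X t, Y t) := by
  obtain ⟨α₀, γ₀, α₁, γ₁, γ₂, α₀', γ₀', α₁', γ₁', γ₂', h, d0, d1, d2, d3, d4⟩ :=
    exists_isLift_germ hX hY hc
  have g : ∀ (i : Fin 5) {α γ α' γ' : ℂ → ℂ}, (∀ t, (α t, γ t) =
      lin5 (α₀ t) (γ₀ t) (α₁ t) (γ₁ t) (γ₂ t) i) → (∀ᶠ t in 𝓝 t₀, HasDerivAt α (α' t) t) →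
      (∀ᶠ t in 𝓝 t₀, HasDerivAt γ (γ' t) t) → HasRep α γ α' γ' t₀ := fun i α γ α' γ' e e1 e2 =>
    IsGerm.hasRep ⟨h.mono fun t ht => ⟨_, (e t).symm ▸ ht.liesOver i⟩, e1, e2⟩
  have d5 : ∀ᶠ t in 𝓝 t₀, HasDerivAt (fun t => α₁ t - α₀ t) (α₁' t - α₀' t) t := by
    filter_upwards [d0, d2] with t e0 e2 using e2.sub e0
  have d6 : ∀ᶠ t in 𝓝 t₀, HasDerivAt (fun t => α₁ t - α₀ t + γ₁ t - γ₀ t)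
      (α₁' t - α₀' t + γ₁' t - γ₀' t) t := by
    filter_upwards [d5, d1, d3] with t e0 e1 e2 using (e0.add e2).sub e1
  have d7 : ∀ᶠ t in 𝓝 t₀, HasDerivAt (fun t => γ₂ t - γ₁ t) (γ₂' t - γ₁' t) t := by
    filter_upwards [d3, d4] with t e0 e2 using e2.sub e0
  have d8 : ∀ᶠ t in 𝓝 t₀, HasDerivAt (fun t => γ₁ t - γ₀ t) (γ₁' t - γ₀' t) t := by
    filter_upwards [d1, d3] with t e0 e2 using e2.sub e0
  have d9 : ∀ᶠ t in 𝓝 t₀, HasDerivAt (fun t => γ₂ t - γ₁ t - α₀ t)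
      (γ₂' t - γ₁' t - α₀' t) t := by
    filter_upwards [d7, d0] with t e0 e2 using e0.sub e2
  obtain ⟨r0, k0, l0⟩ := g 0 (fun _ => rfl) d0 d1
  obtain ⟨r1, k1, l1⟩ := g 1 (fun _ => rfl) d2 d3
  obtain ⟨r2, k2, l2⟩ := g 2 (fun _ => rfl) d5 d4
  obtain ⟨r3, k3, l3⟩ := g 3 (fun _ => rfl) d6 d7
  obtain ⟨r4, k4, l4⟩ := g 4 (fun _ => rfl) d8 d9
  have hv : ∀ᶠ t in 𝓝 t₀, V (X t, Y t) = hm (r0 t - r1 t + r2 t - r3 t + r4 t) := by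
    filter_upwards [h, k0, k1, k2, k3, k4] with t e e0 e1 e2 e3 e4
    rw [← hV e, alt5, e0, e1, e2, e3, e4, map_add, map_sub, map_add, map_sub]
  have hd : ∀ᶠ t in 𝓝 t₀, HasDerivAt (fun t => r0 t - r1 t + r2 t - r3 t + r4 t) 0 t := by
    filter_upwards [l0, l1, l2, l3, l4] with t e0 e1 e2 e3 e4
    exact ((((e0.sub e1).add e2).sub e3).add e4).congr_deriv (by ring)
  obtain ⟨ε, hε, hb⟩ := Metric.eventually_nhds_iff_ball.1 hd
  obtain ⟨k, hk⟩ := Metric.isOpen_ball.exists_is_const_of_deriv_eq_zero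
    (convex_ball t₀ ε).isPreconnected
    (fun t ht => (hb t ht).differentiableAt.differentiableWithinAt) (fun t ht => (hb t ht).deriv)
  filter_upwards [hv, Metric.ball_mem_nhds t₀ hε] with t e0 e1
  rw [hv.self_of_nhds, e0, hk t e1, hk t₀ (Metric.mem_ball_self hε)]

lemma exists_alt5_rog_eq : ∃ s : HalfMod, ∀ {x y a₀ c₀ a₁ c₁ c₂ : ℂ},
    IsLift x y a₀ c₀ a₁ c₁ c₂ → alt5 rog a₀ c₀ a₁ c₁ c₂ = s := by
  obtain ⟨V, hV⟩ := exists_rog_value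
  have hb : ((2, 3) : ℂ × ℂ) ∈ Conf := by refine ⟨⟨?_, ?_⟩, ⟨?_, ?_⟩, ?_⟩ <;> norm_num
  have key : ∀ p ∈ Conf, V p = V (2, 3) := by
    intro p hp
    refine conf_induction (Q := fun p => V p = V (2, 3)) hb rfl ?_ ?_ hp
    · intro x x' y h h' hq
      have hf := Set.toFinite ({0, 1, y} : Set ℂ)
      have hm := @mem_compl_iff_left y
      refine .trans ?_ hq
      refine (isPathConnected_compl hf).isConnected.isPreconnected.induction₂
        (fun t t' => V (t, y) = V (t', y)) (fun t ht => nhdsWithin_le_nhds ?_)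
        (fun _ _ _ _ _ _ e e' => e.trans e') (fun _ _ _ _ e => e.symm) ((hm h.2.1).2 h')
        ((hm h.2.1).2 h)
      exact eventually_alt5_rog_eq (X := fun t => t) (Y := fun _ => y)
        (.of_forall fun t => hasDerivAt_id t) (.of_forall fun t => hasDerivAt_const t y)
        ((hf.isClosed.isOpen_compl.eventually_mem ht).mono fun t => (hm h.2.1).1) hV
    · intro x y y' h h' hq
      have hf := Set.toFinite ({0, 1, x} : Set ℂ)
      have hm := @mem_compl_iff_right x
      refine .trans ?_ hq
      refine (isPathConnected_compl hf).isConnected.isPreconnected.induction₂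
        (fun t t' => V (x, t) = V (x, t')) (fun t ht => nhdsWithin_le_nhds ?_)
        (fun _ _ _ _ _ _ e e' => e.trans e') (fun _ _ _ _ e => e.symm) ((hm h.1).2 h')
        ((hm h.1).2 h)
      exact eventually_alt5_rog_eq (X := fun _ => x) (Y := fun t => t)
        (.of_forall fun t => hasDerivAt_const t x) (.of_forall fun t => hasDerivAt_id t)
        ((hf.isClosed.isOpen_compl.eventually_mem ht).mono fun t => (hm h.1).1) hV
  exact ⟨V (2, 3), fun h => (hV h).trans (key _ ⟨h.hx, h.hy, h.hne⟩)⟩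

lemma exists_isExtBloch_rog : ∃ s : HalfMod, IsExtBloch fun w => rog w - s := by
  obtain ⟨s, hs⟩ := exists_alt5_rog_eq
  refine ⟨s, fun h => ?_, ?_⟩
  · rw [← sub_self s]
    nth_rw 2 [← hs h]
    rw [← sub_eq_zero, alt5, alt5]
    abel
  · rintro ⟨a, c⟩ z h p q
    have e1 := rog_shift h p 0
    have e2 := rog_shift h 0 q
    simp only [Int.cast_zero, zero_mul, add_zero, zero_sub, sub_zero] at e1 e2
    rw [rog_shift h p q, e1, e2, mul_sub, map_sub, mul_neg, map_neg]
    abel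

/-- The torsion of the extended Bloch group is detected by the Rogers dilogarithm. -/
lemma exists_two_mul_of_kapE_eq_zero {q : ℚ} (h : kapE q = 0) : ∃ n : ℤ, 2 * q = n := by
  have h0 : DE (q • (2 * Cpi * I)) = 0 := by rw [← coe_kapE, h]; rfl
  by_cases h1 : exp (q • (2 * Cpi * I)) = 1
  · obtain ⟨n, hn⟩ := exp_eq_one_iff.1 h1
    refine ⟨2 * n, ?_⟩
    have e : (q : ℂ) * (2 * Cpi * I) = n * (2 * Cpi * I) := by
      rw [← Rat.smul_def, hn, Cpi]
    have e' := mul_right_cancel₀ (by simp [Cpi, Real.pi_ne_zero, I_ne_zero]) e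
    have e2 : q = n := by exact_mod_cast e'
    rw [e2]; push_cast; ring
  · obtain ⟨s, hs⟩ := exists_isExtBloch_rog
    set a := q • (2 * Cpi * I) with ha
    have hp : LiesOver (a, (pt (exp a) 0 0).2) (exp a) := by
      have h0 := liesOver_iff.1 (liesOver_pt (reg_exp h1) 0 0)
      exact liesOver_iff.2 ⟨h0.1, by rw [two_mul, exp_add, sq], h0.2.2⟩
    have h2 := hp.shift_snd 1
    have e := rog_shift hp 0 1
    simp only [Int.cast_zero, Int.cast_one, zero_mul, one_mul, add_zero, sub_zero] at h2 e
    have e1 := congrArg hs.hom h0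
    rw [DE_apply, Dq₁, if_neg h1, ← dq_eq hp, dq, map_sub, hs.hom_ec hp.mem_Cover,
      hs.hom_ec h2.mem_Cover, e, map_zero, sub_sub_sub_cancel_right, add_sub_cancel_left,
      hm_eq_zero] at e1
    obtain ⟨n, hn⟩ := e1
    refine ⟨-n, ?_⟩
    rw [ha, Rat.smul_def] at hn
    have hc : Cpi ≠ 0 := by simp [Cpi, Real.pi_ne_zero]
    have e2 : (2 * q : ℂ) * (Cpi ^ 2 / 2) = -n * (Cpi ^ 2 / 2) := by
      linear_combination -hn + (q : ℂ) * Cpi ^ 2 * I_sq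
    have e3 := mul_right_cancel₀ (by simpa using hc) e2
    exact_mod_cast e3

end Dilogarithm

end Homology

section KernelOfOrderTwo

variable {A E D X : Type*} [AddCommGroup A] [AddCommGroup E] [AddCommGroup D] [AddCommGroup X]

/-- A quotient of `ℚ ⧸ ℤ` by a subgroup of order at most two. -/
lemma exists_period {φ : ℚ →+ X} (h1 : φ 1 = 0) (h2 : ∀ q, φ q = 0 → ∃ n : ℤ, 2 * q = n) :
    ∃ c : ℚ, c ≠ 0 ∧ ∀ q, φ q = 0 ↔ ∃ n : ℤ, q = n * c := by
  have hn : ∀ n : ℤ, φ n = 0 := fun n => by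
    rw [← zsmul_one, map_zsmul, h1, smul_zero]
  by_cases h : φ (1 / 2) = 0
  · refine ⟨1 / 2, by norm_num, fun q => ⟨fun hq => ?_, ?_⟩⟩
    · obtain ⟨n, hn⟩ := h2 q hq
      exact ⟨n, by rw [← hn]; ring⟩
    · rintro ⟨n, rfl⟩
      rw [← zsmul_eq_mul, map_zsmul, h, smul_zero]
  · refine ⟨1, one_ne_zero, fun q => ⟨fun hq => ?_, ?_⟩⟩
    · obtain ⟨n, e⟩ := h2 q hq
      obtain ⟨m, rfl | rfl⟩ := Int.even_or_odd' n
      · exact ⟨m, by push_cast at e; linarith⟩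
      · refine (h ?_).elim
        have e' : (1 / 2 : ℚ) = q - m := by push_cast at e; linarith
        rw [e', map_sub, hq, hn, sub_zero]
    · rintro ⟨n, rfl⟩
      rw [mul_one, hn]

lemma exists_extension {κ : ℚ →+ E} (ι : X →+ A) (hι : Function.Injective ι)
    (g : X →+ κ.range) : ∃ f : A →+ κ.range, ∀ x, f (ι x) = g x := by
  let _ : DivisibleBy κ.range ℤ := κ.rangeRestrict_surjective.divisibleBy κ.rangeRestrict
    fun a n => map_zsmul _ _ _
  obtain ⟨f, hf⟩ := (Module.Baer.of_divisible κ.range).extension_property_addMonoidHom ι hι g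
  exact ⟨f, fun x => DFunLike.congr_fun hf x⟩

/-- Two extensions of the same group by images of `ℚ` with infinite cyclic kernels are related
by a surjection with kernel of order two. -/
theorem exists_surjective_card_ker_eq_two {β : A →+ D} {π : E →+ D} {θ : ℚ →+ A} {κ : ℚ →+ E}
    (hβ : θ.range = β.ker) (hπ : κ.range = π.ker) (hr : β.range = π.range) {c c' : ℚ}
    (hc : c ≠ 0) (hc' : c' ≠ 0) (hθ : ∀ q, θ q = 0 ↔ ∃ n : ℤ, q = n * c)
    (hκ : ∀ q, κ q = 0 ↔ ∃ n : ℤ, q = n * c') :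
    ∃ lam : A →+ E, Function.Surjective lam ∧ Nat.card lam.ker = 2 := by
  have hβ' : ∀ x, β x = 0 ↔ ∃ q, θ q = x := fun x => by
    rw [← AddMonoidHom.mem_ker, ← hβ, AddMonoidHom.mem_range]
  have hπ' : ∀ x, π x = 0 ↔ ∃ q, κ q = x := fun x => by
    rw [← AddMonoidHom.mem_ker, ← hπ, AddMonoidHom.mem_range]
  obtain ⟨g, hg⟩ : ∃ g : A →+ κ.range, ∀ q, (g (θ q) : E) = κ (2 * c' / c * q) := by
    obtain ⟨g, hg⟩ := exists_extension θ.range.subtype θ.range.subtype_injective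
      (θ.rangeRestrict.liftOfSurjective θ.rangeRestrict_surjective
        ⟨κ.rangeRestrict.comp (AddMonoidHom.mulLeft (2 * c' / c)), fun q hq => by
          rw [AddMonoidHom.mem_ker] at hq ⊢
          obtain ⟨n, rfl⟩ := (hθ q).1 (congrArg Subtype.val hq)
          refine Subtype.ext ((hκ _).2 ⟨2 * n, ?_⟩)
          change 2 * c' / c * (n * c) = _
          push_cast
          field_simp⟩)
    refine ⟨g, fun q => ?_⟩
    have h := hg (θ.rangeRestrict q)
    rw [AddMonoidHom.liftOfSurjective, AddMonoidHom.liftOfRightInverse_comp_apply] at h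
    exact congrArg Subtype.val h
  obtain ⟨r, hr'⟩ := exists_extension κ.range.subtype κ.range.subtype_injective
    (AddMonoidHom.id κ.range)
  have hrκ : ∀ q, (r (κ q) : E) = κ q := fun q => congrArg Subtype.val (hr' ⟨κ q, q, rfl⟩)
  have hex : ∀ (u : κ.range) (d : D), d ∈ π.range → ∃ e, r e = u ∧ π e = d := by
    rintro u _ ⟨e, rfl⟩
    obtain ⟨q, hq⟩ := (u - r e).2
    refine ⟨e + κ q, Subtype.ext ?_, ?_⟩
    · rw [map_add, AddSubgroup.coe_add, hrκ, hq, AddSubgroup.coe_sub, add_sub_cancel]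
    · rw [map_add, (hπ' _).2 ⟨q, rfl⟩, add_zero]
  have hun : ∀ e, r e = 0 → π e = 0 → e = 0 := fun e h1 h2 => by
    obtain ⟨q, rfl⟩ := (hπ' e).1 h2
    rw [← hrκ, h1]; rfl
  have hun' : ∀ e e', r e = r e' → π e = π e' → e = e' := fun e e' h1 h2 =>
    sub_eq_zero.1 (hun _ (by rw [map_sub, h1, sub_self]) (by rw [map_sub, h2, sub_self]))
  choose l hl hl' using fun x => hex (g x) (β x) (hr ▸ ⟨x, rfl⟩)
  let lam : A →+ E := AddMonoidHom.mk' l fun x y => hun' _ _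
    (by rw [map_add, hl, hl, hl, map_add]) (by rw [map_add, hl', hl', hl', map_add])
  have hlam : ∀ x, lam x = 0 ↔ g x = 0 ∧ β x = 0 := fun x => by
    rw [← hl, ← hl']
    exact ⟨fun h => by rw [show l x = 0 from h]; simp, fun h => hun _ h.1 h.2⟩
  refine ⟨lam, fun e => ?_, ?_⟩
  · obtain ⟨x, hx⟩ : π e ∈ β.range := hr ▸ ⟨e, rfl⟩
    obtain ⟨q, hq⟩ := (r e - g x).2
    refine ⟨x + θ (c / (2 * c') * q), hun' _ _ ?_ ?_⟩
    · refine (hl _).trans (Subtype.ext ?_)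
      rw [map_add, AddSubgroup.coe_add, hg, show 2 * c' / c * (c / (2 * c') * q) = q by field_simp,
        hq, AddSubgroup.coe_sub, add_sub_cancel]
    · refine (hl' _).trans ?_
      rw [map_add, (hβ' _).2 ⟨_, rfl⟩, add_zero, hx]
  · have hk : ∀ x, lam x = 0 ↔ ∃ n : ℤ, x = θ (n * (c / 2)) := fun x => by
      rw [hlam]
      refine ⟨fun ⟨h1, h2⟩ => ?_, ?_⟩
      · obtain ⟨q, rfl⟩ := (hβ' x).1 h2
        have h3 := hg q
        rw [h1] at h3
        obtain ⟨n, hn⟩ := (hκ _).1 h3.symm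
        refine ⟨n, congrArg θ ?_⟩
        field_simp at hn ⊢
        linarith
      · rintro ⟨n, rfl⟩
        refine ⟨Subtype.ext ((hg _).trans ((hκ _).2 ⟨n, by field_simp⟩)), (hβ' _).2 ⟨_, rfl⟩⟩
    have h0 : θ (c / 2) ≠ 0 := fun h => by
      obtain ⟨n, hn⟩ := (hθ _).1 h
      have h2 : (1 : ℚ) = 2 * n := by field_simp at hn; linarith
      have h3 : (1 : ℤ) = 2 * n := by exact_mod_cast h2
      omega
    have hm : ∀ m : ℤ, θ (m * c) = 0 := fun m => (hθ _).2 ⟨m, rfl⟩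
    refine (Nat.card_eq_two_iff' 0).2 ⟨⟨θ (c / 2), (hk _).2 ⟨1, by simp⟩⟩,
      fun h => h0 (congrArg Subtype.val h), ?_⟩
    rintro ⟨y, hy⟩ hne
    obtain ⟨n, rfl⟩ := (hk y).1 hy
    refine Subtype.ext ?_
    obtain ⟨m, rfl | rfl⟩ := Int.even_or_odd' n
    · refine (hne (Subtype.ext ?_)).elim
      change θ _ = 0
      rw [← hm m]
      congr 1; push_cast; ring
    · change θ _ = θ _
      rw [show ((2 * m + 1 : ℤ) : ℚ) * (c / 2) = m * c + c / 2 by push_cast; ring, map_add, hm,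
        zero_add]

end KernelOfOrderTwo

/-- there is a surjective homomorphism `λ : H₃(PSL(2,ℂ);ℤ) → êB(ℂ)` whose kernel
has order 2. -/
theorem stmt6 :
    ∃ lam : H3PSL2C →+ ↥EBloch, Function.Surjective lam ∧ Nat.card ↥lam.ker = 2 := by
  obtain ⟨θ, hθ, hθ1, hθ2⟩ := exists_theta
  obtain ⟨c, hc, hc2⟩ := exists_period hθ1 fun q hq => by
    rw [← Rat.num_div_den q, hθ2 _ _ q.den_nz] at hq
    obtain ⟨k, hk⟩ := dvd_of_zsmul_rhoStd_eq_zero q.den_nz hq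
    refine ⟨k, ?_⟩
    have hd : (q.den : ℚ) ≠ 0 := by exact_mod_cast q.den_nz
    have hk' : (2 * q.num : ℚ) = q.den * k := by exact_mod_cast hk
    nth_rw 1 [← Rat.num_div_den q]
    rw [← mul_div_assoc, hk', mul_div_cancel_left₀ _ hd]
  obtain ⟨c', hc', hc2'⟩ := exists_period kapE_one fun q hq => exists_two_mul_of_kapE_eq_zero hq
  refine exists_surjective_card_ker_eq_two (π := piE.comp EBloch.subtype) hθ ?_ ?_ hc hc' hc2 hc2'
  · ext e
    exact ⟨fun ⟨q, hq⟩ => hq ▸ piE_kapE q, fun h => exists_kapE_eq h⟩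
  · ext s
    refine ⟨fun ⟨x, hx⟩ => exists_piE_eq (hx ▸ dehnP_blochMap x), fun ⟨e, he⟩ =>
      exists_blochMap_eq (he ▸ dehnP_piE_coe e)⟩

end ExtendedBloch

end
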